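/- Let G be a connected affine algebraic group over ℂ and A_u a unipotent connected abelian algebraic group with an algebraic G-action by group automorphisms. Then the map D assigning to each extension 1 → A_u → Ĝ → G → 1 of algebraic groups the class of the associated Lie algebra extension induces a bijection D : Ext_alg(G, A_u) → H²(𝔤, 𝔤_red, 𝔞_u), where 𝔤 = L(G), 𝔞_u = L(A_u), and 𝔤_red is the Lie algebra of a Levi subgroup G_red of G (here H²(𝔤, 𝔤_red, 𝔞_u) is viewed as a subgroup of H²(𝔤, 𝔞_u) ≅ Ext(𝔤, 𝔞_u) via the injective restriction map). -/

import Mathlib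

noncomputable section

open MvPolynomial

/-- Points of affine `n`-space over `ℂ`. -/
abbrev Pt (n : ℕ) : Type := Fin n → ℂ

/-- A subset of `ℂ^n` is an (affine) algebraic set if it is the common zero
locus of a set of polynomials. -/
def IsAlgebraicSet {n : ℕ} (V : Set (Pt n)) : Prop :=
  ∃ S : Set (MvPolynomial (Fin n) ℂ), V = {x : Pt n | ∀ p ∈ S, eval x p = 0}

/-- A map `ℂ^n → ℂ^m` is regular (polynomial) on a subset `V ⊆ ℂ^n`. -/
def IsRegularOn {n m : ℕ} (V : Set (Pt n)) (f : Pt n → Pt m) : Prop :=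
  ∃ P : Fin m → MvPolynomial (Fin n) ℂ, ∀ x ∈ V, ∀ i, f x i = eval x (P i)

def Pt.left {n m : ℕ} (z : Pt (n + m)) : Pt n := fun i => z (Fin.castAdd m i)
def Pt.right {n m : ℕ} (z : Pt (n + m)) : Pt m := fun i => z (Fin.natAdd n i)

/-- An affine algebraic group over `ℂ`, realized as an algebraic subset of some
`ℂ^n`, with polynomial multiplication and inversion. -/
structure AffAlgGroup : Type where
  n : ℕ
  carrier : Set (Pt n)
  isAlgebraic : IsAlgebraicSet carrier
  one : Pt n
  one_mem : one ∈ carrier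
  mul : Pt n → Pt n → Pt n
  inv : Pt n → Pt n
  mul_mem : ∀ {x y : Pt n}, x ∈ carrier → y ∈ carrier → mul x y ∈ carrier
  inv_mem : ∀ {x : Pt n}, x ∈ carrier → inv x ∈ carrier
  mul_assoc' : ∀ {x y z : Pt n}, x ∈ carrier → y ∈ carrier → z ∈ carrier →
    mul (mul x y) z = mul x (mul y z)
  one_mul' : ∀ {x : Pt n}, x ∈ carrier → mul one x = x
  mul_one' : ∀ {x : Pt n}, x ∈ carrier → mul x one = x
  inv_mul' : ∀ {x : Pt n}, x ∈ carrier → mul (inv x) x = one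
  mul_regular : IsRegularOn
    {z : Pt (n + n) | Pt.left z ∈ carrier ∧ Pt.right z ∈ carrier}
    (fun z => mul (Pt.left z) (Pt.right z))
  inv_regular : IsRegularOn carrier inv

namespace AffAlgGroup

/-- The group of `ℂ`-points of `G`, as a bundled group. -/
def Gp (G : AffAlgGroup) : Type := {x : Pt G.n // x ∈ G.carrier}

instance (G : AffAlgGroup) : Group G.Gp where
  mul x y := ⟨G.mul x.1 y.1, G.mul_mem x.2 y.2⟩
  one := ⟨G.one, G.one_mem⟩
  inv x := ⟨G.inv x.1, G.inv_mem x.2⟩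
  mul_assoc a b c := Subtype.ext (G.mul_assoc' a.2 b.2 c.2)
  one_mul a := Subtype.ext (G.one_mul' a.2)
  mul_one a := Subtype.ext (G.mul_one' a.2)
  inv_mul_cancel a := Subtype.ext (G.inv_mul' a.2)

/-- The Euclidean (classical) topology on the points of `G`. -/
instance (G : AffAlgGroup) : TopologicalSpace G.Gp :=
  instTopologicalSpaceSubtype

/-- Connectedness of an affine algebraic group: the carrier cannot be divided
into two disjoint relatively (Zariski-)closed pieces. -/
def IsConnected (G : AffAlgGroup) : Prop :=
  ∀ V W : Set (Pt G.n), IsAlgebraicSet V → IsAlgebraicSet W →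
    G.carrier ⊆ V ∪ W → G.carrier ∩ (V ∩ W) = ∅ →
    G.carrier ⊆ V ∨ G.carrier ⊆ W

def IsAbelianGrp (G : AffAlgGroup) : Prop :=
  ∀ x ∈ G.carrier, ∀ y ∈ G.carrier, G.mul x y = G.mul y x

/-- `G` is a torus: it is isomorphic, as an algebraic group, to `(ℂ*)^k`;
the isomorphism and its inverse are required to be given by (Laurent)
polynomials. -/
def IsTorus (G : AffAlgGroup) : Prop :=
  ∃ (k : ℕ) (φ : (Fin k → ℂˣ) → Pt G.n),
    (∀ u, φ u ∈ G.carrier) ∧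
    Function.Injective φ ∧
    (∀ x ∈ G.carrier, ∃ u, φ u = x) ∧
    φ (fun _ => 1) = G.one ∧
    (∀ u v, φ (u * v) = G.mul (φ u) (φ v)) ∧
    (∀ i : Fin G.n, ∃ P : MvPolynomial (Fin k ⊕ Fin k) ℂ,
      ∀ u, φ u i = eval (Sum.elim (fun j => (u j : ℂ)) (fun j => ((u j)⁻¹ : ℂˣ))) P) ∧
    (∀ j : Fin k, ∃ Q : MvPolynomial (Fin G.n) ℂ, ∀ u, (u j : ℂ) = eval (φ u) Q)

end AffAlgGroup

/-- matrix entry access for a point of `ℂ^{m·m}` viewed as an `m × m` matrix -/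
def matEntry {m : ℕ} (x : Pt (m * m)) (i j : Fin m) : ℂ := x (finProdFinEquiv (i, j))

/-- matrix multiplication on points of `ℂ^{m·m}` -/
def matMulPt (m : ℕ) (x y : Pt (m * m)) : Pt (m * m) :=
  fun idx => ∑ k : Fin m,
    matEntry x (finProdFinEquiv.symm idx).1 k * matEntry y k (finProdFinEquiv.symm idx).2

/-- the identity matrix as a point of `ℂ^{m·m}` -/
def idMatPt (m : ℕ) : Pt (m * m) :=
  fun idx => if (finProdFinEquiv.symm idx).1 = (finProdFinEquiv.symm idx).2 then 1 else 0

/-- an upper triangular matrix with `1`'s on the diagonal -/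
def IsUnitriangular (m : ℕ) (x : Pt (m * m)) : Prop :=
  (∀ i : Fin m, matEntry x i i = 1) ∧ (∀ i j : Fin m, j < i → matEntry x i j = 0)

/-- `G` is unipotent: it admits a faithful polynomial representation by
upper triangular unipotent matrices. -/
def AffAlgGroup.IsUnipotent (G : AffAlgGroup) : Prop :=
  ∃ (m : ℕ) (φ : Pt G.n → Pt (m * m)),
    IsRegularOn G.carrier φ ∧
    Set.InjOn φ G.carrier ∧
    (∀ x ∈ G.carrier, IsUnitriangular m (φ x)) ∧
    (∀ x ∈ G.carrier, ∀ y ∈ G.carrier, φ (G.mul x y) = matMulPt m (φ x) (φ y))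

/-- A homomorphism of affine algebraic groups: a polynomial map which is
multiplicative on points. -/
structure AlgGroupHom (G H : AffAlgGroup) : Type where
  toFun : Pt G.n → Pt H.n
  maps_to : ∀ {x : Pt G.n}, x ∈ G.carrier → toFun x ∈ H.carrier
  map_mul : ∀ {x y : Pt G.n}, x ∈ G.carrier → y ∈ G.carrier →
    toFun (G.mul x y) = H.mul (toFun x) (toFun y)
  regular : IsRegularOn G.carrier toFun

/-- An algebraic action of `G` on `A` by group automorphisms. -/
structure AlgAction (G A : AffAlgGroup) : Type where
  act : Pt G.n → Pt A.n → Pt A.n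
  maps_to : ∀ {g : Pt G.n} {a : Pt A.n}, g ∈ G.carrier → a ∈ A.carrier →
    act g a ∈ A.carrier
  act_one : ∀ {a : Pt A.n}, a ∈ A.carrier → act G.one a = a
  act_mul : ∀ {g h : Pt G.n} {a : Pt A.n}, g ∈ G.carrier → h ∈ G.carrier →
    a ∈ A.carrier → act (G.mul g h) a = act g (act h a)
  act_map_mul : ∀ {g : Pt G.n} {a b : Pt A.n}, g ∈ G.carrier → a ∈ A.carrier →
    b ∈ A.carrier → act g (A.mul a b) = A.mul (act g a) (act g b)
  act_bij : ∀ {g : Pt G.n}, g ∈ G.carrier → ∀ a ∈ A.carrier, ∃ b ∈ A.carrier, act g b = a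
  regular : IsRegularOn
    {z : Pt (G.n + A.n) | Pt.left z ∈ G.carrier ∧ Pt.right z ∈ A.carrier}
    (fun z => act (Pt.left z) (Pt.right z))

/-- the trivial action of `G` on `A` -/
def AlgAction.IsTrivial {G A : AffAlgGroup} (ρ : AlgAction G A) : Prop :=
  ∀ g ∈ G.carrier, ∀ a ∈ A.carrier, ρ.act g a = a

/-- An extension `1 → A → E → G → 1` of affine algebraic groups inducing
(via conjugation in `E`) the action `ρ` of `G` on `A`. -/
structure AlgExtension (G A : AffAlgGroup) (ρ : AlgAction G A) : Type where
  E : AffAlgGroup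
  i : AlgGroupHom A E
  q : AlgGroupHom E G
  i_inj : Set.InjOn i.toFun A.carrier
  q_surj : ∀ g ∈ G.carrier, ∃ x ∈ E.carrier, q.toFun x = g
  exact : ∀ x ∈ E.carrier, (q.toFun x = G.one ↔ ∃ a ∈ A.carrier, i.toFun a = x)
  conj_compat : ∀ x ∈ E.carrier, ∀ a ∈ A.carrier,
    E.mul x (E.mul (i.toFun a) (E.inv x)) = i.toFun (ρ.act (q.toFun x) a)

namespace AlgExtension

variable {G A : AffAlgGroup} {ρ : AlgAction G A}

/-- An extension splits if the quotient map admits an algebraic group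
theoretic section. -/
def Splits (e : AlgExtension G A ρ) : Prop :=
  ∃ σ : AlgGroupHom G e.E, ∀ g ∈ G.carrier, e.q.toFun (σ.toFun g) = g

/-- Equivalence of extensions (via a morphism over `G` and under `A`;
such a morphism is automatically an isomorphism). -/
def Equiv (e₁ e₂ : AlgExtension G A ρ) : Prop :=
  ∃ f : AlgGroupHom e₁.E e₂.E,
    (∀ a ∈ A.carrier, f.toFun (e₁.i.toFun a) = e₂.i.toFun a) ∧
    (∀ x ∈ e₁.E.carrier, e₂.q.toFun (f.toFun x) = e₁.q.toFun x)

/-- `e₃` is a Baer sum of `e₁` and `e₂`: there is a regular map from the fiber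
product `E₁ ×_G E₂` to `E₃` which is multiplicative, lies over `G` and
restricts to the multiplication `A × A → A` on the kernels.  (This
characterizes the Baer sum up to equivalence.) -/
def IsBaerSum (e₁ e₂ e₃ : AlgExtension G A ρ) : Prop :=
  ∃ h : Pt (e₁.E.n + e₂.E.n) → Pt e₃.E.n,
    IsRegularOn {z : Pt (e₁.E.n + e₂.E.n) | Pt.left z ∈ e₁.E.carrier ∧
      Pt.right z ∈ e₂.E.carrier ∧ e₁.q.toFun (Pt.left z) = e₂.q.toFun (Pt.right z)} h ∧
    (∀ x ∈ e₁.E.carrier, ∀ y ∈ e₂.E.carrier, e₁.q.toFun x = e₂.q.toFun y →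
      h (Fin.append x y) ∈ e₃.E.carrier) ∧
    (∀ x x' y y', x ∈ e₁.E.carrier → x' ∈ e₁.E.carrier → y ∈ e₂.E.carrier →
      y' ∈ e₂.E.carrier → e₁.q.toFun x = e₂.q.toFun y → e₁.q.toFun x' = e₂.q.toFun y' →
      h (Fin.append (e₁.E.mul x x') (e₂.E.mul y y')) =
        e₃.E.mul (h (Fin.append x y)) (h (Fin.append x' y'))) ∧
    (∀ x ∈ e₁.E.carrier, ∀ y ∈ e₂.E.carrier, e₁.q.toFun x = e₂.q.toFun y →
      e₃.q.toFun (h (Fin.append x y)) = e₁.q.toFun x) ∧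
    (∀ a ∈ A.carrier, ∀ b ∈ A.carrier,
      h (Fin.append (e₁.i.toFun a) (e₂.i.toFun b)) = e₃.i.toFun (A.mul a b))

end AlgExtension

/-- A realization of the abelian group `Ext_alg(G, A)` of equivalence classes
of extensions of `G` by `A` (inducing the action `ρ`), with addition given by
the Baer sum, and zero element the class of split extensions. -/
structure IsExtGroup (G A : AffAlgGroup) (ρ : AlgAction G A)
    (Ext : Type) [AddCommGroup Ext] : Prop where
  exists_cls : ∃ cls : AlgExtension G A ρ → Ext,
    Function.Surjective cls ∧
    (∀ e₁ e₂, cls e₁ = cls e₂ ↔ Relation.EqvGen AlgExtension.Equiv e₁ e₂) ∧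
    (∀ e, cls e = 0 ↔ e.Splits) ∧
    (∀ e₁ e₂ e₃, AlgExtension.IsBaerSum e₁ e₂ e₃ → cls e₁ + cls e₂ = cls e₃)

/-- The class map itself, when we need to name it. -/
structure ExtClassMap (G A : AffAlgGroup) (ρ : AlgAction G A)
    (Ext : Type) [AddCommGroup Ext] : Type where
  cls : AlgExtension G A ρ → Ext
  surj : Function.Surjective cls
  cls_eq_iff : ∀ e₁ e₂, cls e₁ = cls e₂ ↔ Relation.EqvGen AlgExtension.Equiv e₁ e₂
  cls_eq_zero_iff : ∀ e, cls e = 0 ↔ e.Splits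
  cls_baer : ∀ e₁ e₂ e₃, AlgExtension.IsBaerSum e₁ e₂ e₃ → cls e₁ + cls e₂ = cls e₃

/-- An algebraic subgroup of `G`. -/
structure AlgSubgroup (G : AffAlgGroup) : Type where
  carrier : Set (Pt G.n)
  subset : carrier ⊆ G.carrier
  isAlgebraic : IsAlgebraicSet carrier
  one_mem : G.one ∈ carrier
  mul_mem : ∀ {x y : Pt G.n}, x ∈ carrier → y ∈ carrier → G.mul x y ∈ carrier
  inv_mem : ∀ {x : Pt G.n}, x ∈ carrier → G.inv x ∈ carrier

namespace AlgSubgroup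

variable {G : AffAlgGroup}

/-- An algebraic subgroup is itself an affine algebraic group. -/
def toGrp (H : AlgSubgroup G) : AffAlgGroup where
  n := G.n
  carrier := H.carrier
  isAlgebraic := H.isAlgebraic
  one := G.one
  one_mem := H.one_mem
  mul := G.mul
  inv := G.inv
  mul_mem := H.mul_mem
  inv_mem := H.inv_mem
  mul_assoc' hx hy hz := G.mul_assoc' (H.subset hx) (H.subset hy) (H.subset hz)
  one_mul' hx := G.one_mul' (H.subset hx)
  mul_one' hx := G.mul_one' (H.subset hx)
  inv_mul' hx := G.inv_mul' (H.subset hx)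
  mul_regular := by
    obtain ⟨P, hP⟩ := G.mul_regular
    exact ⟨P, fun z hz => hP z ⟨H.subset hz.1, H.subset hz.2⟩⟩
  inv_regular := by
    obtain ⟨P, hP⟩ := G.inv_regular
    exact ⟨P, fun x hx => hP x (H.subset hx)⟩

def IsNormal (H : AlgSubgroup G) : Prop :=
  ∀ g ∈ G.carrier, ∀ x ∈ H.carrier, G.mul g (G.mul x (G.inv g)) ∈ H.carrier

/-- `H` is the unipotent radical of `G`: the largest connected normal
unipotent algebraic subgroup. -/
def IsUnipotentRadical (H : AlgSubgroup G) : Prop :=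
  H.IsNormal ∧ H.toGrp.IsConnected ∧ H.toGrp.IsUnipotent ∧
    ∀ K : AlgSubgroup G, K.IsNormal → K.toGrp.IsConnected → K.toGrp.IsUnipotent →
      K.carrier ⊆ H.carrier

/-- `G` is reductive: its unipotent radical is trivial. -/
def _root_.AffAlgGroup.IsReductive (G : AffAlgGroup) : Prop :=
  ∀ K : AlgSubgroup G, K.IsNormal → K.toGrp.IsConnected → K.toGrp.IsUnipotent →
    K.carrier = {G.one}

end AlgSubgroup

/-- A Levi decomposition `G = G_u ⋊ G_red` of `G`:  `Gu` is the unipotent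
radical and `L` is a connected reductive algebraic subgroup with
`Gu ∩ L = 1` and `Gu · L = G`. -/
structure LeviDecomposition (G : AffAlgGroup) : Type where
  Gu : AlgSubgroup G
  L : AlgSubgroup G
  Gu_radical : Gu.IsUnipotentRadical
  L_connected : L.toGrp.IsConnected
  L_reductive : L.toGrp.IsReductive
  inter : Gu.carrier ∩ L.carrier = {G.one}
  decomp : ∀ x ∈ G.carrier, ∃ u ∈ Gu.carrier, ∃ l ∈ L.carrier, x = G.mul u l

/-- The group homomorphism on point groups induced by a morphism of algebraic
groups. -/
def AlgGroupHom.toGpHom {G H : AffAlgGroup} (f : AlgGroupHom G H) : G.Gp →* H.Gp :=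
  MonoidHom.mk' (fun x => ⟨f.toFun x.1, f.maps_to x.2⟩)
    (fun a b => Subtype.ext (f.map_mul a.2 b.2))

/-- The subgroup of the point group underlying an algebraic subgroup. -/
def AlgSubgroup.toSubgroup {G : AffAlgGroup} (H : AlgSubgroup G) : Subgroup G.Gp where
  carrier := {x : G.Gp | x.1 ∈ H.carrier}
  one_mem' := H.one_mem
  mul_mem' := fun ha hb => H.mul_mem ha hb
  inv_mem' := fun ha => H.inv_mem ha

/-- Iterated product (powers) in an algebraic group. -/
def AffAlgGroup.pow (G : AffAlgGroup) (x : Pt G.n) : ℕ → Pt G.n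
  | 0 => G.one
  | k + 1 => G.mul x (G.pow x k)

/-- The inclusion homomorphism of an algebraic subgroup. -/
def AlgSubgroup.incl {A : AffAlgGroup} (H : AlgSubgroup A) : H.toGrp.Gp →* A.Gp :=
  MonoidHom.mk' (fun x => ⟨x.1, H.subset x.2⟩) (fun _ _ => rfl)
/-! ### Tangent spaces and Lie algebras -/

/-- The (Zariski) tangent space at `x₀` of a subset `V ⊆ ℂ^n`: the directions
annihilated by the differentials at `x₀` of all polynomials vanishing on `V`. -/
def tangentAt {n : ℕ} (V : Set (Pt n)) (x₀ : Pt n) : Submodule ℂ (Pt n) where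
  carrier := {v | ∀ p : MvPolynomial (Fin n) ℂ, (∀ x ∈ V, eval x p = 0) →
    ∑ j, v j * eval x₀ (pderiv j p) = 0}
  zero_mem' := by intro p hp; simp
  add_mem' := by
    intro a b ha hb p hp
    simp only [Pi.add_apply, add_mul, Finset.sum_add_distrib, ha p hp, hb p hp, add_zero]
  smul_mem' := by
    intro t a ha p hp
    simp only [Pi.smul_apply, smul_eq_mul, mul_assoc, ← Finset.mul_sum, ha p hp, mul_zero]

/-- A family of polynomials representing the commutator map
`(x, y) ↦ x y x⁻¹ y⁻¹` of `G` on `G × G`. -/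
def IsCommutatorRep (G : AffAlgGroup) (F : Fin G.n → MvPolynomial (Fin (G.n + G.n)) ℂ) : Prop :=
  ∀ x ∈ G.carrier, ∀ y ∈ G.carrier, ∀ i,
    G.mul (G.mul x y) (G.mul (G.inv x) (G.inv y)) i = eval (Fin.append x y) (F i)

/-- `𝔤` (an abstract complex Lie algebra) is the Lie algebra of `G`, via the
linear identification `e` of `𝔤` with the tangent space of `G` at the
identity; the Lie bracket corresponds to the mixed second-order term at the
identity of the commutator map of `G`. -/
structure IsLieAlgebraOf (G : AffAlgGroup) (𝔤 : Type) [LieRing 𝔤] [LieAlgebra ℂ 𝔤]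
    (e : 𝔤 →ₗ[ℂ] Pt G.n) : Prop where
  inj : Function.Injective e
  range_eq : ∀ v : Pt G.n, (∃ u : 𝔤, e u = v) ↔ v ∈ tangentAt G.carrier G.one
  bracket_eq : ∀ F, IsCommutatorRep G F → ∀ u v : 𝔤, ∀ i : Fin G.n,
    e ⁅u, v⁆ i = ∑ j, ∑ k, e u j * e v k *
      eval (Fin.append G.one G.one)
        (pderiv (Fin.castAdd G.n j) (pderiv (Fin.natAdd G.n k) (F i)))

/-- The Lie subalgebra `𝔥 ⊆ 𝔤` corresponds to the algebraic subgroup `H ⊆ G`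
(under the identification `e` of `𝔤` with the tangent space of `G` at `1`). -/
def IsLieSubalgebraOf {G : AffAlgGroup} (H : AlgSubgroup G) {𝔤 : Type} [LieRing 𝔤]
    [LieAlgebra ℂ 𝔤] (e : 𝔤 →ₗ[ℂ] Pt G.n) (𝔥 : LieSubalgebra ℂ 𝔤) : Prop :=
  ∀ u : 𝔤, u ∈ 𝔥 ↔ e u ∈ tangentAt H.carrier G.one

/-! ### The relative Chevalley–Eilenberg complex of a pair `(𝔤, 𝔥)` -/

section CE
set_option linter.unusedSectionVars false

variable {𝔤 : Type} [LieRing 𝔤] [LieAlgebra ℂ 𝔤]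
variable {M : Type} [AddCommGroup M] [Module ℂ M] [LieRingModule 𝔤 M]

/-- `c` is an alternating `p`-multilinear map `𝔤^p → M`. -/
def IsMultilinearAlt (p : ℕ) (c : (Fin p → 𝔤) → M) : Prop :=
  (∀ (v : Fin p → 𝔤) (i : Fin p) (x y : 𝔤),
    c (Function.update v i (x + y)) = c (Function.update v i x) + c (Function.update v i y)) ∧
  (∀ (v : Fin p → 𝔤) (i : Fin p) (t : ℂ) (x : 𝔤),
    c (Function.update v i (t • x)) = t • c (Function.update v i x)) ∧
  (∀ (v : Fin p → 𝔤) (i j : Fin p), i ≠ j → v i = v j → c v = 0)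

/-- The Chevalley–Eilenberg differential (in the form valid on alternating
cochains). -/
def ceD (p : ℕ) (c : (Fin p → 𝔤) → M) : (Fin (p + 1) → 𝔤) → M := fun v =>
  (∑ i : Fin (p + 1), ((-1 : ℤ) ^ (i : ℕ)) • ⁅v i, c (fun k => v (i.succAbove k))⁆) +
  ∑ i : Fin (p + 1), ∑ j : Fin (p + 1),
    if h : i < j then
      ((-1 : ℤ) ^ ((i : ℕ) + 1)) •
        c (Function.update (fun k => v (i.succAbove k))
            (j.pred (Fin.pos_iff_ne_zero.mp (lt_of_le_of_lt (Fin.zero_le i) h)))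
            ⁅v i, v j⁆)
    else 0

lemma ceD_zero (p : ℕ) : ceD (M := M) (𝔤 := 𝔤) p 0 = 0 := by
  funext v
  simp [ceD]

lemma ceD_add (p : ℕ) (c c' : (Fin p → 𝔤) → M) :
    ceD p (c + c') = ceD p c + ceD p c' := by
  funext v
  simp only [ceD, Pi.add_apply]
  have e1 : (∑ i : Fin (p + 1), ((-1 : ℤ) ^ (i : ℕ)) •
      ⁅v i, c (fun k => v (i.succAbove k)) + c' (fun k => v (i.succAbove k))⁆)
      = (∑ i : Fin (p + 1), ((-1 : ℤ) ^ (i : ℕ)) • ⁅v i, c (fun k => v (i.succAbove k))⁆)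
      + ∑ i : Fin (p + 1), ((-1 : ℤ) ^ (i : ℕ)) • ⁅v i, c' (fun k => v (i.succAbove k))⁆ := by
    rw [← Finset.sum_add_distrib]
    exact Finset.sum_congr rfl fun i _ => by rw [lie_add, smul_add]
  rw [e1]
  have e2 : ∀ i j : Fin (p + 1),
      (if h : i < j then ((-1 : ℤ) ^ ((i : ℕ) + 1)) •
        ((c (Function.update (fun k => v (i.succAbove k))
            (j.pred (Fin.pos_iff_ne_zero.mp (lt_of_le_of_lt (Fin.zero_le i) h))) ⁅v i, v j⁆))
         + (c' (Function.update (fun k => v (i.succAbove k))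
            (j.pred (Fin.pos_iff_ne_zero.mp (lt_of_le_of_lt (Fin.zero_le i) h))) ⁅v i, v j⁆)))
       else 0)
      = (if h : i < j then ((-1 : ℤ) ^ ((i : ℕ) + 1)) •
          (c (Function.update (fun k => v (i.succAbove k))
            (j.pred (Fin.pos_iff_ne_zero.mp (lt_of_le_of_lt (Fin.zero_le i) h))) ⁅v i, v j⁆))
         else 0)
      + (if h : i < j then ((-1 : ℤ) ^ ((i : ℕ) + 1)) •
          (c' (Function.update (fun k => v (i.succAbove k))
            (j.pred (Fin.pos_iff_ne_zero.mp (lt_of_le_of_lt (Fin.zero_le i) h))) ⁅v i, v j⁆))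
         else 0) := by
    intro i j
    by_cases h : i < j <;> simp [h, smul_add]
  simp only [e2, Finset.sum_add_distrib]
  try abel

lemma ceD_neg (p : ℕ) (c : (Fin p → 𝔤) → M) : ceD p (-c) = -(ceD p c) := by
  have h := ceD_add p c (-c)
  simp only [add_neg_cancel, ceD_zero] at h
  rw [eq_comm, neg_eq_iff_add_eq_zero, eq_comm, ← h]
  try rfl

/-- `c` is a relative `p`-cochain for the pair `(𝔤, 𝔥)`: alternating
multilinear, vanishing when one argument lies in `𝔥`, and `𝔥`-equivariant. -/
def IsRelCochain (𝔥 : LieSubalgebra ℂ 𝔤) (p : ℕ) (c : (Fin p → 𝔤) → M) : Prop :=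
  IsMultilinearAlt p c ∧
  (∀ v : Fin p → 𝔤, (∃ i, v i ∈ 𝔥) → c v = 0) ∧
  (∀ x : 𝔤, x ∈ 𝔥 → ∀ v : Fin p → 𝔤,
    ⁅x, c v⁆ = ∑ i, c (Function.update v i ⁅x, v i⁆))

lemma isRelCochain_zero (𝔥 : LieSubalgebra ℂ 𝔤) (p : ℕ) :
    IsRelCochain (M := M) 𝔥 p 0 := by
  refine ⟨⟨?_, ?_, ?_⟩, ?_, ?_⟩ <;> intros <;> simp

lemma isRelCochain_add (𝔥 : LieSubalgebra ℂ 𝔤) (p : ℕ) {c c' : (Fin p → 𝔤) → M}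
    (h : IsRelCochain 𝔥 p c) (h' : IsRelCochain 𝔥 p c') :
    IsRelCochain 𝔥 p (c + c') := by
  obtain ⟨⟨hm, hs, ha⟩, hv, he⟩ := h
  obtain ⟨⟨hm', hs', ha'⟩, hv', he'⟩ := h'
  refine ⟨⟨?_, ?_, ?_⟩, ?_, ?_⟩
  · intro v i x y
    simp only [Pi.add_apply, hm, hm']
    abel
  · intro v i t x
    simp only [Pi.add_apply, hs, hs', smul_add]
  · intro v i j hij hvv
    simp only [Pi.add_apply, ha v i j hij hvv, ha' v i j hij hvv, add_zero]
  · intro v hv₀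
    simp only [Pi.add_apply, hv v hv₀, hv' v hv₀, add_zero]
  · intro x hx v
    simp only [Pi.add_apply, lie_add, he x hx v, he' x hx v, Finset.sum_add_distrib]

lemma isRelCochain_neg (𝔥 : LieSubalgebra ℂ 𝔤) (p : ℕ) {c : (Fin p → 𝔤) → M}
    (h : IsRelCochain 𝔥 p c) : IsRelCochain 𝔥 p (-c) := by
  obtain ⟨⟨hm, hs, ha⟩, hv, he⟩ := h
  refine ⟨⟨?_, ?_, ?_⟩, ?_, ?_⟩
  · intro v i x y
    simp only [Pi.neg_apply, hm]
    abel
  · intro v i t x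
    simp only [Pi.neg_apply, hs, smul_neg]
  · intro v i j hij hvv
    simp only [Pi.neg_apply, ha v i j hij hvv, neg_zero]
  · intro v hv₀
    simp only [Pi.neg_apply, hv v hv₀, neg_zero]
  · intro x hx v
    simp only [Pi.neg_apply, lie_neg, he x hx v, Finset.sum_neg_distrib]

/-- The group of relative `p`-cocycles of the pair `(𝔤, 𝔥)` with values in `M`. -/
def relZ (𝔥 : LieSubalgebra ℂ 𝔤) (M : Type) [AddCommGroup M] [Module ℂ M]
    [LieRingModule 𝔤 M] (p : ℕ) : AddSubgroup ((Fin p → 𝔤) → M) where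
  carrier := {c | IsRelCochain 𝔥 p c ∧ ∀ v, ceD p c v = 0}
  zero_mem' := ⟨isRelCochain_zero 𝔥 p, fun v => by rw [ceD_zero]; rfl⟩
  add_mem' := by
    rintro c c' ⟨hc, hcz⟩ ⟨hc', hcz'⟩
    refine ⟨isRelCochain_add 𝔥 p hc hc', fun v => ?_⟩
    rw [ceD_add]
    simp [hcz v, hcz' v]
  neg_mem' := by
    rintro c ⟨hc, hcz⟩
    refine ⟨isRelCochain_neg 𝔥 p hc, fun v => ?_⟩
    rw [ceD_neg]
    simp [hcz v]

/-- The group of relative `(p+1)`-coboundaries of the pair `(𝔤, 𝔥)`. -/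
def relB (𝔥 : LieSubalgebra ℂ 𝔤) (M : Type) [AddCommGroup M] [Module ℂ M]
    [LieRingModule 𝔤 M] (p : ℕ) : AddSubgroup ((Fin (p + 1) → 𝔤) → M) where
  carrier := {c | ∃ f : (Fin p → 𝔤) → M, IsRelCochain 𝔥 p f ∧ c = ceD p f}
  zero_mem' := ⟨0, isRelCochain_zero 𝔥 p, (ceD_zero p).symm⟩
  add_mem' := by
    rintro c c' ⟨f, hf, rfl⟩ ⟨f', hf', rfl⟩
    exact ⟨f + f', isRelCochain_add 𝔥 p hf hf', (ceD_add p f f').symm⟩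
  neg_mem' := by
    rintro c ⟨f, hf, rfl⟩
    exact ⟨-f, isRelCochain_neg 𝔥 p hf, (ceD_neg p f).symm⟩

/-- The relative Lie algebra cohomology `H^p(𝔤, 𝔥, M)` of the pair `(𝔤, 𝔥)`
with coefficients in the `𝔤`-module `M`. -/
def relH (𝔥 : LieSubalgebra ℂ 𝔤) (M : Type) [AddCommGroup M] [Module ℂ M]
    [LieRingModule 𝔤 M] : ℕ → Type
  | 0 => ↥(relZ 𝔥 M 0)
  | (p + 1) => ↥(relZ 𝔥 M (p + 1)) ⧸ ((relB 𝔥 M p).addSubgroupOf (relZ 𝔥 M (p + 1)))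

instance relH.instAddCommGroup (𝔥 : LieSubalgebra ℂ 𝔤) (M : Type) [AddCommGroup M]
    [Module ℂ M] [LieRingModule 𝔤 M] (p : ℕ) : AddCommGroup (relH 𝔥 M p) :=
  match p with
  | 0 => inferInstanceAs (AddCommGroup ↥(relZ 𝔥 M 0))
  | (p + 1) => inferInstanceAs
      (AddCommGroup (↥(relZ 𝔥 M (p + 1)) ⧸ ((relB 𝔥 M p).addSubgroupOf (relZ 𝔥 M (p + 1)))))

/-- The class in `H^{p+1}(𝔤, 𝔥, M)` of a relative cocycle. -/
def relHClass (𝔥 : LieSubalgebra ℂ 𝔤) (M : Type) [AddCommGroup M] [Module ℂ M]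
    [LieRingModule 𝔤 M] (p : ℕ) (c : ↥(relZ 𝔥 M (p + 1))) : relH 𝔥 M (p + 1) :=
  QuotientAddGroup.mk c

end CE

/-- `df` is the differential at the identity of the morphism `f` of algebraic
groups: for any polynomial representative of `f`, `df` is given on tangent
vectors by the derivative at the identity. -/
def IsDerivAtOne {G H : AffAlgGroup} (f : AlgGroupHom G H)
    (df : Pt G.n →ₗ[ℂ] Pt H.n) : Prop :=
  ∀ P : Fin H.n → MvPolynomial (Fin G.n) ℂ,
    (∀ x ∈ G.carrier, ∀ i, f.toFun x i = eval x (P i)) →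
    ∀ v ∈ tangentAt G.carrier G.one, ∀ i,
      df v i = ∑ j, v j * eval G.one (pderiv j (P i))

/-- matrix-vector action on points -/
def matVec (m : ℕ) (a : Pt (m * m)) (w : Pt m) : Pt m :=
  fun i => ∑ k : Fin m, matEntry a i k * w k

/-- A finite-dimensional algebraic representation of `G` on `ℂ^m`, given by a
regular matrix-valued multiplicative map. -/
structure AlgRep (G : AffAlgGroup) (m : ℕ) : Type where
  ρ : Pt G.n → Pt (m * m)
  regular : IsRegularOn G.carrier ρ
  map_one : ρ G.one = idMatPt m
  map_mul : ∀ {x y : Pt G.n}, x ∈ G.carrier → y ∈ G.carrier →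
    ρ (G.mul x y) = matMulPt m (ρ x) (ρ y)

/-- The (abstract) `𝔤`-module structure on `ℂ^m` is the derived action of the
algebraic representation `r` of `G` (under the identification `e : 𝔤 ≅ L(G)`),
i.e. it is given by differentiating `r` at the identity. -/
def IsDerivedAction {G : AffAlgGroup} {m : ℕ} (r : AlgRep G m) {𝔤 : Type} [LieRing 𝔤]
    [LieAlgebra ℂ 𝔤] (e : 𝔤 →ₗ[ℂ] Pt G.n) [LieRingModule 𝔤 (Pt m)] : Prop :=
  ∀ R : Fin (m * m) → MvPolynomial (Fin G.n) ℂ,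
    (∀ x ∈ G.carrier, ∀ idx, r.ρ x idx = eval x (R idx)) →
    ∀ (u : 𝔤) (w : Pt m) (i : Fin m),
      ⁅u, w⁆ i = ∑ k : Fin m,
        (∑ j, e u j * eval G.one (pderiv j (R (finProdFinEquiv (i, k))))) * w k

/-- The `𝔤`-module structure on `M` (identified via `eA` with the Lie algebra
of `A`) is the derived action of the algebraic action `ρ` of `G` on `A`: the
bracket is the mixed second-order term of `ρ.act` at `(1, 1)`. -/
def IsDerivedActionOnLie {G A : AffAlgGroup} (ρ : AlgAction G A) {𝔤 M : Type}
    [LieRing 𝔤] [LieAlgebra ℂ 𝔤] [AddCommGroup M] [Module ℂ M] [LieRingModule 𝔤 M]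
    (e : 𝔤 →ₗ[ℂ] Pt G.n) (eA : M →ₗ[ℂ] Pt A.n) : Prop :=
  ∀ S : Fin A.n → MvPolynomial (Fin (G.n + A.n)) ℂ,
    (∀ g ∈ G.carrier, ∀ a ∈ A.carrier, ∀ i, ρ.act g a i = eval (Fin.append g a) (S i)) →
    ∀ (u : 𝔤) (w : M) (i : Fin A.n),
      eA ⁅u, w⁆ i = ∑ j, ∑ k, e u j * eA w k *
        eval (Fin.append G.one A.one)
          (pderiv (Fin.castAdd A.n j) (pderiv (Fin.natAdd G.n k) (S i)))

/-- `ω` is a (relative) 2-cocycle representing the Lie algebra extension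
`0 → 𝔞 → L(E) → 𝔤 → 0` associated to the algebraic extension `ext`: for any
identification `e𝔢` of a Lie algebra `𝔢` with `L(E)` compatible with the
differentials `di`, `dq` of `i` and `q`, there is a linear section `s` of `dq`
whose curvature is `ω`. -/
def RepresentsLieExtension {G A : AffAlgGroup} {ρ : AlgAction G A}
    {𝔤 : Type} [LieRing 𝔤] [LieAlgebra ℂ 𝔤] {M : Type} [AddCommGroup M]
    [Module ℂ M] [LieRingModule 𝔤 M]
    (ext : AlgExtension G A ρ) (e𝔤 : 𝔤 →ₗ[ℂ] Pt G.n) (eA : M →ₗ[ℂ] Pt A.n)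
    (ω : (Fin 2 → 𝔤) → M) : Prop :=
  ∀ (𝔢 : Type) [LieRing 𝔢] [LieAlgebra ℂ 𝔢] (e𝔢 : 𝔢 →ₗ[ℂ] Pt ext.E.n),
    IsLieAlgebraOf ext.E 𝔢 e𝔢 →
    ∀ (di : M →ₗ[ℂ] 𝔢) (dq : 𝔢 →ₗ⁅ℂ⁆ 𝔤),
      (∃ di₀ : Pt A.n →ₗ[ℂ] Pt ext.E.n, IsDerivAtOne ext.i di₀ ∧
        ∀ a : M, e𝔢 (di a) = di₀ (eA a)) →
      (∃ dq₀ : Pt ext.E.n →ₗ[ℂ] Pt G.n, IsDerivAtOne ext.q dq₀ ∧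
        ∀ w : 𝔢, e𝔤 (dq w) = dq₀ (e𝔢 w)) →
      ∃ s : 𝔤 →ₗ[ℂ] 𝔢, (∀ u : 𝔤, dq (s u) = u) ∧
        ∀ u v : 𝔤, di (ω ![u, v]) = ⁅s u, s v⁆ - s ⁅u, v⁆


notation:max "FnAlg" X:max => Subalgebra ℂ (X → ℂ)

notation:max "FnDual" X:max => (X → ℂ) →ₗ[ℂ] ℂ

infixr:25 " ⊸ " => LinearMap (RingHom.id ℂ)

/-! ### Algebras of regular functions on a group -/

section BiReg

variable {Γ Δ Γ' Δ' : Type}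

/-- Functions of two variables that are finite sums of products `a x * b y` with `a ∈ R`, `b ∈ S`. -/
def biReg (R : FnAlg Γ) (S : FnAlg Δ) : Submodule ℂ (Γ → Δ → ℂ) :=
  Submodule.span ℂ {F | ∃ a ∈ R, ∃ b ∈ S, F = fun x y => a x * b y}

variable {R : FnAlg Γ} {S : FnAlg Δ}
variable {R' : FnAlg Γ'} {S' : FnAlg Δ'}

lemma biReg_of_mul {a : Γ → ℂ} (ha : a ∈ R) {b : Δ → ℂ} (hb : b ∈ S) :
    (fun x y => a x * b y) ∈ biReg R S :=
  Submodule.subset_span ⟨a, ha, b, hb, rfl⟩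

lemma biReg_of_left {a : Γ → ℂ} (ha : a ∈ R) : (fun x _ => a x) ∈ biReg R S := by
  simpa using biReg_of_mul ha S.one_mem

lemma biReg_of_right {b : Δ → ℂ} (hb : b ∈ S) : (fun _ y => b y) ∈ biReg R S := by
  simpa using biReg_of_mul R.one_mem hb

@[elab_as_elim]
lemma biReg_induction {p : (Γ → Δ → ℂ) → Prop}
    (hmul : ∀ a ∈ R, ∀ b ∈ S, p (fun x y => a x * b y))
    (hzero : p 0) (hadd : ∀ F G, F ∈ biReg R S → G ∈ biReg R S → p F → p G → p (F + G))
    {F : Γ → Δ → ℂ} (hF : F ∈ biReg R S) : p F := by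
  refine Submodule.closure_induction (p := fun F _ => p F) hzero
    (fun F G hF hG => hadd F G hF hG) ?_ hF
  rintro c _ ⟨a, ha, b, hb, rfl⟩
  convert hmul (c • a) (R.smul_mem ha c) b hb using 1
  funext x y; simp [mul_assoc]

lemma biReg_expand {F : Γ → Δ → ℂ} (hF : F ∈ biReg R S) :
    ∃ (n : ℕ) (a : Fin n → Γ → ℂ) (b : Fin n → Δ → ℂ), (∀ i, a i ∈ R) ∧ (∀ i, b i ∈ S) ∧
      ∀ x y, F x y = ∑ i, a i x * b i y := by
  refine biReg_induction (fun a ha b hb => ?_) ?_ ?_ hF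
  · exact ⟨1, fun _ => a, fun _ => b, fun _ => ha, fun _ => hb, by simp⟩
  · exact ⟨0, Fin.elim0, Fin.elim0, fun i => i.elim0, fun i => i.elim0, by simp⟩
  · rintro F G - - ⟨n, a, b, ha, hb, h⟩ ⟨m, a', b', ha', hb', h'⟩
    refine ⟨n + m, Fin.append a a', Fin.append b b', ?_, ?_, ?_⟩
    · intro i; refine Fin.addCases (fun j => ?_) (fun j => ?_) i <;> simp [ha, ha']
    · intro i; refine Fin.addCases (fun j => ?_) (fun j => ?_) i <;> simp [hb, hb']
    · intro x y; simp [Fin.sum_univ_add, h, h']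

lemma biReg_swap {F : Γ → Δ → ℂ} (hF : F ∈ biReg R S) : (fun y x => F x y) ∈ biReg S R := by
  refine biReg_induction (fun a ha b hb => ?_) ?_ ?_ hF
  · simpa [mul_comm] using biReg_of_mul hb ha
  · exact Submodule.zero_mem _
  · intro F G _ _ h1 h2; exact Submodule.add_mem _ h1 h2

lemma biReg_mul {F G : Γ → Δ → ℂ} (hF : F ∈ biReg R S) (hG : G ∈ biReg R S) :
    F * G ∈ biReg R S := by
  refine biReg_induction (fun a ha b hb => ?_) ?_ ?_ hF
  · refine biReg_induction (fun a' ha' b' hb' => ?_) ?_ ?_ hG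
    · convert biReg_of_mul (R.mul_mem ha ha') (S.mul_mem hb hb') using 1
      funext x y; simp only [Pi.mul_apply]; ring
    · simp
    · intro F G _ _ h1 h2; rw [mul_add]; exact Submodule.add_mem _ h1 h2
  · simp
  · intro F G _ _ h1 h2; rw [add_mul]; exact Submodule.add_mem _ h1 h2

lemma biReg_comp {F : Γ → Δ → ℂ} (hF : F ∈ biReg R S) {α : Γ' → Γ} {β : Δ' → Δ}
    (hα : ∀ a ∈ R, a ∘ α ∈ R') (hβ : ∀ b ∈ S, b ∘ β ∈ S') :
    (fun x y => F (α x) (β y)) ∈ biReg R' S' := by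
  refine biReg_induction (fun a ha b hb => ?_) ?_ ?_ hF
  · exact biReg_of_mul (hα a ha) (hβ b hb)
  · exact Submodule.zero_mem _
  · intro F G _ _ h1 h2; exact Submodule.add_mem _ h1 h2

lemma biReg_contract {F : Γ → Δ → ℂ} (hF : F ∈ biReg R S) (X : FnDual Δ) :
    (fun x => X (F x)) ∈ R := by
  refine biReg_induction (fun a ha b hb => ?_) ?_ ?_ hF
  · have : (fun x => X (fun y => a x * b y)) = X b • a := by
      funext x
      have : (fun y => a x * b y) = a x • b := rfl
      rw [this, map_smul]; simp [mul_comm]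
    rw [this]; exact R.smul_mem ha _
  · simp only [Pi.zero_apply]
    change (fun _ => X 0) ∈ R
    rw [map_zero]; exact R.zero_mem
  · intro F G _ _ h1 h2
    have : (fun x => X ((F + G) x)) = (fun x => X (F x)) + fun x => X (G x) := by
      funext x; simp
    rw [this]; exact R.add_mem h1 h2

lemma biReg_eval {F : Γ → Δ → ℂ} (hF : F ∈ biReg R S) (y : Δ) : (fun x => F x y) ∈ R :=
  biReg_contract hF (LinearMap.proj y)

lemma biReg_eval_left {F : Γ → Δ → ℂ} (hF : F ∈ biReg R S) (x : Γ) : F x ∈ S :=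
  biReg_eval (biReg_swap hF) x

lemma biReg_diag {T : FnAlg Γ} {F : Γ → Γ → ℂ} (hF : F ∈ biReg R T) (h : R ≤ T) :
    (fun x => F x x) ∈ T := by
  refine biReg_induction (fun a ha b hb => ?_) ?_ ?_ hF
  · exact T.mul_mem (h ha) hb
  · exact T.zero_mem
  · intro F G _ _ h1 h2; exact T.add_mem h1 h2

lemma biReg_fubini {F : Γ → Δ → ℂ} (hF : F ∈ biReg R S) (X : FnDual Γ)
    (Y : FnDual Δ) : X (fun x => Y (F x)) = Y (fun y => X (fun x => F x y)) := by
  refine biReg_induction (fun a ha b hb => ?_) ?_ ?_ hF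
  · have h1 : (fun x => Y (fun y => a x * b y)) = Y b • a := by
      funext x
      have : (fun y => a x * b y) = a x • b := rfl
      rw [this, map_smul]; simp [mul_comm]
    have h2 : (fun y => X (fun x => a x * b y)) = X a • b := by
      funext y
      have : (fun x => a x * b y) = b y • a := by funext x; simp [mul_comm]
      rw [this, map_smul]; simp [mul_comm]
    rw [h1, h2]; simp [mul_comm]
  · simp only [Pi.zero_apply]
    change X (fun _ => Y 0) = Y (fun _ => X 0)
    simp only [map_zero]
    change X 0 = Y 0
    simp
  · intro F G _ _ h1 h2
    have e1 : (fun x => Y ((F + G) x)) = (fun x => Y (F x)) + fun x => Y (G x) := by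
      funext x; simp
    have e2 : (fun y => X (fun x => (F + G) x y)) =
        (fun y => X (fun x => F x y)) + fun y => X (fun x => G x y) := by
      funext y
      exact map_add X (fun x => F x y) (fun x => G x y)
    simp_all

end BiReg

section Null

variable {B : Type*} [CommRing B] [Algebra ℂ B] [Algebra.FiniteType ℂ B]

lemma exists_algHom_of_ne_top {I : Ideal B} (hI : I ≠ ⊤) :
    ∃ p : B →ₐ[ℂ] ℂ, ∀ b ∈ I, p b = 0 := by
  obtain ⟨m, hm, hIm⟩ := Ideal.exists_le_maximal I hI
  let _ : Field (B ⧸ m) := Ideal.Quotient.field m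
  have := Algebra.FiniteType.of_surjective (Ideal.Quotient.mkₐ ℂ m) Ideal.Quotient.mk_surjective
  have := finite_of_finite_type_of_isJacobsonRing ℂ (B ⧸ m)
  have hb := IsAlgClosed.algebraMap_bijective_of_isIntegral (k := ℂ) (K := B ⧸ m)
  let e : ℂ ≃ₐ[ℂ] (B ⧸ m) := AlgEquiv.ofBijective (Algebra.ofId ℂ _) hb
  refine ⟨e.symm.toAlgHom.comp (Ideal.Quotient.mkₐ ℂ m), fun b hbI => ?_⟩
  have := Ideal.Quotient.eq_zero_iff_mem.mpr (hIm hbI)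
  simp [this]

lemma isNilpotent_of_forall_algHom {b : B} (h : ∀ p : B →ₐ[ℂ] ℂ, p b = 0) : IsNilpotent b := by
  by_contra hb
  have : Algebra.FiniteType B (Localization.Away b) := IsLocalization.finiteType_of_monoid_fg
    (Submonoid.powers b) _
  have : Algebra.FiniteType ℂ (Localization.Away b) :=
    Algebra.FiniteType.trans (S := B) inferInstance inferInstance
  have hne : (⊥ : Ideal (Localization.Away b)) ≠ ⊤ := by
    intro hbt
    have h1 : (1 : Localization.Away b) = 0 := by
      have : (1 : Localization.Away b) ∈ (⊥ : Ideal _) := hbt ▸ trivial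
      simpa using this
    have h2 := (IsLocalization.subsingleton_iff (R := B) (S := Localization.Away b)
      (M := Submonoid.powers b)).1 (subsingleton_of_zero_eq_one h1.symm)
    obtain ⟨n, hn⟩ := h2
    exact hb ⟨n, hn⟩
  obtain ⟨p, -⟩ := exists_algHom_of_ne_top hne
  have hu : IsUnit (algebraMap B (Localization.Away b) b) := IsLocalization.Away.algebraMap_isUnit b
  have := h (p.comp (IsScalarTower.toAlgHom ℂ B _))
  have h3 := (hu.map p).ne_zero
  exact h3 (by simpa using this)

end Null


section HopfFn

variable {Γ : Type} [Group Γ]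

/-- A finitely generated algebra of functions on a group, closed under comultiplication and
inversion. -/
structure IsHopfFn (R : FnAlg Γ) : Prop where
  fg : R.FG
  comul : ∀ f ∈ R, (fun x y => f (x * y)) ∈ biReg R R
  inv : ∀ f ∈ R, (fun x => f x⁻¹) ∈ R

/-- `R` is the algebra of regular functions of an affine algebraic group structure on `Γ`. -/
structure IsAlgGrpFn (R : FnAlg Γ) : Prop extends IsHopfFn R where
  sep : ∀ x y, (∀ f ∈ R, f x = f y) → x = y
  pts : ∀ p : R →ₐ[ℂ] ℂ, ∃ x, ∀ f : R, p f = f.1 x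

/-- Connectedness of the Zariski topology defined by `R`. -/
def IsConnFn (R : FnAlg Γ) : Prop :=
  ∀ S T : Set (Γ → ℂ), S ⊆ R → T ⊆ R →
    (∀ x, (∀ f ∈ S, f x = 0) ∨ (∀ f ∈ T, f x = 0)) →
    (∀ x, (∀ f ∈ S, f x = 0) → (∀ f ∈ T, f x = 0) → False) →
    (∀ x, ∀ f ∈ S, f x = 0) ∨ (∀ x, ∀ f ∈ T, f x = 0)

/-- A point derivation at the identity. -/
def IsPD (R : FnAlg Γ) (X : FnDual Γ) : Prop :=
  ∀ f ∈ R, ∀ g ∈ R, X (f * g) = f 1 * X g + g 1 * X f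

/-- The left-invariant operator attached to a functional. -/
def linv (X : FnDual Γ) : (Γ → ℂ) ⊸ (Γ → ℂ) where
  toFun f x := X (fun y => f (x * y))
  map_add' f g := by funext x; exact map_add X (fun y => f (x * y)) (fun y => g (x * y))
  map_smul' c f := by funext x; exact map_smul X c (fun y => f (x * y))

lemma linv_apply (X : FnDual Γ) (f : Γ → ℂ) (x : Γ) :
    linv X f x = X (fun y => f (x * y)) := rfl

@[simp] lemma linv_one (X : FnDual Γ) (f : Γ → ℂ) : linv X f 1 = X f := by
  simp [linv_apply]

lemma linv_translate (X : FnDual Γ) (f : Γ → ℂ) (z x : Γ) :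
    linv X (fun y => f (z * y)) x = linv X f (z * x) := by
  simp [linv_apply, mul_assoc]

omit [Group Γ] in
lemma exists_linear_ext {R : FnAlg Γ} (p : R ⊸ ℂ) :
    ∃ P : FnDual Γ, ∀ f (hf : f ∈ R), P f = p ⟨f, hf⟩ := by
  obtain ⟨P, hP⟩ := LinearMap.exists_extend (p := Subalgebra.toSubmodule R) p
  exact ⟨P, fun f hf => DFunLike.congr_fun hP ⟨f, hf⟩⟩

namespace IsHopfFn

variable {R : FnAlg Γ} (hR : IsHopfFn R)
include hR

lemma left_translate {f : Γ → ℂ} (hf : f ∈ R) (x : Γ) : (fun y => f (x * y)) ∈ R :=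
  biReg_eval_left (hR.comul f hf) x

lemma right_translate {f : Γ → ℂ} (hf : f ∈ R) (y : Γ) : (fun x => f (x * y)) ∈ R :=
  biReg_eval (hR.comul f hf) y

lemma linv_mem (X : FnDual Γ) {f : Γ → ℂ} (hf : f ∈ R) : linv X f ∈ R :=
  biReg_contract (hR.comul f hf) X

lemma linv_mul {X : FnDual Γ} (hX : IsPD R X) {f g : Γ → ℂ} (hf : f ∈ R) (hg : g ∈ R) :
    linv X (f * g) = f * linv X g + g * linv X f := by
  funext x
  have := hX _ (hR.left_translate hf x) _ (hR.left_translate hg x)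
  simp only [mul_one] at this
  exact this

lemma finiteType : Algebra.FiniteType ℂ R := (Subalgebra.fg_iff_finiteType R).1 hR.fg

lemma isNoetherianRing : IsNoetherianRing R :=
  have := hR.finiteType
  Algebra.FiniteType.isNoetherianRing ℂ R

lemma one_mem_of_translate_stable (I : Submodule ℂ (Γ → ℂ)) (hIR : ∀ f ∈ I, f ∈ R)
    (hmul : ∀ r ∈ R, ∀ f ∈ I, r * f ∈ I) (htr : ∀ f ∈ I, ∀ y, (fun x => f (x * y)) ∈ I)
    {d : Γ → ℂ} (hd : d ∈ I) (hd0 : d ≠ 0) : (1 : Γ → ℂ) ∈ I := by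
  let J : Ideal R :=
    { carrier := {r | r.1 ∈ I}
      add_mem' := fun h1 h2 => I.add_mem h1 h2
      zero_mem' := I.zero_mem
      smul_mem' := fun r f hf => hmul r.1 r.2 f.1 hf }
  have := hR.finiteType
  by_contra h1
  have hJ : J ≠ ⊤ := fun h => h1 ((Ideal.eq_top_iff_one J).1 h)
  obtain ⟨p, hp⟩ := exists_algHom_of_ne_top hJ
  obtain ⟨P, hP⟩ := exists_linear_ext p.toLinearMap
  have hPI : ∀ f ∈ I, P f = 0 := fun f hf => by
    rw [hP f (hIR f hf)]; exact hp ⟨f, hIR f hf⟩ hf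
  have hdiag : ∀ H ∈ biReg R R, P (fun x => H x x) = P (fun x => P (fun z => H x z)) := by
    intro H hH
    refine biReg_induction (fun a ha b hb => ?_) ?_ ?_ hH
    · have e1 : (fun x => a x * b x) = a * b := rfl
      have e2 : (fun x => P (fun z => a x * b z)) = P b • a := by
        funext x
        have : (fun y => a x * b y) = a x • b := rfl
        rw [this, map_smul]; simp [mul_comm]
      rw [e1, e2, map_smul, hP _ (R.mul_mem ha hb), hP a ha, hP b hb, smul_eq_mul]
      exact map_mul p ⟨a, ha⟩ ⟨b, hb⟩ |>.trans (mul_comm _ _)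
    · simp only [Pi.zero_apply]
      change P 0 = P (fun _ => P 0)
      rw [map_zero]; exact (map_zero P).symm
    · intro F G _ _ h1 h2
      have e1 : (fun x => (F + G) x x) = (fun x => F x x) + fun x => G x x := rfl
      have e2 : (fun x => P (fun z => (F + G) x z)) =
          (fun x => P (F x)) + fun x => P (G x) := by
        funext x; exact map_add P (F x) (G x)
      rw [e1, e2, map_add, map_add, h1, h2]
  apply hd0
  funext y
  have hH : (fun x z => d (x * (z⁻¹ * y))) ∈ biReg R R :=
    biReg_comp (α := id) (β := fun z => z⁻¹ * y) (hR.comul d (hIR d hd)) (fun a ha => ha)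
      (fun b hb => hR.inv _ (hR.right_translate hb y))
  have h2 := hdiag _ hH
  rw [biReg_fubini hH] at h2
  have e0 : ∀ z, P (fun x => d (x * (z⁻¹ * y))) = 0 := fun z => hPI _ (htr d hd _)
  simp only [e0, mul_inv_cancel_left] at h2
  have e3 : (fun _ : Γ => d y) = d y • (1 : Γ → ℂ) := by funext x; simp
  have e4 : P (1 : Γ → ℂ) = 1 := by rw [hP 1 R.one_mem]; exact map_one p
  rw [e3, map_smul, e4] at h2
  change _ = P 0 at h2
  rw [map_zero] at h2
  simpa using h2

omit hR in
/-- The functions of `R` that vanish in a neighbourhood of `x`. -/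
def nearZero (R : FnAlg Γ) (x : Γ) : Ideal R where
  carrier := {f | ∃ e : R, e.1 x ≠ 0 ∧ e * f = 0}
  add_mem' := by
    rintro f g ⟨e, he, h⟩ ⟨e', he', h'⟩
    refine ⟨e * e', mul_ne_zero he he', ?_⟩
    linear_combination e' * h + e * h'
  zero_mem' := ⟨1, by simp, by simp⟩
  smul_mem' := by
    rintro c f ⟨e, he, h⟩
    refine ⟨e, he, ?_⟩
    simp only [smul_eq_mul]
    linear_combination c * h

lemma mul_eq_zero_of_conn (hc : IsConnFn R) {f g : Γ → ℂ} (hf : f ∈ R) (hg : g ∈ R)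
    (hfg : f * g = 0) : f = 0 ∨ g = 0 := by
  classical
  have hN := hR.isNoetherianRing
  let tr : Γ → (R →+* R) := fun γ =>
    { toFun := fun f => ⟨fun y => f.1 (γ * y), hR.left_translate f.2 γ⟩
      map_one' := rfl
      map_mul' := fun _ _ => rfl
      map_zero' := rfl
      map_add' := fun _ _ => rfl }
  let N := nearZero R
  have key : ∀ γ x, N (γ * x) = (N x).comap (tr γ) := by
    intro γ x
    ext f
    constructor
    · rintro ⟨e, he, h⟩
      refine ⟨tr γ e, he, ?_⟩
      rw [← map_mul, h, map_zero]
    · rintro ⟨e, he, h⟩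
      refine ⟨tr γ⁻¹ e, ?_, ?_⟩
      · change e.1 (γ⁻¹ * (γ * x)) ≠ 0
        rwa [inv_mul_cancel_left]
      · have : f = tr γ⁻¹ (tr γ f) := by
          apply Subtype.ext; funext y
          change f.1 y = f.1 (γ * (γ⁻¹ * y))
          rw [mul_inv_cancel_left]
        rw [this, ← map_mul, h, map_zero]
  let H : Subgroup Γ :=
    { carrier := {x | N x = N 1}
      one_mem' := rfl
      mul_mem' := by
        intro x z (hx : N x = N 1) (hz : N z = N 1)
        change N (x * z) = N 1
        rw [key, hz, ← key, mul_one, hx]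
      inv_mem' := by
        intro x (hx : N x = N 1)
        change N x⁻¹ = N 1
        rw [← mul_one x⁻¹, key, ← hx, ← key, inv_mul_cancel, hx] }
  obtain ⟨s, hs⟩ : (N 1).FG := IsNoetherian.noetherian _
  have hsN := fun a ha =>
    show a ∈ N 1 from hs ▸ Ideal.subset_span ha
  obtain ⟨e, he, hes⟩ : ∃ e : R, e.1 1 ≠ 0 ∧ ∀ a ∈ s, e * a = 0 := by
    clear hs
    induction s using Finset.induction_on with
    | empty => exact ⟨1, by simp, by simp⟩
    | insert a s _ ih =>
      obtain ⟨e, he, h⟩ := ih (fun b hb => hsN b (Finset.mem_insert_of_mem hb))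
      obtain ⟨e', he', h'⟩ := hsN a (Finset.mem_insert_self _ _)
      refine ⟨e * e', mul_ne_zero he he', fun b hb => ?_⟩
      rcases Finset.mem_insert.1 hb with rfl | hb
      · rw [mul_assoc, h', mul_zero]
      · linear_combination e' * h b hb
  have heN : ∀ a ∈ N 1, e * a = 0 := by
    intro a ha
    rw [← hs] at ha
    induction ha using Submodule.span_induction with
    | mem a h => exact hes a h
    | zero => simp
    | add a b _ _ h1 h2 => rw [mul_add, h1, h2, add_zero]
    | smul c a _ h => rw [smul_eq_mul]; linear_combination c * h
  have hopen : ∀ x, e.1 x ≠ 0 → x ∈ H := by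
    intro x hx
    have hle : N 1 ≤ N x := fun a ha => ⟨e, hx, heN a ha⟩
    let ch : ℕ →o Ideal R := ⟨fun n => N (x ^ n), monotone_nat_of_le_succ fun n => by
      rw [pow_succ, key, ← mul_one (x ^ n), key, mul_one]
      exact Ideal.comap_mono hle⟩
    obtain ⟨n, hn⟩ := monotone_stabilizes_iff_noetherian.2 hN ch
    have h1 : N (x ^ n) = N (x ^ (n + 1)) := hn (n + 1) (Nat.le_succ n)
    change N x = N 1
    have : x = (x ^ n)⁻¹ * x ^ (n + 1) := by rw [pow_succ, inv_mul_cancel_left]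
    rw [this, key, ← h1, ← key, inv_mul_cancel]
  have hall : ∀ x, x ∈ H := by
    have hS : ∀ k, (fun x => e.1 (k⁻¹ * x)) ∈ R := fun k => hR.left_translate e.2 _
    let S : Set (Γ → ℂ) := {f | ∃ k ∉ H, f = fun x => e.1 (k⁻¹ * x)}
    let T : Set (Γ → ℂ) := {f | ∃ k ∈ H, f = fun x => e.1 (k⁻¹ * x)}
    have hcov : ∀ x, (∀ f ∈ S, f x = 0) ∨ (∀ f ∈ T, f x = 0) := by
      intro x
      by_cases hx : x ∈ H
      · left
        rintro _ ⟨k, hk, rfl⟩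
        by_contra h0
        exact hk (by simpa using H.mul_mem hx (H.inv_mem (hopen _ h0)))
      · right
        rintro _ ⟨k, hk, rfl⟩
        by_contra h0
        exact hx (by simpa using H.mul_mem hk (hopen _ h0))
    have hdisj : ∀ x, (∀ f ∈ S, f x = 0) → (∀ f ∈ T, f x = 0) → False := by
      intro x h1 h2
      by_cases hx : x ∈ H
      · have := h2 _ ⟨x, hx, rfl⟩
        simp only [inv_mul_cancel] at this
        exact he this
      · have := h1 _ ⟨x, hx, rfl⟩
        simp only [inv_mul_cancel] at this
        exact he this
    rcases hc S T (by rintro _ ⟨k, -, rfl⟩; exact hS k) (by rintro _ ⟨k, -, rfl⟩; exact hS k)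
      hcov hdisj with h | h
    · intro x
      by_contra hx
      have := h x _ ⟨x, hx, rfl⟩
      simp only [inv_mul_cancel] at this
      exact he this
    · have := h 1 _ ⟨1, H.one_mem, rfl⟩
      simp only [inv_one, one_mul] at this
      exact absurd this he
  by_cases hf0 : f = 0
  · exact Or.inl hf0
  right
  obtain ⟨z, hz⟩ := Function.ne_iff.1 hf0
  have hgz : (⟨g, hg⟩ : R) ∈ N z := ⟨⟨f, hf⟩, hz, Subtype.ext hfg⟩
  rw [show N z = N 1 from hall z] at hgz
  funext x
  rw [← show N x = N 1 from hall x] at hgz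
  obtain ⟨e', he', h⟩ := hgz
  have := congrFun (congrArg Subtype.val h) x
  exact (mul_eq_zero.1 this).resolve_left he'

lemma isDomain_of_conn (hc : IsConnFn R) : IsDomain R := by
  have : NoZeroDivisors R := ⟨fun {a b} h => by
    rcases hR.mul_eq_zero_of_conn hc a.2 b.2 (congrArg Subtype.val h) with h | h
    · exact Or.inl (Subtype.ext h)
    · exact Or.inr (Subtype.ext h)⟩
  exact NoZeroDivisors.to_isDomain _

end IsHopfFn
end HopfFn


section Coords

variable {Γ : Type} [Group Γ]

/-- The ideal of functions in `R` vanishing at the identity. -/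
def augIdeal (R : FnAlg Γ) : Ideal R :=
  RingHom.ker ((Pi.evalAlgHom ℂ (fun _ : Γ => ℂ) 1).comp R.val)

lemma mem_augIdeal {R : FnAlg Γ} {f : R} : f ∈ augIdeal R ↔ f.1 1 = 0 := Iff.rfl

lemma sub_mem_augIdeal {R : FnAlg Γ} (f : R) :
    f - algebraMap ℂ R (f.1 1) ∈ augIdeal R := by
  rw [mem_augIdeal]; simp

/-- Coordinates at the identity: functions `t` and dual point derivations `X`. -/
structure IsCoords (R : FnAlg Γ) {n : ℕ} (t : Fin n → R)
    (X : Fin n → FnDual Γ) : Prop where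
  t_mem : ∀ i, t i ∈ augIdeal R
  pd : ∀ i, IsPD R (X i)
  dual : ∀ i j, X i (t j).1 = if i = j then 1 else 0
  expand : ∀ g ∈ augIdeal R, g - ∑ i, X i g.1 • t i ∈ augIdeal R ^ 2

lemma IsPD.map_one {R : FnAlg Γ} {X : FnDual Γ} (hX : IsPD R X) :
    X 1 = 0 := by
  have := hX 1 R.one_mem 1 R.one_mem
  simpa using this

lemma IsPD.map_aug_sq {R : FnAlg Γ} {X : FnDual Γ} (hX : IsPD R X) {g : R}
    (hg : g ∈ augIdeal R ^ 2) : X g.1 = 0 := by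
  rw [pow_two] at hg
  induction hg using Submodule.mul_induction_on' with
  | mem_mul_mem a ha b hb =>
    have := hX a.1 a.2 b.1 b.2
    rw [mem_augIdeal.1 ha, mem_augIdeal.1 hb] at this
    simpa using this
  | add a _ b _ h1 h2 =>
    have : X (a.1 + b.1) = 0 := by rw [map_add, h1, h2, add_zero]
    exact this

lemma exists_isPD_of_functional {R : FnAlg Γ} (c : R ⊸ ℂ)
    (hc : ∀ g ∈ augIdeal R ^ 2, c g = 0) :
    ∃ X : FnDual Γ, IsPD R X ∧ ∀ f : R, f ∈ augIdeal R → X f.1 = c f := by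
  let ev : R ⊸ ℂ := ((Pi.evalAlgHom ℂ (fun _ : Γ => ℂ) 1).comp R.val).toLinearMap
  let d : R ⊸ ℂ := c - (LinearMap.toSpanSingleton ℂ ℂ (c 1)).comp ev
  have hev : ∀ f : R, ev f = f.1 1 := fun _ => rfl
  have hd : ∀ f : R, d f = c f - f.1 1 * c 1 := fun f => by simp [d, hev]
  obtain ⟨X, hX⟩ := exists_linear_ext d
  refine ⟨X, ?_, ?_⟩
  · intro f hf g hg
    rw [hX _ (R.mul_mem hf hg), hX f hf, hX g hg, hd, hd, hd]
    have h1 : ((⟨f, hf⟩ : R) - algebraMap ℂ R (f 1)) * ((⟨g, hg⟩ : R) - algebraMap ℂ R (g 1)) ∈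
        augIdeal R ^ 2 := by
      rw [pow_two]; exact Ideal.mul_mem_mul (sub_mem_augIdeal ⟨f, hf⟩) (sub_mem_augIdeal ⟨g, hg⟩)
    have h2 := hc _ h1
    have h3 : ((⟨f, hf⟩ : R) - algebraMap ℂ R (f 1)) * ((⟨g, hg⟩ : R) - algebraMap ℂ R (g 1)) =
        ⟨f * g, R.mul_mem hf hg⟩ - f 1 • (⟨g, hg⟩ : R) - g 1 • (⟨f, hf⟩ : R)
          + (f 1 * g 1) • (1 : R) := by
      apply Subtype.ext; funext x
      simp; ring
    rw [h3] at h2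
    simp only [map_add, map_sub, map_smul, smul_eq_mul] at h2
    simp only [Pi.mul_apply]
    linear_combination h2
  · intro f hf
    rw [hX f.1 f.2, hd, mem_augIdeal.1 hf, zero_mul, sub_zero]

lemma IsHopfFn.exists_coords {R : FnAlg Γ} (hR : IsHopfFn R) :
    ∃ (n : ℕ) (t : Fin n → R) (X : Fin n → FnDual Γ), IsCoords R t X := by
  have hN := hR.isNoetherianRing
  set m := augIdeal R with hm
  let W : Submodule ℂ R := (m ^ 2).restrictScalars ℂ
  let π := W.mkQ
  let P : Submodule ℂ (R ⧸ W) := (m.restrictScalars ℂ).map π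
  obtain ⟨s, hs⟩ : m.FG := IsNoetherian.noetherian _
  have hPle : P ≤ Submodule.span ℂ (π '' s) := by
    rintro _ ⟨g, hg, rfl⟩
    change g ∈ m at hg
    rw [← hs] at hg
    induction hg using Submodule.span_induction with
    | mem a h => exact Submodule.subset_span ⟨a, h, rfl⟩
    | zero => simp
    | add a b _ _ h1 h2 => rw [map_add]; exact Submodule.add_mem _ h1 h2
    | smul c a ha h =>
      have ha' : a ∈ m := hs ▸ ha
      have : π (c • a) = c.1 1 • π a := by
        rw [← map_smul, ← sub_eq_zero, ← map_sub]
        apply (Submodule.Quotient.mk_eq_zero W).2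
        change _ ∈ m ^ 2
        have : c • a - c.1 1 • a = (c - algebraMap ℂ R (c.1 1)) * a := by
          rw [sub_mul, smul_eq_mul, Algebra.smul_def]
        rw [this, pow_two]
        exact Ideal.mul_mem_mul (sub_mem_augIdeal c) ha'
      rw [this]; exact Submodule.smul_mem _ _ h
  have hfd : FiniteDimensional ℂ P := by
    have : FiniteDimensional ℂ (Submodule.span ℂ (π '' s)) :=
      FiniteDimensional.span_of_finite ℂ (s.finite_toSet.image _)
    exact Submodule.finiteDimensional_of_le hPle
  have hfree : Module.Free ℂ P := Module.Free.of_divisionRing ℂ P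
  let b := Module.finBasis ℂ P
  have hlift : ∀ i, ∃ t : R, t ∈ m ∧ π t = (b i).1 := fun i => by
    obtain ⟨t, ht, h⟩ := (b i).2; exact ⟨t, ht, h⟩
  choose t htm ht using hlift
  have hc : ∀ i, ∃ c : (R ⧸ W) ⊸ ℂ, c.comp P.subtype = b.coord i := fun i =>
    LinearMap.exists_extend _
  choose c hc using hc
  have hX : ∀ i, ∃ X : FnDual Γ, IsPD R X ∧ ∀ f : R, f ∈ augIdeal R →
      X f.1 = (c i).comp π f := fun i => by
    apply exists_isPD_of_functional
    intro g hg
    have : π g = 0 := (Submodule.Quotient.mk_eq_zero W).2 hg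
    simp [this]
  choose X hX hXc using hX
  have hval : ∀ i (p : P), c i p.1 = b.coord i p := fun i p => DFunLike.congr_fun (hc i) p
  refine ⟨_, t, X, htm, hX, ?_, ?_⟩
  · intro i j
    rw [hXc i _ (htm j), LinearMap.comp_apply, ht, hval]
    simp [Finsupp.single_apply, eq_comm]
  · intro g hg
    change _ ∈ W
    rw [← Submodule.Quotient.mk_eq_zero W]
    change π _ = 0
    rw [map_sub, map_sum, sub_eq_zero]
    have hp := b.sum_repr ⟨π g, g, hg, rfl⟩
    have hp' := congrArg Subtype.val hp
    simp only [Submodule.coe_sum, Submodule.coe_smul] at hp'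
    rw [← hp']
    refine Finset.sum_congr rfl fun i _ => ?_
    rw [map_smul, ht, hXc i g hg, LinearMap.comp_apply, hval i ⟨π g, g, hg, rfl⟩]
    rfl

lemma IsHopfFn.eq_zero_of_linv_stable {R : FnAlg Γ} (hR : IsHopfFn R) [IsDomain R]
    (N : Set (Γ → ℂ)) (hNR : N ⊆ R) (hN1 : ∀ f ∈ N, f 1 = 0)
    (hNX : ∀ f ∈ N, ∀ X, IsPD R X → linv X f ∈ N) : ∀ f ∈ N, f = 0 := by
  have hNoe := hR.isNoetherianRing
  obtain ⟨n, t, X, hX⟩ := hR.exists_coords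
  let D : Fin n → R → R := fun i f => ⟨linv (X i) f.1, hR.linv_mem _ f.2⟩
  have hDm : ∀ i f g, D i (f * g) = f * D i g + g * D i f := fun i f g =>
    Subtype.ext (hR.linv_mul (hX.pd i) f.2 g.2)
  have hDa : ∀ i f g, D i (f + g) = D i f + D i g := fun i f g =>
    Subtype.ext (map_add (linv (X i)) f.1 g.1)
  let E : R → R := fun f => ∑ i, t i * D i f
  have hEm : ∀ f g, E (f * g) = f * E g + g * E f := fun f g => by
    simp only [E, hDm, Finset.mul_sum, ← Finset.sum_add_distrib]
    exact Finset.sum_congr rfl fun i _ => by ring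
  have hEa : ∀ f g, E (f + g) = E f + E g := fun f g => by
    simp only [E, hDa, ← Finset.sum_add_distrib, mul_add]
  have hE1 : ∀ f ∈ augIdeal R, E f - f ∈ augIdeal R ^ 2 := by
    intro f hf
    have h1 := hX.expand f hf
    have h2 : E f - ∑ i, X i f.1 • t i ∈ augIdeal R ^ 2 := by
      rw [← Finset.sum_sub_distrib]
      refine Ideal.sum_mem _ fun i _ => ?_
      have : t i * D i f - X i f.1 • t i = t i * (D i f - algebraMap ℂ R ((D i f).1 1)) := by
        rw [mul_sub, Algebra.smul_def, mul_comm (algebraMap _ _ _) (t i)]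
        simp [D]
      rw [this, pow_two]
      exact Ideal.mul_mem_mul (hX.t_mem i) (sub_mem_augIdeal _)
    have := Ideal.sub_mem _ h2 h1
    rwa [show E f - ∑ i, X i f.1 • t i - (f - ∑ i, X i f.1 • t i) = E f - f by ring] at this
  have hEk : ∀ k : ℕ, ∀ f ∈ augIdeal R ^ (k + 1), E f - (k + 1 : R) * f ∈ augIdeal R ^ (k + 2) := by
    intro k
    induction k with
    | zero => intro f hf; simpa using hE1 f (by simpa using hf)
    | succ k ih =>
      intro f hf
      rw [pow_succ] at hf
      induction hf using Submodule.mul_induction_on' with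
      | mem_mul_mem b hb a ha =>
        have e : E (b * a) - ((k + 1 : ℕ) + 1 : R) * (b * a) =
            (E b - (k + 1 : R) * b) * a + b * (E a - a) := by
          rw [hEm]; push_cast; ring
        rw [e]
        refine Ideal.add_mem _ ?_ ?_
        · rw [pow_succ]; exact Ideal.mul_mem_mul (ih b hb) ha
        · rw [show k + 1 + 2 = (k + 1) + 2 by rfl, pow_add]
          exact Ideal.mul_mem_mul hb (hE1 a ha)
      | add a _ b _ h1 h2 =>
        have := Ideal.add_mem _ h1 h2
        rw [hEa]
        convert this using 1
        ring
  have hpow : ∀ k : ℕ, ∀ f (hf : f ∈ N), (⟨f, hNR hf⟩ : R) ∈ augIdeal R ^ (k + 1) := by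
    intro k
    induction k with
    | zero => intro f hf; simpa using mem_augIdeal.2 (hN1 f hf)
    | succ k ih =>
      intro f hf
      have h1 := hEk k _ (ih f hf)
      have h2 : E ⟨f, hNR hf⟩ ∈ augIdeal R ^ (k + 2) := by
        refine Ideal.sum_mem _ fun i _ => ?_
        rw [pow_succ']
        exact Ideal.mul_mem_mul (hX.t_mem i) (ih _ (hNX f hf _ (hX.pd i)))
      have h3 := Ideal.sub_mem _ h2 h1
      rw [sub_sub_cancel] at h3
      have h4 := Ideal.mul_mem_left _ (algebraMap ℂ R ((k + 1 : ℂ)⁻¹)) h3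
      rw [← mul_assoc] at h4
      have h5 : algebraMap ℂ R ((k + 1 : ℂ)⁻¹) * (k + 1 : R) = 1 := by
        have : (k + 1 : R) = algebraMap ℂ R (k + 1) := by simp
        rw [this, ← map_mul, inv_mul_cancel₀ (Nat.cast_add_one_ne_zero k), map_one]
      rwa [h5, one_mul] at h4
  intro f hf
  have hne : augIdeal R ≠ ⊤ := by
    intro h
    have : (1 : R) ∈ augIdeal R := h ▸ trivial
    rw [mem_augIdeal] at this
    simp at this
  have hbot := Ideal.iInf_pow_eq_bot_of_isDomain (augIdeal R) hne
  have : (⟨f, hNR hf⟩ : R) ∈ ⨅ i : ℕ, augIdeal R ^ i := by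
    rw [Submodule.mem_iInf]
    intro i
    exact Ideal.pow_le_pow_right (Nat.le_succ i) (hpow i f hf)
  rw [hbot] at this
  exact congrArg Subtype.val (Submodule.mem_bot R |>.1 this)

lemma IsHopfFn.eq_zero_of_linv_eq_zero {R : FnAlg Γ} (hR : IsHopfFn R) [IsDomain R]
    {f : Γ → ℂ} (hf : f ∈ R) (h1 : f 1 = 0) (hX : ∀ X, IsPD R X → linv X f = 0) : f = 0 := by
  refine hR.eq_zero_of_linv_stable {f, 0} ?_ ?_ ?_ f (by simp)
  · rintro g (rfl | rfl)
    exacts [hf, R.zero_mem]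
  · rintro g (rfl | rfl)
    exacts [h1, rfl]
  · rintro g (rfl | rfl) X h
    · simp [hX X h]
    · simp

end Coords


section NullGeneral

open scoped TensorProduct

variable {k Ω B : Type} [Field k] [Field Ω] [Algebra k Ω] [IsAlgClosed Ω]
variable [CommRing B] [Algebra k B] [Algebra.FiniteType k B]

lemma exists_algHom_algClosed [Nontrivial B] : Nonempty (B →ₐ[k] Ω) := by
  obtain ⟨m, hm⟩ := Ideal.exists_maximal B
  let _ : Field (B ⧸ m) := Ideal.Quotient.field m
  have := Algebra.FiniteType.of_surjective (Ideal.Quotient.mkₐ k m) Ideal.Quotient.mk_surjective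
  have := finite_of_finite_type_of_isJacobsonRing k (B ⧸ m)
  exact ⟨(IsAlgClosed.lift (R := k) (S := B ⧸ m) (M := Ω)).comp (Ideal.Quotient.mkₐ k m)⟩

lemma isNilpotent_of_forall_algHom_algClosed {b : B} (h : ∀ p : B →ₐ[k] Ω, p b = 0) :
    IsNilpotent b := by
  by_contra hb
  have : Algebra.FiniteType B (Localization.Away b) := IsLocalization.finiteType_of_monoid_fg
    (Submonoid.powers b) _
  have : Algebra.FiniteType k (Localization.Away b) :=
    Algebra.FiniteType.trans (S := B) inferInstance inferInstance
  have : Nontrivial (Localization.Away b) := by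
    by_contra hbt
    rw [not_nontrivial_iff_subsingleton] at hbt
    obtain ⟨n, hn⟩ := (IsLocalization.subsingleton_iff (R := B) (S := Localization.Away b)
      (M := Submonoid.powers b)).1 hbt
    exact hb ⟨n, hn⟩
  obtain ⟨p⟩ := exists_algHom_algClosed (k := k) (Ω := Ω) (B := Localization.Away b)
  have hu : IsUnit (algebraMap B (Localization.Away b) b) := IsLocalization.Away.algebraMap_isUnit b
  have := h (p.comp (IsScalarTower.toAlgHom k B _))
  have h3 := (hu.map p).ne_zero
  exact h3 (by simpa using this)

lemma exists_smul_mem_range_of_nilpotent {R S : Type} [CommRing R] [IsDomain R] [CharZero R]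
    [CommRing S] [IsReduced S] [Algebra R S] [Algebra.FiniteType R S]
    (hinj : Function.Injective (algebraMap R S)) (f : S)
    (hf : IsNilpotent (f ⊗ₜ[R] (1 : S) - (1 : S) ⊗ₜ[R] f)) :
    ∃ d : R, d ≠ 0 ∧ ∃ a : R, d • f = algebraMap R S a := by
  let K := FractionRing R
  let Ω := AlgebraicClosure K
  have := charZero_of_injective_algebraMap (IsFractionRing.injective R K)
  have hgal := IsAlgClosure.isGalois K Ω
  let T := K ⊗[R] S
  have hloc := (isLocalizedModule_iff_isBaseChange (nonZeroDivisors R) K _).2 (TensorProduct.isBaseChange R S K)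
  have hker : ∀ s : S, (1 : K) ⊗ₜ[R] s = 0 → ∃ e : R, e ≠ 0 ∧ e • s = 0 := by
    intro s hs
    obtain ⟨c, hc⟩ := (IsLocalizedModule.eq_zero_iff (nonZeroDivisors R)
      (TensorProduct.mk R K S 1)).1 hs
    exact ⟨c.1, nonZeroDivisors.ne_zero c.2, hc⟩
  have : Nontrivial T := by
    by_contra hbt
    rw [not_nontrivial_iff_subsingleton] at hbt
    obtain ⟨e, he, h⟩ := hker 1 (Subsingleton.elim _ _)
    rw [Algebra.smul_def, mul_one] at h
    exact he (hinj (by rw [h, map_zero]))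
  obtain ⟨φ⟩ := exists_algHom_algClosed (k := K) (Ω := Ω) (B := T)
  have huniq : ∀ ψ : T →ₐ[K] Ω, ψ (1 ⊗ₜ f) = φ (1 ⊗ₜ f) := by
    intro ψ
    let φ' : S →ₐ[R] Ω := (φ.restrictScalars R).comp Algebra.TensorProduct.includeRight
    let ψ' : S →ₐ[R] Ω := (ψ.restrictScalars R).comp Algebra.TensorProduct.includeRight
    have := hf.map (Algebra.TensorProduct.productMap ψ' φ')
    rw [map_sub, Algebra.TensorProduct.productMap_apply_tmul,
      Algebra.TensorProduct.productMap_apply_tmul, map_one, map_one, mul_one, one_mul] at this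
    exact sub_eq_zero.1 this.eq_zero
  obtain ⟨α, hα⟩ : φ (1 ⊗ₜ f) ∈ Set.range (algebraMap K Ω) :=
    (InfiniteGalois.mem_range_algebraMap_iff_fixed _).2 fun σ => huniq (σ.toAlgHom.comp φ)
  obtain ⟨a, d, hd, rfl⟩ := IsFractionRing.div_surjective (A := R) α
  have hd0 : d ≠ 0 := nonZeroDivisors.ne_zero hd
  have hnil : IsNilpotent ((1 : K) ⊗ₜ[R] (d • f - algebraMap R S a) : T) := by
    apply isNilpotent_of_forall_algHom_algClosed (k := K) (Ω := Ω)
    intro p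
    have e1 : ((1 : K) ⊗ₜ[R] (d • f - algebraMap R S a) : T) =
        algebraMap K T (algebraMap R K d) * 1 ⊗ₜ f - algebraMap K T (algebraMap R K a) := by
      rw [TensorProduct.tmul_sub, ← TensorProduct.smul_tmul, Algebra.TensorProduct.algebraMap_apply,
        Algebra.TensorProduct.tmul_mul_tmul, Algebra.TensorProduct.algebraMap_apply,
        Algebra.algebraMap_eq_smul_one (A := S), ← TensorProduct.smul_tmul,
        Algebra.algebraMap_eq_smul_one (A := K) a, Algebra.algebraMap_eq_smul_one (A := K) d]
      simp
    rw [e1, map_sub, map_mul, AlgHom.commutes, AlgHom.commutes, huniq p, ← hα, ← map_mul,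
      mul_div_cancel₀, sub_self]
    exact fun h => hd0 (IsFractionRing.injective R K (by rw [h, map_zero]))
  obtain ⟨n, hn⟩ := hnil
  have hn' : (1 : K) ⊗ₜ[R] ((d • f - algebraMap R S a) ^ n) = 0 := by
    rw [Algebra.TensorProduct.tmul_pow, one_pow] at hn; exact hn
  obtain ⟨e, he, h⟩ := hker _ hn'
  have h2 : e • (d • f - algebraMap R S a) = 0 := by
    apply IsReduced.eq_zero
    refine ⟨n + 1, ?_⟩
    have : (e • (d • f - algebraMap R S a)) ^ (n + 1) =
        e ^ n • ((e • (d • f - algebraMap R S a) ^ n) * (d • f - algebraMap R S a)) := by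
      generalize d • f - algebraMap R S a = w
      simp only [Algebra.smul_def, map_pow]; ring
    rw [this, h, zero_mul, smul_zero]
  refine ⟨e * d, mul_ne_zero he hd0, e * a, ?_⟩
  rw [smul_sub, sub_eq_zero] at h2
  rw [mul_smul, h2, map_mul, Algebra.smul_def]

end NullGeneral

section Descent

open scoped TensorProduct

variable {Γ : Type} [Group Γ]

lemma IsHopfFn.exists_mul_mem_of_constant_on_classes {R S : FnAlg Γ}
    [IsDomain R] (hRS : R ≤ S) (hS : IsHopfFn S)
    (hpts : ∀ p : S →ₐ[ℂ] ℂ, ∃ x, ∀ f : S, p f = f.1 x) {f : Γ → ℂ} (hf : f ∈ S)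
    (hconst : ∀ x y, (∀ r ∈ R, r x = r y) → f x = f y) : ∃ d ∈ R, d ≠ 0 ∧ d * f ∈ R := by
  let _ : Algebra R S := (Subalgebra.inclusion hRS).toRingHom.toAlgebra
  have hmap : ∀ r : R, algebraMap R S r = ⟨r.1, hRS r.2⟩ := fun _ => rfl
  have : IsScalarTower ℂ R S := IsScalarTower.of_algebraMap_eq fun _ => rfl
  have hSft := hS.finiteType
  have := Algebra.FiniteType.of_restrictScalars_finiteType ℂ R S
  have : Algebra.FiniteType ℂ (S ⊗[R] S) :=
    Algebra.FiniteType.trans (S := S) inferInstance inferInstance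
  have := isReduced_of_injective S.val Subtype.val_injective
  have := charZero_of_injective_algebraMap (algebraMap ℂ R).injective
  obtain ⟨d, hd, a, ha⟩ := exists_smul_mem_range_of_nilpotent (R := R) (S := S)
    (fun a b h => Subtype.ext (congrArg (fun s : S => s.1) h)) ⟨f, hf⟩ (by
      apply isNilpotent_of_forall_algHom
      intro p
      obtain ⟨x, hx⟩ := hpts (p.comp Algebra.TensorProduct.includeLeft)
      obtain ⟨y, hy⟩ := hpts (p.comp
        ((Algebra.TensorProduct.includeRight : S →ₐ[R] S ⊗[R] S).restrictScalars ℂ))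
      have hxy : ∀ r ∈ R, r x = r y := fun r hr => by
        refine (hx ⟨r, hRS hr⟩).symm.trans (Eq.trans ?_ (hy ⟨r, hRS hr⟩))
        change p (algebraMap R S ⟨r, hr⟩ ⊗ₜ 1) = p (1 ⊗ₜ algebraMap R S ⟨r, hr⟩)
        rw [Algebra.algebraMap_eq_smul_one, TensorProduct.smul_tmul]
      rw [map_sub, sub_eq_zero]
      exact (hx ⟨f, hf⟩).trans ((hconst x y hxy).trans (hy ⟨f, hf⟩).symm))
  refine ⟨d.1, d.2, fun h => hd (Subtype.ext h), ?_⟩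
  rw [Algebra.smul_def, hmap, hmap] at ha
  have := congrArg Subtype.val ha
  change d.1 * f = a.1 at this
  rw [this]; exact a.2

lemma IsHopfFn.mem_of_constant_on_classes {R S : FnAlg Γ} (hR : IsHopfFn R)
    [IsDomain R] (hRS : R ≤ S) (hS : IsHopfFn S)
    (hpts : ∀ p : S →ₐ[ℂ] ℂ, ∃ x, ∀ f : S, p f = f.1 x) {f : Γ → ℂ} (hf : f ∈ S)
    (hconst : ∀ x y, (∀ r ∈ R, r x = r y) → f x = f y) : f ∈ R := by
  classical
  have hconst' : ∀ z x y, (∀ r ∈ R, r x = r y) → f (x * z) = f (y * z) := fun z x y h =>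
    hconst _ _ fun r hr => h _ (hR.right_translate hr z)
  let I : Submodule ℂ (Γ → ℂ) :=
    { carrier := {d | d ∈ R ∧ ∀ z, (d * fun x => f (x * z)) ∈ R}
      add_mem' := fun {a b} h1 h2 => ⟨R.add_mem h1.1 h2.1, fun z => by
        rw [add_mul]; exact R.add_mem (h1.2 z) (h2.2 z)⟩
      zero_mem' := ⟨R.zero_mem, fun z => by rw [zero_mul]; exact R.zero_mem⟩
      smul_mem' := fun c a h => ⟨R.smul_mem h.1 c, fun z => by
        rw [smul_mul_assoc]; exact R.smul_mem (h.2 z) c⟩ }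
  obtain ⟨d, hdI, hd0⟩ : ∃ d ∈ I, d ≠ 0 := by
    obtain ⟨n, a, b, ha, hb, hab⟩ := biReg_expand (hS.comul f hf)
    let V : Submodule ℂ (Γ → ℂ) := Submodule.span ℂ (Set.range fun z x => f (x * z))
    have hVfd : FiniteDimensional ℂ V := by
      have hle : V ≤ Submodule.span ℂ (Set.range a) := by
        rw [Submodule.span_le]
        rintro _ ⟨z, rfl⟩
        have : (fun x => f (x * z)) = ∑ i, b i z • a i := by
          funext x; simp [hab, mul_comm]
        change (fun x => f (x * z)) ∈ _
        rw [this]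
        exact Submodule.sum_mem _ fun i _ => Submodule.smul_mem _ _ (Submodule.subset_span ⟨i, rfl⟩)
      have := FiniteDimensional.span_of_finite ℂ (Set.finite_range a)
      exact Submodule.finiteDimensional_of_le hle
    obtain ⟨s, hsub, hs⟩ := Submodule.fg_span_iff_fg_span_finset_subset
      (Set.range fun z x => f (x * z)) |>.1 ((Submodule.fg_iff_finiteDimensional V).2 hVfd)
    have hprod : ∀ s : Finset (Γ → ℂ), (s : Set (Γ → ℂ)) ⊆ (Set.range fun z x => f (x * z)) →
        ∃ d ∈ R, d ≠ 0 ∧ ∀ g ∈ s, d * g ∈ R := by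
      intro s
      induction s using Finset.induction_on with
      | empty => intro _; exact ⟨1, R.one_mem, one_ne_zero, by simp⟩
      | insert g s _ ih =>
        intro h
        rw [Finset.coe_insert, Set.insert_subset_iff] at h
        obtain ⟨d, hd, hd0, hds⟩ := ih h.2
        obtain ⟨z, rfl⟩ := h.1
        obtain ⟨e, he, he0, hes⟩ := exists_mul_mem_of_constant_on_classes hRS hS hpts
          (hS.right_translate hf z) (hconst' z)
        refine ⟨d * e, R.mul_mem hd he, fun h0 => ?_, fun g' hg' => ?_⟩
        · have : (⟨d, hd⟩ : R) * ⟨e, he⟩ = 0 := Subtype.ext h0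
          rcases mul_eq_zero.1 this with h | h
          · exact hd0 (congrArg Subtype.val h)
          · exact he0 (congrArg Subtype.val h)
        · rcases Finset.mem_insert.1 hg' with rfl | hg'
          · rw [mul_assoc]; exact R.mul_mem hd hes
          · rw [mul_comm d e, mul_assoc]; exact R.mul_mem he (hds g' hg')
    obtain ⟨d, hd, hd0, hds⟩ := hprod s hsub
    refine ⟨d, ⟨hd, fun z => ?_⟩, hd0⟩
    have hz : (fun x => f (x * z)) ∈ Submodule.span ℂ (s : Set (Γ → ℂ)) := by
      rw [← hs]; exact Submodule.subset_span ⟨z, rfl⟩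
    generalize (fun x => f (x * z)) = g at hz
    induction hz using Submodule.span_induction with
    | mem a h => exact hds a h
    | zero => rw [mul_zero]; exact R.zero_mem
    | add a b _ _ h1 h2 => rw [mul_add]; exact R.add_mem h1 h2
    | smul c a _ h => rw [mul_smul_comm]; exact R.smul_mem h c
  have h1 := hR.one_mem_of_translate_stable I (fun f h => h.1)
    (fun r hr f h => ⟨R.mul_mem hr h.1, fun z => by rw [mul_assoc]; exact R.mul_mem hr (h.2 z)⟩)
    (fun f' h y => ⟨hR.right_translate h.1 y, fun z => by
      have := hR.right_translate (h.2 (y⁻¹ * z)) y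
      convert this using 1
      funext x
      simp only [Pi.mul_apply]
      rw [mul_assoc x y, mul_inv_cancel_left]⟩) hdI hd0
  simpa using h1.2 1

end Descent


section PowPoly

variable {Γ : Type} [Group Γ]

/-- Polynomial functions on the line. -/
def polyFn : FnAlg ℂ := Algebra.adjoin ℂ {id}

lemma mem_polyFn {b : ℂ → ℂ} : b ∈ polyFn ↔ ∃ q : Polynomial ℂ, b = fun t => q.eval t := by
  rw [polyFn, Algebra.adjoin_singleton_eq_range_aeval]
  have : ∀ q : Polynomial ℂ, Polynomial.aeval (id : ℂ → ℂ) q = fun t => q.eval t := by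
    intro q
    funext t
    have := Polynomial.aeval_algHom_apply (Pi.evalAlgHom ℂ (fun _ : ℂ => ℂ) t) id q
    simpa [Polynomial.aeval_def, Polynomial.eval₂_eq_eval_map] using this.symm
  constructor
  · rintro ⟨q, rfl⟩; exact ⟨q, this q⟩
  · rintro ⟨q, rfl⟩; exact ⟨q, this q⟩

/-- All functions of `R` are polynomial along the powers of every element. -/
def IsPowPoly (R : FnAlg Γ) : Prop :=
  ∀ f ∈ R, ∃ F ∈ biReg R polyFn, ∀ x (n : ℕ), f (x ^ n) = F x n

lemma poly_eq_of_nat {p q : Polynomial ℂ} (h : ∀ n : ℕ, p.eval (n : ℂ) = q.eval (n : ℂ)) : p = q := by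
  apply Polynomial.eq_of_infinite_eval_eq
  refine Set.Infinite.mono ?_ (Set.infinite_range_of_injective (Nat.cast_injective (R := ℂ)))
  rintro _ ⟨n, rfl⟩; exact h n

open Classical in
/-- The polynomial interpolating `n ↦ f (x ^ n)`. -/
def powPoly (f : Γ → ℂ) (x : Γ) : Polynomial ℂ :=
  if h : ∃ p : Polynomial ℂ, ∀ n : ℕ, p.eval (n : ℂ) = f (x ^ n) then h.choose else 0

lemma powPoly_eq {f : Γ → ℂ} {x : Γ} {p : Polynomial ℂ} (h : ∀ n : ℕ, p.eval (n : ℂ) = f (x ^ n)) :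
    powPoly f x = p := by
  have hex : ∃ p : Polynomial ℂ, ∀ n : ℕ, p.eval (n : ℂ) = f (x ^ n) := ⟨p, h⟩
  rw [powPoly, dif_pos hex]
  exact poly_eq_of_nat fun n => by rw [hex.choose_spec n, h n]

lemma isPowPoly_of_adjoin {R : FnAlg Γ} (s : Set (Γ → ℂ)) (hs : R = Algebra.adjoin ℂ s)
    (h : ∀ f ∈ s, ∃ F ∈ biReg R polyFn, ∀ x (n : ℕ), f (x ^ n) = F x n) : IsPowPoly R := by
  intro f hf
  rw [hs] at hf
  induction hf using Algebra.adjoin_induction with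
  | mem f hf => exact h f hf
  | algebraMap c => exact ⟨fun _ _ => c, by
      simpa using biReg_of_left (R := R) (S := polyFn) (R.algebraMap_mem c), fun _ _ => rfl⟩
  | add f g _ _ h1 h2 =>
    obtain ⟨F, hF, hf⟩ := h1
    obtain ⟨G, hG, hg⟩ := h2
    exact ⟨F + G, Submodule.add_mem _ hF hG, fun x n => by simp [hf, hg]⟩
  | mul f g _ _ h1 h2 =>
    obtain ⟨F, hF, hf⟩ := h1
    obtain ⟨G, hG, hg⟩ := h2
    exact ⟨F * G, biReg_mul hF hG, fun x n => by simp [hf, hg]⟩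

namespace IsPowPoly

variable {R : FnAlg Γ} (hP : IsPowPoly R)
include hP

lemma spec {f : Γ → ℂ} (hf : f ∈ R) :
    (∀ x (n : ℕ), (powPoly f x).eval (n : ℂ) = f (x ^ n)) ∧
    (∀ k, (fun x => (powPoly f x).coeff k) ∈ R) ∧
    (∃ N, ∀ x, (powPoly f x).natDegree < N) := by
  obtain ⟨F, hF, h⟩ := hP f hf
  obtain ⟨n, a, b, ha, hb, hab⟩ := biReg_expand hF
  choose q hq using fun i => mem_polyFn.1 (hb i)
  have hp : ∀ x, powPoly f x = ∑ i, a i x • q i := fun x => powPoly_eq fun m => by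
    rw [h, hab, Polynomial.eval_finsetSum]
    simp [hq]
  refine ⟨fun x m => ?_, fun k => ?_, ?_⟩
  · rw [hp, h, hab, Polynomial.eval_finsetSum]; simp [hq]
  · have : (fun x => (powPoly f x).coeff k) = ∑ i, (q i).coeff k • a i := by
      funext x; simp [hp, mul_comm]
    rw [this]
    exact R.sum_mem fun i _ => R.smul_mem (ha i) _
  · refine ⟨Finset.univ.sup (fun i => (q i).natDegree) + 1, fun x => ?_⟩
    rw [hp, Nat.lt_succ_iff]
    refine Polynomial.natDegree_sum_le_of_forall_le _ _ fun i _ => ?_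
    exact (Polynomial.natDegree_smul_le _ _).trans
      (Finset.le_sup (f := fun i => (q i).natDegree) (Finset.mem_univ i))

lemma eval_nat {f : Γ → ℂ} (hf : f ∈ R) (x : Γ) (n : ℕ) :
    (powPoly f x).eval (n : ℂ) = f (x ^ n) := (hP.spec hf).1 x n

lemma coeff_mem {f : Γ → ℂ} (hf : f ∈ R) (k : ℕ) : (fun x => (powPoly f x).coeff k) ∈ R :=
  (hP.spec hf).2.1 k

lemma add {f g : Γ → ℂ} (hf : f ∈ R) (hg : g ∈ R) (x : Γ) :
    powPoly (f + g) x = powPoly f x + powPoly g x :=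
  powPoly_eq fun n => by simp [hP.eval_nat hf, hP.eval_nat hg]

lemma mul {f g : Γ → ℂ} (hf : f ∈ R) (hg : g ∈ R) (x : Γ) :
    powPoly (f * g) x = powPoly f x * powPoly g x :=
  powPoly_eq fun n => by simp [hP.eval_nat hf, hP.eval_nat hg]

lemma smul {f : Γ → ℂ} (hf : f ∈ R) (c : ℂ) (x : Γ) :
    powPoly (c • f) x = c • powPoly f x :=
  powPoly_eq fun n => by simp [hP.eval_nat hf]

omit hP in
lemma const (c : ℂ) (x : Γ) : powPoly (fun _ : Γ => c) x = Polynomial.C c :=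
  powPoly_eq fun n => by simp

lemma eval_one {f : Γ → ℂ} (hf : f ∈ R) (x : Γ) : (powPoly f x).eval 1 = f x := by
  simpa using hP.eval_nat hf x 1

lemma eval_zero {f : Γ → ℂ} (hf : f ∈ R) (x : Γ) : (powPoly f x).eval 0 = f 1 := by
  simpa using hP.eval_nat hf x 0

lemma at_pow {f : Γ → ℂ} (hf : f ∈ R) (x : Γ) (n : ℕ) :
    powPoly f (x ^ n) = (powPoly f x).comp (Polynomial.C (n : ℂ) * Polynomial.X) :=
  powPoly_eq fun m => by
    have := hP.eval_nat hf x (n * m)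
    rw [pow_mul, Nat.cast_mul] at this
    simp [Polynomial.eval_comp, this]

lemma coeff_powPoly {f : Γ → ℂ} (hf : f ∈ R) (k : ℕ) (x : Γ) :
    powPoly (fun x => (powPoly f x).coeff k) x = Polynomial.monomial k ((powPoly f x).coeff k) :=
  powPoly_eq fun n => by
    rw [hP.at_pow hf, Polynomial.comp_C_mul_X_coeff, Polynomial.eval_monomial]

lemma isConnFn : IsConnFn R := by
  have key : ∀ S T : Set (Γ → ℂ), S ⊆ R → T ⊆ R →
      (∀ x, (∀ f ∈ S, f x = 0) ∨ (∀ f ∈ T, f x = 0)) →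
      (∀ x, (∀ f ∈ S, f x = 0) → (∀ f ∈ T, f x = 0) → False) → (∀ f ∈ S, f 1 = 0) →
      ∀ x, ∀ f ∈ S, f x = 0 := by
    intro S T hS hT hcov hdisj h1 x
    by_contra hx
    have hinf : ∀ V : Set (Γ → ℂ), V ⊆ R → {n : ℕ | ∀ f ∈ V, f (x ^ n) = 0}.Infinite →
        ∀ n : ℕ, ∀ f ∈ V, f (x ^ n) = 0 := by
      intro V hV hi n f hf
      have : powPoly f x = 0 := by
        apply Polynomial.eq_zero_of_infinite_isRoot
        refine Set.Infinite.mono ?_ (hi.image (Nat.cast_injective (R := ℂ)).injOn)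
        rintro _ ⟨m, hm, rfl⟩
        rw [Set.mem_ofPred, Polynomial.IsRoot, hP.eval_nat (hV hf), hm f hf]
      rw [← hP.eval_nat (hV hf), this, Polynomial.eval_zero]
    have hunion : ({n : ℕ | ∀ f ∈ S, f (x ^ n) = 0} ∪ {n : ℕ | ∀ f ∈ T, f (x ^ n) = 0}).Infinite := by
      have : ({n : ℕ | ∀ f ∈ S, f (x ^ n) = 0} ∪ {n : ℕ | ∀ f ∈ T, f (x ^ n) = 0}) = Set.univ :=
        Set.eq_univ_of_forall fun n => hcov _
      rw [this]; exact Set.infinite_univ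
    rcases Set.infinite_union.1 hunion with h | h
    · apply hx
      intro f hf
      simpa using hinf S hS h 1 f hf
    · apply hdisj 1 h1
      intro f hf
      simpa using hinf T hT h 0 f hf
  intro S T hS hT hcov hdisj
  rcases hcov 1 with h | h
  · exact Or.inl (key S T hS hT hcov hdisj h)
  · exact Or.inr (key T S hT hS (fun x => (hcov x).symm) (fun x a b => hdisj x b a) h)

lemma pd_coeff (hR : IsHopfFn R) {X : FnDual Γ} (hX : IsPD R X) {f : Γ → ℂ} (hf : f ∈ R)
    (k : ℕ) : X (fun x => (powPoly f x).coeff k) = if k = 1 then X f else 0 := by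
  have hpow : ∀ n : ℕ, ∀ f ∈ R, (fun x => f (x ^ n)) ∈ R ∧ X (fun x => f (x ^ n)) = n * X f := by
    intro n
    induction n with
    | zero =>
      intro f hf
      simp only [pow_zero]
      have : (fun _ : Γ => f 1) = f 1 • (1 : Γ → ℂ) := by funext x; simp
      rw [this, map_smul, hX.map_one]
      exact ⟨R.smul_mem R.one_mem _, by simp⟩
    | succ n ih =>
      intro f hf
      obtain ⟨m, a, b, ha, hb, hab⟩ := biReg_expand (hR.comul f hf)
      have e : (fun x => f (x ^ (n + 1))) = ∑ i, (fun x => a i (x ^ n)) * b i := by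
        funext x; simp [pow_succ, hab]
      have e1 : f = ∑ i, b i 1 • a i := by
        funext x
        have := hab x 1
        simpa [mul_comm] using this
      have e2 : f = ∑ i, a i 1 • b i := by
        funext x
        have := hab 1 x
        simpa using this
      refine ⟨?_, ?_⟩
      · rw [e]; exact R.sum_mem fun i _ => R.mul_mem (ih _ (ha i)).1 (hb i)
      · rw [e, map_sum]
        have h1 : X f = ∑ i, b i 1 * X (a i) := by
          conv_lhs => rw [e1]
          simp
        have h2 : X f = ∑ i, a i 1 * X (b i) := by
          conv_lhs => rw [e2]
          simp
        have : ∀ i, X ((fun x => a i (x ^ n)) * b i) = a i 1 * X (b i) + n * (b i 1 * X (a i)) := by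
          intro i
          rw [hX _ (ih _ (ha i)).1 _ (hb i), (ih _ (ha i)).2, one_pow]
          ring
        rw [Finset.sum_congr rfl fun i _ => this i, Finset.sum_add_distrib, ← Finset.mul_sum,
          ← h1, ← h2]
        push_cast; ring
  obtain ⟨N, hN⟩ := (hP.spec hf).2.2
  have hXe : ∀ n : ℕ, ∑ k ∈ Finset.range N, X (fun x => (powPoly f x).coeff k) * (n : ℂ) ^ k =
      n * X f := by
    intro n
    rw [← (hpow n f hf).2]
    have : (fun x => f (x ^ n)) =
        ∑ k ∈ Finset.range N, (n : ℂ) ^ k • (fun x => (powPoly f x).coeff k) := by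
      funext x
      rw [← hP.eval_nat hf, Polynomial.eval_eq_sum_range' (hN x)]
      simp [mul_comm]
    rw [this, map_sum]
    exact Finset.sum_congr rfl fun k _ => by rw [map_smul, smul_eq_mul, mul_comm]
  have hpoly : ∑ k ∈ Finset.range N, Polynomial.monomial k (X (fun x => (powPoly f x).coeff k)) =
      Polynomial.C (X f) * Polynomial.X := by
    apply poly_eq_of_nat
    intro n
    rw [Polynomial.eval_finsetSum]
    simp only [Polynomial.eval_monomial]
    rw [hXe, Polynomial.eval_mul, Polynomial.eval_C, Polynomial.eval_X, mul_comm]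
  have hc := congrArg (fun p => Polynomial.coeff p k) hpoly
  simp only [Polynomial.finsetSum_coeff, Polynomial.coeff_monomial, Finset.sum_ite_eq',
    Polynomial.coeff_C_mul, Polynomial.coeff_X, Finset.mem_range] at hc
  by_cases hk : k < N
  · rw [if_pos hk] at hc
    rw [hc]
    by_cases h1 : k = 1
    · simp [h1]
    · rw [if_neg h1, if_neg (fun h => h1 h.symm), mul_zero]
  · rw [if_neg hk] at hc
    have h0 : (fun x => (powPoly f x).coeff k) = 0 := by
      funext x
      exact Polynomial.coeff_eq_zero_of_natDegree_lt ((hN x).trans_le (not_lt.1 hk))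
    rw [h0, map_zero]
    by_cases h1 : k = 1
    · simpa [h1] using hc
    · simp [h1]

end IsPowPoly
end PowPoly


section Poincare

/-- A Lie algebra acting by derivations on a Noetherian domain with a distinguished maximal ideal,
together with an Euler derivation `∑ p a • D (e a)`. -/
structure EulerData (R : Type) [CommRing R] [Algebra ℂ R] (𝔲 : Type) [LieRing 𝔲] [LieAlgebra ℂ 𝔲]
    (m : Ideal R) (D : 𝔲 ⊸ Derivation ℂ R R) {n : ℕ} (e : Module.Basis (Fin n) ℂ 𝔲)
    (p : Fin n → R) (E : R → R) : Prop where
  ne_top : m ≠ ⊤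
  lie : ∀ u v f, D ⁅u, v⁆ f = D u (D v f) - D v (D u f)
  euler : ∀ f, E f = ∑ a, p a * D (e a) f
  p_mem : ∀ a, p a ∈ m
  D_p : ∀ a b, D (e b) (p a) - (if a = b then 1 else 0) ∈ m
  euler_sub : ∀ f ∈ m, E f - f ∈ m ^ 2
  homog : ∀ f, ∃ (c₀ : ℂ) (N : ℕ) (c : Fin N → R), f = algebraMap ℂ R c₀ + ∑ k, c k ∧
    ∀ k, E (c k) = ((k : ℕ) + 1 : ℂ) • c k
  forms : ∀ a, ∃ (N : ℕ) (r s : Fin N → R), ∀ b, ∑ i, r i * D (e b) (s i) = if a = b then 1 else 0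

lemma sum_skew_eq_zero {R : Type} [CommRing R] [Algebra ℂ R] {n : ℕ} (p : Fin n → R)
    (B : Fin n → Fin n → R) (hB : ∀ a b, B a b = - B b a) : ∑ b, p b * ∑ a, p a * B a b = 0 := by
  have h1 : ∑ b, p b * ∑ a, p a * B a b = - ∑ b, p b * ∑ a, p a * B a b := by
    conv_rhs => simp only [Finset.mul_sum]
    rw [Finset.sum_comm, ← Finset.sum_neg_distrib]
    refine Finset.sum_congr rfl fun b _ => ?_
    rw [Finset.mul_sum, ← Finset.sum_neg_distrib]
    grind
  have h2 : (2 : ℂ) • ∑ b, p b * ∑ a, p a * B a b = 0 := by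
    rw [two_smul]; grind
  simpa using congrArg ((2 : ℂ)⁻¹ • ·) h2

namespace EulerData

variable {R : Type} [CommRing R] [Algebra ℂ R] {𝔲 : Type} [LieRing 𝔲]
  [LieAlgebra ℂ 𝔲] {m : Ideal R} {D : 𝔲 ⊸ Derivation ℂ R R} {n : ℕ}
  {e : Module.Basis (Fin n) ℂ 𝔲} {p : Fin n → R} {E : R → R} (h : EulerData R 𝔲 m D e p E)
include h

lemma E_add (f g : R) : E (f + g) = E f + E g := by
  simp [h.euler, mul_add, Finset.sum_add_distrib]

lemma E_mul (f g : R) : E (f * g) = f * E g + g * E f := by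
  simp only [h.euler, Derivation.leibniz, smul_eq_mul, Finset.mul_sum, ← Finset.sum_add_distrib]
  grind

lemma E_smul (c : ℂ) (f : R) : E (c • f) = c • E f := by
  simp [h.euler, Finset.smul_sum]

lemma E_pow {k : ℕ} {f : R} (hf : f ∈ m ^ k) : E f - (k : R) * f ∈ m ^ (k + 1) := by
  induction k generalizing f with
  | zero =>
    simp only [Nat.cast_zero, zero_mul, sub_zero, zero_add, pow_one]
    rw [h.euler]
    exact Ideal.sum_mem _ fun a _ => m.mul_mem_right _ (h.p_mem a)
  | succ k ih =>
    rw [pow_succ] at hf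
    induction hf using Submodule.mul_induction_on' with
    | mem_mul_mem a ha b hb =>
      have h1 := ih ha
      have h2 := h.euler_sub b hb
      rw [h.E_mul]
      have : a * E b + b * E a - ((k + 1 : ℕ) : R) * (a * b) =
          a * (E b - b) + (E a - k * a) * b := by push_cast; ring
      rw [this]
      refine Ideal.add_mem _ ?_ ?_
      · have := Ideal.mul_mem_mul ha h2
        grind
      · have := Ideal.mul_mem_mul h1 hb
        rwa [← pow_succ] at this
    | add a _ b _ h1 h2 =>
      rw [h.E_add]
      have : E a + E b - ((k + 1 : ℕ) : R) * (a + b) =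
          (E a - ((k + 1 : ℕ) : R) * a) + (E b - ((k + 1 : ℕ) : R) * b) := by ring
      rw [this]; exact Ideal.add_mem _ h1 h2

omit h in
lemma mem_of_nat_mul {I : Ideal R} {k : ℕ} (hk : k ≠ 0) {f : R} (hf : (k : R) * f ∈ I) : f ∈ I := by
  have : f = algebraMap ℂ R ((k : ℂ)⁻¹) * ((k : R) * f) := by
    rw [← mul_assoc, ← map_natCast (algebraMap ℂ R), ← map_mul,
      inv_mul_cancel₀ (Nat.cast_ne_zero.2 hk), map_one, one_mul]
  rw [this]; exact I.mul_mem_left _ hf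

variable [IsDomain R] [IsNoetherianRing R]

lemma eq_zero_of_forall_pow {f : R} (hf : ∀ k, f ∈ m ^ k) : f = 0 := by
  have := Ideal.iInf_pow_eq_bot_of_isDomain m h.ne_top
  have h2 : f ∈ ⨅ k, m ^ k := by simpa [Submodule.mem_iInf] using hf
  simp_all

lemma eq_zero_of_step {ι : Type} (Θ : ι → R) (c k₀ : ℕ) (hc : c + k₀ ≠ 0)
    (h0 : ∀ i, Θ i ∈ m ^ k₀)
    (hs : ∀ k, (∀ i, Θ i ∈ m ^ k) → ∀ i, E (Θ i) + (c : R) * Θ i ∈ m ^ (k + 1)) : ∀ i, Θ i = 0 := by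
  have key : ∀ k, ∀ i, Θ i ∈ m ^ (k₀ + k) := by
    intro k
    induction k with
    | zero => simpa using h0
    | succ k ih =>
      intro i
      have h1 := hs _ ih i
      have h2 := h.E_pow (ih i)
      have h3 := Ideal.sub_mem _ h1 h2
      have : E (Θ i) + (c : R) * Θ i - (E (Θ i) - ((k₀ + k : ℕ) : R) * Θ i) =
          ((c + k₀ + k : ℕ) : R) * Θ i := by push_cast; ring
      rw [this] at h3
      exact mem_of_nat_mul (by omega) h3
  intro i
  refine h.eq_zero_of_forall_pow fun k => ?_
  exact Ideal.pow_le_pow_right (by omega) (key k i)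

lemma eq_zero_of_E_eq_zero {f : R} (hf : f ∈ m) (hE : E f = 0) : f = 0 := by
  refine h.eq_zero_of_step (ι := Unit) (fun _ => f) 0 1 (by simp) (by simpa using hf) ?_ ()
  simp_all

omit [IsDomain R] [IsNoetherianRing R] in
lemma E_mem (f : R) : E f ∈ m := by
  rw [h.euler]
  exact Ideal.sum_mem _ fun a _ => m.mul_mem_right _ (h.p_mem a)

omit [IsDomain R] [IsNoetherianRing R] in
lemma E_sum {ι : Type} (s : Finset ι) (c : ι → R) : E (∑ k ∈ s, c k) = ∑ k ∈ s, E (c k) := by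
  simp only [h.euler, map_sum, Finset.mul_sum]
  rw [Finset.sum_comm]

omit [IsDomain R] [IsNoetherianRing R] in
lemma exists_E_eq {g : R} (hg : g ∈ m) : ∃ f, E f = g := by
  obtain ⟨c₀, N, c, hc, hk⟩ := h.homog g
  have hE : ∀ k : Fin N, E ((((k : ℕ) + 1 : ℂ)⁻¹) • c k) = c k := fun k => by
    rw [h.E_smul, hk, smul_smul, inv_mul_cancel₀ (Nat.cast_add_one_ne_zero _), one_smul]
  have hcm : ∀ k, c k ∈ m := fun k => by rw [← hE k]; exact h.E_mem _
  have hc0 : algebraMap ℂ R c₀ ∈ m := by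
    have : algebraMap ℂ R c₀ = g - ∑ k, c k := by rw [hc]; ring
    rw [this]
    exact Ideal.sub_mem _ hg (Ideal.sum_mem _ fun k _ => hcm k)
  have h0 : c₀ = 0 := by
    by_contra h0
    apply h.ne_top
    rw [Ideal.eq_top_iff_one]
    have := m.mul_mem_left (algebraMap ℂ R c₀⁻¹) hc0
    rwa [← map_mul, inv_mul_cancel₀ h0, map_one] at this
  refine ⟨∑ k : Fin N, (((k : ℕ) + 1 : ℂ)⁻¹) • c k, ?_⟩
  rw [h.E_sum, hc, h0, map_zero, zero_add]
  grind

omit [IsDomain R] [IsNoetherianRing R] in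
lemma D_p_mul (b : Fin n) (Θ : Fin n → R) {k : ℕ} (hΘ : ∀ a, Θ a ∈ m ^ k) :
    ∑ a, D (e b) (p a) * Θ a - Θ b ∈ m ^ (k + 1) := by
  have : ∑ a, D (e b) (p a) * Θ a - Θ b =
      ∑ a, (D (e b) (p a) - (if a = b then 1 else 0)) * Θ a := by
    simp [sub_mul, Finset.sum_sub_distrib]
  rw [this, pow_succ']
  exact Ideal.sum_mem _ fun a _ => Ideal.mul_mem_mul (h.D_p a b) (hΘ a)

omit h [IsDomain R] [IsNoetherianRing R] in
lemma lin_mem {I : Ideal R} {θ : 𝔲 ⊸ R} (hθ : ∀ a, θ (e a) ∈ I) (u : 𝔲) : θ u ∈ I := by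
  rw [← e.sum_repr u, map_sum]
  refine Ideal.sum_mem _ fun a _ => ?_
  rw [map_smul, Algebra.smul_def]
  exact I.mul_mem_left _ (hθ a)

omit h [IsDomain R] [IsNoetherianRing R] in
lemma D_repr (u : 𝔲) (f : R) : D u f = ∑ b, e.repr u b • D (e b) f := by
  let ev : 𝔲 ⊸ R :=
    { toFun := fun u => D u f, map_add' := fun u v => by simp, map_smul' := fun c u => by simp }
  have : ev u = ∑ b, e.repr u b • ev (e b) := by
    conv_lhs => rw [← e.sum_repr u]
    rw [map_sum]
    simp
  exact this

lemma poincare_one (θ : 𝔲 ⊸ R) (hθ : ∀ u v, D u (θ v) - D v (θ u) = θ ⁅u, v⁆) :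
    ∃ b : R, b ∈ m ∧ ∀ u, D u b = θ u := by
  obtain ⟨b', hb'⟩ := h.exists_E_eq (g := ∑ a, p a * θ (e a))
    (Ideal.sum_mem _ fun a _ => m.mul_mem_right _ (h.p_mem a))
  obtain ⟨b, hbm, hb⟩ : ∃ b, b ∈ m ∧ E b = ∑ a, p a * θ (e a) := by
    obtain ⟨c₀, N, c, hc, hk⟩ := h.homog b'
    refine ⟨∑ k, c k, Ideal.sum_mem _ fun k _ => ?_, ?_⟩
    · have : c k = (((k : ℕ) + 1 : ℂ)⁻¹) • E (c k) := by
        rw [hk, smul_smul, inv_mul_cancel₀ (Nat.cast_add_one_ne_zero _), one_smul]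
      rw [this, Algebra.smul_def]
      exact m.mul_mem_left _ (h.E_mem _)
    · rw [← hb', hc, h.E_add]
      simp [h.euler (algebraMap ℂ R c₀)]
  refine ⟨b, hbm, ?_⟩
  let η : 𝔲 ⊸ R :=
    { toFun := fun u => D u b - θ u
      map_add' := fun u v => by simp; ring
      map_smul' := fun c u => by simp [smul_sub] }
  have hη : ∀ u v, D u (η v) - D v (η u) = η ⁅u, v⁆ := by
    intro u v
    have h1 := hθ u v
    have h2 := h.lie u v b
    simp only [η, LinearMap.coe_mk, AddHom.coe_mk, map_sub, h2, ← h1]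
    ring
  have hι : ∑ a, p a * η (e a) = 0 := by
    simp only [η, LinearMap.coe_mk, AddHom.coe_mk, mul_sub, Finset.sum_sub_distrib]
    rw [← hb, h.euler b, sub_self]
  have hz : ∀ b, η (e b) = 0 := by
    refine h.eq_zero_of_step (fun b => η (e b)) 1 0 (by simp) (by simp) ?_
    intro k hk b
    have h1 : ∑ a, (D (e b) (p a) * η (e a) + p a * D (e b) (η (e a))) = 0 := by
      have := congrArg (D (e b)) hι
      simp only [map_sum, Derivation.leibniz, smul_eq_mul, map_zero] at this
      rw [← this]
      exact Finset.sum_congr rfl fun a _ => by ring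
    have h2 := h.D_p_mul b (fun a => η (e a)) hk
    have h3 : ∑ a, p a * η ⁅e a, e b⁆ ∈ m ^ (k + 1) := by
      rw [pow_succ']
      exact Ideal.sum_mem _ fun a _ => Ideal.mul_mem_mul (h.p_mem a) (lin_mem hk _)
    have h4 : E (η (e b)) = ∑ a, p a * D (e b) (η (e a)) + ∑ a, p a * η ⁅e a, e b⁆ := by
      rw [h.euler, ← Finset.sum_add_distrib]
      refine Finset.sum_congr rfl fun a _ => ?_
      rw [← hη]; ring
    rw [Finset.sum_add_distrib] at h1
    have : E (η (e b)) + ((1 : ℕ) : R) * η (e b) = ∑ a, p a * η ⁅e a, e b⁆ -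
        (∑ a, D (e b) (p a) * η (e a) - η (e b)) := by
      rw [h4]
      push_cast
      linear_combination h1
    rw [this]
    exact Ideal.sub_mem _ h3 h2
  intro u
  have : η u = 0 := by
    rw [← e.sum_repr u, map_sum]
    simp [hz]
  exact sub_eq_zero.1 this

lemma exists_lieDeriv_eq (ζ : 𝔲 ⊸ R) : ∃ η : 𝔲 ⊸ R, ∀ u,
    D u (∑ a, p a * η (e a)) +
      ∑ a, p a * (D (e a) (η u) - D u (η (e a)) - η ⁅e a, u⁆) = ζ u := by
  let L : (𝔲 ⊸ R) ⊸ (𝔲 → R) :=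
    { toFun := fun η u => D u (∑ a, p a * η (e a)) +
        ∑ a, p a * (D (e a) (η u) - D u (η (e a)) - η ⁅e a, u⁆)
      map_add' := fun η η' => by
        funext u
        simp only [LinearMap.add_apply, mul_add, Finset.sum_add_distrib, map_add, Pi.add_apply,
          mul_sub, Finset.sum_sub_distrib]
        ring
      map_smul' := fun c η => by
        funext u
        simp only [LinearMap.smul_apply, Pi.smul_apply, RingHom.id_apply, smul_add,
          mul_smul_comm, ← Finset.smul_sum, Derivation.map_smul, ← smul_sub] }
  suffices hs : (fun u => ζ u) ∈ LinearMap.range L by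
    obtain ⟨η, hη⟩ := hs
    exact ⟨η, fun u => congrFun hη u⟩
  have hrs : ∀ (r s : R) (k l : ℂ), E r = k • r → E s = l • s → k + l ≠ 0 →
      (fun u => r * D u s) ∈ LinearMap.range L := by
    intro r s k l hr hs hkl
    let η : 𝔲 ⊸ R :=
      { toFun := fun u => r * D u s
        map_add' := fun u v => by simp [mul_add]
        map_smul' := fun c u => by simp }
    have hLη : L η = (k + l) • fun u => r * D u s := by
      funext u
      have e1 : ∑ a, p a * (r * D (e a) s) = r * (l • s) := by
        rw [← hs, h.euler, Finset.mul_sum]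
        grind
      have e2 : ∑ a, p a * (D (e a) (r * D u s) - D u (r * D (e a) s) - r * D ⁅e a, u⁆ s) =
          (k • r) * D u s - D u r * (l • s) := by
        rw [← hs, ← hr, h.euler, h.euler, Finset.mul_sum, Finset.sum_mul, ← Finset.sum_sub_distrib]
        refine Finset.sum_congr rfl fun a _ => ?_
        rw [h.lie, Derivation.leibniz, Derivation.leibniz]
        simp only [smul_eq_mul]
        ring
      change D u (∑ a, p a * (r * D (e a) s)) +
        ∑ a, p a * (D (e a) (r * D u s) - D u (r * D (e a) s) - r * D ⁅e a, u⁆ s) = _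
      rw [e1, e2, Derivation.leibniz, Derivation.map_smul]
      simp only [smul_eq_mul, Pi.smul_apply, Algebra.smul_def, map_add]
      ring
    refine ⟨(k + l)⁻¹ • η, ?_⟩
    simp_all
  have hrs' : ∀ r s : R, (fun u => r * D u s) ∈ LinearMap.range L := by
    intro r s
    obtain ⟨c₀, N, c, hc, hk⟩ := h.homog r
    obtain ⟨c₀', N', c', hc', hk'⟩ := h.homog s
    have : (fun u => r * D u s) = ∑ l, (((fun u => algebraMap ℂ R c₀ * D u (c' l))) +
        ∑ k, fun u => c k * D u (c' l)) := by
      funext u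
      simp only [Finset.sum_apply, Pi.add_apply, ← Finset.sum_mul, ← add_mul, ← hc]
      rw [← Finset.mul_sum, hc']
      simp
    rw [this]
    refine Submodule.sum_mem _ fun l _ => Submodule.add_mem _ ?_
      (Submodule.sum_mem _ fun k _ => ?_)
    · refine hrs _ _ 0 _ (by simp [h.euler]) (hk' l) ?_
      rw [zero_add]; exact Nat.cast_add_one_ne_zero _
    · refine hrs _ _ _ _ (hk k) (hk' l) ?_
      norm_cast
  choose N r s hN using h.forms
  have : (fun u => ζ u) = ∑ a, ∑ i, fun u => ζ (e a) * r a i * D u (s a i) := by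
    funext u
    have hu : ∀ a, ∑ i, r a i * D u (s a i) = algebraMap ℂ R (e.repr u a) := by
      intro a
      have : ∀ i, D u (s a i) = ∑ b, e.repr u b • D (e b) (s a i) := by
        exact fun i => D_repr u (s a i)
      simp only [this, Finset.mul_sum]
      rw [Finset.sum_comm]
      have h3 : ∀ b, ∑ i, r a i * (e.repr u b • D (e b) (s a i)) =
          e.repr u b • (if a = b then (1 : R) else 0) := by
        intro b
        rw [← hN a b, Finset.smul_sum]
        simp
      simp only [h3]
      simp [Algebra.smul_def]
    simp only [Finset.sum_apply, mul_assoc, ← Finset.mul_sum, hu]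
    conv_lhs => rw [← e.sum_repr u]
    rw [map_sum]
    exact Finset.sum_congr rfl fun a _ => by rw [map_smul, Algebra.smul_def, mul_comm]
  rw [this]
  exact Submodule.sum_mem _ fun a _ => Submodule.sum_mem _ fun i _ => hrs' _ _

lemma poincare_two (Ω : 𝔲 ⊸ 𝔲 ⊸ R) (halt : ∀ u, Ω u u = 0)
    (hΩ : ∀ u v w, D u (Ω v w) - D v (Ω u w) + D w (Ω u v) - Ω ⁅u, v⁆ w + Ω ⁅u, w⁆ v
      - Ω ⁅v, w⁆ u = 0) :
    ∃ η : 𝔲 ⊸ R, ∀ u v, D u (η v) - D v (η u) - η ⁅u, v⁆ = Ω u v := by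
  obtain ⟨η, hη⟩ := h.exists_lieDeriv_eq (∑ a, p a • Ω (e a))
  refine ⟨η, ?_⟩
  have hskew : ∀ u v, Ω u v = - Ω v u := fun u v => by
    have := halt (u + v)
    simp only [map_add, LinearMap.add_apply, halt, zero_add, add_zero] at this
    grind
  have hη' : ∀ u, D u (∑ a, p a * η (e a)) +
      ∑ a, p a * (D (e a) (η u) - D u (η (e a)) - η ⁅e a, u⁆) = ∑ a, p a * Ω (e a) u := by
    intro u
    rw [hη u]
    simp
  -- the contraction of the primitive with the Euler field vanishes
  have hι : ∑ a, p a * η (e a) = 0 := by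
    refine h.eq_zero_of_E_eq_zero (Ideal.sum_mem _ fun a _ => m.mul_mem_right _ (h.p_mem a)) ?_
    have h1 : ∑ b, p b * (∑ a, p a * (D (e a) (η (e b)) - D (e b) (η (e a)) - η ⁅e a, e b⁆)) =
        0 := by
      refine sum_skew_eq_zero p (fun a b => D (e a) (η (e b)) - D (e b) (η (e a)) - η ⁅e a, e b⁆) ?_
      intro a b
      rw [← lie_skew (e b) (e a), map_neg]
      ring
    have h2 : ∑ b, p b * (∑ a, p a * Ω (e a) (e b)) = 0 :=
      sum_skew_eq_zero p (fun a b => Ω (e a) (e b)) fun a b => hskew _ _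
    have h3 := Finset.sum_congr rfl fun b (_ : b ∈ Finset.univ) => congrArg (p b * ·) (hη' (e b))
    simp only [mul_add, Finset.sum_add_distrib] at h3
    rw [h1, h2, add_zero] at h3
    rw [h.euler]
    exact h3
  let W : 𝔲 ⊸ 𝔲 ⊸ R := LinearMap.mk₂ ℂ
    (fun u v => Ω u v - (D u (η v) - D v (η u) - η ⁅u, v⁆))
    (fun u u' v => by simp; ring) (fun c u v => by simp [smul_sub])
    (fun u v v' => by simp; ring) (fun c u v => by simp [smul_sub])
  have hWd : ∀ u v, W u v = Ω u v - (D u (η v) - D v (η u) - η ⁅u, v⁆) := fun u v => rfl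
  have hWalt : ∀ u v, W u v = - W v u := fun u v => by
    rw [hWd, hWd, hskew u v, ← lie_skew v u, map_neg]; ring
  have hW : ∀ u v w, D u (W v w) - D v (W u w) + D w (W u v) - W ⁅u, v⁆ w + W ⁅u, w⁆ v
      - W ⁅v, w⁆ u = 0 := by
    intro u v w
    have h0 := hΩ u v w
    have hj := congrArg η (lie_lie u v w)
    have hj2 := congrArg η (lie_skew ⁅v, w⁆ u)
    have hj3 := congrArg η (lie_skew ⁅u, w⁆ v)
    simp only [map_sub, map_neg] at hj hj2 hj3
    simp only [hWd, map_sub, h.lie]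
    linear_combination h0 - hj + hj2 - hj3
  have hιW : ∀ v, ∑ a, p a * W (e a) v = 0 := by
    intro v
    have := hη' v
    rw [hι, map_zero, zero_add] at this
    simp only [hWd]
    simp only [mul_sub, Finset.sum_sub_distrib] at this ⊢
    linear_combination -this
  have hz : ∀ bc : Fin n × Fin n, W (e bc.1) (e bc.2) = 0 := by
    refine h.eq_zero_of_step (fun bc : Fin n × Fin n => W (e bc.1) (e bc.2)) 2 0 (by simp)
      (by simp) ?_
    rintro k hk ⟨b, c⟩
    have hk' : ∀ u v, W u v ∈ m ^ k := fun u v =>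
      lin_mem (θ := W u) (fun c => lin_mem (θ := W.flip (e c)) (fun b => hk (b, c)) u) v
    have hd : ∀ b c, ∑ a, p a * D (e b) (W (e a) (e c)) =
        - ∑ a, D (e b) (p a) * W (e a) (e c) := by
      intro b c
      have := congrArg (D (e b)) (hιW (e c))
      simp only [map_sum, Derivation.leibniz, smul_eq_mul, map_zero, Finset.sum_add_distrib] at this
      rw [← sub_eq_zero, sub_neg_eq_add, ← this]
      congr 1
      exact Finset.sum_congr rfl fun a _ => by ring
    have h1 : ∑ a, p a * (W ⁅e a, e b⁆ (e c) - W ⁅e a, e c⁆ (e b)) ∈ m ^ (k + 1) := by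
      rw [pow_succ']
      exact Ideal.sum_mem _ fun a _ => Ideal.mul_mem_mul (h.p_mem a)
        (Ideal.sub_mem _ (hk' _ _) (hk' _ _))
    have h2 := h.D_p_mul b (fun a => W (e a) (e c)) fun a => hk' _ _
    have h3 := h.D_p_mul c (fun a => W (e a) (e b)) fun a => hk' _ _
    have h4 : ∑ a, p a * W ⁅e b, e c⁆ (e a) = 0 := by
      have := hιW ⁅e b, e c⁆
      rw [← neg_eq_zero, ← this, ← Finset.sum_neg_distrib]
      exact Finset.sum_congr rfl fun a _ => by rw [hWalt (e a)]; ring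
    have h5 : ∑ a, p a * (D (e a) (W (e b) (e c)) - D (e b) (W (e a) (e c)) + D (e c) (W (e a) (e b))
        - W ⁅e a, e b⁆ (e c) + W ⁅e a, e c⁆ (e b) - W ⁅e b, e c⁆ (e a)) = 0 :=
      Finset.sum_eq_zero fun a _ => by rw [hW, mul_zero]
    simp only [mul_add, mul_sub, Finset.sum_add_distrib, Finset.sum_sub_distrib] at h5
    simp only [mul_sub, Finset.sum_sub_distrib] at h1
    rw [hd b c, hd c b, h4] at h5
    have h6 := hWalt (e c) (e b)
    have : E (W (e b) (e c)) + ((2 : ℕ) : R) * W (e b) (e c) =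
        (∑ a, p a * W ⁅e a, e b⁆ (e c) - ∑ a, p a * W ⁅e a, e c⁆ (e b)) -
        (∑ a, D (e b) (p a) * W (e a) (e c) - W (e b) (e c)) +
        (∑ a, D (e c) (p a) * W (e a) (e b) - W (e c) (e b)) := by
      rw [h.euler]
      push_cast
      linear_combination h5 + h6
    rw [this]
    exact Ideal.add_mem _ (Ideal.sub_mem _ h1 h2) h3
  intro u v
  have hWz : W = 0 := e.ext fun b => e.ext fun c => by simpa using hz (b, c)
  have := hWd u v
  rw [hWz] at this
  simpa using (sub_eq_zero.1 this.symm).symm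

end EulerData
end Poincare


section LieFn

variable {Γ : Type} [Group Γ]

/-- `der` identifies the Lie algebra `𝔤` with the point derivations of `R`. -/
structure IsLieFn (R : FnAlg Γ) (𝔤 : Type) [LieRing 𝔤] [LieAlgebra ℂ 𝔤]
    (der : 𝔤 ⊸ FnDual Γ) : Prop where
  pd : ∀ u, IsPD R (der u)
  full : ∀ X, IsPD R X → ∃ u, ∀ f ∈ R, der u f = X f
  inj : ∀ u, (∀ f ∈ R, der u f = 0) → u = 0
  lie : ∀ u v, ∀ f ∈ R, der ⁅u, v⁆ f = der u (linv (der v) f) - der v (linv (der u) f)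

lemma IsPD.eq_sum {R : FnAlg Γ} {n : ℕ} {t : Fin n → R}
    {X : Fin n → FnDual Γ} (hX : IsCoords R t X) {Y : FnDual Γ} (hY : IsPD R Y)
    {f : Γ → ℂ} (hf : f ∈ R) : Y f = ∑ i, Y (t i).1 * X i f := by
  let f' : R := ⟨f, hf⟩
  have h1 := hX.expand _ (sub_mem_augIdeal f')
  have h2 := hY.map_aug_sq h1
  have hc : ∀ Z, IsPD R Z → Z (f' - algebraMap ℂ R (f'.1 1)).1 = Z f := by
    intro Z hZ
    have : (f' - algebraMap ℂ R (f'.1 1)).1 = f - f 1 • (1 : Γ → ℂ) := by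
      funext x; simp [f', Algebra.algebraMap_eq_smul_one]
    rw [this, map_sub, map_smul, hZ.map_one, smul_zero, sub_zero]
  have h3 : ((f' - algebraMap ℂ R (f'.1 1)) -
      ∑ i, X i (f' - algebraMap ℂ R (f'.1 1)).1 • t i : R).1 =
      (f' - algebraMap ℂ R (f'.1 1)).1 - ∑ i, X i f • (t i).1 := by
    simp only [hc _ (hX.pd _)]
    simp
  rw [h3, map_sub, hc Y hY, map_sum, sub_eq_zero] at h2
  rw [h2]
  exact Finset.sum_congr rfl fun i _ => by rw [map_smul, smul_eq_mul, mul_comm]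

lemma IsCoords.mem_aug_sq {R : FnAlg Γ} {n : ℕ} {t : Fin n → R}
    {X : Fin n → FnDual Γ} (hX : IsCoords R t X) {g : R} (hg : g ∈ augIdeal R)
    (h0 : ∀ i, X i g.1 = 0) : g ∈ augIdeal R ^ 2 := by
  have := hX.expand g hg
  simp_all

/-- Left-invariant derivations. -/
def linvDer {R : FnAlg Γ} (hR : IsHopfFn R) {X : FnDual Γ} (hX : IsPD R X) :
    Derivation ℂ R R :=
  Derivation.mk'
    { toFun := fun f => ⟨linv X f.1, hR.linv_mem X f.2⟩
      map_add' := fun f g => Subtype.ext (by simp)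
      map_smul' := fun c f => Subtype.ext (by simp) }
    (fun f g => Subtype.ext (by
      have := hR.linv_mul hX f.2 g.2
      simpa using this))

namespace IsLieFn

variable {R : FnAlg Γ} {𝔤 : Type} [LieRing 𝔤] [LieAlgebra ℂ 𝔤]
  {der : 𝔤 ⊸ FnDual Γ} (hL : IsLieFn R 𝔤 der) (hR : IsHopfFn R)

/-- The left-invariant derivations as a linear map. -/
def D : 𝔤 ⊸ Derivation ℂ R R where
  toFun u := linvDer hR (hL.pd u)
  map_add' u v := by
    ext f : 1
    apply Subtype.ext; funext x
    simp [linvDer, linv_apply]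
  map_smul' c u := by
    ext f : 1
    apply Subtype.ext; funext x
    simp [linvDer, linv_apply]

lemma D_apply (u : 𝔤) (f : R) : (hL.D hR u f).1 = linv (der u) f.1 := rfl

include hL in
lemma linv_lie {u v : 𝔤} {f : Γ → ℂ} (hf : f ∈ R) (hR : IsHopfFn R) :
    linv (der ⁅u, v⁆) f = linv (der u) (linv (der v) f) - linv (der v) (linv (der u) f) := by
  funext x
  have h := hL.lie u v (fun y => f (x * y)) (hR.left_translate hf x)
  have e1 : ∀ w, linv (der w) (fun y => f (x * y)) = fun y => linv (der w) f (x * y) := by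
    intro w; funext y; exact linv_translate _ _ _ _
  rw [e1, e1] at h
  exact h

include hL in
lemma exists_basis {n : ℕ} {t : Fin n → R} {X : Fin n → FnDual Γ} (hX : IsCoords R t X) :
    ∃ e : Module.Basis (Fin n) ℂ 𝔤, ∀ i, ∀ f ∈ R, der (e i) f = X i f := by
  choose e he using fun i => hL.full (X i) (hX.pd i)
  have hli : LinearIndependent ℂ e := by
    rw [Fintype.linearIndependent_iff]
    intro c hc j
    have := congrArg (fun u => der u (t j).1) hc
    simp only [map_sum, map_smul, LinearMap.sum_apply, LinearMap.smul_apply, map_zero,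
      LinearMap.zero_apply, he _ _ (t j).2, hX.dual, smul_eq_mul] at this
    simpa using this
  have hsp : ⊤ ≤ Submodule.span ℂ (Set.range e) := by
    intro u _
    have : u = ∑ i, der u (t i).1 • e i := by
      rw [← sub_eq_zero]
      apply hL.inj
      intro f hf
      rw [map_sub, LinearMap.sub_apply, (hL.pd u).eq_sum hX hf, map_sum, LinearMap.sum_apply]
      simp [he _ _ hf]
    rw [this]
    exact Submodule.sum_mem _ fun i _ => Submodule.smul_mem _ _ (Submodule.subset_span ⟨i, rfl⟩)
  exact ⟨Module.Basis.mk hli hsp, fun i f hf => by simp_all⟩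

include hL hR in
lemma finite : Module.Finite ℂ 𝔤 := by
  obtain ⟨n, t, X, hX⟩ := hR.exists_coords
  obtain ⟨e, _⟩ := hL.exists_basis hX
  exact Module.Finite.of_basis e

end IsLieFn

lemma IsHopfFn.exists_transl_expand {R : FnAlg Γ} (hR : IsHopfFn R) (t : R) :
    ∃ (N : ℕ) (r s : Fin N → R), ∀ x y, t.1 (x⁻¹ * y) = ∑ i, (r i).1 x * (s i).1 y := by
  have h1 := biReg_comp (α := fun x => x⁻¹) (β := id) (hR.comul _ t.2) (fun f hf => hR.inv f hf)
      (fun f hf => hf)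
  obtain ⟨N, r, s, hr, hs, h⟩ := biReg_expand h1
  exact ⟨N, fun i => ⟨r i, hr i⟩, fun i => ⟨s i, hs i⟩, h⟩

lemma IsHopfFn.derivation_eq_sum {R : FnAlg Γ} (hR : IsHopfFn R) {n : ℕ}
    {t : Fin n → R} {X : Fin n → FnDual Γ} (hX : IsCoords R t X) (E : Derivation ℂ R R) :
    ∃ p : Fin n → R, (∀ a, (p a).1 1 = (E (t a)).1 1) ∧
      ∀ f : R, (E f).1 = ∑ a, (p a).1 * linv (X a) f.1 := by
  choose N r s hrs using fun a => hR.exists_transl_expand (t a)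
  refine ⟨fun a => ∑ i, r a i * E (s a i), fun a => ?_, fun f => ?_⟩
  · have : t a = ∑ i, (r a i).1 1 • s a i := by
      apply Subtype.ext; funext y
      have := hrs a 1 y
      simpa using this
    conv_rhs => rw [this]
    simp [map_sum]
  · funext x
    let q : R ⊸ ℂ :=
      { toFun := fun g => (E ⟨fun y => g.1 (x⁻¹ * y), hR.left_translate g.2 _⟩).1 x
        map_add' := fun g g' => by
          have : (⟨fun y => (g + g').1 (x⁻¹ * y), hR.left_translate (g + g').2 _⟩ : R) =
            ⟨fun y => g.1 (x⁻¹ * y), hR.left_translate g.2 _⟩ +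
            ⟨fun y => g'.1 (x⁻¹ * y), hR.left_translate g'.2 _⟩ := rfl
          rw [this, map_add]; rfl
        map_smul' := fun c g => by
          have : (⟨fun y => (c • g).1 (x⁻¹ * y), hR.left_translate (c • g).2 _⟩ : R) =
            c • ⟨fun y => g.1 (x⁻¹ * y), hR.left_translate g.2 _⟩ := rfl
          rw [this, Derivation.map_smul]; rfl }
    obtain ⟨Y, hY⟩ := exists_linear_ext q
    have hpd : IsPD R Y := by
      intro g hg g' hg'
      rw [hY _ (R.mul_mem hg hg'), hY _ hg, hY _ hg']
      have : (⟨fun y => (g * g') (x⁻¹ * y), hR.left_translate (R.mul_mem hg hg') _⟩ : R) =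
            ⟨fun y => g (x⁻¹ * y), hR.left_translate hg _⟩ *
            ⟨fun y => g' (x⁻¹ * y), hR.left_translate hg' _⟩ := rfl
      change (E ⟨fun y => (g * g') (x⁻¹ * y), _⟩).1 x = _
      rw [this, Derivation.leibniz]
      simp [q]
    have h1 := hpd.eq_sum hX (hR.left_translate f.2 x)
    rw [hY _ (hR.left_translate f.2 x)] at h1
    have h2 : q ⟨fun y => f.1 (x * y), hR.left_translate f.2 x⟩ = (E f).1 x := by
      change (E ⟨fun y => f.1 (x * (x⁻¹ * y)), _⟩).1 x = _
      simp
    have h3 : ∀ a, Y (t a).1 = (∑ i, r a i * E (s a i) : R).1 x := by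
      intro a
      rw [hY _ (t a).2]
      have : (⟨fun y => (t a).1 (x⁻¹ * y), hR.left_translate (t a).2 _⟩ : R) =
          ∑ i, (r a i).1 x • s a i := by
        apply Subtype.ext; funext y
        simpa using hrs a x y
      change (E ⟨fun y => (t a).1 (x⁻¹ * y), _⟩).1 x = _
      rw [this, map_sum]
      simp
    rw [← h2, h1, Finset.sum_apply]
    simp only [h3]
    rfl

/-- The Euler derivation of a group with polynomial powers. -/
def IsPowPoly.euler {R : FnAlg Γ} (hP : IsPowPoly R) : Derivation ℂ R R :=
  Derivation.mk'
    { toFun := fun f => ⟨fun x => (powPoly f.1 x).derivative.eval 1, by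
        obtain ⟨N, hN⟩ := (hP.spec f.2).2.2
        have : (fun x => (powPoly f.1 x).derivative.eval 1) =
            ∑ k ∈ Finset.range N, (k : ℂ) • fun x => (powPoly f.1 x).coeff k := by
          funext x
          conv_lhs => rw [(powPoly f.1 x).as_sum_range' N (hN x)]
          rw [Polynomial.derivative_sum, Polynomial.eval_finsetSum, Finset.sum_apply]
          exact Finset.sum_congr rfl fun k _ => by
            rw [Polynomial.derivative_monomial, Polynomial.eval_monomial]; simp [mul_comm]
        rw [this]
        exact R.sum_mem fun k _ => R.smul_mem (hP.coeff_mem f.2 k) _⟩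
      map_add' := fun f g => Subtype.ext (by
        funext x
        have := hP.add f.2 g.2 x
        simp [this])
      map_smul' := fun c f => Subtype.ext (by
        funext x
        have := hP.smul f.2 c x
        simp [this]) }
    (fun f g => Subtype.ext (by
      funext x
      have := hP.mul f.2 g.2 x
      simp [this, hP.eval_one f.2, hP.eval_one g.2]
      ring))

lemma IsPowPoly.euler_apply {R : FnAlg Γ} (hP : IsPowPoly R) (f : R) (x : Γ) :
    (hP.euler f).1 x = (powPoly f.1 x).derivative.eval 1 := rfl

lemma IsPowPoly.euler_homog {R : FnAlg Γ} (hP : IsPowPoly R) (f : R) (k : ℕ) :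
    hP.euler ⟨fun x => (powPoly f.1 x).coeff k, hP.coeff_mem f.2 k⟩ =
      (k : ℂ) • ⟨fun x => (powPoly f.1 x).coeff k, hP.coeff_mem f.2 k⟩ := by
  apply Subtype.ext; funext x
  rw [hP.euler_apply]
  simp only [hP.coeff_powPoly f.2 k x]
  rw [Polynomial.derivative_monomial, Polynomial.eval_monomial]
  simp [mul_comm]

lemma IsPowPoly.coeff_zero {R : FnAlg Γ} (hP : IsPowPoly R) {f : Γ → ℂ} (hf : f ∈ R)
    (x : Γ) : (powPoly f x).coeff 0 = f 1 := by
  rw [Polynomial.coeff_zero_eq_eval_zero, hP.eval_zero hf]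

lemma IsPowPoly.expand {R : FnAlg Γ} (hP : IsPowPoly R) (f : R) :
    ∃ N : ℕ, f = algebraMap ℂ R (f.1 1) +
      ∑ k : Fin N, ⟨fun x => (powPoly f.1 x).coeff (k + 1), hP.coeff_mem f.2 _⟩ := by
  obtain ⟨N, hN⟩ := (hP.spec f.2).2.2
  refine ⟨N, ?_⟩
  apply Subtype.ext; funext x
  have h := hP.eval_one f.2 x
  rw [Polynomial.eval_eq_sum_range' ((hN x).trans (Nat.lt_succ_self N)),
    Finset.sum_range_succ'] at h
  simp only [one_pow, mul_one, hP.coeff_zero f.2] at h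
  rw [← h, Finset.sum_range]
  simp [Algebra.algebraMap_eq_smul_one, add_comm]

lemma IsPowPoly.pd_euler {R : FnAlg Γ} (hP : IsPowPoly R) (hR : IsHopfFn R)
    {X : FnDual Γ} (hX : IsPD R X) (f : R) : X (hP.euler f).1 = X f.1 := by
  obtain ⟨N, hN⟩ := hP.expand f
  have h1 : hP.euler f =
      ∑ k : Fin N, ((k + 1 : ℕ) : ℂ) • ⟨fun x => (powPoly f.1 x).coeff (k + 1), hP.coeff_mem f.2 _⟩ := by
    conv_lhs => rw [hN]
    rw [map_add, Derivation.map_algebraMap, zero_add, map_sum]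
    exact Finset.sum_congr rfl fun k _ => hP.euler_homog f (k + 1)
  have h2 : X f.1 = ∑ k : Fin N, X fun x => (powPoly f.1 x).coeff (k + 1) := by
    conv_lhs => rw [hN]
    have : (algebraMap ℂ R (f.1 1) : R).1 = f.1 1 • (1 : Γ → ℂ) := by
      funext x; simp
    simp [hX.map_one, this]
  rw [h2, h1]
  have h3 : (∑ k : Fin N, ((k + 1 : ℕ) : ℂ) •
      (⟨fun x => (powPoly f.1 x).coeff (k + 1), hP.coeff_mem f.2 _⟩ : R)).1 =
      ∑ k : Fin N, ((k + 1 : ℕ) : ℂ) • fun x => (powPoly f.1 x).coeff (k + 1) := by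
    simp
  rw [h3, map_sum]
  refine Finset.sum_congr rfl fun k _ => ?_
  rw [map_smul, hP.pd_coeff hR hX f.2]
  by_cases hk : (k : ℕ) = 0
  · simp [hk]
  · simp [hk]

lemma IsPowPoly.exists_eulerData {R : FnAlg Γ} (hP : IsPowPoly R) (hR : IsHopfFn R)
    {𝔤 : Type} [LieRing 𝔤] [LieAlgebra ℂ 𝔤] {der : 𝔤 ⊸ FnDual Γ}
    (hL : IsLieFn R 𝔤 der) :
    ∃ (n : ℕ) (e : Module.Basis (Fin n) ℂ 𝔤) (p : Fin n → R),
      EulerData R 𝔤 (augIdeal R) (hL.D hR) e p hP.euler := by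
  obtain ⟨n, t, X, hX⟩ := hR.exists_coords
  obtain ⟨e, he⟩ := hL.exists_basis hX
  obtain ⟨p, hp1, hp⟩ := hR.derivation_eq_sum hX hP.euler
  have heX : ∀ a, ∀ f ∈ R, linv (der (e a)) f = linv (X a) f := fun a f hf => by
    funext x; exact he a _ (hR.left_translate hf x)
  have hE1 : ∀ f, (hP.euler f).1 1 = 0 := fun f => by
    have : powPoly f.1 1 = Polynomial.C (f.1 1) := powPoly_eq fun n => by simp
    rw [hP.euler_apply, this]; simp
  have hpm : ∀ a, p a ∈ augIdeal R := fun a => by rw [mem_augIdeal, hp1, hE1]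
  refine ⟨n, e, p, ⟨?_, ?_, ?_, hpm, ?_, ?_, ?_, ?_⟩⟩
  · intro h
    have := (Ideal.eq_top_iff_one _).1 h
    rw [mem_augIdeal] at this
    simp at this
  · intro u v f
    exact Subtype.ext (hL.linv_lie f.2 hR)
  · intro f
    apply Subtype.ext
    rw [hp f]
    funext x
    simp [IsLieFn.D_apply, heX _ _ f.2]
  · intro a b
    rw [mem_augIdeal]
    have h1 : X b (p a).1 = if a = b then 1 else 0 := by
      have h2 := hP.pd_euler hR (hX.pd b) (t a)
      rw [hp, map_sum, hX.dual] at h2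
      have h3 : ∀ c, X b ((p c).1 * linv (X c) (t a).1) = if c = a then X b (p c).1 else 0 := by
        intro c
        rw [hX.pd b _ (p c).2 _ (hR.linv_mem _ (t a).2), linv_one, hX.dual,
          mem_augIdeal.1 (hpm c)]
        simp
      simp only [h3, Finset.sum_ite_eq', Finset.mem_univ, if_true] at h2
      rw [h2]
      simp [eq_comm]
    have h4 : (hL.D hR (e b) (p a)).1 1 = X b (p a).1 := by
      rw [IsLieFn.D_apply, linv_one, he b _ (p a).2]
    change (hL.D hR (e b) (p a)).1 1 - ((if a = b then 1 else 0 : R)).1 1 = 0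
    rw [h4, h1]
    split_ifs <;> simp
  · intro f hf
    refine hX.mem_aug_sq ?_ ?_
    · rw [mem_augIdeal]
      change (hP.euler f).1 1 - f.1 1 = 0
      rw [hE1, mem_augIdeal.1 hf, sub_zero]
    · intro i
      change X i ((hP.euler f).1 - f.1) = 0
      rw [map_sub, hP.pd_euler hR (hX.pd i), sub_self]
  · intro f
    obtain ⟨N, hN⟩ := hP.expand f
    refine ⟨f.1 1, N, _, hN, fun k => ?_⟩
    have := hP.euler_homog f (k + 1)
    push_cast at this
    exact this
  · intro a
    obtain ⟨N, r, s, hrs⟩ := hR.exists_transl_expand (t a)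
    refine ⟨N, r, s, fun b => ?_⟩
    apply Subtype.ext; funext x
    have h1 : (t a).1 = ∑ i, (r i).1 x • fun y => (s i).1 (x * y) := by
      funext y
      have := hrs x (x * y)
      rw [inv_mul_cancel_left] at this
      simpa using this
    have h2 : X b (t a).1 = ∑ i, (r i).1 x * linv (X b) (s i).1 x := by
      conv_lhs => rw [h1]
      rw [map_sum]
      exact Finset.sum_congr rfl fun i _ => by rw [map_smul]; rfl
    rw [hX.dual] at h2
    have h3 : (∑ i, r i * hL.D hR (e b) (s i) : R).1 x = ∑ i, (r i).1 x * linv (X b) (s i).1 x := by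
      simp [IsLieFn.D_apply, heX _ _ (s _).2]
    rw [h3, ← h2]
    by_cases hab : a = b <;> simp [hab, eq_comm]

end LieFn


section Generation

variable {Γ Δ : Type} [Group Γ] [Group Δ]

lemma isHopfFn_of_adjoin {R : FnAlg Γ} {s : Set (Γ → ℂ)} (hfin : s.Finite)
    (hs : R = Algebra.adjoin ℂ s) (hmul : ∀ f ∈ s, (fun x y => f (x * y)) ∈ biReg R R)
    (hinv : ∀ f ∈ s, (fun x => f x⁻¹) ∈ R) : IsHopfFn R where
  fg := ⟨hfin.toFinset, by simp [hs]⟩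
  comul := by
    intro f hf
    rw [hs] at hf
    induction hf using Algebra.adjoin_induction with
    | mem f hf => exact hmul f hf
    | algebraMap c => exact biReg_of_left (R.algebraMap_mem c)
    | add f g _ _ h1 h2 => exact (biReg R R).add_mem h1 h2
    | mul f g _ _ h1 h2 => exact biReg_mul h1 h2
  inv := by
    intro f hf
    rw [hs] at hf
    induction hf using Algebra.adjoin_induction with
    | mem f hf => exact hinv f hf
    | algebraMap c => exact R.algebraMap_mem c
    | add f g _ _ h1 h2 => exact R.add_mem h1 h2
    | mul f g _ _ h1 h2 => exact R.mul_mem h1 h2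

/-- The algebra of pulled back functions. -/
def pullFn {Γ Δ : Type} (α : Γ → Δ) (R : FnAlg Δ) : FnAlg Γ :=
  R.map
    { toFun := fun f => f ∘ α
      map_one' := rfl
      map_mul' := fun _ _ => rfl
      map_zero' := rfl
      map_add' := fun _ _ => rfl
      commutes' := fun _ => rfl }

lemma mem_pullFn {Γ Δ : Type} {α : Γ → Δ} {R : FnAlg Δ} {f : Γ → ℂ} :
    f ∈ pullFn α R ↔ ∃ r ∈ R, r ∘ α = f := Iff.rfl

lemma comp_mem_pullFn {Γ Δ : Type} {α : Γ → Δ} {R : FnAlg Δ} {r : Δ → ℂ}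
    (hr : r ∈ R) : r ∘ α ∈ pullFn α R := ⟨r, hr, rfl⟩

lemma IsHopfFn.pull {R : FnAlg Δ} (hR : IsHopfFn R) (α : Γ →* Δ) :
    IsHopfFn (pullFn α R) where
  fg := hR.fg.map _
  comul := by
    rintro _ ⟨r, hr, rfl⟩
    have := biReg_comp (hR.comul r hr) (α := α) (β := α)
      (fun a ha => comp_mem_pullFn ha) (fun a ha => comp_mem_pullFn ha)
    convert this using 3
    exact congrArg r (map_mul α _ _)
  inv := by
    rintro _ ⟨r, hr, rfl⟩
    refine ⟨_, hR.inv r hr, ?_⟩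
    funext x
    exact congrArg r (map_inv α x).symm

lemma isDomain_of_le {R S : FnAlg Γ} (h : R ≤ S) [IsDomain S] : IsDomain R :=
  (Subalgebra.inclusion_injective h).isDomain (Subalgebra.inclusion h).toRingHom

lemma IsAlgGrpFn.eq_of_sep {R S : FnAlg Γ} (hR : IsHopfFn R) [IsDomain R]
    (hRS : R ≤ S) (hS : IsAlgGrpFn S) (hsep : ∀ x y, (∀ r ∈ R, r x = r y) → x = y) : R = S :=
  le_antisymm hRS fun _ hf => hR.mem_of_constant_on_classes hRS hS.toIsHopfFn hS.pts hf
    fun x y h => by rw [hsep x y h]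

end Generation

section Unitriangular

variable {Γ : Type} [Group Γ] {m : ℕ}

/-- The algebra generated by the coefficients of a matrix representation. -/
def coeffAlg (φ : Γ →* Matrix (Fin m) (Fin m) ℂ) : FnAlg Γ :=
  Algebra.adjoin ℂ (Set.range fun ij : Fin m × Fin m => fun x => φ x ij.1 ij.2)

lemma entry_mem_coeffAlg (φ : Γ →* Matrix (Fin m) (Fin m) ℂ) (i j : Fin m) :
    (fun x => φ x i j) ∈ coeffAlg φ := Algebra.subset_adjoin ⟨(i, j), rfl⟩

variable {φ : Γ →* Matrix (Fin m) (Fin m) ℂ}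

lemma sub_one_pow_eq_zero (h1 : ∀ x i, φ x i i = 1) (h0 : ∀ x i j, j < i → φ x i j = 0) (x : Γ) :
    (φ x - 1) ^ m = 0 := by
  have hT := fun i j hij => h0 x i j hij
  have hc := Matrix.charpoly_of_upperTriangular _ hT
  have := Matrix.aeval_self_charpoly (φ x)
  rw [hc] at this
  simpa [h1, map_pow] using this

lemma pow_entry_mem (k : ℕ) (i j : Fin m) : (fun x => ((φ x - 1) ^ k) i j) ∈ coeffAlg φ := by
  induction k generalizing i j with
  | zero => exact (coeffAlg φ).algebraMap_mem ((1 : Matrix (Fin m) (Fin m) ℂ) i j)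
  | succ k ih =>
    have : (fun x => ((φ x - 1) ^ (k + 1)) i j) =
        ∑ l, (fun x => ((φ x - 1) ^ k) i l) * ((fun x => φ x l j) -
          fun _ => (1 : Matrix (Fin m) (Fin m) ℂ) l j) := by
      funext x; rw [pow_succ, Matrix.mul_apply, Finset.sum_apply]; rfl
    rw [this]
    exact sum_mem fun l _ => mul_mem (ih i l) (sub_mem (entry_mem_coeffAlg φ l j)
      ((coeffAlg φ).algebraMap_mem ((1 : Matrix (Fin m) (Fin m) ℂ) l j)))

lemma isHopfFn_coeffAlg (h1 : ∀ x i, φ x i i = 1) (h0 : ∀ x i j, j < i → φ x i j = 0) :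
    IsHopfFn (coeffAlg φ) := by
  refine isHopfFn_of_adjoin (Set.finite_range _) rfl ?_ ?_
  · rintro _ ⟨⟨i, j⟩, rfl⟩
    have : (fun x y => φ (x * y) i j) = ∑ l, fun x y => φ x i l * φ y l j := by
      funext x y; simp [Matrix.mul_apply]
    change (fun x y => φ (x * y) i j) ∈ _
    rw [this]
    exact Submodule.sum_mem _ fun l _ =>
      biReg_of_mul (entry_mem_coeffAlg φ i l) (entry_mem_coeffAlg φ l j)
  · rintro _ ⟨⟨i, j⟩, rfl⟩
    have key : ∀ x, φ x⁻¹ = ∑ k ∈ Finset.range m, (-(φ x - 1)) ^ k := by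
      intro x
      have h2 := mul_neg_geom_sum (-(φ x - 1)) m
      rw [neg_pow, sub_one_pow_eq_zero h1 h0, mul_zero, sub_zero] at h2
      have h3 : (1 - -(φ x - 1)) = φ x := by abel
      rw [h3] at h2
      calc φ x⁻¹ = φ x⁻¹ * (φ x * ∑ k ∈ Finset.range m, (-(φ x - 1)) ^ k) := by rw [h2, mul_one]
        _ = _ := by rw [← mul_assoc, ← map_mul]; simp
    have : (fun x => φ x⁻¹ i j) = ∑ k ∈ Finset.range m,
        ((-1 : ℂ) ^ k) • fun x => ((φ x - 1) ^ k) i j := by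
      funext x
      rw [key, Matrix.sum_apply, Finset.sum_apply]
      refine Finset.sum_congr rfl fun k _ => ?_
      rcases Nat.even_or_odd k with hk | hk
      · rw [hk.neg_pow, hk.neg_one_pow]; simp
      · rw [hk.neg_pow, hk.neg_one_pow]; simp
    change (fun x => φ x⁻¹ i j) ∈ _
    rw [this]
    exact sum_mem fun k _ => (coeffAlg φ).smul_mem (pow_entry_mem k i j) _

lemma isPowPoly_coeffAlg (h1 : ∀ x i, φ x i i = 1) (h0 : ∀ x i j, j < i → φ x i j = 0) :
    IsPowPoly (coeffAlg φ) := by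
  refine isPowPoly_of_adjoin _ rfl ?_
  rintro _ ⟨⟨i, j⟩, rfl⟩
  refine ⟨∑ k ∈ Finset.range m, fun x t => ((φ x - 1) ^ k) i j *
    ((k.factorial : ℂ)⁻¹ * (descPochhammer ℂ k).eval t), ?_, ?_⟩
  · refine Submodule.sum_mem _ fun k _ => biReg_of_mul (pow_entry_mem k i j) ?_
    refine mem_polyFn.2 ⟨Polynomial.C (k.factorial : ℂ)⁻¹ * descPochhammer ℂ k, ?_⟩
    funext t; simp
  · intro x n
    have hb : ∀ k : ℕ, (k.factorial : ℂ)⁻¹ * (descPochhammer ℂ k).eval (n : ℂ) = n.choose k := by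
      intro k
      rw [descPochhammer_eval_eq_descFactorial, Nat.descFactorial_eq_factorial_mul_choose]
      push_cast
      rw [inv_mul_cancel_left₀ (by exact_mod_cast k.factorial_ne_zero)]
    have hz : ∀ k, m ≤ k → (φ x - 1) ^ k = 0 := fun k hk =>
      pow_eq_zero_of_le hk (sub_one_pow_eq_zero h1 h0 x)
    have hp : φ (x ^ n) = ∑ k ∈ Finset.range m, (n.choose k) • (φ x - 1) ^ k := by
      have e1 : φ (x ^ n) = ∑ k ∈ Finset.range (n + 1), (n.choose k) • (φ x - 1) ^ k := by
        rw [map_pow]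
        conv_lhs => rw [← sub_add_cancel (φ x) 1]
        rw [(Commute.one_right (φ x - 1)).add_pow]
        refine Finset.sum_congr rfl fun k _ => ?_
        rw [one_pow, mul_one, nsmul_eq_mul, (Nat.cast_commute _ _).eq]
      rw [e1]
      rcases le_total m (n + 1) with h | h
      · refine (Finset.sum_subset (Finset.range_mono h) fun k _ hk => ?_).symm
        rw [hz k (by simpa using hk), smul_zero]
      · refine Finset.sum_subset (Finset.range_mono h) fun k _ hk => ?_
        rw [Nat.choose_eq_zero_of_lt (by simpa using hk), zero_smul]
    change φ (x ^ n) i j = _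
    rw [hp]
    simp only [Finset.sum_apply, Matrix.sum_apply, hb]
    exact Finset.sum_congr rfl fun k _ => by
      rw [Matrix.smul_apply, nsmul_eq_mul, mul_comm]

lemma IsAlgGrpFn.isPowPoly_of_unitriangular {S : FnAlg Γ} (hS : IsAlgGrpFn S)
    (hφ : ∀ i j, (fun x => φ x i j) ∈ S) (hinj : Function.Injective φ)
    (h1 : ∀ x i, φ x i i = 1) (h0 : ∀ x i j, j < i → φ x i j = 0) : IsPowPoly S := by
  have hH := isHopfFn_coeffAlg h1 h0
  have hP := isPowPoly_coeffAlg h1 h0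
  have := hH.isDomain_of_conn hP.isConnFn
  have hle : coeffAlg φ ≤ S := Algebra.adjoin_le (by rintro _ ⟨⟨i, j⟩, rfl⟩; exact hφ i j)
  have := IsAlgGrpFn.eq_of_sep hH hle hS fun x y h => hinj (Matrix.ext fun i j =>
    h _ (entry_mem_coeffAlg φ i j))
  rwa [← this]

end Unitriangular


section VecGrp

variable {Γ : Type} [Group Γ]

/-- The logarithm identifies a commutative unipotent group with the vector group of its
tangent space. -/
structure IsVecGrp (R : FnAlg Γ) {M : Type} [AddCommGroup M] [Module ℂ M]
    (der : M ⊸ FnDual Γ) (log : Γ → M) : Prop where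
  finite : Module.Finite ℂ M
  map_mul : ∀ a b, log (a * b) = log a + log b
  bij : Function.Bijective log
  mem : ∀ ξ : Module.Dual ℂ M, (fun a => ξ (log a)) ∈ R
  adjoin : R = Algebra.adjoin ℂ (Set.range fun ξ : Module.Dual ℂ M => fun a => ξ (log a))
  der_log : ∀ w (ξ : Module.Dual ℂ M), der w (fun a => ξ (log a)) = ξ w

variable {R : FnAlg Γ}

lemma IsPowPoly.pow_add_expand (hP : IsPowPoly R) {N : ℕ}
    {u v : Fin N → Γ → ℂ} (hv : ∀ i, v i ∈ R) {f : Γ → ℂ} (hf : f ∈ R)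
    (h : ∀ x y, f (x * y) = ∑ i, u i x * v i y) (x : Γ) (n : ℕ) :
    (powPoly f x).derivative.eval (n : ℂ) = ∑ i, u i (x ^ n) * (powPoly (v i) x).coeff 1 := by
  have key : (powPoly f x).comp (Polynomial.X + Polynomial.C (n : ℂ)) =
      ∑ i, Polynomial.C (u i (x ^ n)) * powPoly (v i) x := by
    refine poly_eq_of_nat fun k => ?_
    rw [Polynomial.eval_comp, Polynomial.eval_finsetSum]
    simp only [Polynomial.eval_mul, Polynomial.eval_C, hP.eval_nat (hv _), Polynomial.eval_add,
      Polynomial.eval_X]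
    rw [← Nat.cast_add, hP.eval_nat hf, ← h, add_comm, pow_add]
  have h1 := congrArg (fun p => (Polynomial.derivative p).eval 0) key
  simp only [Polynomial.derivative_comp, Polynomial.derivative_sum, Polynomial.eval_finsetSum]
    at h1
  simpa [Polynomial.derivative_mul, Polynomial.eval_comp, ← Polynomial.coeff_zero_eq_eval_zero,
    Polynomial.coeff_derivative] using h1

lemma IsPowPoly.coeff_one_mul (hP : IsPowPoly R) (hcomm : ∀ a b : Γ, a * b = b * a) {N : ℕ}
    {u v : Fin N → Γ → ℂ} (hu : ∀ i, u i ∈ R) (hv : ∀ i, v i ∈ R) {f : Γ → ℂ}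
    (h : ∀ x y, f (x * y) = ∑ i, u i x * v i y) (a b : Γ) :
    (powPoly f (a * b)).coeff 1 =
      ∑ i, (u i 1 * (powPoly (v i) b).coeff 1 + (powPoly (u i) a).coeff 1 * v i 1) := by
  have key : powPoly f (a * b) = ∑ i, powPoly (u i) a * powPoly (v i) b := by
    refine powPoly_eq fun n => ?_
    rw [Polynomial.eval_finsetSum]
    simp only [Polynomial.eval_mul, hP.eval_nat (hv _), hP.eval_nat (hu _)]
    rw [← h, (show Commute a b from hcomm a b).mul_pow]
  rw [key, Polynomial.finsetSum_coeff]
  refine Finset.sum_congr rfl fun i _ => ?_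
  rw [Polynomial.mul_coeff_one, hP.coeff_zero (hu i), hP.coeff_zero (hv i)]

variable {M : Type} [AddCommGroup M] [Module ℂ M] {der : M ⊸ FnDual Γ}

lemma finite_of_pd (hR : IsHopfFn R) (pd : ∀ u, IsPD R (der u))
    (inj : ∀ u, (∀ f ∈ R, der u f = 0) → u = 0) : Module.Finite ℂ M := by
  obtain ⟨n, t, X, hX⟩ := hR.exists_coords
  let Φ : M ⊸ (Fin n → ℂ) := LinearMap.pi fun i =>
    (LinearMap.applyₗ (t i).1) ∘ₗ der
  refine Module.Finite.of_injective Φ ((injective_iff_map_eq_zero Φ).2 fun u hu => inj u ?_)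
  intro f hf
  rw [(pd u).eq_sum hX hf]
  refine Finset.sum_eq_zero fun i _ => ?_
  have : der u (t i).1 = 0 := congrFun hu i
  rw [this, zero_mul]

lemma exists_dual_repr [Module.Finite ℂ M] (inj : ∀ u, (∀ f ∈ R, der u f = 0) → u = 0)
    (ξ : Module.Dual ℂ M) : ∃ f ∈ R, ∀ w, ξ w = der w f := by
  let Φ : R ⊸ Module.Dual ℂ M :=
    (LinearMap.flip der) ∘ₗ (Subalgebra.toSubmodule R).subtype
  have htop : LinearMap.range Φ = ⊤ := by
    by_contra hne
    obtain ⟨g, hg0, hg⟩ := Submodule.exists_le_ker_of_lt_top _ (lt_top_iff_ne_top.2 hne)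
    obtain ⟨w, rfl⟩ := (Module.evalEquiv ℂ M).surjective g
    apply hg0
    rw [inj w fun f hf => hg ⟨⟨f, hf⟩, rfl⟩, map_zero]
  obtain ⟨f, hf⟩ := (htop ▸ Submodule.mem_top : ξ ∈ LinearMap.range Φ)
  exact ⟨f.1, f.2, fun w => by rw [← hf]; rfl⟩

lemma IsAlgGrpFn.exists_vecGrp (hR : IsAlgGrpFn R) (hP : IsPowPoly R)
    (hcomm : ∀ a b : Γ, a * b = b * a) (pd : ∀ u, IsPD R (der u))
    (full : ∀ X, IsPD R X → ∃ u, ∀ f ∈ R, der u f = X f)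
    (inj : ∀ u, (∀ f ∈ R, der u f = 0) → u = 0) : ∃ log : Γ → M, IsVecGrp R der log := by
  have hfin := finite_of_pd hR.toIsHopfFn pd inj
  have hlog : ∀ a : Γ, ∃ w : M, ∀ f ∈ R, der w f = (powPoly f a).coeff 1 := by
    intro a
    obtain ⟨X, hX⟩ := exists_linear_ext (R := R)
      { toFun := fun f => (powPoly f.1 a).coeff 1
        map_add' := fun f g => by
          rw [Subalgebra.coe_add, hP.add f.2 g.2, Polynomial.coeff_add]
        map_smul' := fun c f => by
          rw [Subalgebra.coe_smul, hP.smul f.2, Polynomial.coeff_smul]; rfl }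
    obtain ⟨w, hw⟩ := full X (by
      intro f hf g hg
      rw [hX _ (R.mul_mem hf hg), hX _ hf, hX _ hg]
      simp only [LinearMap.coe_mk, AddHom.coe_mk]
      rw [hP.mul hf hg, Polynomial.mul_coeff_one, hP.coeff_zero hf, hP.coeff_zero hg]
      ring)
    exact ⟨w, fun f hf => (hw f hf).trans (hX f hf)⟩
  choose log hlog using hlog
  have hext : ∀ {w w' : M}, (∀ f ∈ R, der w f = der w' f) → w = w' := fun h =>
    sub_eq_zero.1 (inj _ fun f hf => by
      rw [map_sub, LinearMap.sub_apply, h f hf, sub_self])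
  have hmul : ∀ a b, log (a * b) = log a + log b := by
    intro a b
    refine hext fun f hf => ?_
    obtain ⟨N, u, v, hu, hv, h⟩ := biReg_expand (hR.comul f hf)
    have e1 : f = ∑ i, u i 1 • v i := by
      funext x; have := h 1 x; rw [one_mul] at this; simpa using this
    have e2 : f = ∑ i, v i 1 • u i := by
      funext x; have := h x 1; rw [mul_one] at this; simpa [mul_comm] using this
    rw [hlog _ f hf, hP.coeff_one_mul hcomm hu hv h, map_add, LinearMap.add_apply,
      Finset.sum_add_distrib, add_comm]
    congr 1
    · conv_rhs => rw [e2, map_sum]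
      exact Finset.sum_congr rfl fun i _ => by
        rw [map_smul, hlog _ _ (hu i), smul_eq_mul, mul_comm]
    · conv_rhs => rw [e1, map_sum]
      exact Finset.sum_congr rfl fun i _ => by
        rw [map_smul, hlog _ _ (hv i), smul_eq_mul]
  have hmem : ∀ ξ : Module.Dual ℂ M, ∃ f ∈ R, (∀ w, ξ w = der w f) ∧
      (fun a => ξ (log a)) = fun a => (powPoly f a).coeff 1 := by
    intro ξ
    obtain ⟨f, hf, h⟩ := exists_dual_repr inj ξ
    exact ⟨f, hf, h, funext fun a => by rw [h, hlog a f hf]⟩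
  have hinj : Function.Injective log := by
    have h1 : ∀ x, log x = 0 → x = 1 := by
      intro x hx
      refine hR.sep _ _ fun f hf => ?_
      obtain ⟨N, u, v, hu, hv, h⟩ := biReg_expand (hR.comul f hf)
      have hd : (powPoly f x).derivative = 0 := by
        refine poly_eq_of_nat fun n => ?_
        rw [hP.pow_add_expand hv hf h, Polynomial.eval_zero]
        refine Finset.sum_eq_zero fun i _ => ?_
        rw [← hlog x _ (hv i), hx, map_zero, LinearMap.zero_apply, mul_zero]
      have hC := Polynomial.natDegree_eq_zero_of_derivative_eq_zero hd
      rw [← hP.eval_one hf x, ← hP.eval_zero hf x, Polynomial.eq_C_of_natDegree_eq_zero hC]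
      simp
    let lh : Γ →* Multiplicative M := MonoidHom.mk' (fun a => Multiplicative.ofAdd (log a))
      (fun a b => by rw [hmul]; rfl)
    exact (injective_iff_map_eq_one lh).2 fun x hx => h1 x hx
  have hsurj : Function.Surjective log := by
    let N : Submodule ℂ M :=
      { carrier := Set.range log
        add_mem' := by rintro _ _ ⟨a, rfl⟩ ⟨b, rfl⟩; exact ⟨a * b, hmul a b⟩
        zero_mem' := ⟨1, by have := hmul 1 1; rw [one_mul] at this; exact left_eq_add.1 this⟩
        smul_mem' := by
          rintro t _ ⟨a, rfl⟩
          obtain ⟨b, hb⟩ := hR.pts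
            { toFun := fun f => (powPoly f.1 a).eval t
              map_one' := by
                change (powPoly (fun _ => 1) a).eval t = 1
                rw [IsPowPoly.const]; simp
              map_mul' := fun f g => by
                rw [Subalgebra.coe_mul, hP.mul f.2 g.2, Polynomial.eval_mul]
              map_zero' := by
                change (powPoly (fun _ => 0) a).eval t = 0
                rw [IsPowPoly.const]; simp
              map_add' := fun f g => by
                rw [Subalgebra.coe_add, hP.add f.2 g.2, Polynomial.eval_add]
              commutes' := fun c => by
                change (powPoly (fun _ => c) a).eval t = c
                rw [IsPowPoly.const]; simp }
          refine ⟨b, hext fun f hf => ?_⟩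
          have h2 := hb ⟨_, hP.coeff_mem hf 1⟩
          simp only [AlgHom.coe_mk, RingHom.coe_mk, MonoidHom.coe_mk, OneHom.coe_mk] at h2
          rw [hP.coeff_powPoly hf, Polynomial.eval_monomial, pow_one] at h2
          rw [hlog b f hf, ← h2, map_smul, LinearMap.smul_apply, hlog a f hf, smul_eq_mul,
            mul_comm] }
    have htop : N = ⊤ := by
      by_contra hne
      obtain ⟨ξ, hξ0, hξ⟩ := Submodule.exists_le_ker_of_lt_top _ (lt_top_iff_ne_top.2 hne)
      obtain ⟨f, hf, h1, h2⟩ := hmem ξ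
      apply hξ0
      ext w
      have h3 := hP.pd_coeff hR.toIsHopfFn (pd w) hf 1
      rw [← h2, if_pos rfl, ← h1] at h3
      have h4 : (fun a => ξ (log a)) = 0 := funext fun a => hξ ⟨a, rfl⟩
      rw [← h3, h4, map_zero, LinearMap.zero_apply]
    intro w
    exact (htop ▸ Submodule.mem_top : w ∈ N)
  have hmemR : ∀ ξ : Module.Dual ℂ M, (fun a => ξ (log a)) ∈ R := by
    intro ξ
    obtain ⟨f, hf, -, h2⟩ := hmem ξ
    rw [h2]; exact hP.coeff_mem hf 1
  refine ⟨log, hfin, hmul, ⟨hinj, hsurj⟩, hmemR, ?_, ?_⟩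
  · set R₀ := Algebra.adjoin ℂ (Set.range fun ξ : Module.Dual ℂ M => fun a => ξ (log a)) with hR₀
    have hle : R₀ ≤ R := Algebra.adjoin_le (by rintro _ ⟨ξ, rfl⟩; exact hmemR ξ)
    let B := Module.finBasis ℂ M
    have hdual : ∀ ξ : Module.Dual ℂ M, (fun a => ξ (log a)) =
        ∑ i, ξ (B i) • fun a => B.coord i (log a) := by
      intro ξ; funext a
      conv_lhs => rw [← B.sum_repr (log a), map_sum]
      simp [mul_comm]
    have hgen : R₀ = Algebra.adjoin ℂ (Set.range fun i => fun a => B.coord i (log a)) := by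
      refine le_antisymm (Algebra.adjoin_le ?_) (Algebra.adjoin_mono ?_)
      · rintro _ ⟨ξ, rfl⟩
        simp only [hdual ξ]
        exact sum_mem fun i _ => Subalgebra.smul_mem _
          (Algebra.subset_adjoin (Set.mem_range_self i)) _
      · rintro _ ⟨i, rfl⟩; exact ⟨B.coord i, rfl⟩
    have hg : ∀ i, (fun a => B.coord i (log a)) ∈ R₀ := fun i =>
      Algebra.subset_adjoin ⟨B.coord i, rfl⟩
    have hlog1 : log 1 = 0 := by
      have := hmul 1 1; rw [one_mul] at this; exact left_eq_add.1 this
    have hH : IsHopfFn R₀ := by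
      refine isHopfFn_of_adjoin (Set.finite_range _) hgen ?_ ?_
      · rintro _ ⟨i, rfl⟩
        simp only [hmul, map_add]
        exact (biReg R₀ R₀).add_mem (biReg_of_left (hg i)) (biReg_of_right (hg i))
      · rintro _ ⟨i, rfl⟩
        have : ∀ x, log x⁻¹ = - log x := fun x => by
          rw [eq_neg_iff_add_eq_zero, ← hmul, inv_mul_cancel, hlog1]
        simp only [this, map_neg]
        exact R₀.neg_mem (hg i)
    have := hR.toIsHopfFn.isDomain_of_conn hP.isConnFn
    have := isDomain_of_le hle
    refine (IsAlgGrpFn.eq_of_sep hH hle hR fun x y h => hinj ?_).symm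
    exact B.ext_elem fun i => h _ (hg i)
  · intro w ξ
    obtain ⟨f, hf, h1, h2⟩ := hmem ξ
    rw [h2, hP.pd_coeff hR.toIsHopfFn (pd w) hf 1, if_pos rfl, h1]

end VecGrp


section VectorValued

variable {Γ Δ Γ' Δ' : Type} {M N : Type} [AddCommGroup M] [Module ℂ M]
  [AddCommGroup N] [Module ℂ N]

/-- Regular functions with values in a vector space. -/
def RegV (R : FnAlg Γ) (F : Γ → M) : Prop :=
  ∀ ξ : Module.Dual ℂ M, (fun x => ξ (F x)) ∈ R

/-- Regular functions of two variables with values in a vector space. -/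
def BiRegV (R : FnAlg Γ) (S : FnAlg Δ) (F : Γ → Δ → M) : Prop :=
  ∀ ξ : Module.Dual ℂ M, (fun x y => ξ (F x y)) ∈ biReg R S

/-- The extension of a functional to functions with values in a finite-dimensional space. -/
def vext [Module.Finite ℂ M] (X : FnDual Γ) : (Γ → M) ⊸ M where
  toFun F := ∑ i, X (fun x => (Module.finBasis ℂ M).coord i (F x)) • Module.finBasis ℂ M i
  map_add' F G := by
    rw [← Finset.sum_add_distrib]
    refine Finset.sum_congr rfl fun i _ => ?_
    rw [← add_smul, ← map_add]
    congr 2; funext x; simp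
  map_smul' c F := by
    rw [Finset.smul_sum]
    refine Finset.sum_congr rfl fun i _ => ?_
    have h : (fun x => (Module.finBasis ℂ M).coord i ((c • F) x)) =
        c • fun x => (Module.finBasis ℂ M).coord i (F x) := by funext x; simp
    rw [h, map_smul, smul_assoc, RingHom.id_apply]

variable [Module.Finite ℂ M] [Module.Finite ℂ N]

lemma dual_vext (X : FnDual Γ) (F : Γ → M) (ξ : Module.Dual ℂ M) :
    ξ (vext X F) = X (fun x => ξ (F x)) := by
  have : (fun x => ξ (F x)) = ∑ i, ξ (Module.finBasis ℂ M i) •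
      fun x => (Module.finBasis ℂ M).coord i (F x) := by
    funext x
    conv_lhs => rw [← (Module.finBasis ℂ M).sum_repr (F x), map_sum]
    simp [mul_comm]
  rw [this]
  simp [vext, mul_comm]

omit [Module.Finite ℂ M] in
lemma dual_ext {v w : M} (h : ∀ ξ : Module.Dual ℂ M, ξ v = ξ w) : v = w :=
  sub_eq_zero.1 ((Module.forall_dual_apply_eq_zero_iff ℂ _).1 fun ξ => by
    rw [map_sub, h, sub_self])

lemma map_vext (X : FnDual Γ) (F : Γ → M) (T : M ⊸ N) :
    T (vext X F) = vext X (fun x => T (F x)) := by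
  refine dual_ext fun ξ => ?_
  rw [dual_vext]
  exact dual_vext X F (ξ ∘ₗ T)

lemma vext_const (X : FnDual Γ) (v : M) :
    vext X (fun _ : Γ => v) = X 1 • v := by
  refine dual_ext fun ξ => ?_
  rw [dual_vext, map_smul, smul_eq_mul, mul_comm, ← smul_eq_mul, ← map_smul]
  congr 1; funext x; simp

lemma vext_add (X : FnDual Γ) (F G : Γ → M) :
    vext X (fun x => F x + G x) = vext X F + vext X G := map_add (vext X) F G

lemma vext_sub (X : FnDual Γ) (F G : Γ → M) :
    vext X (fun x => F x - G x) = vext X F - vext X G := map_sub (vext X) F G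

lemma vext_sum {ι : Type} (s : Finset ι) (X : FnDual Γ) (F : ι → Γ → M) :
    vext X (fun x => ∑ i ∈ s, F i x) = ∑ i ∈ s, vext X (F i) := by
  rw [← map_sum]; congr 1; funext x; simp

lemma vext_smul_left (X : FnDual Γ) (g : Γ → ℂ) (v : M) :
    vext X (fun x => g x • v) = X g • v := by
  refine dual_ext fun ξ => ?_
  rw [dual_vext, map_smul, smul_eq_mul, mul_comm, ← smul_eq_mul, ← map_smul]
  congr 1; funext x; simp [mul_comm]

lemma vext_add_left (X Y : FnDual Γ) (F : Γ → M) :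
    vext (X + Y) F = vext X F + vext Y F :=
  dual_ext fun ξ => by rw [map_add, dual_vext, dual_vext, dual_vext]; rfl

lemma vext_sub_left (X Y : FnDual Γ) (F : Γ → M) :
    vext (X - Y) F = vext X F - vext Y F :=
  dual_ext fun ξ => by rw [map_sub, dual_vext, dual_vext, dual_vext]; rfl

lemma vext_smul_functional (c : ℂ) (X : FnDual Γ) (F : Γ → M) :
    vext (c • X) F = c • vext X F :=
  dual_ext fun ξ => by rw [map_smul, dual_vext, dual_vext]; rfl

variable {R : FnAlg Γ} {S : FnAlg Δ}
variable {R' : FnAlg Γ'} {S' : FnAlg Δ'}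

omit [Module.Finite ℂ M] [Module.Finite ℂ N]

lemma RegV.const (v : M) : RegV R (fun _ => v) := fun ξ => R.algebraMap_mem (ξ v)

lemma RegV.add {F G : Γ → M} (hF : RegV R F) (hG : RegV R G) : RegV R (fun x => F x + G x) :=
  fun ξ => by simp only [map_add]; exact R.add_mem (hF ξ) (hG ξ)

lemma RegV.sub {F G : Γ → M} (hF : RegV R F) (hG : RegV R G) : RegV R (fun x => F x - G x) :=
  fun ξ => by simp only [map_sub]; exact R.sub_mem (hF ξ) (hG ξ)

lemma RegV.neg {F : Γ → M} (hF : RegV R F) : RegV R (fun x => - F x) :=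
  fun ξ => by simp only [map_neg]; exact R.neg_mem (hF ξ)

lemma RegV.smul {g : Γ → ℂ} (hg : g ∈ R) {F : Γ → M} (hF : RegV R F) :
    RegV R (fun x => g x • F x) :=
  fun ξ => by simp only [map_smul, smul_eq_mul]; exact R.mul_mem hg (hF ξ)

lemma RegV.sum {ι : Type} (s : Finset ι) {F : ι → Γ → M} (hF : ∀ i ∈ s, RegV R (F i)) :
    RegV R (fun x => ∑ i ∈ s, F i x) := fun ξ => by
  have : (fun x => ξ (∑ i ∈ s, F i x)) = ∑ i ∈ s, fun x => ξ (F i x) := by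
    funext x; simp
  rw [this]; exact R.sum_mem fun i hi => hF i hi ξ

lemma RegV.map {F : Γ → M} (hF : RegV R F) (T : M ⊸ N) : RegV R (fun x => T (F x)) :=
  fun ξ => hF (ξ ∘ₗ T)

lemma RegV.comp {F : Γ → M} (hF : RegV R F) {α : Γ' → Γ} (hα : ∀ a ∈ R, a ∘ α ∈ R') :
    RegV R' (fun x => F (α x)) := fun ξ => hα _ (hF ξ)

lemma BiRegV.add {F G : Γ → Δ → M} (hF : BiRegV R S F) (hG : BiRegV R S G) :
    BiRegV R S (fun x y => F x y + G x y) :=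
  fun ξ => by simp only [map_add]; exact (biReg R S).add_mem (hF ξ) (hG ξ)

lemma BiRegV.sub {F G : Γ → Δ → M} (hF : BiRegV R S F) (hG : BiRegV R S G) :
    BiRegV R S (fun x y => F x y - G x y) :=
  fun ξ => by simp only [map_sub]; exact (biReg R S).sub_mem (hF ξ) (hG ξ)

lemma BiRegV.smul {g : Γ → Δ → ℂ} (hg : g ∈ biReg R S) {F : Γ → Δ → M} (hF : BiRegV R S F) :
    BiRegV R S (fun x y => g x y • F x y) :=
  fun ξ => by simp only [map_smul, smul_eq_mul]; exact biReg_mul hg (hF ξ)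

lemma BiRegV.sum {ι : Type} (s : Finset ι) {F : ι → Γ → Δ → M} (hF : ∀ i ∈ s, BiRegV R S (F i)) :
    BiRegV R S (fun x y => ∑ i ∈ s, F i x y) := fun ξ => by
  have : (fun x y => ξ (∑ i ∈ s, F i x y)) = ∑ i ∈ s, fun x y => ξ (F i x y) := by
    funext x y; simp
  rw [this]; exact (biReg R S).sum_mem fun i hi => hF i hi ξ

lemma BiRegV.comp {F : Γ → Δ → M} (hF : BiRegV R S F) {α : Γ' → Γ} {β : Δ' → Δ}
    (hα : ∀ a ∈ R, a ∘ α ∈ R') (hβ : ∀ b ∈ S, b ∘ β ∈ S') :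
    BiRegV R' S' (fun x y => F (α x) (β y)) := fun ξ => biReg_comp (hF ξ) hα hβ

lemma BiRegV.swap {F : Γ → Δ → M} (hF : BiRegV R S F) : BiRegV S R (fun y x => F x y) :=
  fun ξ => biReg_swap (hF ξ)

lemma RegV.left {F : Γ → M} (hF : RegV R F) : BiRegV R S (fun x _ => F x) :=
  fun ξ => biReg_of_left (hF ξ)

lemma RegV.right {F : Δ → M} (hF : RegV S F) : BiRegV R S (fun _ y => F y) :=
  fun ξ => biReg_of_right (hF ξ)

lemma BiRegV.eval {F : Γ → Δ → M} (hF : BiRegV R S F) (y : Δ) : RegV R (fun x => F x y) :=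
  fun ξ => biReg_eval (hF ξ) y

lemma BiRegV.eval_left {F : Γ → Δ → M} (hF : BiRegV R S F) (x : Γ) : RegV S (F x) :=
  fun ξ => biReg_eval_left (hF ξ) x

variable [Module.Finite ℂ M]

lemma BiRegV.contract {F : Γ → Δ → M} (hF : BiRegV R S F) (X : FnDual Δ) :
    RegV R (fun x => vext X (F x)) := fun ξ => by
  simp only [dual_vext]; exact biReg_contract (hF ξ) X

lemma BiRegV.contract_left {F : Γ → Δ → M} (hF : BiRegV R S F) (X : FnDual Γ) :
    RegV S (fun y => vext X (fun x => F x y)) := hF.swap.contract X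

lemma BiRegV.fubini {F : Γ → Δ → M} (hF : BiRegV R S F) (X : FnDual Γ)
    (Y : FnDual Δ) :
    vext X (fun x => vext Y (F x)) = vext Y (fun y => vext X (fun x => F x y)) :=
  dual_ext fun ξ => by
    simp only [dual_vext]; exact biReg_fubini (hF ξ) X Y

lemma RegV.eq_sum {F : Γ → M} (x : Γ) :
    F x = ∑ i, (Module.finBasis ℂ M).coord i (F x) • Module.finBasis ℂ M i := by
  simp

/-- A regular family of linear maps. -/
def RegOp (R : FnAlg Γ) (T : Γ → M ⊸ N) : Prop := ∀ v, RegV R (fun x => T x v)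

lemma RegOp.apply {T : Γ → M ⊸ N} (hT : RegOp R T) {F : Γ → M} (hF : RegV R F) :
    RegV R (fun x => T x (F x)) := by
  have : (fun x => T x (F x)) = fun x => ∑ i, (Module.finBasis ℂ M).coord i (F x) •
      T x (Module.finBasis ℂ M i) := by
    funext x
    conv_lhs => rw [RegV.eq_sum (F := F) x, map_sum]
    simp only [map_smul]
  rw [this]
  exact RegV.sum _ fun i _ => RegV.smul (hF _) (hT _)

lemma RegOp.biApply {T : Γ → M ⊸ N} (hT : RegOp R T) {F : Γ → Δ → M} (hF : BiRegV R S F) :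
    BiRegV R S (fun x y => T x (F x y)) := by
  have : (fun x y => T x (F x y)) = fun x y => ∑ i, (Module.finBasis ℂ M).coord i (F x y) •
      T x (Module.finBasis ℂ M i) := by
    funext x y
    conv_lhs => rw [RegV.eq_sum (F := F x) y, map_sum]
    simp only [map_smul]
  rw [this]
  exact BiRegV.sum _ fun i _ => BiRegV.smul (hF _) (hT _).left

lemma RegOp.comp {T : Γ → M ⊸ N} (hT : RegOp R T) {α : Γ' → Γ}
    (hα : ∀ a ∈ R, a ∘ α ∈ R') : RegOp R' (fun x => T (α x)) := fun v => (hT v).comp hα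

lemma BiRegV.expand {F : Γ → Δ → M} (hF : BiRegV R S F) :
    ∃ (n : ℕ) (a : Fin n → Γ → ℂ) (G : Fin n → Δ → M), (∀ i, a i ∈ R) ∧ (∀ i, RegV S (G i)) ∧
      ∀ x y, F x y = ∑ i, a i x • G i y := by
  have key : ∀ s : Finset (Fin (Module.finrank ℂ M)),
      ∃ (n : ℕ) (a : Fin n → Γ → ℂ) (G : Fin n → Δ → M), (∀ i, a i ∈ R) ∧ (∀ i, RegV S (G i)) ∧
      ∀ x y, ∑ k ∈ s, (Module.finBasis ℂ M).coord k (F x y) • Module.finBasis ℂ M k =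
        ∑ i, a i x • G i y := by
    intro s
    induction s using Finset.induction_on with
    | empty => exact ⟨0, Fin.elim0, Fin.elim0, fun i => i.elim0, fun i => i.elim0, by simp⟩
    | insert k s hk ih =>
      obtain ⟨n, a, G, ha, hG, h⟩ := ih
      obtain ⟨n', a', b', ha', hb', h'⟩ := biReg_expand (hF ((Module.finBasis ℂ M).coord k))
      refine ⟨n' + n, Fin.append a' a,
        Fin.append (fun i y => b' i y • Module.finBasis ℂ M k) G, ?_, ?_, ?_⟩
      · exact fun i => Fin.addCases (fun i => by simpa using ha' i) (fun i => by simpa using ha i) i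
      · refine fun i => Fin.addCases (fun i => ?_) (fun i => by simpa using hG i) i
        simpa using RegV.smul (hb' i) (RegV.const _)
      · intro x y
        rw [Finset.sum_insert hk, h, h', Fin.sum_univ_add, Finset.sum_smul]
        simp [smul_smul]
  obtain ⟨n, a, G, ha, hG, h⟩ := key Finset.univ
  exact ⟨n, a, G, ha, hG, fun x y => by rw [← h, ← RegV.eq_sum (F := F x) y]⟩

end VectorValued


section Casimir

variable {V : Type} [AddCommGroup V] [Module ℂ V] [Module.Finite ℂ V]

lemma exists_casimir (Q : Submodule ℂ (Module.End ℂ V)) (hlie : ∀ a ∈ Q, ∀ b ∈ Q, a * b - b * a ∈ Q)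
    (hnd : ∀ a ∈ Q, (∀ b ∈ Q, LinearMap.trace ℂ V (a * b) = 0) → a = 0) (hQ : Q ≠ ⊥) :
    ∃ C : Module.End ℂ V, (∀ a ∈ Q, a * C = C * a) ∧ (∀ v, (∀ a ∈ Q, a v = 0) → C v = 0) ∧
      ¬ IsNilpotent C := by
  let B : LinearMap.BilinForm ℂ Q :=
    LinearMap.mk₂ ℂ (fun a b => LinearMap.trace ℂ V (a.1 * b.1))
      (by intros; simp [add_mul]) (by intros; simp) (by intros; simp [mul_add]) (by intros; simp)
  have hBap : ∀ a b, B a b = LinearMap.trace ℂ V (a.1 * b.1) := fun a b => rfl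
  have hsymm : ∀ a b, B a b = B b a := fun a b => by rw [hBap, hBap, LinearMap.trace_mul_comm]
  have hB : B.Nondegenerate := by
    refine ⟨fun a ha => ?_, fun a ha => ?_⟩
    · exact Subtype.ext (hnd a.1 a.2 fun b hb => ha ⟨b, hb⟩)
    · exact Subtype.ext (hnd a.1 a.2 fun b hb => by rw [LinearMap.trace_mul_comm]; exact ha ⟨b, hb⟩)
  let b := Module.finBasis ℂ Q
  let d := B.dualBasis hB b
  have hdb : ∀ i j, B (d i) (b j) = if j = i then 1 else 0 := fun i j =>
    LinearMap.BilinForm.apply_dualBasis_left hB b i j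
  have expb : ∀ q, q = ∑ j, B (d j) q • b j := fun q => by
    conv_lhs => rw [← b.sum_repr q]
    refine Finset.sum_congr rfl fun j _ => ?_
    congr 1
    have : B (d j) q = B (d j) (∑ i, b.repr q i • b i) := by rw [b.sum_repr]
    rw [this]
    simp only [map_sum, map_smul, hdb]
    simp
  have expd : ∀ q, q = ∑ j, B (b j) q • d j := fun q => by
    conv_lhs => rw [← d.sum_repr q]
    refine Finset.sum_congr rfl fun j _ => ?_
    congr 1
    have : B (b j) q = B (∑ i, d.repr q i • d i) (b j) := by rw [d.sum_repr, hsymm]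
    rw [this]
    simp only [map_sum, map_smul, hdb, LinearMap.sum_apply, LinearMap.smul_apply]
    simp
  refine ⟨∑ i, (b i).1 * (d i).1, fun a ha => ?_, fun v hv => ?_, fun hnil => ?_⟩
  · let ad : Q → Q := fun q => ⟨a * q.1 - q.1 * a, hlie a ha q.1 q.2⟩
    have hinv : ∀ p q, B (ad p) q = - B p (ad q) := fun p q => by
      simp only [hBap, ad]
      rw [← sub_eq_zero, sub_neg_eq_add, ← map_add]
      have : (a * p.1 - p.1 * a) * q.1 + p.1 * (a * q.1 - q.1 * a) =
        a * (p.1 * q.1) - (p.1 * q.1) * a := by noncomm_ring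
      rw [this, map_sub, LinearMap.trace_mul_comm, sub_self]
    have h1 : ∑ i, (ad (b i)).1 * (d i).1 = ∑ i, ∑ j, B (d j) (ad (b i)) • ((b j).1 * (d i).1) := by
      refine Finset.sum_congr rfl fun i _ => ?_
      conv_lhs => rw [expb (ad (b i))]
      simp [Finset.sum_mul]
    have h2 : ∑ i, (b i).1 * (ad (d i)).1 = ∑ i, ∑ j, B (b j) (ad (d i)) • ((b i).1 * (d j).1) := by
      refine Finset.sum_congr rfl fun i _ => ?_
      conv_lhs => rw [expd (ad (d i))]
      simp [Finset.mul_sum]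
    have h3 : ∑ i, (ad (b i)).1 * (d i).1 + ∑ i, (b i).1 * (ad (d i)).1 = 0 := by
      rw [h1, h2, Finset.sum_comm, ← Finset.sum_add_distrib]
      refine Finset.sum_eq_zero fun i _ => ?_
      rw [← Finset.sum_add_distrib]
      refine Finset.sum_eq_zero fun j _ => ?_
      rw [← add_smul, hsymm (b j) (ad (d i)), hinv, add_neg_cancel, zero_smul]
    rw [← sub_eq_zero, Finset.mul_sum, Finset.sum_mul, ← Finset.sum_sub_distrib, ← h3,
      ← Finset.sum_add_distrib]
    refine Finset.sum_congr rfl fun i _ => ?_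
    simp only [ad]
    noncomm_ring
  · simp only [LinearMap.sum_apply, Module.End.mul_apply]
    exact Finset.sum_eq_zero fun i _ => by rw [hv _ (d i).2, map_zero]
  · have ht := (LinearMap.isNilpotent_trace_of_isNilpotent hnil).eq_zero
    rw [map_sum] at ht
    have h1 : ∀ i, LinearMap.trace ℂ V ((b i).1 * (d i).1) = 1 := fun i => by
      rw [← hBap, hsymm, hdb]; simp
    simp only [h1, Finset.sum_const, Finset.card_univ, Fintype.card_fin, nsmul_eq_mul, mul_one,
      Nat.cast_eq_zero] at ht
    exact hQ (Submodule.finrank_eq_zero.1 ht)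

end Casimir

section LieReductive

variable {𝔩 : Type} [LieRing 𝔩] [LieAlgebra ℂ 𝔩]

lemma radical_scalar_of_irreducible {V : Type} [AddCommGroup V] [Module ℂ V] [LieRingModule 𝔩 V]
    [Module.Finite ℂ 𝔩] [LieModule ℂ 𝔩 V] [Module.Finite ℂ V] [Nontrivial V]
    (hirr : ∀ N : LieSubmodule ℂ 𝔩 V, N = ⊥ ∨ N = ⊤)
    {z : 𝔩} (hz : z ∈ LieAlgebra.radical ℂ 𝔩) : ∃ c : ℂ, ∀ v : V, ⁅z, v⁆ = c • v := by
  obtain ⟨χ, hχ⟩ := LieModule.exists_nontrivial_weightSpace_of_isSolvable ℂ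
    (LieAlgebra.radical ℂ 𝔩) V
  obtain ⟨w, hw⟩ := exists_ne (0 : LieModule.weightSpace V χ)
  rcases hirr (LieModule.weightSpaceOfIsLieTower ℂ V (L := 𝔩) χ) with h | h
  · exact absurd (Subtype.ext (show w.1 = 0 from by
      have : w.1 ∈ LieModule.weightSpaceOfIsLieTower ℂ V (L := 𝔩) χ := w.2
      rw [h] at this; simpa using this)) hw
  · refine ⟨χ ⟨z, hz⟩, fun v => ?_⟩
    have hv : v ∈ LieModule.weightSpaceOfIsLieTower ℂ V (L := 𝔩) χ := by rw [h]; trivial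
    have hv' : v ∈ LieModule.weightSpace V χ := hv
    rw [LieModule.mem_weightSpace] at hv'
    exact hv' ⟨z, hz⟩

end LieReductive


section LieTrace

attribute [local instance 100] LieRing.ofAssociativeRing

variable {𝔩 : Type} [LieRing 𝔩] [LieAlgebra ℂ 𝔩] [Module.Finite ℂ 𝔩]
  {V : Type} [AddCommGroup V] [Module ℂ V] [LieRingModule 𝔩 V] [LieModule ℂ 𝔩 V]
  [Module.Finite ℂ V]

lemma toEnd_ad_pow (x : 𝔩) (n : ℕ) (y : 𝔩) :
    LieModule.toEnd ℂ 𝔩 V (((LieAlgebra.ad ℂ 𝔩 x) ^ n) y) =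
      ((LieAlgebra.ad ℂ (Module.End ℂ V) (LieModule.toEnd ℂ 𝔩 V x)) ^ n)
        (LieModule.toEnd ℂ 𝔩 V y) := by
  induction n with
  | zero => simp
  | succ n ih => simp [pow_succ', ih]

lemma act_zero_of_trace_zero (hcen : ∀ z ∈ LieAlgebra.radical ℂ 𝔩, ∀ x : 𝔩, ⁅x, z⁆ = 0)
    (htriv : ∀ z ∈ LieAlgebra.radical ℂ 𝔩, ∀ v : V, ⁅z, v⁆ = 0)
    {x : 𝔩} (hx : ∀ y : 𝔩, LieModule.traceForm ℂ 𝔩 V x y = 0) : LieModule.toEnd ℂ 𝔩 V x = 0 := by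
  set k : LieIdeal ℂ 𝔩 := (LieModule.toEnd ℂ 𝔩 V).ker with hk
  have hmk : ∀ y, y ∈ k ↔ LieModule.toEnd ℂ 𝔩 V y = 0 := fun y => by simp [hk]
  have hrk : LieAlgebra.radical ℂ 𝔩 ≤ k := fun z hz => (hmk z).2 (LinearMap.ext fun v => htriv z hz v)
  let c : LieIdeal ℂ 𝔩 := k.killingCompl
  let J : LieIdeal ℂ 𝔩 := LieAlgebra.InvariantForm.orthogonal (LieModule.traceForm ℂ 𝔩 V)
    (LieModule.traceForm_lieInvariant ℂ 𝔩 V) ⊤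
  have hJ : ∀ y, y ∈ J ↔ ∀ w, LieModule.traceForm ℂ 𝔩 V w y = 0 := fun y => by
    simp [J, LieAlgebra.InvariantForm.mem_orthogonal]
  have hck : c ⊓ k ≤ LieAlgebra.radical ℂ 𝔩 := by
    rw [← LieAlgebra.LieIdeal.solvable_iff_le_radical]
    refine LieIdeal.isSolvable_of_killingForm_apply_lie_eq_zero _ fun a ha b hb => ?_
    have hb' := LieSubmodule.lie_le_left _ _ hb
    exact LieIdeal.mem_killingCompl ℂ 𝔩 k |>.1 hb'.1 a ha.2
  have htop : c ⊔ k = ⊤ := by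
    have hrad := fun y hy =>
      LieAlgebra.killingCompl_top_le_radical ℂ 𝔩 (hy : y ∈ LieIdeal.killingCompl ℂ 𝔩 ⊤)
    have hradc : ∀ z ∈ LieAlgebra.radical ℂ 𝔩, ∀ y, killingForm ℂ 𝔩 y z = 0 := fun z hz y => by
      have : LieAlgebra.ad ℂ 𝔩 z = 0 := LinearMap.ext fun w => by
        rw [LieAlgebra.ad_apply, ← lie_skew, hcen z hz, neg_zero]; rfl
      rw [killingForm_apply_apply, this]; simp
    have hd := LinearMap.BilinForm.finrank_add_finrank_orthogonal
      (LieModule.traceForm_isSymm ℂ 𝔩 𝔩).isRefl k.toSubmodule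
    have hle : k.toSubmodule ⊓ (killingForm ℂ 𝔩).orthogonal ⊤ = c.toSubmodule ⊓ k.toSubmodule := by
      apply le_antisymm
      · rintro y ⟨h1, h2⟩
        exact ⟨fun z _ => h2 z trivial, h1⟩
      · rintro y hy
        exact ⟨hy.2, fun z _ => hradc y (hck hy) z⟩
    have hs := Submodule.finrank_sup_add_finrank_inf_eq c.toSubmodule k.toSubmodule
    rw [← LieSubmodule.toSubmodule_inj, LieSubmodule.sup_toSubmodule]
    apply Submodule.eq_top_of_finrank_eq
    have hc : c.toSubmodule = (killingForm ℂ 𝔩).orthogonal k.toSubmodule := rfl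
    change _ = Module.finrank ℂ 𝔩 + Module.finrank ℂ
      (k.toSubmodule ⊓ (killingForm ℂ 𝔩).orthogonal ⊤ : Submodule ℂ 𝔩) at hd
    rw [hle] at hd
    have hd' : Module.finrank ℂ k.toSubmodule + Module.finrank ℂ c.toSubmodule =
      Module.finrank ℂ 𝔩 +
        Module.finrank ℂ (c.toSubmodule ⊓ k.toSubmodule : Submodule ℂ 𝔩) := hd
    omega
  set I : LieIdeal ℂ 𝔩 := J ⊓ c with hI
  have hIr : I ≤ LieAlgebra.radical ℂ 𝔩 := by
    rw [← LieAlgebra.LieIdeal.solvable_iff_le_radical]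
    set DI : LieIdeal ℂ 𝔩 := ⁅I, I⁆ with hDI
    have tf : LieModule.traceForm ℂ I V = 0 := by
      ext ⟨a, ha⟩ ⟨b, hb⟩
      change LieModule.traceForm ℂ 𝔩 V a b = 0
      exact (hJ b).1 hb.1 a
    have mn := LieModule.isNilpotent_derivedSeries_of_traceForm_eq_zero tf
    have rn : LieRing.IsNilpotent DI := by
      rw [LieAlgebra.isNilpotent_iff_forall (R := ℂ)]
      rintro ⟨y, hy⟩
      apply LieSubalgebra.isNilpotent_ad_of_isNilpotent_ad (DI : LieSubalgebra ℂ 𝔩) (x := ⟨y, hy⟩)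
      have hyI := LieSubmodule.lie_le_left I I hy
      have h1 : IsNilpotent (LieModule.toEnd ℂ 𝔩 V y) := by
        refine (LieModule.isNilpotent_iff_forall' (R := ℂ)).mp mn ⟨⟨y, hyI⟩, ?_⟩
        rwa [LieIdeal.derivedSeries_eq_derivedSeriesOfIdeal_comap, LieIdeal.mem_comap]
      obtain ⟨n, hn⟩ := LieAlgebra.ad_nilpotent_of_nilpotent (R := ℂ) h1
      refine ⟨n + 2, LinearMap.ext fun w => ?_⟩
      have h2 : ((LieAlgebra.ad ℂ 𝔩 y) ^ (n + 1)) w ∈ LieAlgebra.radical ℂ 𝔩 := by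
        refine hck ⟨?_, (hmk _).2 ?_⟩
        · rw [pow_succ']
          exact lie_mem_left ℂ 𝔩 c _ _ hyI.2
        · rw [toEnd_ad_pow, pow_succ, Module.End.mul_apply]
          have := hn
          rw [this]; simp
      change ((LieAlgebra.ad ℂ 𝔩 y) ^ (n + 2)) w = 0
      rw [pow_succ', Module.End.mul_apply, LieAlgebra.ad_apply, hcen _ h2]
    obtain ⟨m, hm⟩ := LieAlgebra.IsSolvable.solvable ℂ DI
    rw [LieIdeal.derivedSeries_eq_bot_iff] at hm
    refine LieAlgebra.IsSolvable.mk ((LieIdeal.derivedSeries_eq_bot_iff I (m + 1)).mpr ?_)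
    rwa [LieAlgebra.derivedSeriesOfIdeal_add, LieAlgebra.derivedSeriesOfIdeal_succ,
      LieAlgebra.derivedSeriesOfIdeal_zero]
  have hxt : x ∈ c ⊔ k := by rw [htop]; trivial
  obtain ⟨a, ha, b, hb, hab⟩ := LieSubmodule.mem_sup .. |>.1 hxt
  have hka := hrk (hIr ⟨(hJ a).2 fun w => by
    have : LieModule.traceForm ℂ 𝔩 V w b = 0 := by
      rw [LieModule.traceForm_apply_apply, (hmk b).1 hb]; simp
    have h2 := hx w
    rw [LieModule.traceForm_comm, ← hab, map_add, this, add_zero] at h2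
    exact h2, ha⟩)
  rw [← hab, map_add, (hmk a).1 hka, (hmk b).1 hb, add_zero]

lemma exists_commuting_operator (hcen : ∀ z ∈ LieAlgebra.radical ℂ 𝔩, ∀ x : 𝔩, ⁅x, z⁆ = 0)
    (hss : ∀ z ∈ LieAlgebra.radical ℂ 𝔩, ∀ v : V, ⁅z, ⁅z, v⁆⁆ = 0 → ⁅z, v⁆ = 0)
    (hne : ∃ (x : 𝔩) (v : V), ⁅x, v⁆ ≠ 0) :
    ∃ C : Module.End ℂ V, (∀ (x : 𝔩) v, ⁅x, C v⁆ = C ⁅x, v⁆) ∧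
      (∀ v, (∀ x : 𝔩, ⁅x, v⁆ = 0) → C v = 0) ∧ ¬ IsNilpotent C := by
  by_cases hz : ∃ z ∈ LieAlgebra.radical ℂ 𝔩, ∃ v : V, ⁅z, v⁆ ≠ 0
  · obtain ⟨z, hz, v, hv⟩ := hz
    refine ⟨LieModule.toEnd ℂ 𝔩 V z, fun x w => ?_, fun w hw => hw z, ?_⟩
    · have := leibniz_lie x z w
      rw [hcen z hz, zero_lie, zero_add] at this
      exact this
    · rintro ⟨n, hn⟩
      have key : ∀ n w, ((LieModule.toEnd ℂ 𝔩 V z) ^ (n + 1)) w = 0 → ⁅z, w⁆ = 0 := by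
        intro n
        induction n with
        | zero => intro w hw; simpa using hw
        | succ n ih =>
          intro w hw
          refine hss z hz w (ih ⁅z, w⁆ ?_)
          rw [pow_succ, Module.End.mul_apply] at hw
          exact hw
      exact hv (key n v (by rw [pow_succ', hn]; simp))
  · push Not at hz
    let Q : Submodule ℂ (Module.End ℂ V) := LinearMap.range (LieModule.toEnd ℂ 𝔩 V : 𝔩 ⊸ _)
    obtain ⟨C, h1, h2, h3⟩ := exists_casimir Q (by
        rintro _ ⟨x, rfl⟩ _ ⟨y, rfl⟩
        exact ⟨⁅x, y⁆, by simp [LieRing.of_associative_ring_bracket]⟩)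
      (by
        rintro _ ⟨x, rfl⟩ h
        exact act_zero_of_trace_zero hcen hz fun y => h _ ⟨y, rfl⟩)
      (by
        obtain ⟨x, v, hxv⟩ := hne
        intro h
        have : LieModule.toEnd ℂ 𝔩 V x ∈ Q := ⟨x, rfl⟩
        rw [h, Submodule.mem_bot] at this
        exact hxv (by rw [← LieModule.toEnd_apply_apply ℂ, this]; rfl))
    refine ⟨C, fun x v => LinearMap.congr_fun (h1 _ ⟨x, rfl⟩) v, fun v hv => h2 v ?_, h3⟩
    rintro _ ⟨x, rfl⟩
    exact hv x

omit [Module.Finite ℂ V] in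
lemma invariant_eq_zero (hcen : ∀ z ∈ LieAlgebra.radical ℂ 𝔩, ∀ x : 𝔩, ⁅x, z⁆ = 0) (n : ℕ) :
    ∀ (V : Type) [AddCommGroup V] [Module ℂ V] [LieRingModule 𝔩 V] [LieModule ℂ 𝔩 V]
      [Module.Finite ℂ V] (_ : Module.finrank ℂ V ≤ n)
      (_ : ∀ z ∈ LieAlgebra.radical ℂ 𝔩, ∀ v : V, ⁅z, ⁅z, v⁆⁆ = 0 → ⁅z, v⁆ = 0)
      (v₀ : V) (_ : ∀ x : 𝔩, ⁅x, v₀⁆ = 0)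
      (_ : v₀ ∈ Submodule.span ℂ {w : V | ∃ (x : 𝔩) (v : V), ⁅x, v⁆ = w}), v₀ = 0 := by
  induction n with
  | zero =>
    intro V _ _ _ _ _ hn hss v₀ hv hsp
    have := Module.finrank_zero_iff.1 (Nat.le_zero.1 hn)
    exact Subsingleton.elim _ _
  | succ n ih =>
    intro V _ _ _ _ _ hn hss v₀ hv hsp
    by_cases hne : ∃ (x : 𝔩) (v : V), ⁅x, v⁆ ≠ 0
    · obtain ⟨C, h1, h2, h3⟩ := exists_commuting_operator hcen hss hne
      obtain ⟨m, hm, hm1⟩ := (C.eventually_isCompl_ker_pow_range_pow.and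
        (Filter.eventually_ge_atTop 1)).exists
      have hpow : ∀ (x : 𝔩) v, ⁅x, (C ^ m) v⁆ = (C ^ m) ⁅x, v⁆ := by
        intro x
        clear hm hm1
        induction m with
        | zero => intro v; rfl
        | succ m ihm => intro v; rw [pow_succ', Module.End.mul_apply, h1, ihm]; rfl
      let N : LieSubmodule ℂ 𝔩 V := { LinearMap.ker (C ^ m) with
        lie_mem := fun {x v} hx => by
          change (C ^ m) ⁅x, v⁆ = 0
          rw [← hpow, show (C ^ m) v = 0 from hx, lie_zero] }
      let p : V ⊸ N := Submodule.projectionOnto _ _ hm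
      have hpl : ∀ v ∈ LinearMap.range (C ^ m), p v = 0 := fun v hv =>
        Submodule.projectionOnto_apply_of_mem_right hm hv
      have hpk : ∀ v : N, p v.1 = v := fun v => Submodule.projectionOnto_apply_left hm v
      have hp : ∀ (x : 𝔩) v, p ⁅x, v⁆ = ⁅x, p v⁆ := by
        intro x v
        have hvt : v ∈ LinearMap.ker (C ^ m) ⊔ LinearMap.range (C ^ m) := by
          rw [hm.sup_eq_top]; trivial
        obtain ⟨a, ha, _, ⟨b, rfl⟩, rfl⟩ := Submodule.mem_sup.1 hvt
        have ha1 := hpk ⟨a, ha⟩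
        have ha2 := hpk ⁅x, (⟨a, ha⟩ : N)⁆
        rw [lie_add, map_add, map_add, hpow, hpl _ ⟨b, rfl⟩, hpl _ ⟨_, rfl⟩, add_zero, add_zero, ha1]
        exact ha2
      have hv0 : v₀ ∈ N := by
        change (C ^ m) v₀ = 0
        obtain ⟨m', rfl⟩ := Nat.exists_eq_add_of_le hm1
        rw [add_comm, pow_succ, Module.End.mul_apply, h2 v₀ hv, map_zero]
      have hlt : Module.finrank ℂ N < Module.finrank ℂ V := by
        apply Submodule.finrank_lt
        intro h
        exact h3 ⟨m, LinearMap.ker_eq_top.1 h⟩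
      have := ih N (by omega) (fun z hz v h => Subtype.ext (hss z hz v.1 (congrArg Subtype.val h)))
        ⟨v₀, hv0⟩ (fun x => Subtype.ext (hv x)) (by
          have h4 := hpk ⟨v₀, hv0⟩
          rw [← h4]
          have h5 : p v₀ ∈ Submodule.map p (Submodule.span ℂ {w : V | ∃ (x : 𝔩) (v : V), ⁅x, v⁆ = w}) :=
            Submodule.mem_map_of_mem hsp
          rw [Submodule.map_span] at h5
          refine Submodule.span_mono ?_ h5
          rintro _ ⟨_, ⟨x, v, rfl⟩, rfl⟩
          exact ⟨x, p v, (hp x v).symm⟩)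
      exact congrArg Subtype.val this
    · push Not at hne
      have : {w : V | ∃ (x : 𝔩) (v : V), ⁅x, v⁆ = w} ⊆ {0} := by
        rintro _ ⟨x, v, rfl⟩
        exact hne x v
      have h := Submodule.span_mono this hsp
      simpa using h

end LieTrace


section AdaptedBasis

variable {𝔩 : Type} [LieRing 𝔩] [LieAlgebra ℂ 𝔩] [Module.Finite ℂ 𝔩]

lemma exists_adapted_basis (n : ℕ) : ∀ (V : Type) [AddCommGroup V] [Module ℂ V]
    [LieRingModule 𝔩 V] [LieModule ℂ 𝔩 V] [Module.Finite ℂ V] (_ : Module.finrank ℂ V ≤ n),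
    ∃ (m : ℕ) (b : Module.Basis (Fin m) ℂ V) (blk : Fin m → ℕ) (s : ℕ) (lam : 𝔩 → ℕ → ℂ),
      Monotone blk ∧ (∀ i, blk i < s) ∧
      (∀ (x : 𝔩) i j, blk j < blk i → b.repr ⁅x, b j⁆ i = 0) ∧
      (∀ z ∈ LieAlgebra.radical ℂ 𝔩, ∀ i j, blk i = blk j →
        b.repr ⁅z, b j⁆ i = if i = j then lam z (blk j) else 0) := by
  induction n with
  | zero =>
    intro V _ _ _ _ _ hn
    have := Module.finrank_zero_iff.1 (Nat.le_zero.1 hn)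
    exact ⟨0, Module.Basis.empty V, fun _ => 0, 0, fun _ _ => 0,
      fun i => i.elim0, fun i => i.elim0, fun _ i => i.elim0, fun _ _ i => i.elim0⟩
  | succ n ih =>
    intro V _ _ _ _ _ hn
    classical
    by_cases hV : Nontrivial V
    swap
    · have := not_nontrivial_iff_subsingleton.1 hV
      exact ih V (by rw [Module.finrank_zero_of_subsingleton]; omega)
    have hbt : (⊥ : LieSubmodule ℂ 𝔩 V) ≠ ⊤ := bot_ne_top
    obtain ⟨N, hN, -⟩ := (eq_top_or_exists_le_coatom (⊥ : LieSubmodule ℂ 𝔩 V)).resolve_left hbt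
    have hlt : Module.finrank ℂ N < Module.finrank ℂ V := by
      apply Submodule.finrank_lt
      intro h
      exact hN.1 (by rw [← LieSubmodule.toSubmodule_inj]; exact h)
    obtain ⟨m, b, blk, s, lam, hmono, hs, h1, h2⟩ := ih N (by omega)
    have hmk : ∀ (x : 𝔩) (v : V), (LieSubmodule.Quotient.mk ⁅x, v⁆ : V ⧸ N) =
      ⁅x, (LieSubmodule.Quotient.mk v : V ⧸ N)⁆ := fun x v => rfl
    have := Module.Finite.quotient ℂ N.toSubmodule
    have hnt : Nontrivial (V ⧸ N) := by
      refine Submodule.Quotient.nontrivial_iff.2 fun h => hN.1 ?_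
      rw [← LieSubmodule.toSubmodule_inj]; exact h
    have hirr : ∀ P : LieSubmodule ℂ 𝔩 (V ⧸ N), P = ⊥ ∨ P = ⊤ := by
      intro P
      let π : V →ₗ⁅ℂ, 𝔩⁆ V ⧸ N := LieSubmodule.Quotient.mk' N
      have hle : N ≤ P.comap π := fun v hv => by
        rw [LieSubmodule.mem_comap]
        have : π v = 0 := (LieSubmodule.Quotient.mk_eq_zero').2 hv
        rw [this]; exact P.zero_mem
      rcases hle.eq_or_lt with h | h
      · left
        rw [eq_bot_iff]
        intro q hq
        obtain ⟨v, rfl⟩ := LieSubmodule.Quotient.surjective_mk' N q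
        have : v ∈ P.comap π := hq
        rw [← h] at this
        exact (LieSubmodule.Quotient.mk_eq_zero').2 this
      · right
        have := hN.2 _ h
        rw [eq_top_iff]
        intro q _
        obtain ⟨v, rfl⟩ := LieSubmodule.Quotient.surjective_mk' N q
        have hv : v ∈ P.comap π := by rw [this]; trivial
        exact hv
    let bQ := Module.finBasis ℂ (V ⧸ N)
    choose c hc using fun (z : LieAlgebra.radical ℂ 𝔩) =>
      radical_scalar_of_irreducible (V := V ⧸ N) hirr z.2
    let B : Module.Basis (Fin m ⊕ Fin _) ℂ V := Module.Basis.sumQuot b bQ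
    have hBl : ∀ i, B (Sum.inl i) = b i := fun i => Module.Basis.sumQuot_inl b bQ i
    have hBr : ∀ j, (LieSubmodule.Quotient.mk (B (Sum.inr j)) : V ⧸ N) = bQ j := fun j =>
      Module.Basis.sumQuot_inr (W := N.toSubmodule) b bQ j
    have hl : ∀ (w : N) i, B.repr w (Sum.inl i) = b.repr w i := fun w i =>
      Module.Basis.sumQuot_repr_inl b bQ w i
    have hr : ∀ v j, B.repr v (Sum.inr j) = bQ.repr (LieSubmodule.Quotient.mk v : V ⧸ N) j := fun v j =>
      Module.Basis.sumQuot_repr_inr (W := N.toSubmodule) b bQ v j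
    have hr0 : ∀ (w : N) j, B.repr w (Sum.inr j) = 0 := fun w j => by
      rw [hr, (LieSubmodule.Quotient.mk_eq_zero' (N := N)).2 w.2, map_zero]; rfl
    let blk' : Fin m ⊕ Fin (Module.finrank ℂ (V ⧸ N)) → ℕ := Sum.elim blk fun _ => s
    let lam' : 𝔩 → ℕ → ℂ := fun z k => if k < s then lam z k else
      if hz : z ∈ LieAlgebra.radical ℂ 𝔩 then c ⟨z, hz⟩ else 0
    have g1 : ∀ (x : 𝔩) i j, blk' j < blk' i → B.repr ⁅x, B j⁆ i = 0 := by
      rintro x (i | i) (j | j) h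
      · rw [hBl, ← LieSubmodule.coe_bracket, hl]; exact h1 x i j h
      · exact absurd h (not_lt.2 (hs i).le)
      · rw [hBl, ← LieSubmodule.coe_bracket, hr0]
      · exact absurd h (lt_irrefl _)
    have g2 : ∀ z ∈ LieAlgebra.radical ℂ 𝔩, ∀ i j, blk' i = blk' j →
        B.repr ⁅z, B j⁆ i = if i = j then lam' z (blk' j) else 0 := by
      rintro z hz (i | i) (j | j) h
      · rw [hBl, ← LieSubmodule.coe_bracket, hl, h2 z hz i j h]
        simp [lam', blk', hs]
      · exact absurd h (hs i).ne
      · exact absurd h (hs j).ne'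
      · rw [hr, hmk, hBr, hc ⟨z, hz⟩, map_smul, Finsupp.smul_apply, bQ.repr_self]
        simp [lam', blk', hz, Finsupp.single_apply, eq_comm]
    refine ⟨m + Module.finrank ℂ (V ⧸ N), B.reindex finSumFinEquiv,
      fun i => blk' (finSumFinEquiv.symm i), s + 1, lam', ?_, ?_, ?_, ?_⟩
    · intro i j hij
      obtain ⟨i, rfl⟩ := finSumFinEquiv.surjective i
      obtain ⟨j, rfl⟩ := finSumFinEquiv.surjective j
      simp only [Equiv.symm_apply_apply]
      rcases i with i | i <;> rcases j with j | j
      · simp only [finSumFinEquiv_apply_left, Fin.le_def, Fin.val_castAdd] at hij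
        exact hmono (Fin.le_def.2 hij)
      · exact (hs i).le
      · exfalso
        simp only [finSumFinEquiv_apply_left, finSumFinEquiv_apply_right, Fin.le_def,
          Fin.val_castAdd, Fin.val_natAdd] at hij
        omega
      · exact le_rfl
    · intro i
      obtain ⟨i, rfl⟩ := finSumFinEquiv.surjective i
      rcases i with i | i
      · simpa [blk'] using (hs i).trans (Nat.lt_succ_self s)
      · simp [blk']
    · intro x i j h
      simpa using g1 x _ _ h
    · intro z hz i j h
      simpa using g2 z hz _ _ h

end AdaptedBasis


section TriangularRep

variable {Γ : Type} [Group Γ] {R : FnAlg Γ}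

lemma mem_of_forall_functional {V : Submodule ℂ (Γ → ℂ)} {f : Γ → ℂ}
    (h : ∀ P : FnDual Γ, (∀ v ∈ V, P v = 0) → P f = 0) : f ∈ V := by
  by_contra hf
  obtain ⟨P, hP, hV⟩ := Submodule.exists_le_ker_of_notMem hf
  exact hP (h P fun v hv => hV hv)

lemma IsHopfFn.exists_stable (hR : IsHopfFn R) (s : Set (Γ → ℂ)) (hfin : s.Finite)
    (hs : s ⊆ R) : ∃ V : Submodule ℂ (Γ → ℂ), Module.Finite ℂ V ∧ s ⊆ V ∧ (∀ f ∈ V, f ∈ R) ∧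
      (∀ f ∈ V, ∀ y, (fun x => f (x * y)) ∈ V) ∧ ∀ X, ∀ f ∈ V, linv X f ∈ V := by
  let V : Submodule ℂ (Γ → ℂ) := Submodule.span ℂ {g | ∃ f ∈ s, ∃ y, g = fun x => f (x * y)}
  have hVR : ∀ f ∈ V, f ∈ R := by
    intro f hf
    have : V ≤ Subalgebra.toSubmodule R := Submodule.span_le.2 (by
      rintro _ ⟨f, hf, y, rfl⟩
      exact hR.right_translate (hs hf) y)
    exact this hf
  have hVt : ∀ f ∈ V, ∀ y, (fun x => f (x * y)) ∈ V := by
    intro f hf y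
    let T : (Γ → ℂ) ⊸ (Γ → ℂ) := LinearMap.funLeft ℂ ℂ (fun x => x * y)
    have : V ≤ V.comap T := Submodule.span_le.2 (by
      rintro _ ⟨f, hf, y', rfl⟩
      exact Submodule.subset_span ⟨f, hf, y * y', by ext x; simp [T, LinearMap.funLeft, mul_assoc]⟩)
    exact this hf
  refine ⟨V, ?_, fun f hf => Submodule.subset_span ⟨f, hf, 1, by simp⟩, hVR, hVt, fun X f hf => ?_⟩
  · choose! n a b ha hb hab using fun f (hf : f ∈ s) => biReg_expand (hR.comul f (hs hf))
    have hfs : (⋃ f ∈ s, Set.range (a f)).Finite := hfin.biUnion fun f _ => Set.finite_range _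
    have h1 := FiniteDimensional.span_of_finite ℂ hfs
    refine Submodule.finiteDimensional_of_le (S₂ := Submodule.span ℂ (⋃ f ∈ s, Set.range (a f))) ?_
    refine Submodule.span_le.2 ?_
    rintro _ ⟨f, hf, y, rfl⟩
    have : (fun x => f (x * y)) = ∑ i, b f i y • a f i := by
      ext x
      rw [hab f hf x y]
      simp [mul_comm]
    rw [this]
    exact Submodule.sum_mem _ fun i _ => Submodule.smul_mem _ _
      (Submodule.subset_span (Set.mem_biUnion hf (Set.mem_range_self i)))
  · refine mem_of_forall_functional fun P hP => ?_
    have := biReg_fubini (hR.comul f (hVR f hf)) P X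
    have h0 : (fun y => P (fun x => f (x * y))) = 0 := by ext y; exact hP _ (hVt f hf y)
    rw [h0, map_zero] at this
    exact this

variable {𝔩 : Type} [LieRing 𝔩] [LieAlgebra ℂ 𝔩] {der : 𝔩 ⊸ FnDual Γ}

/-- The action of the Lie algebra on a stable space of regular functions. -/
@[reducible] def IsLieFn.lieRingModule (hL : IsLieFn R 𝔩 der) (hR : IsHopfFn R)
    (V : Submodule ℂ (Γ → ℂ)) (hVR : ∀ f ∈ V, f ∈ R) (hV : ∀ X, ∀ f ∈ V, linv X f ∈ V) :
    LieRingModule 𝔩 V where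
  bracket u v := ⟨linv (der u) v.1, hV _ _ v.2⟩
  add_lie u v w := by
    apply Subtype.ext; funext x
    change linv (der (u + v)) w.1 x = linv (der u) w.1 x + linv (der v) w.1 x
    simp [linv_apply]
  lie_add u v w := by
    apply Subtype.ext
    exact map_add (linv (der u)) v.1 w.1
  leibniz_lie u v w := by
    apply Subtype.ext
    change linv (der u) (linv (der v) w.1) = linv (der ⁅u, v⁆) w.1 + linv (der v) (linv (der u) w.1)
    rw [hL.linv_lie (hVR _ w.2) hR, sub_add_cancel]

lemma IsLieFn.lieModule (hL : IsLieFn R 𝔩 der) (hR : IsHopfFn R)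
    (V : Submodule ℂ (Γ → ℂ)) (hVR : ∀ f ∈ V, f ∈ R) (hV : ∀ X, ∀ f ∈ V, linv X f ∈ V) :
    let _ := hL.lieRingModule hR V hVR hV
    LieModule ℂ 𝔩 V := by
  intro _
  refine ⟨fun c u w => Subtype.ext ?_, fun c u w => Subtype.ext ?_⟩
  · funext x
    change linv (der (c • u)) w.1 x = c * linv (der u) w.1 x
    simp [linv_apply]
  · exact map_smul (linv (der u)) c w.1

lemma IsAlgGrpFn.exists_triangular_rep (hR : IsAlgGrpFn R) (hL : IsLieFn R 𝔩 der) :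
    ∃ (m : ℕ) (φ : Γ →* Matrix (Fin m) (Fin m) ℂ) (blk : Fin m → ℕ) (lam : 𝔩 → ℕ → ℂ),
      Monotone blk ∧ (∀ i j, (fun x => φ x i j) ∈ R) ∧ Function.Injective φ ∧
      (∀ u i j, blk j < blk i → der u (fun x => φ x i j) = 0) ∧
      (∀ z ∈ LieAlgebra.radical ℂ 𝔩, ∀ i j, blk i = blk j →
        der z (fun x => φ x i j) = if i = j then lam z (blk j) else 0) := by
  obtain ⟨s, hs⟩ := hR.fg
  have hsR : (s : Set (Γ → ℂ)) ⊆ R := by rw [← hs]; exact Algebra.subset_adjoin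
  obtain ⟨V, hfd, hsV, hVR, hVt, hVX⟩ := hR.exists_stable s s.finite_toSet hsR
  have hfin := hL.finite hR.toIsHopfFn
  let _ := hL.lieRingModule hR.toIsHopfFn V hVR hVX
  have _ := hL.lieModule hR.toIsHopfFn V hVR hVX
  obtain ⟨m, b, blk, -, lam, hmono, -, h1, h2⟩ := exists_adapted_basis (𝔩 := 𝔩) _ V le_rfl
  let ρ : Γ →* Module.End ℂ V :=
    { toFun := fun y =>
        { toFun := fun v => ⟨fun x => v.1 (x * y), hVt _ v.2 y⟩
          map_add' := fun v w => rfl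
          map_smul' := fun c v => rfl }
      map_one' := by ext v; simp
      map_mul' := fun y z => by ext v x; simp [mul_assoc] }
  let φ : Γ →* Matrix (Fin m) (Fin m) ℂ :=
    (LinearMap.toMatrixAlgEquiv b : Module.End ℂ V →* _).comp ρ
  have hφ : ∀ x i j, φ x i j = b.repr (ρ x (b j)) i := fun x i j => by
    simp [φ, LinearMap.toMatrixAlgEquiv_apply]
  have hP : ∀ i, ∃ P : FnDual Γ, ∀ v : V, P v.1 = b.repr v i := fun i => by
    obtain ⟨P, hP⟩ := LinearMap.exists_extend (b.coord i)
    exact ⟨P, LinearMap.congr_fun hP⟩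
  choose P hP using hP
  have hφ' : ∀ i j, (fun x => φ x i j) = fun x => P i (fun t => (b j).1 (t * x)) := fun i j => by
    ext x
    rw [hφ, ← hP]; rfl
  have hX : ∀ X i j, X (fun x => φ x i j) = b.repr ⟨linv X (b j).1, hVX X _ (b j).2⟩ i :=
    fun X i j => by
    rw [hφ', ← biReg_fubini (hR.comul _ (hVR _ (b j).2)) (P i) X, ← hP]
    rfl
  refine ⟨m, φ, blk, lam, hmono, fun i j => ?_, fun x y hxy => ?_, fun u i j h => ?_,
    fun z hz i j h => ?_⟩
  · rw [hφ']
    exact biReg_contract (biReg_swap (hR.comul _ (hVR _ (b j).2))) (P i)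
  · have hρ := (LinearMap.toMatrixAlgEquiv b).injective hxy
    refine hR.sep x y fun f hf => ?_
    rw [← hs] at hf
    induction hf using Algebra.adjoin_induction with
    | mem f hf =>
      have := congrFun (congrArg Subtype.val (LinearMap.congr_fun hρ ⟨f, hsV hf⟩)) 1
      simpa [ρ] using this
    | algebraMap c => rfl
    | add f g _ _ hf hg => simp [hf, hg]
    | mul f g _ _ hf hg => simp [hf, hg]
  · rw [hX]; exact h1 u i j h
  · rw [hX]; exact h2 z hz i j h

end TriangularRep


section Restrict

variable {Γ : Type} [Group Γ] {R : FnAlg Γ}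

lemma IsAlgGrpFn.restrict (hR : IsAlgGrpFn R) (H : Subgroup Γ) {Z : Set (Γ → ℂ)} (hZR : Z ⊆ R)
    (hZ : ∀ x, x ∈ H ↔ ∀ f ∈ Z, f x = 0) : IsAlgGrpFn (pullFn H.subtype R) where
  toIsHopfFn := hR.toIsHopfFn.pull H.subtype
  sep x y h := Subtype.ext (hR.sep _ _ fun f hf => h _ (comp_mem_pullFn hf))
  pts p := by
    let res : R →ₐ[ℂ] pullFn H.subtype R :=
      { toFun := fun f => ⟨f.1 ∘ H.subtype, comp_mem_pullFn f.2⟩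
        map_one' := rfl
        map_mul' := fun _ _ => rfl
        map_zero' := rfl
        map_add' := fun _ _ => rfl
        commutes' := fun _ => rfl }
    obtain ⟨x, hx⟩ := hR.pts (p.comp res)
    have hxH : x ∈ H := by
      refine (hZ x).2 fun f hf => ?_
      have h0 : res ⟨f, hZR hf⟩ = 0 := Subtype.ext (funext fun y => (hZ _).1 y.2 f hf)
      have h1 := hx ⟨f, hZR hf⟩
      rw [AlgHom.comp_apply, h0, map_zero] at h1
      exact h1.symm
    refine ⟨⟨x, hxH⟩, ?_⟩
    rintro ⟨f, hf⟩
    obtain ⟨r, hr, rfl⟩ := mem_pullFn.1 hf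
    exact hx ⟨r, hr⟩

lemma IsPD.map_inv (hR : IsHopfFn R) {X : FnDual Γ} (hX : IsPD R X) {f : Γ → ℂ}
    (hf : f ∈ R) : X (fun x => f x⁻¹) = -X f := by
  obtain ⟨n, a, b, ha, hb, hab⟩ := biReg_expand (hR.comul f hf)
  have h1 : X (fun x => ∑ i, a i x * b i x⁻¹) = 0 := by
    have : (fun x => ∑ i, a i x * b i x⁻¹) = f 1 • (1 : Γ → ℂ) := by
      funext x
      simp [← hab]
    rw [this, map_smul, hX.map_one, smul_zero]
  have h2 : (fun x => ∑ i, a i x * b i x⁻¹) = ∑ i, a i * fun x => b i x⁻¹ := by funext x; simp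
  have h3 : (fun x => f x⁻¹) = ∑ i, a i 1 • fun x => b i x⁻¹ := by funext x; simp [← hab]
  have h4 : f = ∑ i, b i 1 • a i := by
    funext x
    have := hab x 1
    rw [mul_one] at this
    simp [this, mul_comm]
  rw [h2, map_sum] at h1
  rw [h3, map_sum]
  conv_rhs => rw [h4, map_sum]
  rw [eq_neg_iff_add_eq_zero, ← Finset.sum_add_distrib, ← h1]
  refine Finset.sum_congr rfl fun i _ => ?_
  rw [hX _ (ha i) _ (hR.inv _ (hb i))]
  simp

end Restrict

section LeviRep

variable {Γ : Type} [Group Γ] {R : FnAlg Γ}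
variable {𝔩 : Type} [LieRing 𝔩] [LieAlgebra ℂ 𝔩] {der : 𝔩 ⊸ FnDual Γ}

/-- The only connected normal closed subgroup with a faithful unitriangular representation is
trivial. -/
def IsRedFn (R : FnAlg Γ) : Prop :=
  ∀ (K : Subgroup Γ) (_ : K.Normal) (Z : Set (Γ → ℂ)) (_ : Z ⊆ R)
    (_ : ∀ x, x ∈ K ↔ ∀ f ∈ Z, f x = 0) (_ : IsConnFn (pullFn K.subtype R))
    (m : ℕ) (ψ : K →* Matrix (Fin m) (Fin m) ℂ)
    (_ : ∀ i j, (fun x => ψ x i j) ∈ pullFn K.subtype R) (_ : Function.Injective ψ)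
    (_ : ∀ x i, ψ x i i = 1) (_ : ∀ x i j, j < i → ψ x i j = 0), K = ⊥

lemma linv_entry {m : ℕ} (φ : Γ →* Matrix (Fin m) (Fin m) ℂ) (X : FnDual Γ)
    (i j : Fin m) : linv X (fun x => φ x i j) =
      ∑ k, X (fun x => φ x k j) • fun x => φ x i k := by
  funext x
  rw [linv_apply]
  have : (fun y => φ (x * y) i j) = ∑ k, φ x i k • fun y => φ y k j := by
    funext y; simp [Matrix.mul_apply]
  rw [this, map_sum]
  simp [mul_comm]

lemma triangular_of_der [IsDomain R] (hR : IsHopfFn R) (hL : IsLieFn R 𝔩 der)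
    {m : ℕ} (φ : Γ →* Matrix (Fin m) (Fin m) ℂ) (blk : Fin m → ℕ)
    (hφ : ∀ i j, (fun x => φ x i j) ∈ R)
    (h0 : ∀ u i j, blk j < blk i → der u (fun x => φ x i j) = 0) (x : Γ) (i j : Fin m)
    (hij : blk j < blk i) : φ x i j = 0 := by
  let N : Submodule ℂ (Γ → ℂ) :=
    Submodule.span ℂ {f | ∃ i j, blk j < blk i ∧ (fun x => φ x i j) = f}
  have key := hR.eq_zero_of_linv_stable (N : Set (Γ → ℂ)) ?_ ?_ ?_
  · exact congrFun (key (fun x => φ x i j) (Submodule.subset_span ⟨i, j, hij, rfl⟩)) x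
  · have : N ≤ Subalgebra.toSubmodule R := Submodule.span_le.2 (by
      rintro _ ⟨i, j, _, rfl⟩; exact hφ i j)
    exact this
  · have : N ≤ LinearMap.ker (LinearMap.proj (1 : Γ) : FnDual Γ) := Submodule.span_le.2 (by
      rintro _ ⟨i, j, hij, rfl⟩
      have : i ≠ j := by rintro rfl; exact lt_irrefl _ hij
      simp [this])
    exact fun f hf => this hf
  · intro f hf X hX
    have : N ≤ N.comap (linv X) := Submodule.span_le.2 (by
      rintro _ ⟨i, j, hij, rfl⟩
      rw [SetLike.mem_coe, Submodule.mem_comap, linv_entry]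
      refine Submodule.sum_mem _ fun k _ => ?_
      by_cases hk : blk k < blk i
      · exact Submodule.smul_mem _ _ (Submodule.subset_span ⟨i, k, hk, rfl⟩)
      · obtain ⟨u, hu⟩ := hL.full X hX
        rw [← hu _ (hφ k j), h0 u k j (by omega), zero_smul]
        exact Submodule.zero_mem _)
    exact this hf

lemma exists_block_rep [IsDomain R] (hR : IsAlgGrpFn R) (hL : IsLieFn R 𝔩 der)
    (hred : IsRedFn R) :
    ∃ (m : ℕ) (Φ : Γ →* Matrix (Fin m) (Fin m) ℂ) (blk : Fin m → ℕ) (lam : 𝔩 → ℕ → ℂ),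
      (∀ i j, (fun x => Φ x i j) ∈ R) ∧ Function.Injective Φ ∧
      (∀ x i j, blk i ≠ blk j → Φ x i j = 0) ∧
      (∀ z ∈ LieAlgebra.radical ℂ 𝔩, ∀ i j,
        der z (fun x => Φ x i j) = if i = j then lam z (blk j) else 0) := by
  obtain ⟨m, φ, blk, lam, hmono, hφ, hinj, h0, hlam⟩ := hR.exists_triangular_rep hL
  have htri := triangular_of_der hR.toIsHopfFn hL φ blk hφ h0
  let Φ : Γ →* Matrix (Fin m) (Fin m) ℂ :=
    { toFun := fun x => Matrix.of fun i j => if blk i = blk j then φ x i j else 0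
      map_one' := by
        ext i j
        by_cases h : i = j
        · subst h; simp
        · simp [h]
      map_mul' := by
        intro x y
        ext i j
        simp only [Matrix.of_apply, map_mul, Matrix.mul_apply]
        by_cases h : blk i = blk j
        · rw [if_pos h]
          refine Finset.sum_congr rfl fun k _ => ?_
          by_cases hk : blk i = blk k
          · rw [if_pos hk, if_pos (hk ▸ h)]
          · rw [if_neg hk, zero_mul]
            rcases lt_or_gt_of_ne hk with hk | hk
            · rw [htri y k j (h ▸ hk), mul_zero]
            · rw [htri x i k hk, zero_mul]
        · rw [if_neg h]
          symm
          refine Finset.sum_eq_zero fun k _ => ?_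
          by_cases hk : blk i = blk k
          · rw [if_neg (fun hh => h (hk.trans hh)), mul_zero]
          · rw [if_neg hk, zero_mul] }
  have hΦ : ∀ x i j, Φ x i j = if blk i = blk j then φ x i j else 0 := fun _ _ _ => rfl
  have hΦR : ∀ i j, (fun x => Φ x i j) ∈ R := by
    intro i j
    simp only [hΦ]
    by_cases h : blk i = blk j
    · simp only [h, if_true]; exact hφ i j
    · simp only [h, if_false]; exact R.zero_mem
  have hK : Φ.ker = ⊥ := by
    let Z : Set (Γ → ℂ) := {f | ∃ i j, (fun x => Φ x i j - (1 : Matrix _ _ ℂ) i j) = f}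
    have hZR : Z ⊆ R := by
      rintro _ ⟨i, j, rfl⟩
      exact R.sub_mem (hΦR i j) (R.algebraMap_mem _)
    have hZ : ∀ x, x ∈ Φ.ker ↔ ∀ f ∈ Z, f x = 0 := by
      intro x
      rw [MonoidHom.mem_ker]
      constructor
      · rintro h _ ⟨i, j, rfl⟩
        simp [h]
      · intro h
        ext i j
        exact sub_eq_zero.1 (h _ ⟨i, j, rfl⟩)
    have hS := hR.restrict Φ.ker hZR hZ
    let ψ : Φ.ker →* Matrix (Fin m) (Fin m) ℂ := φ.comp Φ.ker.subtype
    have hψ : ∀ i j, (fun x => ψ x i j) ∈ pullFn Φ.ker.subtype R := fun i j =>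
      comp_mem_pullFn (hφ i j)
    have hψi : Function.Injective ψ := hinj.comp Subtype.val_injective
    have hker : ∀ x i j, blk i = blk j → ψ x i j = (1 : Matrix _ _ ℂ) i j := by
      intro x i j h
      have h1 := MonoidHom.mem_ker.1 x.2
      rw [← h1, hΦ, if_pos h]
      rfl
    have h1 : ∀ x i, ψ x i i = 1 := fun x i => by rw [hker x i i rfl, Matrix.one_apply_eq]
    have h0' : ∀ x i j, j < i → ψ x i j = 0 := by
      intro x i j hij
      rcases (hmono hij.le).lt_or_eq with h | h
      · exact htri x.1 i j h
      · rw [hker x i j h.symm, Matrix.one_apply_ne hij.ne']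
    exact hred Φ.ker inferInstance Z hZR hZ
      (hS.isPowPoly_of_unitriangular hψ hψi h1 h0').isConnFn m ψ hψ hψi h1 h0'
  refine ⟨m, Φ, blk, lam, hΦR, (MonoidHom.ker_eq_bot_iff Φ).1 hK, fun x i j h => by rw [hΦ, if_neg h], ?_⟩
  intro z hz i j
  by_cases h : blk i = blk j
  · simp only [hΦ, h, if_true]
    exact hlam z hz i j h
  · simp only [hΦ, h, if_false]
    rw [if_neg (fun hij : i = j => h (congrArg blk hij))]
    exact map_zero _

end LeviRep


lemma apply_eq_zero_of_apply_apply {V : Type*} [AddCommGroup V] [Module ℂ V] (T : V ⊸ V) {v : V}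
    (hv : v ∈ Submodule.span ℂ {w | ∃ μ : ℂ, T w = μ • w}) (h : T (T v) = 0) : T v = 0 := by
  have key : ∃ Q : Polynomial ℂ, Q.coeff 0 ≠ 0 ∧ Polynomial.aeval T Q (T v) = 0 := by
    clear h
    induction hv using Submodule.span_induction with
    | mem w hw =>
      obtain ⟨μ, hμ⟩ := hw
      by_cases h0 : μ = 0
      · exact ⟨1, by simp, by simp [hμ, h0]⟩
      · exact ⟨Polynomial.X - Polynomial.C μ, by simp [h0], by simp [hμ]⟩
    | zero => exact ⟨1, by simp, by simp⟩
    | add x y _ _ hx hy =>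
      obtain ⟨P, hP0, hP⟩ := hx
      obtain ⟨Q, hQ0, hQ⟩ := hy
      refine ⟨P * Q, by simp [Polynomial.mul_coeff_zero, hP0, hQ0], ?_⟩
      rw [map_add, map_add, map_mul, Module.End.mul_apply, Module.End.mul_apply, hQ, map_zero,
        add_zero, ← Module.End.mul_apply, ← map_mul, mul_comm, map_mul, Module.End.mul_apply, hP,
        map_zero]
    | smul a x _ hx =>
      obtain ⟨P, hP0, hP⟩ := hx
      exact ⟨P, hP0, by rw [map_smul, map_smul, hP, smul_zero]⟩
  obtain ⟨Q, hQ0, hQ⟩ := key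
  rw [← Polynomial.divX_mul_X_add Q] at hQ
  simp only [map_add, map_mul, Polynomial.aeval_X, Polynomial.aeval_C, LinearMap.add_apply,
    Module.End.mul_apply, h, map_zero, zero_add, Module.algebraMap_end_apply] at hQ
  exact (smul_eq_zero.1 hQ).resolve_left hQ0

section Mean

variable {Γ : Type} [Group Γ] {R : FnAlg Γ}
variable {𝔩 : Type} [LieRing 𝔩] [LieAlgebra ℂ 𝔩] {der : 𝔩 ⊸ FnDual Γ}

/-- Entries of a matrix representation together with their inversions. -/
def entrySet {m : ℕ} (Φ : Γ →* Matrix (Fin m) (Fin m) ℂ) : Set (Γ → ℂ) :=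
  Set.range (fun p : Fin m × Fin m => fun x => Φ x p.1 p.2) ∪
    Set.range (fun p : Fin m × Fin m => fun x => Φ x⁻¹ p.1 p.2)

lemma adjoin_entrySet [IsDomain R] (hR : IsAlgGrpFn R) {m : ℕ}
    (Φ : Γ →* Matrix (Fin m) (Fin m) ℂ) (hΦ : ∀ i j, (fun x => Φ x i j) ∈ R)
    (hinj : Function.Injective Φ) : Algebra.adjoin ℂ (entrySet Φ) = R := by
  have hle : Algebra.adjoin ℂ (entrySet Φ) ≤ R := Algebra.adjoin_le (by
    rintro _ (⟨p, rfl⟩ | ⟨p, rfl⟩)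
    · exact hΦ _ _
    · exact hR.inv _ (hΦ _ _))
  have h1 : ∀ i j, (fun x => Φ x i j) ∈ Algebra.adjoin ℂ (entrySet Φ) := fun i j =>
    Algebra.subset_adjoin (Or.inl ⟨(i, j), rfl⟩)
  have h2 : ∀ i j, (fun x => Φ x⁻¹ i j) ∈ Algebra.adjoin ℂ (entrySet Φ) := fun i j =>
    Algebra.subset_adjoin (Or.inr ⟨(i, j), rfl⟩)
  have hH : IsHopfFn (Algebra.adjoin ℂ (entrySet Φ)) := by
    refine isHopfFn_of_adjoin ((Set.finite_range _).union (Set.finite_range _)) rfl ?_ ?_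
    · rintro _ (⟨p, rfl⟩ | ⟨p, rfl⟩)
      · have : (fun x y => Φ (x * y) p.1 p.2) = ∑ k, fun x y => Φ x p.1 k * Φ y k p.2 := by
          funext x y
          simp [Matrix.mul_apply]
        simp only [this]
        exact Submodule.sum_mem _ fun k _ => biReg_of_mul (h1 _ _) (h1 _ _)
      · have : (fun x y => Φ (x * y)⁻¹ p.1 p.2) = ∑ k, fun x y => Φ x⁻¹ k p.2 * Φ y⁻¹ p.1 k := by
          funext x y
          simp [Matrix.mul_apply, mul_comm]
        simp only [this]
        exact Submodule.sum_mem _ fun k _ => biReg_of_mul (h2 _ _) (h2 _ _)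
    · rintro _ (⟨p, rfl⟩ | ⟨p, rfl⟩)
      · exact h2 _ _
      · simp only [inv_inv]
        exact h1 _ _
  have := isDomain_of_le hle
  exact IsAlgGrpFn.eq_of_sep hH hle hR fun x y h => hinj (by
    ext i j
    exact h _ (h1 i j))

lemma IsPD.eq_zero_of_adjoin {s : Set (Γ → ℂ)} (hs : Algebra.adjoin ℂ s = R)
    {X : FnDual Γ} (hX : IsPD R X) (h : ∀ f ∈ s, X f = 0) {f : Γ → ℂ} (hf : f ∈ R) :
    X f = 0 := by
  subst hs
  induction hf using Algebra.adjoin_induction with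
  | mem x hx => exact h x hx
  | algebraMap c =>
    have : algebraMap ℂ (Γ → ℂ) c = c • 1 := Algebra.algebraMap_eq_smul_one c
    rw [this, map_smul, hX.map_one, smul_zero]
  | add x y _ _ hx hy => rw [map_add, hx, hy, add_zero]
  | mul x y hx' hy' hx hy => rw [hX x hx' y hy', hx, hy, mul_zero, mul_zero, add_zero]

lemma linv_entry_inv (hR : IsHopfFn R) {m : ℕ} (Φ : Γ →* Matrix (Fin m) (Fin m) ℂ)
    (hΦ : ∀ i j, (fun x => Φ x i j) ∈ R) {X : FnDual Γ} (hX : IsPD R X) (i j : Fin m) :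
    linv X (fun x => Φ x⁻¹ i j) = ∑ k, (-X (fun x => Φ x i k)) • fun x => Φ x⁻¹ k j := by
  funext x
  rw [linv_apply]
  have : (fun y => Φ (x * y)⁻¹ i j) = ∑ k, Φ x⁻¹ k j • fun y => Φ y⁻¹ i k := by
    funext y; simp [Matrix.mul_apply, mul_comm]
  rw [this, map_sum]
  simp only [Finset.sum_apply, map_smul, Pi.smul_apply, smul_eq_mul]
  refine Finset.sum_congr rfl fun k _ => ?_
  rw [hX.map_inv hR (hΦ i k), mul_comm]

lemma radical_data [IsDomain R] (hR : IsAlgGrpFn R) (hL : IsLieFn R 𝔩 der) (hred : IsRedFn R) :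
    (∀ z ∈ LieAlgebra.radical ℂ 𝔩, ∀ x : 𝔩, ⁅x, z⁆ = 0) ∧
    ∀ z ∈ LieAlgebra.radical ℂ 𝔩, ∀ f ∈ R,
      linv (der z) (linv (der z) f) = 0 → linv (der z) f = 0 := by
  obtain ⟨m, Φ, blk, lam, hΦ, hinj, hblk, hlam⟩ := exists_block_rep hR hL hred
  have hgen := adjoin_entrySet hR Φ hΦ hinj
  have hH := hR.toIsHopfFn
  have hlin : ∀ z ∈ LieAlgebra.radical ℂ 𝔩, ∀ i j, linv (der z) (fun x => Φ x i j) =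
      lam z (blk j) • fun x => Φ x i j := by
    intro z hz i j
    rw [linv_entry]
    simp only [hlam z hz, ite_smul, zero_smul]
    rw [Finset.sum_ite_eq' Finset.univ j]
    simp
  constructor
  · intro z hz x
    refine hL.inj _ fun f hf => (hL.pd _).eq_zero_of_adjoin hgen ?_ hf
    have h1 : ∀ i j, der ⁅x, z⁆ (fun y => Φ y i j) = 0 := by
      intro i j
      rw [hL.lie x z _ (hΦ i j), hlin z hz, linv_entry, map_smul, map_sum]
      simp only [map_smul, hlam z hz, smul_eq_mul, mul_ite, mul_zero]
      rw [Finset.sum_ite_eq Finset.univ i]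
      simp only [Finset.mem_univ, if_true]
      by_cases h : blk i = blk j
      · rw [h]; ring
      · have : (fun y => Φ y i j) = 0 := funext fun y => hblk y i j h
        rw [this]; simp
    rintro _ (⟨p, rfl⟩ | ⟨p, rfl⟩)
    · exact h1 _ _
    · rw [(hL.pd _).map_inv hH (hΦ p.1 p.2), h1, neg_zero]
  · intro z hz f hf
    refine apply_eq_zero_of_apply_apply _ ?_
    have hsub : (Submonoid.closure (entrySet Φ) : Set (Γ → ℂ)) ⊆
        {w | ∃ μ : ℂ, linv (der z) w = μ • w} := by
      intro w hw
      suffices w ∈ R ∧ ∃ μ, linv (der z) w = μ • w from this.2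
      induction hw using Submonoid.closure_induction with
      | mem w hw =>
        rcases hw with ⟨p, rfl⟩ | ⟨p, rfl⟩
        · exact ⟨hΦ _ _, _, hlin z hz _ _⟩
        · refine ⟨hH.inv _ (hΦ _ _), -lam z (blk p.1), ?_⟩
          rw [linv_entry_inv hH Φ hΦ (hL.pd z)]
          simp only [hlam z hz, neg_smul, ite_smul, zero_smul, Finset.sum_neg_distrib]
          rw [Finset.sum_ite_eq Finset.univ p.1]
          simp
      | one =>
        refine ⟨R.one_mem, 0, ?_⟩
        rw [zero_smul]
        funext x
        rw [linv_apply]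
        exact (hL.pd z).map_one
      | mul a b _ _ ha hb =>
        obtain ⟨haR, μ, hμ⟩ := ha
        obtain ⟨hbR, ν, hν⟩ := hb
        refine ⟨R.mul_mem haR hbR, μ + ν, ?_⟩
        rw [hH.linv_mul (hL.pd z) haR hbR, hμ, hν, add_smul, mul_smul_comm, mul_smul_comm,
          mul_comm b a, add_comm]
    refine Submodule.span_mono hsub ?_
    rw [← Algebra.adjoin_eq_span, hgen]
    exact hf

lemma exists_mean [IsDomain R] (hR : IsAlgGrpFn R) (hL : IsLieFn R 𝔩 der) (hred : IsRedFn R) :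
    ∃ I : FnDual Γ, I 1 = 1 ∧ (∀ f ∈ R, ∀ y, I (fun x => f (x * y)) = I f) ∧
      (∀ f ∈ R, ∀ y, I (fun x => f (y * x)) = I f) := by
  obtain ⟨hcen, hss⟩ := radical_data hR hL hred
  have hH := hR.toIsHopfFn
  have := hL.finite hH
  let W : Submodule ℂ (Γ → ℂ) := Submodule.span ℂ {g | ∃ u, ∃ f ∈ R, linv (der u) f = g}
  have hW : (1 : Γ → ℂ) ∉ W := by
    intro h1
    obtain ⟨n, c, g, hg⟩ := (Submodule.mem_span_set').1 h1
    choose u f hf huf using fun i => (g i).2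
    obtain ⟨V, hVfin, hsV, hVR, -, hV⟩ := hH.exists_stable (insert 1 (Set.range f))
      ((Set.finite_range f).insert 1) (by
        rintro _ (rfl | ⟨i, rfl⟩)
        · exact R.one_mem
        · exact hf i)
    let _ := hL.lieRingModule hH V hVR hV
    have _ := hL.lieModule hH V hVR hV
    have hfV : ∀ i, f i ∈ V := fun i => hsV (Or.inr ⟨i, rfl⟩)
    have h1V : (1 : Γ → ℂ) ∈ V := hsV (Or.inl rfl)
    have h0 := invariant_eq_zero hcen (Module.finrank ℂ V) V le_rfl
      (fun z hz v hv => Subtype.ext (hss z hz v.1 (hVR _ v.2) (congrArg Subtype.val hv)))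
      ⟨1, h1V⟩ (fun x => Subtype.ext (by
        show linv (der x) 1 = 0
        funext y
        rw [linv_apply]
        exact (hL.pd x).map_one)) (by
        have : (⟨1, h1V⟩ : V) = ∑ i, c i • ⁅u i, (⟨f i, hfV i⟩ : V)⁆ := by
          apply Subtype.ext
          rw [AddSubmonoidClass.coe_finsetSum]
          refine hg.symm.trans ?_
          exact Finset.sum_congr rfl fun i _ => congrArg (c i • ·) (huf i).symm
        rw [this]
        exact Submodule.sum_mem _ fun i _ => Submodule.smul_mem _ _
          (Submodule.subset_span ⟨_, _, rfl⟩))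
    have := congrFun (congrArg Subtype.val h0) 1
    simp at this
  obtain ⟨I₀, hI₀, hker⟩ := Submodule.exists_le_ker_of_notMem hW
  let I : FnDual Γ := (I₀ 1)⁻¹ • I₀
  have hI1 : I 1 = 1 := by simp [I, hI₀]
  have hIW : ∀ u, ∀ f ∈ R, I (linv (der u) f) = 0 := by
    intro u f hf
    have : I₀ (linv (der u) f) = 0 := hker (Submodule.subset_span ⟨u, f, hf, rfl⟩)
    simp [I, this]
  have hright : ∀ f ∈ R, ∀ y, I (fun x => f (x * y)) = I f := by
    let ψ : (Γ → ℂ) → Γ → ℂ := fun f y => I (fun x => f (x * y)) - I f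
    have hconst : ∀ X, IsPD R X → ∀ c, X (fun _ => c) = 0 := by
      intro X hX c
      have : (fun _ : Γ => c) = c • 1 := by funext; simp
      rw [this, map_smul, hX.map_one, smul_zero]
    have key := hH.eq_zero_of_linv_stable {g | ∃ f ∈ R, ψ f = g} ?_ ?_ ?_
    · intro f hf y
      exact sub_eq_zero.1 (congrFun (key _ ⟨f, hf, rfl⟩) y)
    · rintro _ ⟨f, hf, rfl⟩
      exact R.sub_mem (biReg_contract (biReg_swap (hH.comul f hf)) I) (R.algebraMap_mem _)
    · rintro _ ⟨f, hf, rfl⟩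
      simp [ψ]
    · rintro _ ⟨f, hf, rfl⟩ X hX
      refine ⟨linv X f, hH.linv_mem X hf, ?_⟩
      obtain ⟨u, hu⟩ := hL.full X hX
      have hzero : I (linv X f) = 0 := by
        have : linv X f = linv (der u) f := funext fun x => (hu _ (hH.left_translate hf x)).symm
        rw [this]
        exact hIW u f hf
      funext y
      have hb : (fun x z => f (x * (y * z))) ∈ biReg R R :=
        biReg_comp (hH.comul f hf) (fun a ha => ha)
          (fun b hb => hH.left_translate hb y)
      have h1 := biReg_fubini hb I X
      have h2 : (fun z => ψ f (y * z)) =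
          (fun z => I (fun x => f (x * (y * z)))) - fun _ => I f := rfl
      rw [linv_apply, h2, map_sub, hconst X hX, sub_zero, ← h1]
      simp only [ψ, hzero, sub_zero, linv_apply, mul_assoc]
  have hconstI : ∀ c, I (fun _ => c) = c := by
    intro c
    have : (fun _ : Γ => c) = c • 1 := by funext; simp
    rw [this, map_smul, hI1, smul_eq_mul, mul_one]
  have hinv : ∀ f ∈ R, I (fun x => f x⁻¹) = I f := by
    intro f hf
    have hb : (fun x y => f (x * y⁻¹)) ∈ biReg R R :=
      biReg_comp (hH.comul f hf) (fun a ha => ha)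
        (fun b => hH.inv b)
    have h1 := biReg_fubini hb I I
    have h2 : ∀ y, I (fun x => f (x * y⁻¹)) = I f := fun y => hright f hf _
    have h3 : ∀ x, I (fun y => f (x * y⁻¹)) = I (fun x => f x⁻¹) := by
      intro x
      have := hright (fun z => f z⁻¹) (hH.inv f hf) x⁻¹
      simp only [mul_inv_rev, inv_inv] at this
      exact this
    simp only [h2, h3, hconstI] at h1
    exact h1
  refine ⟨I, hI1, hright, fun f hf y => ?_⟩
  rw [← hinv f hf, ← hinv _ (hH.left_translate hf y)]
  have := hright (fun z => f z⁻¹) (hH.inv f hf) y⁻¹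
  simp only [mul_inv_rev, inv_inv] at this
  exact this

end Mean


section Retract

variable {Γ H : Type} [Group Γ] [Group H]

/-- A closed subgroup together with a regular retraction. -/
structure IsRetr (R : FnAlg Γ) (S : FnAlg H) (ι : H →* Γ) (r : Γ → H) :
    Prop where
  left_inv : ∀ h, r (ι h) = h
  res : ∀ f ∈ R, f ∘ ι ∈ S
  ext : ∀ g ∈ S, g ∘ r ∈ R

/-- The functional on functions of a subgroup induced through a retraction. -/
def pushDer (r : Γ → H) : FnDual Γ ⊸ FnDual H where
  toFun X :=
    { toFun := fun g => X (g ∘ r)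
      map_add' := fun g g' => map_add X (g ∘ r) (g' ∘ r)
      map_smul' := fun c g => map_smul X c (g ∘ r) }
  map_add' _ _ := rfl
  map_smul' _ _ := rfl

variable {R : FnAlg Γ} {S : FnAlg H} {ι : H →* Γ} {r : Γ → H}
variable {𝔤 : Type} [LieRing 𝔤] [LieAlgebra ℂ 𝔤] {der : 𝔤 ⊸ FnDual Γ}

/-- `𝔥` consists of the tangent vectors along the image of `ι`. -/
def IsTangentTo (R : FnAlg Γ) (der : 𝔤 ⊸ FnDual Γ) (ι : H →* Γ)
    (𝔥 : LieSubalgebra ℂ 𝔤) : Prop :=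
  ∀ u, u ∈ 𝔥 ↔ ∀ f ∈ R, f ∘ ι = 0 → der u f = 0

lemma exists_isTangentTo (hR : IsHopfFn R) (hL : IsLieFn R 𝔤 der) (ι : H →* Γ) :
    ∃ 𝔥 : LieSubalgebra ℂ 𝔤, IsTangentTo R der ι 𝔥 := by
  have key : ∀ u v, (∀ f ∈ R, f ∘ ι = 0 → der u f = 0) → (∀ f ∈ R, f ∘ ι = 0 → der v f = 0) →
      ∀ f ∈ R, f ∘ ι = 0 → der u (linv (der v) f) = 0 := by
    intro u v hu hv f hf h0
    refine hu _ (hR.linv_mem _ hf) (funext fun x => hv _ (hR.left_translate hf _) ?_)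
    funext y
    have := congrFun h0 (x * y)
    simpa using this
  refine ⟨{ carrier := {u | ∀ f ∈ R, f ∘ ι = 0 → der u f = 0}, add_mem' := ?_, zero_mem' := ?_,
            smul_mem' := ?_, lie_mem' := ?_ }, fun u => Iff.rfl⟩
  · intro u v hu hv f hf h0
    rw [map_add, LinearMap.add_apply, hu f hf h0, hv f hf h0, add_zero]
  · intro f _ _
    rw [map_zero, LinearMap.zero_apply]
  · intro c u hu f hf h0
    rw [map_smul, LinearMap.smul_apply, hu f hf h0, smul_zero]
  · intro u v hu hv f hf h0
    rw [hL.lie u v f hf, key u v hu hv f hf h0, key v u hv hu f hf h0, sub_zero]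

/-- The differentials of a subgroup. -/
def subDer (der : 𝔤 ⊸ FnDual Γ) (r : Γ → H) (𝔥 : LieSubalgebra ℂ 𝔤) :
    𝔥 ⊸ FnDual H :=
  pushDer r ∘ₗ der ∘ₗ 𝔥.toSubmodule.subtype

lemma subDer_apply (𝔥 : LieSubalgebra ℂ 𝔤) (u : 𝔥) (g : H → ℂ) :
    subDer der r 𝔥 u g = der u.1 (g ∘ r) := rfl

section

variable (hr : IsRetr R S ι r) {𝔥 : LieSubalgebra ℂ 𝔤} (h𝔥 : IsTangentTo R der ι 𝔥)
include hr h𝔥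

lemma subDer_res (u : 𝔥) {f : Γ → ℂ} (hf : f ∈ R) : subDer der r 𝔥 u (f ∘ ι) = der u.1 f := by
  rw [subDer_apply, ← sub_eq_zero, ← map_sub]
  refine (h𝔥 u.1).1 u.2 _ (R.sub_mem (hr.ext _ (hr.res _ hf)) hf) ?_
  funext x
  simp [hr.left_inv]

lemma isLieFn_sub (hR : IsHopfFn R) (hL : IsLieFn R 𝔤 der) : IsLieFn S 𝔥 (subDer der r 𝔥) where
  pd u f hf g hg := by
    have h1 : r 1 = 1 := by simpa using hr.left_inv 1
    have := hL.pd u.1 _ (hr.ext f hf) _ (hr.ext g hg)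
    simp only [Function.comp_apply, h1] at this
    exact this
  full X hX := by
    let Y : FnDual Γ := pushDer ι X
    have hY : IsPD R Y := by
      intro f hf g hg
      have := hX _ (hr.res f hf) _ (hr.res g hg)
      simp only [Function.comp_apply, map_one] at this
      exact this
    obtain ⟨u, hu⟩ := hL.full Y hY
    have hu𝔥 := (h𝔥 u).2 fun f hf h0 => by
      rw [hu f hf]
      show X (f ∘ ι) = 0
      rw [h0, map_zero]
    refine ⟨⟨u, hu𝔥⟩, fun g hg => ?_⟩
    rw [subDer_apply, hu _ (hr.ext g hg)]
    show X ((g ∘ r) ∘ ι) = X g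
    congr 1
    funext x
    simp [hr.left_inv]
  inj u hu := by
    refine Subtype.ext (hL.inj u.1 fun f hf => ?_)
    rw [← subDer_res hr h𝔥 u hf]
    exact hu _ (hr.res f hf)
  lie u v g hg := by
    have key : ∀ u v, subDer der r 𝔥 u (linv (subDer der r 𝔥 v) g) =
        der u.1 (linv (der v.1) (g ∘ r)) := by
      intro u v
      rw [← subDer_res hr h𝔥 u (hR.linv_mem _ (hr.ext g hg))]
      congr 1
      funext x
      rw [linv_apply, Function.comp_apply, linv_apply,
        ← subDer_res hr h𝔥 v (hR.left_translate (hr.ext g hg) (ι x))]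
      congr 1
      funext y
      simp only [Function.comp_apply, ← map_mul, hr.left_inv]
    rw [key, key, subDer_apply]
    exact hL.lie u.1 v.1 _ (hr.ext g hg)

lemma vext_subDer {M : Type} [AddCommGroup M] [Module ℂ M] [Module.Finite ℂ M] (u : 𝔥) {F : Γ → M}
    (hF : RegV R F) : vext (subDer der r 𝔥 u) (fun x => F (ι x)) = vext (der u.1) F := by
  refine dual_ext fun ξ => ?_
  rw [dual_vext, dual_vext, ← subDer_res hr h𝔥 u (hF ξ)]
  rfl

end

end Retract

section Adjoint

variable {Γ : Type} [Group Γ] {R : FnAlg Γ}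
variable {𝔤 : Type} [LieRing 𝔤] [LieAlgebra ℂ 𝔤] {der : 𝔤 ⊸ FnDual Γ}

lemma IsHopfFn.conj_mem (hR : IsHopfFn R) (g : Γ) {f : Γ → ℂ} (hf : f ∈ R) :
    (fun y => f (g * y * g⁻¹)) ∈ R :=
  hR.left_translate (hR.right_translate hf g⁻¹) g

lemma IsHopfFn.conj_biReg (hR : IsHopfFn R) {f : Γ → ℂ} (hf : f ∈ R) :
    (fun x y => f (x * y * x⁻¹)) ∈ biReg R R := by
  obtain ⟨n, a, b, ha, hb, hab⟩ := biReg_expand (hR.comul f hf)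
  have : (fun x y => f (x * y * x⁻¹)) = ∑ i, (fun x y => a i (x * y)) * fun x _ => b i x⁻¹ := by
    funext x y
    simp [hab]
  rw [this]
  exact Submodule.sum_mem _ fun i _ =>
    biReg_mul (hR.comul _ (ha i)) (biReg_of_left (hR.inv _ (hb i)))

lemma exists_adjoint (hR : IsHopfFn R) (hL : IsLieFn R 𝔤 der) :
    ∃ Ad : Γ → 𝔤 ⊸ 𝔤,
      (∀ g u, ∀ f ∈ R, der (Ad g u) f = der u (fun y => f (g * y * g⁻¹))) ∧
      (∀ g h u, Ad (g * h) u = Ad g (Ad h u)) ∧ (∀ u, Ad 1 u = u) ∧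
      RegOp R Ad ∧ ∀ [Module.Finite ℂ 𝔤], ∀ z u, vext (der z) (fun x => Ad x u) = ⁅z, u⁆ := by
  have hex : ∀ g u, ∃ w, ∀ f ∈ R, der w f = der u (fun y => f (g * y * g⁻¹)) := by
    intro g u
    let X : FnDual Γ := pushDer (fun y => g * y * g⁻¹) (der u)
    refine hL.full X fun f hf f' hf' => ?_
    have := hL.pd u _ (hR.conj_mem g hf) _ (hR.conj_mem g hf')
    simp only [mul_one, mul_inv_cancel] at this
    exact this
  have huniq : ∀ u v, (∀ f ∈ R, der u f = der v f) → u = v := by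
    intro u v h
    refine sub_eq_zero.1 (hL.inj _ fun f hf => ?_)
    rw [map_sub, LinearMap.sub_apply, h f hf, sub_self]
  choose A hA using hex
  let Ad : Γ → 𝔤 ⊸ 𝔤 := fun g =>
    { toFun := A g
      map_add' := fun u v => huniq _ _ fun f hf => by
        rw [hA g _ f hf, map_add, map_add, LinearMap.add_apply, LinearMap.add_apply, hA g u f hf,
          hA g v f hf]
      map_smul' := fun c u => huniq _ _ fun f hf => by
        rw [hA g _ f hf, map_smul, LinearMap.smul_apply, RingHom.id_apply, map_smul,
          LinearMap.smul_apply, hA g u f hf] }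
  have hAd : ∀ g u, ∀ f ∈ R, der (Ad g u) f = der u (fun y => f (g * y * g⁻¹)) := hA
  have hfin := hL.finite hR
  have hreg : RegOp R Ad := by
    intro u ξ
    obtain ⟨f, hf, hξ⟩ := exists_dual_repr hL.inj ξ
    simp only [hξ, hAd _ _ f hf]
    exact biReg_contract (hR.conj_biReg hf) (der u)
  refine ⟨Ad, hAd, ?_, ?_, hreg, ?_⟩
  · intro g h u
    refine huniq _ _ fun f hf => ?_
    rw [hAd _ _ f hf, hAd _ _ f hf, hAd _ _ _ (hR.conj_mem g hf)]
    simp only [mul_inv_rev, mul_assoc]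
  · intro u
    refine huniq _ _ fun f hf => ?_
    rw [hAd _ _ f hf]
    simp
  · intro _ z u
    refine dual_ext fun ξ => ?_
    obtain ⟨f, hf, hξ⟩ := exists_dual_repr hL.inj ξ
    rw [dual_vext, hξ]
    simp only [hξ, hAd _ _ f hf]
    obtain ⟨n, a, b, ha, hb, hab⟩ := biReg_expand (hR.comul f hf)
    have h1 : (fun x => der u fun y => f (x * y * x⁻¹)) =
        ∑ i, linv (der u) (a i) * fun x => b i x⁻¹ := by
      funext x
      have : (fun y => f (x * y * x⁻¹)) = ∑ i, b i x⁻¹ • fun y => a i (x * y) := by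
        funext y
        simp [hab, mul_comm]
      rw [this, map_sum]
      simp [linv_apply, mul_comm]
    have h2 : ∀ X, linv X f = ∑ i, X (b i) • a i := by
      intro X
      funext x
      rw [linv_apply]
      have : (fun y => f (x * y)) = ∑ i, a i x • b i := by funext y; simp [hab]
      rw [this, map_sum]
      simp [mul_comm]
    have h3 : linv (der u) f = ∑ i, b i 1 • linv (der u) (a i) := by
      have : f = ∑ i, b i 1 • a i := by
        funext x
        have := hab x 1
        rw [mul_one] at this
        simp [this, mul_comm]
      conv_lhs => rw [this, map_sum]
      simp
    rw [h1, map_sum, hL.lie z u f hf, h3, h2, map_sum, map_sum, ← Finset.sum_sub_distrib]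
    refine Finset.sum_congr rfl fun i _ => ?_
    rw [hL.pd z _ (hR.linv_mem _ (ha i)) _ (hR.inv _ (hb i)), (hL.pd z).map_inv hR (hb i)]
    simp only [linv_one, inv_one, map_smul, smul_eq_mul]
    ring

end Adjoint


section Cocycle

variable {Γ : Type} [Group Γ] {R : FnAlg Γ}
variable {𝔤 : Type} [LieRing 𝔤] [LieAlgebra ℂ 𝔤] {der : 𝔤 ⊸ FnDual Γ}
variable {M : Type} [AddCommGroup M] [Module ℂ M]

/-- A group two-cocycle. -/
def IsCoc (π : Γ →* (M ⊸ M)) (f : Γ → Γ → M) : Prop :=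
  ∀ x y z, π x (f y z) - f (x * y) z + f x (y * z) - f x y = 0

/-- The coboundary of a one-cochain. -/
def cobd (π : Γ →* (M ⊸ M)) (b : Γ → M) (x y : Γ) : M := π x (b y) - b (x * y) + b x

lemma isCoc_cobd (π : Γ →* (M ⊸ M)) (b : Γ → M) : IsCoc π (cobd π b) := by
  intro x y z
  simp only [cobd, map_add, map_sub, map_mul, Module.End.mul_apply, mul_assoc]
  abel

lemma IsCoc.sub {π : Γ →* (M ⊸ M)} {f g : Γ → Γ → M} (hf : IsCoc π f) (hg : IsCoc π g) :
    IsCoc π (fun x y => f x y - g x y) := by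
  intro x y z
  have := congrArg₂ (· - ·) (hf x y z) (hg x y z)
  simp only [sub_zero] at this
  simp only [map_sub]
  rw [← this]
  abel

lemma IsCoc.add {π : Γ →* (M ⊸ M)} {f g : Γ → Γ → M} (hf : IsCoc π f) (hg : IsCoc π g) :
    IsCoc π (fun x y => f x y + g x y) := by
  intro x y z
  have := congrArg₂ (· + ·) (hf x y z) (hg x y z)
  simp only [add_zero] at this
  simp only [map_add]
  rw [← this]
  abel

lemma BiRegV.cobd (hR : IsHopfFn R) [Module.Finite ℂ M] {π : Γ →* (M ⊸ M)} (hπ : RegOp R π)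
    {b : Γ → M} (hb : RegV R b) : BiRegV R R (cobd π b) :=
  ((hπ.biApply hb.right).sub (fun ξ => hR.comul _ (hb ξ))).add hb.left

variable [Module.Finite ℂ M]

/-- Applying a pair of functionals to a function of two variables. -/
def tens (X Y : FnDual Γ) (f : Γ → Γ → M) : M := vext X (fun x => vext Y (f x))

/-- The antisymmetrised second-order term of a two-cochain. -/
def curv (der : 𝔤 ⊸ FnDual Γ) (f : Γ → Γ → M) (u v : 𝔤) : M :=
  tens (der u) (der v) f - tens (der v) (der u) f

lemma tens_sub (X Y : FnDual Γ) (f g : Γ → Γ → M) :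
    tens X Y (fun x y => f x y - g x y) = tens X Y f - tens X Y g := by simp only [tens, vext_sub]

lemma tens_add (X Y : FnDual Γ) (f g : Γ → Γ → M) :
    tens X Y (fun x y => f x y + g x y) = tens X Y f + tens X Y g := by simp only [tens, vext_add]

lemma curv_sub (f g : Γ → Γ → M) (u v : 𝔤) :
    curv der (fun x y => f x y - g x y) u v = curv der f u v - curv der g u v := by
  simp only [curv, tens_sub]
  abel

lemma curv_add (f g : Γ → Γ → M) (u v : 𝔤) :
    curv der (fun x y => f x y + g x y) u v = curv der f u v + curv der g u v := by
  simp only [curv, tens_add]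
  abel

lemma tens_swap {f : Γ → Γ → M} (hf : BiRegV R R f) (X Y : FnDual Γ) :
    tens X Y f = vext Y (fun y => vext X (fun x => f x y)) := hf.fubini X Y

/-- The curvature as a bilinear map. -/
def curvL (der : 𝔤 ⊸ FnDual Γ) (f : Γ → Γ → M) : 𝔤 ⊸ 𝔤 ⊸ M :=
  LinearMap.mk₂ ℂ (curv der f)
    (fun u u' v => by
      simp only [curv, tens, map_add, vext_add_left, vext_add]; abel)
    (fun c u v => by
      simp only [curv, tens, map_smul, vext_smul_functional, smul_sub]
      congr 1
      exact map_smul (vext (der v)) c _)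
    (fun u v v' => by
      simp only [curv, tens, map_add, vext_add_left, vext_add]; abel)
    (fun c u v => by
      simp only [curv, tens, map_smul, vext_smul_functional, smul_sub]
      congr 1
      exact map_smul (vext (der u)) c _)

lemma curvL_apply (f : Γ → Γ → M) (u v : 𝔤) : curvL der f u v = curv der f u v := rfl

lemma curv_self (f : Γ → Γ → M) (u : 𝔤) : curv der f u u = 0 := sub_self _

lemma IsPD.vext_const {X : FnDual Γ} (hX : IsPD R X) (w : M) :
    vext X (fun _ : Γ => w) = 0 := by rw [_root_.vext_const, hX.map_one, zero_smul]

lemma IsLieFn.vext_lie (hL : IsLieFn R 𝔤 der) {b : Γ → M} (hb : RegV R b) (u v : 𝔤) :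
    vext (der ⁅u, v⁆) b = vext (der u) (fun x => vext (der v) fun y => b (x * y)) -
      vext (der v) (fun x => vext (der u) fun y => b (x * y)) := by
  refine dual_ext fun ξ => ?_
  simp only [map_sub, dual_vext]
  exact hL.lie u v _ (hb ξ)

/-- The derived action. -/
structure IsMod [LieRingModule 𝔤 M] (R : FnAlg Γ) (der : 𝔤 ⊸ FnDual Γ)
    (π : Γ →* (M ⊸ M)) : Prop where
  reg : RegOp R π
  act : ∀ (u : 𝔤) (w : M), ⁅u, w⁆ = vext (der u) (fun x => π x w)

variable [LieRingModule 𝔤 M] {π : Γ →* (M ⊸ M)}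

lemma IsMod.act_mul (hM : IsMod R der π) (u : 𝔤) (w : M) (x : Γ) :
    vext (der u) (fun y => π (x * y) w) = π x ⁅u, w⁆ := by
  rw [hM.act, map_vext]
  simp only [map_mul, Module.End.mul_apply]

lemma curv_cobd (hL : IsLieFn R 𝔤 der) (hM : IsMod R der π) {b : Γ → M}
    (hb : RegV R b) (u v : 𝔤) : curv der (cobd π b) u v =
      ⁅u, vext (der v) b⁆ - ⁅v, vext (der u) b⁆ - vext (der ⁅u, v⁆) b := by
  have key : ∀ u v, tens (der u) (der v) (cobd π b) = ⁅u, vext (der v) b⁆ -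
      vext (der u) (fun x => vext (der v) fun y => b (x * y)) := by
    intro u v
    have : ∀ x, vext (der v) (cobd π b x) =
        π x (vext (der v) b) - vext (der v) fun y => b (x * y) := by
      intro x
      have : cobd π b x = fun y => (π x (b y) - b (x * y)) + b x := rfl
      rw [this, vext_add, vext_sub, (hL.pd v).vext_const, add_zero, map_vext]
    simp only [tens, this, vext_sub, hM.act]
  rw [curv, key, key, hL.vext_lie hb]
  abel

lemma curv_closed (hR : IsHopfFn R) (hL : IsLieFn R 𝔤 der) (hM : IsMod R der π) {f : Γ → Γ → M}
    (hf : BiRegV R R f) (hc : IsCoc π f) (u v w : 𝔤) :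
    ⁅u, curv der f v w⁆ - ⁅v, curv der f u w⁆ + ⁅w, curv der f u v⁆ - curv der f ⁅u, v⁆ w
      + curv der f ⁅u, w⁆ v - curv der f ⁅v, w⁆ u = 0 := by
  let A : 𝔤 → 𝔤 → 𝔤 → M := fun u v w =>
    vext (der u) fun x => vext (der v) fun y => vext (der w) fun z => f (x * y) z
  let B : 𝔤 → 𝔤 → 𝔤 → M := fun u v w =>
    vext (der u) fun x => vext (der v) fun y => vext (der w) fun z => f x (y * z)
  have h1 : ∀ u v w, ⁅u, tens (der v) (der w) f⁆ - A u v w + B u v w = 0 := by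
    intro u v w
    have h : ∀ x y, (vext (der w) fun z => f x (y * z)) =
        (vext (der w) fun z => f (x * y) z) - π x (vext (der w) (f y)) := by
      intro x y
      have h0 : (fun z => f x (y * z)) = fun z => (f (x * y) z - π x (f y z)) + f x y := by
        funext z
        rw [← sub_eq_zero, ← hc x y z]
        abel
      rw [h0, vext_add, vext_sub, (hL.pd w).vext_const, add_zero, map_vext]
    simp only [A, B, tens, h, vext_sub, hM.act, map_vext]
    abel
  have hA : ∀ u v w, A u v w - A v u w = tens (der ⁅u, v⁆) (der w) f := fun u v w =>
    (hL.vext_lie (hf.contract (der w)) u v).symm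
  have hB : ∀ u v w, B u v w - B u w v = tens (der u) (der ⁅v, w⁆) f := by
    intro u v w
    simp only [B, tens, ← vext_sub]
    congr 1
    funext x
    exact (hL.vext_lie (hf.eval_left x) v w).symm
  simp only [curv, lie_sub, ← hA, ← hB]
  have e := congrArg₂ (· + ·) (congrArg₂ (· - ·) (congrArg₂ (· - ·) (h1 u v w) (h1 u w v))
    (congrArg₂ (· - ·) (h1 v u w) (h1 v w u))) (congrArg₂ (· - ·) (h1 w u v) (h1 w v u))
  simp only [sub_zero, add_zero] at e
  rw [← e]
  abel

omit [LieRingModule 𝔤 M] in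
lemma eq_zero_of_vext [IsDomain R] (hR : IsHopfFn R) (hL : IsLieFn R 𝔤 der) {F : Γ → M}
    (hF : RegV R F) (h1 : F 1 = 0) (h : ∀ u x, vext (der u) (fun y => F (x * y)) = 0) (x : Γ) :
    F x = 0 := by
  refine dual_ext fun ξ => ?_
  rw [map_zero]
  refine congrFun (hR.eq_zero_of_linv_eq_zero (hF ξ) (by simp [h1]) fun X hX => ?_) x
  obtain ⟨u, hu⟩ := hL.full X hX
  funext z
  rw [linv_apply, ← hu _ (hR.left_translate (hF ξ) z)]
  show (der u) (fun y => ξ (F (z * y))) = 0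
  rw [← dual_vext, h, map_zero]

end Cocycle


section VectorPoincare

variable {Γ : Type} [Group Γ] {R : FnAlg Γ}
variable {𝔤 : Type} [LieRing 𝔤] [LieAlgebra ℂ 𝔤] {der : 𝔤 ⊸ FnDual Γ}
variable {M : Type} [AddCommGroup M] [Module ℂ M] [Module.Finite ℂ M]

lemma RegV.of_coord {F : Γ → M} (h : ∀ i, (fun x => (Module.finBasis ℂ M).coord i (F x)) ∈ R) :
    RegV R F := by
  intro ξ
  have : (fun x => ξ (F x)) = fun x => ∑ i, ((Module.finBasis ℂ M).coord i (F x)) *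
      ξ (Module.finBasis ℂ M i) := by
    funext x
    conv_lhs => rw [RegV.eq_sum (F := F) x, map_sum]
    exact Finset.sum_congr rfl fun i _ => by rw [map_smul, smul_eq_mul]
  rw [this]
  have h2 := R.sum_mem (t := Finset.univ)
    (f := fun i => (fun x => (Module.finBasis ℂ M).coord i (F x)) *
      algebraMap ℂ (Γ → ℂ) (ξ (Module.finBasis ℂ M i)))
    (fun i _ => R.mul_mem (h i) (R.algebraMap_mem _))
  convert h2 using 1
  funext x
  simp

lemma RegV.vext_mul (hR : IsHopfFn R) {F : Γ → M} (hF : RegV R F) (X : FnDual Γ) :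
    RegV R (fun x => vext X (fun y => F (x * y))) :=
  BiRegV.contract (S := R) (F := fun x y => F (x * y)) (fun ξ => hR.comul _ (hF ξ)) X

lemma RegV.mul (hR : IsHopfFn R) {F : Γ → M} (hF : RegV R F) :
    BiRegV R R (fun x y => F (x * y)) := fun ξ => hR.comul _ (hF ξ)

lemma RegV.left_translate (hR : IsHopfFn R) {F : Γ → M} (hF : RegV R F) (x : Γ) :
    RegV R (fun y => F (x * y)) := (hF.mul hR).eval_left x

/-- Reading off a coordinate of a vector-valued function as an element of the function algebra. -/
def coordFn (F : Γ → M) (hF : RegV R F) (i : Fin (Module.finrank ℂ M)) : R :=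
  ⟨fun x => (Module.finBasis ℂ M).coord i (F x), hF _⟩

/-- The vector-valued function with prescribed coordinates. -/
def ofCoords (b : Fin (Module.finrank ℂ M) → R) (x : Γ) : M := ∑ i, (b i).1 x • Module.finBasis ℂ M i

lemma coord_ofCoords (b : Fin (Module.finrank ℂ M) → R) (x : Γ) (i) :
    (Module.finBasis ℂ M).coord i (ofCoords b x) = (b i).1 x := by
  simp [ofCoords, map_sum, Finsupp.single_apply]

lemma regV_ofCoords (b : Fin (Module.finrank ℂ M) → R) : RegV R (ofCoords (M := M) b) := by
  refine RegV.of_coord fun i => ?_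
  simp only [coord_ofCoords]
  exact (b i).2

lemma coord_ext {v w : M}
    (h : ∀ i, (Module.finBasis ℂ M).coord i v = (Module.finBasis ℂ M).coord i w) : v = w :=
  (Module.finBasis ℂ M).ext_elem fun i => by simpa using h i

lemma vector_poincare_one [IsDomain R] (hR : IsHopfFn R) (hP : IsPowPoly R)
    (hL : IsLieFn R 𝔤 der) (θ : 𝔤 ⊸ Γ → M) (hθ : ∀ u, RegV R (θ u))
    (hc : ∀ u v x, vext (der u) (fun y => θ v (x * y)) - vext (der v) (fun y => θ u (x * y))
      = θ ⁅u, v⁆ x) :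
    ∃ b : Γ → M, RegV R b ∧ b 1 = 0 ∧ ∀ u x, vext (der u) (fun y => b (x * y)) = θ u x := by
  obtain ⟨n, e, p, hE⟩ := hP.exists_eulerData hR hL
  have := hR.isNoetherianRing
  have key : ∀ i, ∃ b, b ∈ augIdeal R ∧
      ∀ u, hL.D hR u b = coordFn (θ u) (hθ u) i := by
    intro i
    let θi : 𝔤 ⊸ R :=
      { toFun := fun u => coordFn (θ u) (hθ u) i
        map_add' := fun u v => Subtype.ext (by funext x; simp [coordFn])
        map_smul' := fun c u => Subtype.ext (by funext x; simp [coordFn]) }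
    refine hE.poincare_one θi fun u v => Subtype.ext ?_
    funext x
    have h := congrArg ((Module.finBasis ℂ M).coord i) (hc u v x)
    rw [map_sub, dual_vext, dual_vext] at h
    have e1 := congrFun (hL.D_apply hR u (θi v)) x
    have e2 := congrFun (hL.D_apply hR v (θi u)) x
    change (hL.D hR u (θi v)).1 x - (hL.D hR v (θi u)).1 x = _
    rw [e1, e2]
    exact h
  choose b hb hD using key
  refine ⟨ofCoords b, regV_ofCoords b, ?_, fun u x => coord_ext fun i => ?_⟩
  · refine coord_ext fun i => ?_
    rw [coord_ofCoords, map_zero]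
    exact hb i
  · rw [dual_vext]
    simp only [coord_ofCoords]
    have e1 := congrFun (hL.D_apply hR u (b i)) x
    rw [hD] at e1
    exact e1.symm

lemma vector_poincare_two [IsDomain R] (hR : IsHopfFn R) (hP : IsPowPoly R)
    (hL : IsLieFn R 𝔤 der) (Ω : 𝔤 ⊸ 𝔤 ⊸ Γ → M) (hΩ : ∀ u v, RegV R (Ω u v))
    (halt : ∀ u, Ω u u = 0)
    (hc : ∀ u v w x, vext (der u) (fun y => Ω v w (x * y)) - vext (der v) (fun y => Ω u w (x * y))
      + vext (der w) (fun y => Ω u v (x * y)) - Ω ⁅u, v⁆ w x + Ω ⁅u, w⁆ v x - Ω ⁅v, w⁆ u x = 0) :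
    ∃ η : 𝔤 ⊸ Γ → M, (∀ u, RegV R (η u)) ∧
      ∀ u v x, vext (der u) (fun y => η v (x * y)) - vext (der v) (fun y => η u (x * y))
        - η ⁅u, v⁆ x = Ω u v x := by
  obtain ⟨n, e, p, hE⟩ := hP.exists_eulerData hR hL
  have := hR.isNoetherianRing
  have key : ∀ i, ∃ η : 𝔤 ⊸ R, ∀ u v,
      hL.D hR u (η v) - hL.D hR v (η u) - η ⁅u, v⁆ = coordFn (Ω u v) (hΩ u v) i := by
    intro i
    let Ωi : 𝔤 ⊸ 𝔤 ⊸ R := LinearMap.mk₂ ℂ (fun u v => coordFn (Ω u v) (hΩ u v) i)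
      (fun u u' v => Subtype.ext (by funext x; simp [coordFn]))
      (fun c u v => Subtype.ext (by funext x; simp [coordFn]))
      (fun u v v' => Subtype.ext (by funext x; simp [coordFn]))
      (fun c u v => Subtype.ext (by funext x; simp [coordFn]))
    refine hE.poincare_two Ωi (fun u => Subtype.ext ?_) fun u v w => Subtype.ext ?_
    · funext x
      change (Module.finBasis ℂ M).coord i (Ω u u x) = 0
      rw [halt]; simp
    funext x
    have h := congrArg ((Module.finBasis ℂ M).coord i) (hc u v w x)
    simp only [map_sub, map_add, dual_vext, map_zero] at h
    have e1 := congrFun (hL.D_apply hR u (Ωi v w)) x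
    have e2 := congrFun (hL.D_apply hR v (Ωi u w)) x
    have e3 := congrFun (hL.D_apply hR w (Ωi u v)) x
    change (hL.D hR u (Ωi v w)).1 x - (hL.D hR v (Ωi u w)).1 x + (hL.D hR w (Ωi u v)).1 x
      - (Ωi ⁅u, v⁆ w).1 x + (Ωi ⁅u, w⁆ v).1 x - (Ωi ⁅v, w⁆ u).1 x = 0
    rw [e1, e2, e3]
    exact h
  choose η hη using key
  let η' : 𝔤 ⊸ Γ → M :=
    { toFun := fun u => ofCoords fun i => η i u
      map_add' := fun u v => by
        funext x; exact coord_ext fun i => by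
          rw [Pi.add_apply, map_add]; simp only [coord_ofCoords, map_add]; rfl
      map_smul' := fun c u => by
        funext x; exact coord_ext fun i => by
          rw [Pi.smul_apply, map_smul]; simp only [coord_ofCoords, map_smul]; rfl }
  have hη' : ∀ u x i, (Module.finBasis ℂ M).coord i (η' u x) = (η i u).1 x :=
    fun u x i => coord_ofCoords _ x i
  refine ⟨η', fun u => regV_ofCoords _, fun u v x => coord_ext fun i => ?_⟩
  simp only [map_sub, dual_vext, hη']
  have e1 := congrFun (hL.D_apply hR u (η i v)) x
  have e2 := congrFun (hL.D_apply hR v (η i u)) x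
  have h := congrFun (congrArg Subtype.val (hη i u v)) x
  change (hL.D hR u (η i v)).1 x - (hL.D hR v (η i u)).1 x - (η i ⁅u, v⁆).1 x = _ at h
  rw [e1, e2] at h
  exact h

/-- Regular functions vanishing at the identity. -/
def regVAug (R : FnAlg Γ) (M : Type) [AddCommGroup M] [Module ℂ M] :
    Submodule ℂ (Γ → M) where
  carrier := {b | RegV R b ∧ b 1 = 0}
  zero_mem' := ⟨RegV.const 0, rfl⟩
  add_mem' := fun ha hb => ⟨ha.1.add hb.1, by simp [ha.2, hb.2]⟩
  smul_mem' := fun c b hb => ⟨RegV.smul (R.algebraMap_mem c) hb.1, by simp [hb.2]⟩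

lemma parametric_poincare_one [IsDomain R] (hR : IsHopfFn R) (hP : IsPowPoly R)
    (hL : IsLieFn R 𝔤 der) {Δ : Type} {S : FnAlg Δ} (θ : 𝔤 ⊸ Δ → Γ → M)
    (hθ : ∀ u, BiRegV S R (θ u))
    (hc : ∀ p u v x, vext (der u) (fun y => θ v p (x * y)) - vext (der v) (fun y => θ u p (x * y))
      = θ ⁅u, v⁆ p x) :
    ∃ b : Δ → Γ → M, BiRegV S R b ∧ (∀ p, b p 1 = 0) ∧
      ∀ p u x, vext (der u) (fun y => b p (x * y)) = θ u p x := by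
  have := hL.finite hR
  let T : regVAug R M ⊸ 𝔤 ⊸ Γ → M :=
    LinearMap.mk₂ ℂ (fun b u x => vext (der u) (fun y => b.1 (x * y)))
      (fun b b' u => by funext x; exact vext_add _ _ _)
      (fun c b u => by funext x; exact map_smul (vext (der u)) c _)
      (fun b u u' => by funext x; simp only [map_add, vext_add_left]; rfl)
      (fun c b u => by funext x; simp only [map_smul, vext_smul_functional]; rfl)
  have hT : Function.Injective T := by
    rw [← LinearMap.ker_eq_bot, LinearMap.ker_eq_bot']
    rintro ⟨b, hb, hb1⟩ h
    refine Subtype.ext (funext fun x => eq_zero_of_vext hR hL hb hb1 (fun u x => ?_) x)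
    exact congrFun (LinearMap.congr_fun h u) x
  obtain ⟨g, hg⟩ := LinearMap.exists_leftInverse_of_injective T (LinearMap.ker_eq_bot.2 hT)
  let θp : Δ → 𝔤 ⊸ Γ → M := fun p => (LinearMap.proj p).comp θ
  have hsol : ∀ p, T (g (θp p)) = θp p := by
    intro p
    obtain ⟨b, hb, hb1, h⟩ := vector_poincare_one hR hP hL (θp p) (fun u => (hθ u).eval_left p)
      (fun u v x => hc p u v x)
    have hb' : T ⟨b, hb, hb1⟩ = θp p := by ext u x; exact h u x
    rw [← hb']
    exact congrArg T (LinearMap.congr_fun hg _)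
  refine ⟨fun p => (g (θp p)).1, ?_, fun p => (g (θp p)).2.2, fun p u x =>
    congrFun (LinearMap.congr_fun (hsol p) u) x⟩
  let e := Module.finBasis ℂ 𝔤
  choose n a G ha hG hexp using fun k => (hθ (e k)).expand
  have hdec : ∀ p, θp p = ∑ k, ∑ i, a k i p • (e.coord k).smulRight (G k i) := by
    intro p
    refine e.ext fun j => ?_
    funext x
    simp only [LinearMap.sum_apply, LinearMap.smul_apply, LinearMap.smulRight_apply,
      Module.Basis.coord_apply, Module.Basis.repr_self, Finsupp.single_apply, ite_smul, one_smul,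
      zero_smul, smul_ite, smul_zero, Finset.sum_apply]
    rw [Finset.sum_eq_single j (fun k _ hk => by simp [Ne.symm hk]) (by simp)]
    simp only [if_true, Pi.smul_apply]
    exact hexp j p x
  have hfin : (fun p => (g (θp p)).1) = fun p y => ∑ k, ∑ i, a k i p •
      (g ((e.coord k).smulRight (G k i))).1 y := by
    funext p y
    rw [hdec]
    simp only [map_sum, map_smul, Submodule.coe_sum, Submodule.coe_smul, Finset.sum_apply,
      Pi.smul_apply]
  rw [hfin]
  refine BiRegV.sum _ fun k _ => BiRegV.sum _ fun i _ => BiRegV.smul ?_ ?_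
  · exact biReg_of_left (ha k i)
  · exact RegV.right (g ((e.coord k).smulRight (G k i))).2.1

end VectorPoincare


section UnipotentCohomology

variable {Γ : Type} [Group Γ] {R : FnAlg Γ}
variable {𝔤 : Type} [LieRing 𝔤] [LieAlgebra ℂ 𝔤] {der : 𝔤 ⊸ FnDual Γ}
variable {M : Type} [AddCommGroup M] [Module ℂ M] [Module.Finite ℂ M]
variable [LieRingModule 𝔤 M] {π : Γ →* (M ⊸ M)}

omit [LieRingModule 𝔤 M] [Module.Finite ℂ M] in
lemma IsCoc.right_one {f : Γ → Γ → M} (hc : IsCoc π f) (h1 : f 1 1 = 0) (x : Γ) : f x 1 = 0 := by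
  have := hc x 1 1
  grind

omit [LieRingModule 𝔤 M] [Module.Finite ℂ M] in
lemma IsCoc.left_one {f : Γ → Γ → M} (hc : IsCoc π f) (h1 : f 1 1 = 0) (x : Γ) : f 1 x = 0 := by
  have := hc 1 1 x
  simp_all

omit [LieRingModule 𝔤 M] in
lemma IsCoc.vext_vext (hL : IsLieFn R 𝔤 der) {f : Γ → Γ → M} (hc : IsCoc π f)
    (u v : 𝔤) (x : Γ) :
    vext (der u) (fun z => vext (der v) (f (x * z))) = π x (tens (der u) (der v) f) +
      vext (der u) (fun z => vext (der v) fun y => f x (z * y)) := by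
  have h : ∀ z y, f (x * z) y = π x (f z y) + f x (z * y) - f x z := fun z y => by
    have := hc x z y
    grind
  have h2 : ∀ z, vext (der v) (f (x * z)) =
      π x (vext (der v) (f z)) + vext (der v) (fun y => f x (z * y)) := fun z => by
    have := funext (h z)
    rw [this, vext_sub, vext_add, (hL.pd v).vext_const, ← map_vext, sub_zero]
  simp only [h2]
  rw [vext_add, tens, ← map_vext]

lemma exists_cobd_of_curv [IsDomain R] (hR : IsHopfFn R) (hP : IsPowPoly R) (hL : IsLieFn R 𝔤 der)
    (hM : IsMod R der π) {f : Γ → Γ → M} (hf : BiRegV R R f) (hc : IsCoc π f) (h1 : f 1 1 = 0)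
    (c : 𝔤 ⊸ M) (hcurv : ∀ u v, curv der f u v = ⁅u, c v⁆ - ⁅v, c u⁆ - c ⁅u, v⁆) :
    ∃ b : Γ → M, RegV R b ∧ b 1 = 0 ∧ ∀ x y, f x y = cobd π b x y := by
  let θ : 𝔤 ⊸ Γ → M :=
    { toFun := fun u x => π x (c u) - vext (der u) (f x)
      map_add' := fun u v => by
        funext x; simp only [map_add, vext_add_left, Pi.add_apply]; abel
      map_smul' := fun a u => by
        funext x
        simp only [map_smul, vext_smul_functional, Pi.smul_apply, RingHom.id_apply, smul_sub] }
  have hθ : ∀ u x, θ u x = π x (c u) - vext (der u) (f x) := fun _ _ => rfl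
  obtain ⟨b, hb, hb1, hD⟩ := vector_poincare_one hR hP hL θ
    (fun u => (hM.reg (c u)).sub (hf.contract (der u))) (fun u v x => by
      simp only [hθ]
      rw [vext_sub, vext_sub, hM.act_mul, hM.act_mul, hc.vext_vext hL, hc.vext_vext hL,
        hL.vext_lie (hf.eval_left x)]
      have := congrArg (π x) (hcurv u v)
      rw [curv] at this
      grind)
  refine ⟨b, hb, hb1, ?_⟩
  have hbu : ∀ u, vext (der u) b = c u := fun u => by
    have := hD u 1
    simp only [hθ, one_mul, map_one, Module.End.one_apply] at this
    rw [this]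
    have h0 := funext fun y => hc.left_one h1 y
    rw [h0, (hL.pd u).vext_const, sub_zero]
  let g : Γ → Γ → M := fun x y => f x y - cobd π b x y
  have hg := hc.sub (isCoc_cobd π b)
  have hgr := hf.sub (BiRegV.cobd hR hM.reg hb)
  have hg1 := hg.right_one (by simp [g, cobd, h1, hb1])
  have hgd : ∀ u x, vext (der u) (g x) = 0 := fun u x => by
    simp only [g, cobd]
    rw [vext_sub, vext_add, vext_sub, (hL.pd u).vext_const, ← map_vext, hbu, hD, hθ]
    abel
  intro x y
  rw [← sub_eq_zero]
  refine eq_zero_of_vext hR hL (hgr.eval_left x) (hg1 x) (fun u z => ?_) y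
  have h : (fun y => g x (z * y)) = fun y => g (x * z) y - π x (g z y) + g x z := by
    funext y
    have := hg x z y
    grind
  rw [h, vext_add, vext_sub, (hL.pd u).vext_const, ← map_vext, hgd, hgd]
  simp

omit [LieRingModule 𝔤 M] in
lemma exists_regV_vext (hR : IsHopfFn R) (hL : IsLieFn R 𝔤 der) (c : 𝔤 ⊸ M) :
    ∃ b : Γ → M, RegV R b ∧ ∀ u, vext (der u) b = c u := by
  have := hL.finite hR
  let e := Module.finBasis ℂ 𝔤
  choose t ht hte using fun k => exists_dual_repr hL.inj (e.coord k)
  refine ⟨fun x => ∑ k, t k x • c (e k),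
    RegV.sum _ fun k _ => RegV.smul (ht k) (RegV.const _), fun u => ?_⟩
  rw [vext_sum]
  simp only [vext_smul_left, ← hte]
  conv_rhs => rw [← e.sum_repr u, map_sum]
  simp

lemma exists_coc_of_closed [IsDomain R] (hR : IsHopfFn R) (hP : IsPowPoly R)
    (hL : IsLieFn R 𝔤 der) (hM : IsMod R der π) (ω : 𝔤 ⊸ 𝔤 ⊸ M) (halt : ∀ u, ω u u = 0)
    (hω : ∀ u v w, ⁅u, ω v w⁆ - ⁅v, ω u w⁆ + ⁅w, ω u v⁆ - ω ⁅u, v⁆ w + ω ⁅u, w⁆ v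
      - ω ⁅v, w⁆ u = 0) :
    ∃ f : Γ → Γ → M, BiRegV R R f ∧ IsCoc π f ∧ (∀ x, f x 1 = 0) ∧ (∀ x, f 1 x = 0) ∧
      ∀ u v, curv der f u v = ω u v := by
  let Ω : 𝔤 ⊸ 𝔤 ⊸ Γ → M := LinearMap.mk₂ ℂ (fun u v x => π x (ω u v))
    (fun u u' v => by funext x; simp) (fun a u v => by funext x; simp)
    (fun u v v' => by funext x; simp) (fun a u v => by funext x; simp)
  have hΩ : ∀ u v x, Ω u v x = π x (ω u v) := fun _ _ _ => rfl
  obtain ⟨η₀, hη₀r, hη₀⟩ := vector_poincare_two hR hP hL Ω (fun u v => hM.reg (ω u v))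
    (fun u => by funext x; simp_all) (fun u v w x => by
      simp only [hΩ]
      rw [hM.act_mul, hM.act_mul, hM.act_mul]
      have := congrArg (π x) (hω u v w)
      grind)
  simp only [hΩ] at hη₀
  obtain ⟨β, hβ, hβu⟩ := exists_regV_vext hR hL ((LinearMap.proj (1 : Γ)).comp η₀)
  let η : 𝔤 ⊸ Γ → M :=
    { toFun := fun u x => η₀ u x - vext (der u) (fun y => β (x * y))
      map_add' := fun u v => by funext x; simp only [map_add, vext_add_left, Pi.add_apply]; abel
      map_smul' := fun a u => by
        funext x
        simp only [map_smul, vext_smul_functional, Pi.smul_apply, RingHom.id_apply, smul_sub] }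
  have hηd : ∀ u x, η u x = η₀ u x - vext (der u) (fun y => β (x * y)) := fun _ _ => rfl
  have hη1 : ∀ u, η u 1 = 0 := fun u => by simp_all
  have hηr : ∀ u, RegV R (η u) := fun u => (hη₀r u).sub (hβ.vext_mul hR (der u))
  have hη : ∀ u v x, vext (der u) (fun y => η v (x * y)) - vext (der v) (fun y => η u (x * y))
        - η ⁅u, v⁆ x = π x (ω u v) := fun u v x => by
    simp only [hηd]
    have h := hL.vext_lie (hβ.left_translate hR x) u v
    simp only [← mul_assoc] at h
    rw [vext_sub, vext_sub, ← hη₀, h]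
    abel
  let θ : 𝔤 ⊸ Γ → Γ → M :=
    { toFun := fun u x y => η u (x * y) - π x (η u y)
      map_add' := fun u v => by funext x y; simp only [map_add, Pi.add_apply]; abel
      map_smul' := fun a u => by
        funext x y
        simp only [map_smul, Pi.smul_apply, RingHom.id_apply, smul_sub] }
  have hθ : ∀ u x y, θ u x y = η u (x * y) - π x (η u y) := fun _ _ _ => rfl
  obtain ⟨f, hf, hf1, hD⟩ := parametric_poincare_one hR hP hL θ
    (fun u => ((hηr u).mul hR).sub (RegOp.biApply hM.reg (hηr u).right)) (fun x u v y => by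
      simp only [hθ]
      simp only [← mul_assoc]
      rw [vext_sub, vext_sub, ← map_vext, ← map_vext]
      have e1 := hη u v (x * y)
      have e2 := congrArg (π x) (hη u v y)
      rw [map_mul, Module.End.mul_apply, ← e2, ← sub_eq_zero] at e1
      grind)
  simp only [hθ] at hD
  have hcoc : IsCoc π f := by
    intro x y z
    have hreg : RegV R (fun z => π x (f y z) - f (x * y) z + f x (y * z) - f x y) :=
      ((((hf.eval_left y).map (π x)).sub (hf.eval_left (x * y))).add
        ((hf.eval_left x).left_translate hR y)).sub (RegV.const _)
    refine eq_zero_of_vext hR hL hreg (by simp [hf1]) (fun u z => ?_) z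
    rw [vext_sub, vext_add, vext_sub, (hL.pd u).vext_const, ← map_vext, hD, hD]
    simp only [← mul_assoc y z]
    rw [hD]
    simp only [map_sub, map_mul, Module.End.mul_apply, mul_assoc]
    abel
  refine ⟨f, hf, hcoc, hf1, hcoc.left_one (hf1 1), fun u v => ?_⟩
  have hd : ∀ v x, vext (der v) (f x) = η v x := fun v x => by
    have := hD x v 1
    simp_all
  have := hη u v 1
  simp only [one_mul, hη1, sub_zero, map_one, Module.End.one_apply] at this
  simp only [curv, tens, hd]
  exact this

end UnipotentCohomology


section Mean

variable {Γ L : Type} [Group Γ] [Group L] {R : FnAlg Γ} {RL : FnAlg L}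
variable {M : Type} [AddCommGroup M] [Module ℂ M] [Module.Finite ℂ M]

/-- A two-sided invariant mean on an algebra of functions. -/
structure IsMean (RL : FnAlg L) (I : FnDual L) : Prop where
  one : I 1 = 1
  right : ∀ f ∈ RL, ∀ y, I (fun x => f (x * y)) = I f
  left : ∀ f ∈ RL, ∀ y, I (fun x => f (y * x)) = I f

variable {I : FnDual L}

lemma IsMean.vext_const (hI : IsMean RL I) (v : M) : vext I (fun _ => v) = v := by
  rw [_root_.vext_const, hI.one, one_smul]

lemma IsMean.vext_right (hI : IsMean RL I) {F : L → M} (hF : RegV RL F) (y : L) :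
    vext I (fun x => F (x * y)) = vext I F := by
  refine dual_ext fun ξ => ?_
  rw [dual_vext, dual_vext]
  exact hI.right _ (hF ξ) y

lemma IsMean.vext_left (hI : IsMean RL I) {F : L → M} (hF : RegV RL F) (y : L) :
    vext I (fun x => F (y * x)) = vext I F := by
  refine dual_ext fun ξ => ?_
  rw [dual_vext, dual_vext]
  exact hI.left _ (hF ξ) y

/-- A cochain vanishing as soon as one argument comes from `L`. -/
def IsNormd (ι : L →* Γ) (f : Γ → Γ → M) : Prop :=
  (∀ x l, f x (ι l) = 0) ∧ ∀ l y, f (ι l) y = 0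

variable {π : Γ →* (M ⊸ M)} {ι : L →* Γ}

lemma RegV.inv {Γ : Type} [Group Γ] {R : FnAlg Γ} (hR : IsHopfFn R) {M : Type}
    [AddCommGroup M] [Module ℂ M] {F : Γ → M} (hF : RegV R F) : RegV R (fun x => F x⁻¹) :=
  fun ξ => hR.inv _ (hF ξ)

lemma RegOp.inv {Γ : Type} [Group Γ] {R : FnAlg Γ} (hR : IsHopfFn R) {M N : Type}
    [AddCommGroup M] [Module ℂ M] [AddCommGroup N] [Module ℂ N] {T : Γ → M ⊸ N}
    (hT : RegOp R T) : RegOp R (fun x => T x⁻¹) :=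
  fun v => (hT v).inv hR

lemma exists_normalized (hRL : IsHopfFn RL) (hR : IsHopfFn R)
    (hι : ∀ f ∈ R, f ∘ ι ∈ RL) (hI : IsMean RL I) (hπ : RegOp R π) {f : Γ → Γ → M}
    (hf : BiRegV R R f) (hc : IsCoc π f) :
    ∃ h : Γ → M, RegV R h ∧ IsNormd ι (fun x y => f x y - cobd π h x y) := by
  have hid : ∀ f ∈ R, f ∘ (id : Γ → Γ) ∈ R := fun f hf => hf
  let h1 : Γ → M := fun x => vext I (fun l => f x (ι l))
  have hf1 := hf.comp hid hι
  have hh1 := hf1.contract I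
  let f1 : Γ → Γ → M := fun x y => f x y - cobd π h1 x y
  have hf1r : BiRegV R R f1 := hf.sub (BiRegV.cobd hR hπ hh1)
  have hf1c : IsCoc π f1 := hc.sub (isCoc_cobd π h1)
  have hz1 : ∀ x l, f1 x (ι l) = 0 := by
    intro x l₀
    have e : (fun l => f (x * ι l₀) (ι l)) =
        fun l => π x (f (ι l₀) (ι l)) + f x (ι (l₀ * l)) - f x (ι l₀) := by
      funext l
      have := hc x (ι l₀) (ι l)
      grind
    have e2 : h1 (x * ι l₀) = π x (h1 (ι l₀)) + h1 x - f x (ι l₀) := by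
      simp only [h1]
      rw [e, vext_sub, vext_add, ← map_vext, hI.vext_const,
        hI.vext_left (F := fun l => f x (ι l)) (hf1.eval_left x)]
    simp only [f1, cobd]
    rw [e2]; abel
  let h2 : Γ → M := fun y => vext I (fun l => π (ι l⁻¹) (f1 (ι l) y))
  have hπL : RegOp RL (fun l => π (ι l)) := hπ.comp hι
  have hreg2 : BiRegV RL R (fun l y => π (ι l⁻¹) (f1 (ι l) y)) :=
    RegOp.biApply (hπL.inv hRL) (hf1r.comp hι hid)
  have hh2 : RegV R h2 := hreg2.contract_left I
  have hright : ∀ l x l₀, f1 (ι l) (x * ι l₀) = f1 (ι l) x := by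
    intro l x l₀
    have := hf1c (ι l) x (ι l₀)
    grind
  have h2r : ∀ x l, h2 (x * ι l) = h2 x := fun x l => by grind
  have h2l : ∀ l, h2 (ι l) = 0 := fun l => by simp only [h2, hz1, map_zero]; exact hI.vext_const 0
  have h2m : ∀ l₀ y, h2 (ι l₀ * y) = π (ι l₀) (h2 y) - f1 (ι l₀) y := by
    intro l₀ y
    have e : (fun l => π (ι l⁻¹) (f1 (ι l) (ι l₀ * y))) = fun l =>
        π (ι l₀) (π (ι (l * l₀)⁻¹) (f1 (ι (l * l₀)) y)) - f1 (ι l₀) y := by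
      funext l
      have h := hf1c (ι l) (ι l₀) y
      rw [hz1, sub_zero] at h
      have h' : f1 (ι l) (ι l₀ * y) = f1 (ι (l * l₀)) y - π (ι l) (f1 (ι l₀) y) := by
        rw [← sub_eq_zero, ← h, map_mul]; abel
      rw [h', map_sub]
      simp
    simp only [h2]
    rw [e, vext_sub, hI.vext_const, ← map_vext,
      hI.vext_right (F := fun l => π (ι l⁻¹) (f1 (ι l) y)) (hreg2.eval y)]
  have hz2 : IsNormd ι (fun x y => f1 x y - cobd π h2 x y) := by
    refine ⟨fun x l => ?_, fun l y => ?_⟩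
    · simp only [cobd]
      simp_all
    · simp only [cobd]
      grind
  refine ⟨fun x => h1 x + h2 x, hh1.add hh2, ?_⟩
  have : (fun x y => f x y - cobd π (fun x => h1 x + h2 x) x y) =
      fun x y => f1 x y - cobd π h2 x y := by funext x y; simp only [f1, cobd, map_add]; abel
  grind

omit [Module.Finite ℂ M] in
lemma IsNormd.mul_right {f : Γ → Γ → M} (hn : IsNormd ι f) (hc : IsCoc π f) (x y : Γ) (l : L) :
    f x (y * ι l) = f x y := by
  have := hc x y (ι l)
  rw [hn.1, hn.1, map_zero] at this
  grind

omit [Module.Finite ℂ M] in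
lemma IsNormd.mul_left {f : Γ → Γ → M} (hn : IsNormd ι f) (hc : IsCoc π f) (x y : Γ) (l : L) :
    f (ι l * x) y = π (ι l) (f x y) := by
  have := hc (ι l) x y
  rw [hn.2, hn.2] at this
  grind

omit [Module.Finite ℂ M] in
lemma IsNormd.mul_mid {f : Γ → Γ → M} (hn : IsNormd ι f) (hc : IsCoc π f) (x y : Γ) (l : L) :
    f (x * ι l) y = f x (ι l * y) := by
  have := hc x (ι l) y
  rw [hn.2, hn.1, map_zero] at this
  grind

omit [Module.Finite ℂ M] in
lemma IsNormd.conj {f : Γ → Γ → M} (hn : IsNormd ι f) (hc : IsCoc π f) (x y : Γ) (l : L) :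
    f (ι l * x * (ι l)⁻¹) (ι l * y * (ι l)⁻¹) = π (ι l) (f x y) := by
  rw [← map_inv, hn.mul_right hc, ← hn.mul_mid hc, mul_assoc (_ * _), ← map_mul, inv_mul_cancel,
    map_one, mul_one, hn.mul_left hc]

lemma IsNormd.exists_invariant (hR : IsHopfFn R) (hι : ∀ f ∈ R, f ∘ ι ∈ RL) (hI : IsMean RL I)
    {f : Γ → Γ → M} (hn : IsNormd ι f) (hc : IsCoc π f) {b : Γ → M} (hb : RegV R b)
    (hfb : ∀ x y, f x y = cobd π b x y) :
    ∃ b' : Γ → M, RegV R b' ∧ (∀ l, b' (ι l) = 0) ∧ ∀ x y, f x y = cobd π b' x y := by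
  have hid : ∀ f ∈ R, f ∘ (id : Γ → Γ) ∈ R := fun f hf => hf
  have hreg := BiRegV.comp (hb.mul hR) hid hι
  let b' : Γ → M := fun x => vext I (fun l => b (x * ι l)) - vext I (fun l => b (ι l))
  have hbl := hb.comp hι
  refine ⟨b', (hreg.contract I).sub (RegV.const _), fun l => ?_, fun x y => ?_⟩
  · simp only [b', ← map_mul]
    rw [hI.vext_left hbl, sub_self]
  · have e1 : vext I (fun l => f x (y * ι l)) = f x y := by
      simp only [hn.mul_right hc]; exact hI.vext_const _
    have e2 : vext I (fun l => f x (ι l)) = 0 := by simp only [hn.1]; exact hI.vext_const _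
    simp only [hfb] at e1 e2
    simp only [cobd] at e1 e2
    rw [vext_add, vext_sub, ← map_vext, hI.vext_const] at e1 e2
    rw [hfb x y]
    have e3 : cobd π b x y = π x (b y) - b (x * y) + b x := rfl
    rw [e3, ← e1]
    simp only [cobd, b', map_sub]
    grind

end Mean

section PD

variable {Γ : Type} [Group Γ] {R : FnAlg Γ}
variable {M N : Type} [AddCommGroup M] [Module ℂ M] [Module.Finite ℂ M]
  [AddCommGroup N] [Module ℂ N] [Module.Finite ℂ N]

lemma IsPD.diag {X : FnDual Γ} (hX : IsPD R X) {F : Γ → Γ → ℂ} (hF : F ∈ biReg R R) :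
    X (fun x => F x x) = X (fun x => F x 1) + X (fun x => F 1 x) := by
  refine biReg_induction (fun a ha b hb => ?_) ?_ (fun F G _ _ h1 h2 => ?_) hF
  · have e1 : (fun x => a x * b 1) = b 1 • a := by funext x; simp [mul_comm]
    have e2 : (fun x => a 1 * b x) = a 1 • b := by funext x; simp
    have := hX a ha b hb
    rw [e1, e2, map_smul, map_smul, smul_eq_mul, smul_eq_mul, add_comm]
    exact this
  · have : (fun _ : Γ => (0 : ℂ)) = 0 := rfl
    simp_all
  · have e1 : ∀ f g, X f + X g = X (fun x => f x + g x) := fun f g => (map_add X f g).symm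
    simp only [Pi.add_apply]
    grind

lemma IsPD.vext_diag {X : FnDual Γ} (hX : IsPD R X) {F : Γ → Γ → M}
    (hF : BiRegV R R F) :
    vext X (fun x => F x x) = vext X (fun x => F x 1) + vext X (fun x => F 1 x) := by
  refine dual_ext fun ξ => ?_
  rw [map_add, dual_vext, dual_vext, dual_vext]
  exact hX.diag (hF ξ)

lemma IsPD.vext_op {X : FnDual Γ} (hX : IsPD R X) {T : Γ → M ⊸ N}
    (hT : RegOp R T) {F : Γ → M} (hF : RegV R F) :
    vext X (fun x => T x (F x)) = vext X (fun x => T x (F 1)) + T 1 (vext X F) := by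
  rw [map_vext]
  exact hX.vext_diag (F := fun x y => T x (F y)) (RegOp.biApply hT hF.right)

lemma IsPD.vext_inv (hR : IsHopfFn R) {X : FnDual Γ} (hX : IsPD R X) {F : Γ → M}
    (hF : RegV R F) : vext X (fun x => F x⁻¹) = - vext X F := by
  refine dual_ext fun ξ => ?_
  rw [map_neg, dual_vext, dual_vext]
  exact hX.map_inv hR (hF ξ)

variable {𝔤 : Type} [LieRing 𝔤] [LieAlgebra ℂ 𝔤] {der : 𝔤 ⊸ FnDual Γ}

lemma eq_const_of_vext_right [IsDomain R] (hR : IsHopfFn R) (hL : IsLieFn R 𝔤 der) {F : Γ → M}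
    (hF : RegV R F) (h : ∀ u x, vext (der u) (fun y => F (y * x)) = 0) (x : Γ) :
    F x = F 1 := by
  have := eq_zero_of_vext hR hL (F := fun x => F x⁻¹ - F 1) ((hF.inv hR).sub (RegV.const _))
    (by simp) (fun u x => ?_) x⁻¹
  · rwa [inv_inv, sub_eq_zero] at this
  · rw [vext_sub, (hL.pd u).vext_const, sub_zero]
    simp only [mul_inv_rev]
    have hr := (hF.mul hR).eval x⁻¹
    rw [(hL.pd u).vext_inv hR hr, h, neg_zero]

end PD


section Levi

variable {Γ U L : Type} [Group Γ] [Group U] [Group L] {R : FnAlg Γ}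
  {RU : FnAlg U} {RL : FnAlg L}

/-- A semidirect decomposition of a group of points, compatible with the function algebras, whose
normal factor has functions polynomial along powers. -/
structure IsLeviFn (R : FnAlg Γ) (RU : FnAlg U)
    (RL : FnAlg L) (ιU : U →* Γ) (ιL : L →* Γ) (prU : Γ → U) (prL : Γ → L) :
    Prop where
  hopf : IsHopfFn R
  hopfU : IsHopfFn RU
  hopfL : IsHopfFn RL
  domU : IsDomain RU
  domL : IsDomain RL
  pow : IsPowPoly RU
  retrU : IsRetr R RU ιU prU
  retrL : IsRetr R RL ιL prL
  decomp : ∀ x, ιU (prU x) * ιL (prL x) = x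
  prU_mul : ∀ u l, prU (ιU u * ιL l) = u
  prL_mul : ∀ u l, prL (ιU u * ιL l) = l
  conj : ∀ l u, ∃ u', ιL l * ιU u * (ιL l)⁻¹ = ιU u'

variable {ιU : U →* Γ} {ιL : L →* Γ} {prU : Γ → U} {prL : Γ → L}

namespace IsLeviFn

section
variable (h : IsLeviFn R RU RL ιU ιL prU prL)
include h

lemma prU_mul_right (x : Γ) (l : L) : prU (x * ιL l) = prU x := by
  conv_lhs => rw [← h.decomp x, mul_assoc, ← map_mul, h.prU_mul]

lemma prU_one : prU 1 = 1 := by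
  have := h.prU_mul 1 1
  simpa using this

lemma prL_one : prL 1 = 1 := by
  have := h.prL_mul 1 1
  simpa using this

lemma prU_L (l : L) : prU (ιL l) = 1 := by
  have := h.prU_mul_right 1 l
  rwa [one_mul, h.prU_one] at this

lemma prL_U (u : U) : prL (ιU u) = 1 := by
  have := h.prL_mul u 1
  simpa using this

lemma move (l : L) (u : U) : ∃ u', ιL l * ιU u = ιU u' * ιL l := by
  obtain ⟨u', hu⟩ := h.conj l u
  exact ⟨u', by rw [← hu]; group⟩

end

variable {𝔤 : Type} [LieRing 𝔤] [LieAlgebra ℂ 𝔤] {der : 𝔤 ⊸ FnDual Γ}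
variable {𝔲 𝔥 : LieSubalgebra ℂ 𝔤}

lemma exists_add (h : IsLeviFn R RU RL ιU ιL prU prL) (hL : IsLieFn R 𝔤 der)
    (h𝔲 : IsTangentTo R der ιU 𝔲) (h𝔥 : IsTangentTo R der ιL 𝔥) (z : 𝔤) :
    ∃ u ∈ 𝔲, ∃ w ∈ 𝔥, z = u + w := by
  have hresU := fun f hf => h.retrU.ext _ (h.retrU.res f hf)
  have hresL := fun f hf => h.retrL.ext _ (h.retrL.res f hf)
  obtain ⟨u, hu⟩ := hL.full ((der z).comp (LinearMap.funLeft ℂ ℂ (ιU ∘ prU))) (by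
    intro f hf g hg
    have := hL.pd z _ (hresU f hf) _ (hresU g hg)
    simp only [Function.comp_apply, h.prU_one, map_one] at this
    exact this)
  obtain ⟨w, hw⟩ := hL.full ((der z).comp (LinearMap.funLeft ℂ ℂ (ιL ∘ prL))) (by
    intro f hf g hg
    have := hL.pd z _ (hresL f hf) _ (hresL g hg)
    simp only [Function.comp_apply, h.prL_one, map_one] at this
    exact this)
  have hu' : ∀ f ∈ R, der u f = der z ((f ∘ ιU) ∘ prU) := fun f => hu f
  have hw' : ∀ f ∈ R, der w f = der z ((f ∘ ιL) ∘ prL) := fun f => hw f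
  refine ⟨u, (h𝔲 u).2 fun f hf h0 => ?_, w, (h𝔥 w).2 fun f hf h0 => ?_, ?_⟩
  · rw [hu' f hf, h0]; simp
  · rw [hw' f hf, h0]; simp
  · rw [← sub_eq_zero]
    refine hL.inj _ fun f hf => ?_
    rw [map_sub, map_add, LinearMap.sub_apply, LinearMap.add_apply, hu' f hf, hw' f hf]
    have hb := biReg_comp (h.hopf.comul f hf)
        hresU hresL
    have := (hL.pd z).diag hb
    simp only [h.decomp, h.prU_one, h.prL_one, map_one, mul_one, one_mul] at this
    rw [sub_eq_zero]
    exact this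

variable {M : Type} [AddCommGroup M] [Module ℂ M] [Module.Finite ℂ M]

end IsLeviFn

section Curv

variable {𝔤 : Type} [LieRing 𝔤] [LieAlgebra ℂ 𝔤] {der : 𝔤 ⊸ FnDual Γ}
variable {M : Type} [AddCommGroup M] [Module ℂ M] [Module.Finite ℂ M]

lemma curv_subDer (hr : IsRetr R RU ιU prU) {𝔲 : LieSubalgebra ℂ 𝔤} (h𝔲 : IsTangentTo R der ιU 𝔲)
    {f : Γ → Γ → M} (hf : BiRegV R R f) (u v : 𝔲) :
    curv (subDer der prU 𝔲) (fun x y => f (ιU x) (ιU y)) u v = curv der f u v := by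
  have key : ∀ u v : 𝔲, tens (subDer der prU 𝔲 u) (subDer der prU 𝔲 v)
      (fun x y => f (ιU x) (ιU y)) = tens (der u) (der v) f := fun u v => by
    have e := funext fun x => vext_subDer hr h𝔲 v (F := f (ιU x)) (hf.eval_left (ιU x))
    rw [tens, e]
    exact vext_subDer hr h𝔲 u (F := fun x => vext (der v) (f x)) (hf.contract (der v))
  have h1 := key u v
  have h2 := key v u
  show tens _ _ _ - tens _ _ _ = tens _ _ _ - tens _ _ _
  rw [h1, h2]

lemma curv_eq_zero_of_normd (hr : IsRetr R RL ιL prL) {𝔥 : LieSubalgebra ℂ 𝔤}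
    (h𝔥 : IsTangentTo R der ιL 𝔥) {f : Γ → Γ → M} (hf : BiRegV R R f) (hn : IsNormd ιL f)
    {w : 𝔤} (hw : w ∈ 𝔥) (v : 𝔤) : curv der f w v = 0 := by
  have h0 : ∀ F : Γ → M, RegV R F → (∀ l, F (ιL l) = 0) → vext (der w) F = 0 := by
    intro F hF h
    rw [← vext_subDer hr h𝔥 ⟨w, hw⟩ hF]
    simp only [h]
    exact map_zero (vext _)
  rw [curv, tens_swap hf, tens]
  have e1 := funext fun y => h0 _ (hf.eval y) fun l => hn.2 l y
  have e2 := funext fun x => h0 _ (hf.eval_left x) fun l => hn.1 x l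
  grind

lemma curv_skew (f : Γ → Γ → M) (u v : 𝔤) : curv der f u v = - curv der f v u := by
  simp only [curv]; abel

lemma IsLeviFn.curv_unique (h : IsLeviFn R RU RL ιU ιL prU prL) (hL : IsLieFn R 𝔤 der)
    {𝔲 𝔥 : LieSubalgebra ℂ 𝔤} (h𝔲 : IsTangentTo R der ιU 𝔲) (h𝔥 : IsTangentTo R der ιL 𝔥)
    {f : Γ → Γ → M} (hf : BiRegV R R f) (hn : IsNormd ιL f) {ω : 𝔤 ⊸ 𝔤 ⊸ M}
    (halt : ∀ u, ω u u = 0) (hω : ∀ w ∈ 𝔥, ∀ v, ω w v = 0)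
    (he : ∀ u ∈ 𝔲, ∀ v ∈ 𝔲, curv der f u v = ω u v) (u v : 𝔤) : curv der f u v = ω u v := by
  have hskew : ∀ u v, ω u v = - ω v u := fun u v => by
    have := halt (u + v)
    simp only [map_add, LinearMap.add_apply, halt, zero_add, add_zero] at this
    grind
  obtain ⟨a, ha, b, hb, rfl⟩ := h.exists_add hL h𝔲 h𝔥 u
  obtain ⟨c, hc, d, hd, rfl⟩ := h.exists_add hL h𝔲 h𝔥 v
  have z1 := curv_eq_zero_of_normd h.retrL h𝔥 hf hn hb
  have z2 := curv_eq_zero_of_normd h.retrL h𝔥 hf hn hd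
  simp only [← curvL_apply] at z1 z2 he ⊢
  have z3 : curvL der f a d = 0 := by rw [curvL_apply, curv_skew, ← curvL_apply, z2, neg_zero]
  have z4 : ω a d = 0 := by grind
  simp only [map_add, LinearMap.add_apply, z1, z3, z4, hω b hb, he a ha c hc]

variable [LieRingModule 𝔤 M] {π : Γ →* (M ⊸ M)}

lemma curv_equivariant (hR : IsHopfFn R) (hL : IsLieFn R 𝔤 der) (hM : IsMod R der π)
    (hr : IsRetr R RL ιL prL) {𝔥 : LieSubalgebra ℂ 𝔤}
    (h𝔥 : IsTangentTo R der ιL 𝔥) {f : Γ → Γ → M} (hf : BiRegV R R f) (hc : IsCoc π f)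
    (hn : IsNormd ιL f) {w : 𝔤} (hw : w ∈ 𝔥) (u v : 𝔤) :
    ⁅w, curv der f u v⁆ = curv der f ⁅w, u⁆ v + curv der f u ⁅w, v⁆ := by
  have h := curv_closed hR hL hM hf hc w u v
  rw [curv_eq_zero_of_normd hr h𝔥 hf hn hw, curv_eq_zero_of_normd hr h𝔥 hf hn hw,
    curv_skew _ ⁅u, v⁆ w, curv_eq_zero_of_normd hr h𝔥 hf hn hw, curv_skew _ ⁅w, v⁆ u,
    lie_zero, lie_zero] at h
  grind

lemma IsNormd.exists_relative (hR : IsHopfFn R) (hL : IsLieFn R 𝔤 der) (hM : IsMod R der π)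
    (hr : IsRetr R RL ιL prL) {𝔥 : LieSubalgebra ℂ 𝔤}
    (h𝔥 : IsTangentTo R der ιL 𝔥) {I : FnDual L} (hI : IsMean RL I)
    {f : Γ → Γ → M} (hf : BiRegV R R f) (hc : IsCoc π f)
    (hn : IsNormd ιL f) {b : Γ → M} (hb : RegV R b) (hfb : ∀ x y, f x y = cobd π b x y) :
    ∃ c : 𝔤 ⊸ M, (∀ w ∈ 𝔥, c w = 0) ∧ (∀ w ∈ 𝔥, ∀ u, ⁅w, c u⁆ = c ⁅w, u⁆) ∧
      ∀ u v, curv der f u v = ⁅u, c v⁆ - ⁅v, c u⁆ - c ⁅u, v⁆ := by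
  obtain ⟨b', hb', hb0, hfb'⟩ := hn.exists_invariant hR hr.res hI hc hb hfb
  let c : 𝔤 ⊸ M :=
    { toFun := fun u => vext (der u) b'
      map_add' := fun u v => by rw [map_add, vext_add_left]
      map_smul' := fun a u => by rw [map_smul, vext_smul_functional]; rfl }
  have hc' : ∀ u v, curv der f u v = ⁅u, c v⁆ - ⁅v, c u⁆ - c ⁅u, v⁆ := by
    have : f = cobd π b' := by grind
    intro u v
    rw [this]
    exact curv_cobd hL hM hb' u v
  have h0 : ∀ w ∈ 𝔥, c w = 0 := fun w hw => by
    change vext (der w) b' = 0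
    rw [← vext_subDer hr h𝔥 ⟨w, hw⟩ hb']
    simp only [hb0]
    exact map_zero (vext _)
  refine ⟨c, h0, fun w hw u => ?_, hc'⟩
  have := hc' w u
  rw [curv_eq_zero_of_normd hr h𝔥 hf hn hw, h0 w hw, lie_zero, sub_zero, eq_comm,
    sub_eq_zero] at this
  exact this

lemma isMod_sub (hM : IsMod R der π) (hr : IsRetr R RU ιU prU) {𝔲 : LieSubalgebra ℂ 𝔤}
    (h𝔲 : IsTangentTo R der ιU 𝔲) : IsMod RU (subDer der prU 𝔲) (π.comp ιU) where
  reg := hM.reg.comp hr.res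
  act := fun u w => (hM.act u.1 w).trans (vext_subDer hr h𝔲 u (hM.reg w)).symm

lemma IsLeviFn.exists_cobd (h : IsLeviFn R RU RL ιU ιL prU prL) (hL : IsLieFn R 𝔤 der)
    {𝔲 : LieSubalgebra ℂ 𝔤} (h𝔲 : IsTangentTo R der ιU 𝔲) (hM : IsMod R der π)
    {I : FnDual L} (hI : IsMean RL I) {f₀ : Γ → Γ → M} (hf₀ : BiRegV R R f₀)
    (hc₀ : IsCoc π f₀) (c₀ : 𝔤 ⊸ M)
    (hcurv₀ : ∀ u v, curv der f₀ u v = ⁅u, c₀ v⁆ - ⁅v, c₀ u⁆ - c₀ ⁅u, v⁆) :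
    ∃ b : Γ → M, RegV R b ∧ ∀ x y, f₀ x y = cobd π b x y := by
  have := h.domU
  obtain ⟨k, hk, hn⟩ := exists_normalized h.hopfL h.hopf h.retrL.res hI hM.reg hf₀ hc₀
  set f : Γ → Γ → M := fun x y => f₀ x y - cobd π k x y with hfdef
  have hf : BiRegV R R f := hf₀.sub (BiRegV.cobd h.hopf hM.reg hk)
  have hc : IsCoc π f := hc₀.sub (isCoc_cobd π k)
  let c : 𝔤 ⊸ M :=
    { toFun := fun u => c₀ u - vext (der u) k
      map_add' := fun u v => by rw [map_add, map_add, vext_add_left]; abel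
      map_smul' := fun a u => by rw [map_smul, map_smul, vext_smul_functional, smul_sub]; rfl }
  have hcc : ∀ u, c u = c₀ u - vext (der u) k := fun _ => rfl
  have hcurv : ∀ u v, curv der f u v = ⁅u, c v⁆ - ⁅v, c u⁆ - c ⁅u, v⁆ := fun u v => by
    rw [hfdef, curv_sub, hcurv₀, curv_cobd hL hM hk]
    simp only [hcc, lie_sub]
    abel
  obtain ⟨b, hb, hb1, hfb⟩ := exists_cobd_of_curv h.hopfU h.pow
    (isLieFn_sub h.retrU h𝔲 h.hopf hL) (isMod_sub hM h.retrU h𝔲)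
    (hf.comp h.retrU.res h.retrU.res)
    (fun x y z => by simpa using hc (ιU x) (ιU y) (ιU z))
    (by simpa using hn.2 1 1) (c.comp 𝔲.subtype) (fun u v => by
      rw [curv_subDer h.retrU h𝔲 hf]; exact hcurv u v)
  let B : Γ → M := fun x => vext I (fun l => π (ιL l) (b (prU ((ιL l)⁻¹ * x))))
  have hbΓ := hb.comp h.retrU.ext
  have hinv : ∀ f ∈ R, (f ∘ fun l => (ιL l)⁻¹) ∈ RL := fun f hf =>
    h.retrL.res _ (h.hopf.inv f hf)
  have hπL : RegOp RL (fun l => π (ιL l)) := hM.reg.comp h.retrL.res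
  have hKr : BiRegV RL R (fun l x => π (ιL l) (b (prU ((ιL l)⁻¹ * x)))) :=
    RegOp.biApply hπL (BiRegV.comp (hbΓ.mul h.hopf)
      hinv (fun f hf => hf))
  have hB : RegV R B := hKr.contract_left I
  have hBr : ∀ x l, B (x * ιL l) = B x := fun x l => by simp only [B, ← mul_assoc, h.prU_mul_right]
  have hBm : ∀ l x, B (ιL l * x) = π (ιL l) (B x) := fun l₀ x => by
    simp only [B]
    rw [map_vext, ← hI.vext_left (hKr.eval (ιL l₀ * x)) l₀]
    simp
  have hB1 : B 1 = 0 := by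
    simp only [B, mul_one, ← map_inv, h.prU_L, hb1, map_zero]
    exact map_zero (vext I)
  have hBl : ∀ l, B (ιL l) = 0 := fun l => by
    have := hBr 1 l
    simp_all
  have hUU : ∀ u u', f (ιU u) (ιU u') = cobd π B (ιU u) (ιU u') := by
    intro u u'
    have hl : ∀ l, f (ιU u) (ιU u') = π (ιU u) (π (ιL l) (b (prU ((ιL l)⁻¹ * ιU u'))))
        - π (ιL l) (b (prU ((ιL l)⁻¹ * (ιU u * ιU u')))) +
        π (ιL l) (b (prU ((ιL l)⁻¹ * ιU u))) := by
      intro l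
      obtain ⟨v, hv⟩ := h.conj l⁻¹ u
      obtain ⟨v', hv'⟩ := h.conj l⁻¹ u'
      simp only [map_inv, inv_inv] at hv hv'
      have e1 : (ιL l)⁻¹ * ιU u' = ιU v' * ιL l⁻¹ := by rw [← hv', map_inv]; group
      have e2 : (ιL l)⁻¹ * ιU u = ιU v * ιL l⁻¹ := by rw [← hv, map_inv]; group
      have e3 : (ιL l)⁻¹ * (ιU u * ιU u') = ιU (v * v') * ιL l⁻¹ := by
        rw [map_mul, ← hv, ← hv', map_inv]; group
      rw [e1, e2, e3, h.prU_mul, h.prU_mul, h.prU_mul]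
      have e4 : ιU u = ιL l * ιU v * (ιL l)⁻¹ := by rw [← hv]; group
      have e5 : ιU u' = ιL l * ιU v' * (ιL l)⁻¹ := by rw [← hv']; group
      have e6 := hn.conj hc (ιU v) (ιU v') l
      rw [← e4, ← e5] at e6
      rw [e6, hfb v v']
      simp only [cobd, map_sub, map_add, MonoidHom.comp_apply]
      congr 2
      rw [← Module.End.mul_apply, ← Module.End.mul_apply, ← map_mul, ← map_mul, e4]
      congr 2; group
    have := hI.vext_const (f (ιU u) (ιU u'))
    rw [funext hl] at this
    rw [vext_add, vext_sub, ← map_vext] at this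
    exact this.symm
  have hcB := hc.sub (isCoc_cobd π B)
  have hnB : IsNormd ιL (fun x y => f x y - cobd π B x y) :=
    ⟨fun x l => by simp only [hn.1, cobd, hBl, hBr]; simp,
      fun l y => by simp only [hn.2, cobd, hBl, hBm]; simp⟩
  have hfB : ∀ x y, f x y = cobd π B x y := by
    intro x y
    rw [← sub_eq_zero]
    have hUU' : ∀ u u', (fun x y => f x y - cobd π B x y) (ιU u) (ιU u') = 0 :=
      fun u u' => sub_eq_zero.2 (hUU u u')
    change (fun x y => f x y - cobd π B x y) x y = 0
    generalize (fun x y => f x y - cobd π B x y) = g at hcB hnB hUU'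
    rw [← h.decomp x, ← h.decomp y, hnB.mul_right hcB, hnB.mul_mid hcB]
    obtain ⟨v, hv⟩ := h.move (prL x) (prU y)
    rw [hv, hnB.mul_right hcB]
    exact hUU' _ _
  refine ⟨fun x => B x + k x, hB.add hk, fun x y => ?_⟩
  have := hfB x y
  rw [hfdef] at this
  simp only [cobd, map_add] at this ⊢
  rw [sub_eq_iff_eq_add] at this
  rw [this]; abel

end Curv

end Levi


section Average

variable {Γ L : Type} [Group Γ] {R : FnAlg Γ} {RL : FnAlg L}
variable {M : Type} [AddCommGroup M] [Module ℂ M]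

/-- Families of regular functions of two variables depending regularly on a parameter. -/
def TriRegV (RL : FnAlg L) (R : FnAlg Γ) (K : L → Γ → Γ → M) : Prop :=
  ∃ (n : ℕ) (a : Fin n → L → Γ → ℂ) (G : Fin n → L → Γ → M), (∀ i, a i ∈ biReg RL R) ∧
    (∀ i, BiRegV RL R (G i)) ∧ ∀ l x y, K l x y = ∑ i, a i l x • G i l y

lemma biRegV_smul_left {a : L → Γ → ℂ} (ha : a ∈ biReg RL R) {G : L → M} (hG : RegV RL G) :
    BiRegV RL R (fun l x => a l x • G l) :=
  BiRegV.smul ha hG.left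

lemma TriRegV.slice {K : L → Γ → Γ → M} (hK : TriRegV RL R K) (x : Γ) :
    BiRegV RL R (fun l y => K l x y) := by
  obtain ⟨n, a, G, ha, hG, h⟩ := hK
  simp only [h]
  exact BiRegV.sum _ fun i _ => BiRegV.smul (biReg_of_left (biReg_eval (ha i) x)) (hG i)

variable [Module.Finite ℂ M]

lemma TriRegV.contract {K : L → Γ → Γ → M} (hK : TriRegV RL R K) (Y : FnDual Γ) :
    BiRegV RL R (fun l x => vext Y (K l x)) := by
  obtain ⟨n, a, G, ha, hG, h⟩ := hK
  have e : (fun l x => vext Y (K l x)) = fun l x => ∑ i, a i l x • vext Y (G i l) := by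
    funext l x
    rw [funext (h l x), vext_sum]
    exact Finset.sum_congr rfl fun i _ => (map_smul (vext Y) (a i l x) (G i l))
  rw [e]
  exact BiRegV.sum _ fun i _ => biRegV_smul_left (ha i) ((hG i).contract Y)

lemma TriRegV.average {K : L → Γ → Γ → M} (hK : TriRegV RL R K) (I : FnDual L) :
    BiRegV R R (fun x y => vext I (fun l => K l x y)) := by
  obtain ⟨n, a, G, ha, hG, h⟩ := hK
  have e : (fun x y => vext I (fun l => K l x y)) =
      fun x y => ∑ i, vext I (fun l => a i l x • G i l y) := by
    funext x y
    simp only [h]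
    exact vext_sum _ _ _
  rw [e]
  refine BiRegV.sum _ fun i _ => ?_
  obtain ⟨m, c, d, hc, hd, hcd⟩ := biReg_expand (ha i)
  have e' : (fun x y => vext I (fun l => a i l x • G i l y)) =
      fun x y => ∑ j, d j x • vext I (fun l => c j l • G i l y) := by
    funext x y
    simp only [hcd, Finset.sum_smul]
    rw [vext_sum]
    refine Finset.sum_congr rfl fun j _ => ?_
    rw [← map_smul (vext I)]
    congr 1; funext l
    simp only [Pi.smul_apply, smul_smul, mul_comm]
  rw [e']
  exact BiRegV.sum _ fun j _ => BiRegV.smul (biReg_of_left (hd j))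
    (BiRegV.contract_left (BiRegV.smul (biReg_of_left (hc j)) (hG i)) I).right

lemma TriRegV.tens_average {K : L → Γ → Γ → M} (hK : TriRegV RL R K) (I : FnDual L)
    (X Y : FnDual Γ) : tens X Y (fun x y => vext I (fun l => K l x y)) =
      vext I (fun l => tens X Y (K l)) := by
  have e := funext fun x => ((hK.slice x).fubini I Y).symm
  rw [tens, e]
  exact ((hK.contract Y).fubini I X).symm

end Average

section Relative

variable {Γ U L : Type} [Group Γ] [Group U] [Group L] {R : FnAlg Γ}
  {RU : FnAlg U} {RL : FnAlg L}
variable {ιU : U →* Γ} {ιL : L →* Γ} {prU : Γ → U} {prL : Γ → L}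
variable {𝔤 : Type} [LieRing 𝔤] [LieAlgebra ℂ 𝔤] {der : 𝔤 ⊸ FnDual Γ}
variable {M : Type} [AddCommGroup M] [Module ℂ M] [Module.Finite ℂ M]
variable [LieRingModule 𝔤 M] {π : Γ →* (M ⊸ M)}

lemma equivariant_of_lie (hR : IsHopfFn R) (hL : IsLieFn R 𝔤 der) [Module.Finite ℂ 𝔤]
    (hM : IsMod R der π) (hRL : IsHopfFn RL)
    [IsDomain RL] (hr : IsRetr R RL ιL prL) {𝔥 : LieSubalgebra ℂ 𝔤}
    (h𝔥 : IsTangentTo R der ιL 𝔥) {Ad : Γ → 𝔤 ⊸ 𝔤}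
    (hmul : ∀ g h u, Ad (g * h) u = Ad g (Ad h u)) (hone : ∀ u, Ad 1 u = u) (hreg : RegOp R Ad)
    (had : ∀ z u, vext (der z) (fun x => Ad x u) = ⁅z, u⁆)
    (ω : 𝔤 ⊸ 𝔤 ⊸ M)
    (he : ∀ w ∈ 𝔥, ∀ u v, ⁅w, ω u v⁆ = ω ⁅w, u⁆ v + ω u ⁅w, v⁆) (l : L) (u v : 𝔤) :
    ω (Ad (ιL l) u) (Ad (ιL l) v) = π (ιL l) (ω u v) := by
  have hω : ∀ u, RegOp R (fun x => ω (Ad x u)) := fun u v => (hreg u).map (ω.flip v)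
  have hF := fun u v => (hω u).apply (hreg v)
  have hπi := hM.reg.inv hR
  have hΨ := fun u v => hπi.apply (hF u v)
  have key : ∀ w ∈ 𝔥, ∀ u v, vext (der w) (fun x => π x⁻¹ (ω (Ad x u) (Ad x v))) = 0 := by
    intro w hw u v
    rw [(hL.pd w).vext_op hπi (hF u v), (hL.pd w).vext_inv hR (hM.reg (ω (Ad 1 u) (Ad 1 v))),
      ← hM.act, (hL.pd w).vext_op (hω u) (hreg v), had]
    have e : vext (der w) (fun x => ω (Ad x u) (Ad 1 v)) = ω ⁅w, u⁆ v := by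
      rw [← had, hone]
      exact (map_vext (der w) (fun x => Ad x u) (ω.flip v)).symm
    simp_all
  have := eq_const_of_vext_right hRL (isLieFn_sub hr h𝔥 hR hL)
    (F := fun l => π (ιL l)⁻¹ (ω (Ad (ιL l) u) (Ad (ιL l) v))) ((hΨ u v).comp hr.res)
    (fun w x => by
      have e : (fun y => π (ιL (y * x))⁻¹ (ω (Ad (ιL (y * x)) u) (Ad (ιL (y * x)) v))) =
          fun y => (fun g => π (ιL x)⁻¹ (π g⁻¹ (ω (Ad g (Ad (ιL x) u)) (Ad g (Ad (ιL x) v)))))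
            (ιL y) := by
        funext y
        simp only [map_mul ιL, mul_inv_rev, hmul, map_mul π, Module.End.mul_apply]
      rw [e, vext_subDer hr h𝔥 w ((hΨ _ _).map _), ← map_vext, key w.1 w.2, map_zero]) l
  simp only [map_one, inv_one, hone, Module.End.one_apply] at this
  rw [← this, ← Module.End.mul_apply, ← map_mul, mul_inv_cancel, map_one, Module.End.one_apply]

lemma IsLeviFn.exists_coc (h : IsLeviFn R RU RL ιU ιL prU prL) (hL : IsLieFn R 𝔤 der)
    {𝔲 𝔥 : LieSubalgebra ℂ 𝔤} (h𝔲 : IsTangentTo R der ιU 𝔲) (h𝔥 : IsTangentTo R der ιL 𝔥)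
    (hM : IsMod R der π) {I : FnDual L} (hI : IsMean RL I) (ω : 𝔤 ⊸ 𝔤 ⊸ M)
    (halt : ∀ u, ω u u = 0)
    (hω : ∀ u v w, ⁅u, ω v w⁆ - ⁅v, ω u w⁆ + ⁅w, ω u v⁆ - ω ⁅u, v⁆ w + ω ⁅u, w⁆ v
      - ω ⁅v, w⁆ u = 0)
    (h0 : ∀ w ∈ 𝔥, ∀ v, ω w v = 0)
    (he : ∀ w ∈ 𝔥, ∀ u v, ⁅w, ω u v⁆ = ω ⁅w, u⁆ v + ω u ⁅w, v⁆) :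
    ∃ f : Γ → Γ → M, BiRegV R R f ∧ IsCoc π f ∧ IsNormd ιL f ∧
      ∀ u v, curv der f u v = ω u v := by
  have := h.domU
  have := h.domL
  have : Module.Finite ℂ 𝔤 := hL.finite h.hopf
  obtain ⟨Ad, hAd, hAmul, hA1, hAreg, had⟩ := exists_adjoint h.hopf hL
  have heq := equivariant_of_lie h.hopf hL hM h.hopfL h.retrL h𝔥 hAmul hA1 hAreg had ω he
  obtain ⟨f₀, hf₀, hc₀, hr₀, hl₀, hcurv₀⟩ := exists_coc_of_closed h.hopfU h.pow
    (isLieFn_sub h.retrU h𝔲 h.hopf hL) (isMod_sub hM h.retrU h𝔲)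
    ((ω.comp (𝔲.subtype : 𝔲 ⊸ 𝔤)).compl₂ (𝔲.subtype : 𝔲 ⊸ 𝔤))
    (fun u => halt u.1) (fun u v w => hω u.1 v.1 w.1)
  -- the cocycle on the group, invariant under right translation by `L`
  have hF : BiRegV R R (fun x y => f₀ (prU x) (prU y)) := hf₀.comp h.retrU.ext h.retrU.ext
  have hFn : IsNormd ιL (fun x y => f₀ (prU x) (prU y)) :=
    ⟨fun x l => by simp only [h.prU_L, hr₀], fun l y => by simp only [h.prU_L, hl₀]⟩
  have hFc : ∀ u v, curv der (fun x y => f₀ (prU x) (prU y)) u v = ω u v :=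
    h.curv_unique hL h𝔲 h𝔥 hF hFn halt h0 fun u hu v hv => by
      have := curv_subDer h.retrU h𝔲 hF ⟨u, hu⟩ ⟨v, hv⟩
      simp only [h.retrU.left_inv] at this
      rw [← this]
      exact hcurv₀ ⟨u, hu⟩ ⟨v, hv⟩
  choose c hc using h.conj
  have hcpr : ∀ l u, prU (ιL l * ιU u * (ιL l)⁻¹) = c l u := fun l u => by rw [hc, h.retrU.left_inv]
  have hιU : Function.Injective ιU := Function.LeftInverse.injective h.retrU.left_inv
  have hcmul : ∀ l m u, c (l * m) u = c l (c m u) := fun l m u => hιU (by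
    rw [← hc, ← hc, ← hc, map_mul]; group)
  have hchom : ∀ l u v, c l (u * v) = c l u * c l v := fun l u v => hιU (by
    rw [map_mul, ← hc, ← hc, ← hc, map_mul]; group)
  have hcone : ∀ u, c 1 u = u := fun u => hιU (by rw [← hc, map_one]; group)
  have hcinv : ∀ l u, c l (c l⁻¹ u) = u := fun l u => by rw [← hcmul, mul_inv_cancel, hcone]
  have hc11 : ∀ l, c l 1 = 1 := fun l => hιU (by rw [← hc, map_one]; group)
  let K : L → Γ → Γ → M := fun l x y => π (ιL l) (f₀ (prU ((ιL l)⁻¹ * x * ιL l))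
    (prU ((ιL l)⁻¹ * y * ιL l)))
  have hKU : ∀ l u v, K l (ιU u) (ιU v) = π (ιL l) (f₀ (c l⁻¹ u) (c l⁻¹ v)) := fun l u v => by
    simp only [K, ← hcpr, map_inv, inv_inv]
  have hK : TriRegV RL R K := by
    obtain ⟨n, a, G, ha, hG, haG⟩ := hF.expand
    have hinv : ∀ f ∈ R, (f ∘ fun l => (ιL l)⁻¹) ∈ RL := fun f hf =>
      h.retrL.res _ (h.hopf.inv f hf)
    have hbi : ∀ f ∈ R, (fun l x => f ((ιL l)⁻¹ * x * ιL l)) ∈ biReg RL R := fun f hf => by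
      have := biReg_comp (h.hopf.conj_biReg hf) hinv
        (fun b hb => hb)
      simpa only [inv_inv] using this
    refine ⟨n, fun i l x => a i ((ιL l)⁻¹ * x * ιL l),
      fun i l y => π (ιL l) (G i ((ιL l)⁻¹ * y * ιL l)), fun i => hbi _ (ha i), fun i => ?_,
      fun l x y => ?_⟩
    · exact RegOp.biApply (hM.reg.comp h.retrL.res) fun ξ => hbi _ (hG i ξ)
    · simp only [K, haG, map_sum, map_smul]
  have hKt : ∀ l u v, curv der (K l) u v = ω u v := fun l u v => by
    have ht : ∀ u v, tens (der u) (der v) (K l) = π (ιL l) (tens (der (Ad (ιL l)⁻¹ u))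
        (der (Ad (ιL l)⁻¹ v)) fun x y => f₀ (prU x) (prU y)) := fun u v => by
      have hv : ∀ {F : Γ → M} (u : 𝔤), RegV R F →
          vext (der u) (fun x => F ((ιL l)⁻¹ * x * ιL l)) = vext (der (Ad (ιL l)⁻¹ u)) F :=
        fun {F} u hF => dual_ext fun ξ => by rw [dual_vext, dual_vext, hAd _ _ _ (hF ξ), inv_inv]
      have e1 : (fun x => vext (der v) (K l x)) = fun x => π (ιL l)
          ((fun x => vext (der (Ad (ιL l)⁻¹ v)) fun y => f₀ (prU x) (prU y))
            ((ιL l)⁻¹ * x * ιL l)) := by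
        funext x
        simp only []
        rw [← hv v (hF.eval_left ((ιL l)⁻¹ * x * ιL l)), map_vext]
      rw [tens, e1, ← map_vext, hv u (hF.contract _)]
      rfl
    rw [curv, ht, ht, ← map_sub]
    have := hFc (Ad (ιL l)⁻¹ u) (Ad (ιL l)⁻¹ v)
    rw [curv] at this
    rw [this, ← map_inv, heq, ← Module.End.mul_apply, ← map_mul, ← map_mul, mul_inv_cancel,
      map_one, map_one, Module.End.one_apply]
  let fb : Γ → Γ → M := fun x y => vext I (fun l => K l x y)
  have hfb : BiRegV R R fb := hK.average I
  have hfbc : ∀ u v, curv der fb u v = ω u v := fun u v => by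
    rw [curv, hK.tens_average, hK.tens_average, ← vext_sub]
    have : (fun l => tens (der u) (der v) (K l) - tens (der v) (der u) (K l)) =
        fun _ => ω u v := funext fun l => hKt l u v
    rw [this, hI.vext_const]
  let g : U → U → M := fun u v => fb (ιU u) (ιU v)
  have hg : ∀ u v, g u v = vext I (fun l => π (ιL l) (f₀ (c l⁻¹ u) (c l⁻¹ v))) := fun u v => by
    simp only [g, fb, hKU]
  have hgr : ∀ u, g u 1 = 0 := fun u => by
    rw [hg]; simp only [hc11, hr₀, map_zero]; exact map_zero (vext I)
  have hgl : ∀ u, g 1 u = 0 := fun u => by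
    rw [hg]; simp only [hc11, hl₀, map_zero]; exact map_zero (vext I)
  have hge : ∀ l u v, g (c l u) (c l v) = π (ιL l) (g u v) := fun l u v => by
    have hreg : RegV RL (fun m => K m (ιU (c l u)) (ιU (c l v))) := (hK.slice _).eval _
    rw [hg u v, map_vext]
    refine (hI.vext_left hreg l).symm.trans ?_
    congr 1; funext m
    rw [hKU, ← hcmul, ← hcmul, mul_inv_rev, inv_mul_cancel_right, map_mul, map_mul,
      Module.End.mul_apply]
  have hgc : ∀ x y z, π (ιU x) (g y z) - g (x * y) z + g x (y * z) - g x y = 0 := fun x y z => by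
    have hl : ∀ l, π (ιU x) (π (ιL l) (f₀ (c l⁻¹ y) (c l⁻¹ z)))
        - π (ιL l) (f₀ (c l⁻¹ (x * y)) (c l⁻¹ z)) + π (ιL l) (f₀ (c l⁻¹ x) (c l⁻¹ (y * z)))
        - π (ιL l) (f₀ (c l⁻¹ x) (c l⁻¹ y)) = 0 := fun l => by
      have := congrArg (π (ιL l)) (hc₀ (c l⁻¹ x) (c l⁻¹ y) (c l⁻¹ z))
      rw [map_zero] at this
      simp only [map_sub, map_add, MonoidHom.comp_apply] at this
      have e : π (ιU x) * π (ιL l) = π (ιL l) * π (ιU (c l⁻¹ x)) := by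
        rw [← map_mul, ← map_mul, ← hc, map_inv]
        congr 1; group
      rw [hchom, hchom, ← this, ← Module.End.mul_apply, e, Module.End.mul_apply]
    rw [hg, hg, hg, hg, map_vext, ← vext_sub, ← vext_add, ← vext_sub, funext hl]
    exact map_zero (vext I)
  have hcm : ∀ l y, c l (prU y) = prU (ιL l * y) := fun l y => by
    have : ιL l * y = ιU (c l (prU y)) * ιL (l * prL y) := by
      conv_lhs => rw [← h.decomp y]
      rw [← hc, map_mul]; group
    rw [this, h.prU_mul]
  have hmulx : ∀ x y, x * y = ιU (prU x * c (prL x) (prU y)) * ιL (prL x * prL y) := fun x y => by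
    conv_lhs => rw [← h.decomp x, ← h.decomp y]
    rw [map_mul, ← hc, map_mul]; group
  have hG : BiRegV R R (fun x y => g (prU x) (c (prL x) (prU y))) := by
    obtain ⟨n, a, G, ha, hG, haG⟩ := hfb.expand
    have hpr : ∀ f ∈ R, (f ∘ fun x => ιU (prU x)) ∈ R := fun f hf =>
      h.retrU.ext _ (h.retrU.res f hf)
    simp only [g, haG, hcm]
    refine BiRegV.sum _ fun i _ => BiRegV.smul (biReg_of_left (hpr _ (ha i))) ?_
    exact (RegV.mul h.hopf ((hG i).comp hpr)).comp
      (fun f hf => h.retrL.ext _ (h.retrL.res f hf)) (fun f hf => hf)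
  have hGn : IsNormd ιL (fun x y => g (prU x) (c (prL x) (prU y))) :=
    ⟨fun x l => by simp only [h.prU_L, hc11, hgr], fun l y => by simp only [h.prU_L, hgl]⟩
  refine ⟨fun x y => g (prU x) (c (prL x) (prU y)), hG, fun x y z => ?_, hGn, ?_⟩
  · have hU : prU (x * y) = prU x * c (prL x) (prU y) := by rw [hmulx, h.prU_mul]
    have hU' : prU (y * z) = prU y * c (prL y) (prU z) := by rw [hmulx, h.prU_mul]
    have hLL : prL (x * y) = prL x * prL y := by rw [hmulx, h.prL_mul]
    have hx : π x = π (ιU (prU x)) * π (ιL (prL x)) := by rw [← map_mul, h.decomp]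
    simp only [hU, hU', hLL, hx, Module.End.mul_apply, ← hge, hchom, hcmul]
    exact hgc _ _ _
  · refine h.curv_unique hL h𝔲 h𝔥 hG hGn halt h0 fun u hu v hv => ?_
    have e1 := curv_subDer h.retrU h𝔲 hG ⟨u, hu⟩ ⟨v, hv⟩
    have e2 := curv_subDer h.retrU h𝔲 hfb ⟨u, hu⟩ ⟨v, hv⟩
    simp only [h.retrU.left_inv, h.prL_U, hcone] at e1
    rw [← e1, ← hfbc, ← e2]

end Relative


section Polynomials

variable {M : Type} [AddCommGroup M] [Module ℂ M]

/-- The algebra of polynomial functions on a vector space. -/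
def vecFn (M : Type) [AddCommGroup M] [Module ℂ M] : FnAlg M :=
  Algebra.adjoin ℂ (Set.range fun ξ : Module.Dual ℂ M => (ξ : M → ℂ))

lemma dual_mem_vecFn (ξ : Module.Dual ℂ M) : (ξ : M → ℂ) ∈ vecFn M :=
  Algebra.subset_adjoin ⟨ξ, rfl⟩

lemma RegV.comp_vecFn {X : Type} {S : FnAlg X} {F : X → M} (hF : RegV S F)
    {a : M → ℂ} (ha : a ∈ vecFn M) : a ∘ F ∈ S := by
  induction ha using Algebra.adjoin_induction with
  | mem x hx => obtain ⟨ξ, rfl⟩ := hx; exact hF ξ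
  | algebraMap r => exact S.algebraMap_mem r
  | add x y _ _ h1 h2 => exact S.add_mem h1 h2
  | mul x y _ _ h1 h2 => exact S.mul_mem h1 h2

lemma exists_polynomial_of_vecFn {a : M → ℂ} (ha : a ∈ vecFn M) (b : M) :
    ∃ P : Polynomial ℂ, ∀ t : ℂ, a (t • b) = P.eval t := by
  induction ha using Algebra.adjoin_induction with
  | mem x hx =>
    obtain ⟨ξ, rfl⟩ := hx
    exact ⟨Polynomial.C (ξ b) * Polynomial.X, fun t => by
      beta_reduce
      rw [map_smul, Polynomial.eval_mul, Polynomial.eval_C, Polynomial.eval_X, smul_eq_mul,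
        mul_comm]⟩
  | algebraMap r => exact ⟨Polynomial.C r, fun t => by simp⟩
  | add x y _ _ h1 h2 =>
    obtain ⟨P, hP⟩ := h1
    obtain ⟨Q, hQ⟩ := h2
    exact ⟨P + Q, fun t => by simp [hP, hQ]⟩
  | mul x y _ _ h1 h2 =>
    obtain ⟨P, hP⟩ := h1
    obtain ⟨Q, hQ⟩ := h2
    exact ⟨P * Q, fun t => by simp [hP, hQ]⟩

/-- `f` is annihilated by any `d` successive differences along `T`. -/
def NilpFn {V X : Type} (T : V → X → X) : ℕ → (X → ℂ) → Prop
  | 0, f => f = 0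
  | d + 1, f => ∀ m, NilpFn T d fun x => f (T m x) - f x

lemma NilpFn.succ {V X : Type} {T : V → X → X} : ∀ {d : ℕ} {f : X → ℂ}, NilpFn T d f →
    NilpFn T (d + 1) f
  | 0, _, h => fun m => by
      have h := h
      subst h
      exact funext fun x => sub_self _
  | _ + 1, _, h => fun m => (h m).succ

lemma NilpFn.mono {V X : Type} {T : V → X → X} {d e : ℕ} (hde : d ≤ e) {f : X → ℂ}
    (h : NilpFn T d f) : NilpFn T e f :=
  Nat.le_induction h (fun _ _ h => h.succ) e hde

lemma NilpFn.add {V X : Type} {T : V → X → X} : ∀ {d : ℕ} {f g : X → ℂ}, NilpFn T d f →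
    NilpFn T d g → NilpFn T d (f + g)
  | 0, _, _, h1, h2 => by
      have h1 : _ = (0 : X → ℂ) := h1
      grind
  | _ + 1, f, g, h1, h2 => fun m => by
      have := (h1 m).add (h2 m)
      convert this using 1
      funext x
      simp only [Pi.add_apply]
      ring

lemma NilpFn.translate : ∀ {d : ℕ} {f : M → ℂ} (k : M), NilpFn (fun m n : M => m + n) d f →
    NilpFn (fun m n : M => m + n) d fun n => f (k + n)
  | 0, f, k, h => by
      have h := h
      subst h
      rfl
  | _ + 1, _, k, h => fun m => by simpa only [add_left_comm] using (h m).translate k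

lemma NilpFn.mul : ∀ {N d e : ℕ} {f g : M → ℂ}, d + e ≤ N → NilpFn (fun m n : M => m + n) d f →
    NilpFn (fun m n : M => m + n) e g → NilpFn (fun m n : M => m + n) N (f * g)
  | N, 0, _, f, g, _, h1, _ => by
      have h1 := h1
      subst h1
      rw [zero_mul]
      exact NilpFn.mono (Nat.zero_le N) (show NilpFn _ 0 (0 : M → ℂ) from rfl)
  | N, _, 0, f, g, _, _, h2 => by
      have h2 := h2
      subst h2
      rw [mul_zero]
      exact NilpFn.mono (Nat.zero_le N) (show NilpFn _ 0 (0 : M → ℂ) from rfl)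
  | N + 1, d + 1, e + 1, f, g, hN, h1, h2 => fun m => by
      have a1 := NilpFn.mul (N := N) (by omega) (h1 m) (h2.translate m)
      have a2 := NilpFn.mul (N := N) (by omega) h1 (h2 m)
      convert a1.add a2 using 1
      funext x
      simp only [Pi.add_apply, Pi.mul_apply]
      ring

lemma exists_nilpFn_of_vecFn {a : M → ℂ} (ha : a ∈ vecFn M) :
    ∃ d, NilpFn (fun m n : M => m + n) d a := by
  induction ha using Algebra.adjoin_induction with
  | mem x hx =>
    obtain ⟨ξ, rfl⟩ := hx
    exact ⟨2, fun m k => funext fun x => by simp⟩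
  | algebraMap r => exact ⟨1, fun m => funext fun x => by simp⟩
  | add x y _ _ h1 h2 =>
    obtain ⟨d, hd⟩ := h1
    obtain ⟨e, he⟩ := h2
    exact ⟨d + e, (hd.mono (Nat.le_add_right d e)).add (he.mono (Nat.le_add_left e d))⟩
  | mul x y _ _ h1 h2 =>
    obtain ⟨d, hd⟩ := h1
    obtain ⟨e, he⟩ := h2
    exact ⟨d + e, NilpFn.mul le_rfl hd he⟩

lemma NilpFn.of_expand {X : Type} {T : M → X → X} (hT : ∀ m n x, T m (T n x) = T (m + n) x)
    (h0 : ∀ x, T 0 x = x) {N : ℕ} {b : Fin N → X → ℂ} : ∀ {d : ℕ} {a : Fin N → M → ℂ}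
    {f : X → ℂ}, (∀ i, NilpFn (fun m n : M => m + n) d (a i)) →
    (∀ m x, f (T m x) = ∑ i, a i m * b i x) → NilpFn T d f
  | 0, a, f, ha, hf => funext fun x => by
      have := hf 0 x
      rw [h0] at this
      rw [this]
      exact Finset.sum_eq_zero fun i _ => by
        have h : a i = 0 := ha i
        simp_all
  | d + 1, a, f, ha, hf => fun m => NilpFn.of_expand (b := b) hT h0 (fun i => ha i m) fun n x => by
      simp only [hT, hf, sub_mul, Finset.sum_sub_distrib]

end Polynomials

section Torsor

variable {E Γ M : Type} [Group E] [Group Γ] [AddCommGroup M] [Module ℂ M]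

/-- `E` is an extension of `Γ` by the vector group `M`. -/
structure IsVecExt (S : FnAlg E) (R : FnAlg Γ) (j : M → E)
    (q : E →* Γ) : Prop where
  alg : IsAlgGrpFn S
  map_add : ∀ m n, j (m + n) = j m * j n
  inj : Function.Injective j
  surj : Function.Surjective q
  comp_mem : ∀ r ∈ R, r ∘ q ∈ S
  map_j : ∀ m, q (j m) = 1
  exact : ∀ x, q x = 1 → ∃ m, j m = x
  reg : ∀ f ∈ S, (fun m x => f (j m * x)) ∈ biReg (vecFn M) S

namespace IsVecExt

variable {S : FnAlg E} {R : FnAlg Γ} {j : M → E} {q : E →* Γ}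
  (h : IsVecExt S R j q)
include h

lemma j_zero : j 0 = 1 := by
  have := h.map_add 0 0
  simp_all

lemma j_mul_j (m n : M) (x : E) : j m * (j n * x) = j (m + n) * x := by
  rw [h.map_add, mul_assoc]

lemma shift_mem {g : E → ℂ} (hg : g ∈ S) {w : E → M} (hw : RegV S w) :
    (fun x => g (j (w x) * x)) ∈ S :=
  biReg_diag (biReg_comp (h.reg g hg) (fun _ => hw.comp_vecFn)
    fun _ hb => hb) le_rfl

lemma exists_mul_of_q_eq {x y : E} (hxy : q x = q y) : ∃ m, x = j m * y := by
  obtain ⟨m, hm⟩ := h.exact (x * y⁻¹) (by simp_all)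
  exact ⟨m, by simp_all⟩

lemma exists_descend (hR : IsHopfFn R) [IsDomain R] (hsep : ∀ x y, (∀ r ∈ R, r x = r y) → x = y)
    {f : E → ℂ} (hf : f ∈ S) (hinv : ∀ m x, f (j m * x) = f x) : ∃ r ∈ R, r ∘ q = f := by
  have hdom : IsDomain (pullFn q R) := by
    have hnt : Nontrivial (pullFn q R) := ⟨0, 1, fun hh =>
      zero_ne_one (congrFun (congrArg Subtype.val hh) 1)⟩
    have hnz : NoZeroDivisors (pullFn q R) := ⟨fun {a b} hab => by
      obtain ⟨r, hr, hra⟩ := mem_pullFn.1 a.2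
      obtain ⟨s, hs, hsb⟩ := mem_pullFn.1 b.2
      have hz : (⟨r, hr⟩ * ⟨s, hs⟩ : R) = 0 := Subtype.ext <| funext fun g => by
        obtain ⟨x, rfl⟩ := h.surj g
        have := congrFun (congrArg Subtype.val hab) x
        have ha := congrFun hra x
        have hb := congrFun hsb x
        show r (q x) * s (q x) = 0
        rw [show r (q x) = a.1 x from ha, show s (q x) = b.1 x from hb]
        exact this
      rcases mul_eq_zero.1 hz with h0 | h0
      · left
        apply Subtype.ext
        rw [← hra, show r = 0 from congrArg Subtype.val h0]
        rfl
      · right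
        apply Subtype.ext
        rw [← hsb, show s = 0 from congrArg Subtype.val h0]
        rfl⟩
    exact NoZeroDivisors.to_isDomain _
  refine mem_pullFn.1 ((hR.pull q).mem_of_constant_on_classes
    (fun f hf => ?_) h.alg.toIsHopfFn h.alg.pts hf fun x y hxy => ?_)
  · obtain ⟨r, hr, rfl⟩ := mem_pullFn.1 hf
    exact h.comp_mem r hr
  · obtain ⟨m, rfl⟩ := h.exists_mul_of_q_eq
      (hsep (q x) (q y) fun r hr => hxy _ (comp_mem_pullFn hr))
    exact hinv m y

lemma exists_minimal {N : Submodule ℂ M} {b : M} {f₀ : E → ℂ} (hf₀ : f₀ ∈ S)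
    (hN₀ : ∀ m ∈ N, ∀ x, f₀ (j m * x) = f₀ x) (hb₀ : ¬ ∀ (t : ℂ) x, f₀ (j (t • b) * x) = f₀ x) :
    ∃ f ∈ S, (∀ m ∈ N, ∀ x, f (j m * x) = f x) ∧ (¬ ∀ (t : ℂ) x, f (j (t • b) * x) = f x) ∧
      ∀ m (t : ℂ) x, f (j m * (j (t • b) * x)) - f (j (t • b) * x) = f (j m * x) - f x := by
  obtain ⟨n, a, c, ha, hc, hac⟩ := biReg_expand (h.reg f₀ hf₀)
  choose e he using fun i => exists_nilpFn_of_vecFn (ha i)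
  have hnil : NilpFn (fun m x => j m * x) (∑ i, e i) f₀ :=
    NilpFn.of_expand (h.j_mul_j) (fun x => by rw [h.j_zero, one_mul])
      (fun i => (he i).mono (Finset.single_le_sum (fun _ _ => Nat.zero_le _) (Finset.mem_univ i)))
      hac
  generalize (∑ i, e i) = d at hnil
  clear ha hc hac he a c e
  induction d generalizing f₀ with
  | zero =>
    have hnil : f₀ = 0 := hnil
    simp_all
  | succ d ih =>
    by_cases hall : ∀ m (t : ℂ) x,
        f₀ (j m * (j (t • b) * x)) - f₀ (j (t • b) * x) = f₀ (j m * x) - f₀ x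
    · grind
    · push Not at hall
      obtain ⟨m, t, x, hx⟩ := hall
      refine ih (f₀ := fun x => f₀ (j m * x) - f₀ x)
        (S.sub_mem (h.alg.toIsHopfFn.left_translate hf₀ _) hf₀) (fun k hk x => ?_)
        (fun hh => hx (hh t x)) (hnil m)
      rw [h.j_mul_j, add_comm, ← h.j_mul_j, hN₀ k hk, hN₀ k hk]

lemma exists_linear_of_minimal {b : M} {f : E → ℂ} (hf : f ∈ S)
    (hmin : ∀ m (t : ℂ) x, f (j m * (j (t • b) * x)) - f (j (t • b) * x) = f (j m * x) - f x)
    (t : ℂ) (x : E) : f (j (t • b) * x) = f x + t * (f (j b * x) - f x) := by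
  obtain ⟨n, a, c, ha, hc, hac⟩ := biReg_expand (h.reg f hf)
  choose P hP using fun i => exists_polynomial_of_vecFn (ha i) b
  let Q : Polynomial ℂ := ∑ i, P i * Polynomial.C (c i x)
  have hQ : ∀ t, f (j (t • b) * x) = Q.eval t := fun t => by
    rw [hac, Polynomial.eval_finsetSum]
    simp_all
  have hnat : ∀ k : ℕ, f (j ((k : ℂ) • b) * x) = f x + k * (f (j b * x) - f x) := fun k => by
    induction k with
    | zero => simp [h.j_zero]
    | succ k ih =>
      have := hmin b k x
      rw [h.j_mul_j, ih] at this
      rw [Nat.cast_succ, add_smul, one_smul, add_comm, sub_eq_iff_eq_add.1 this]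
      ring
  have hQ' : Q = Polynomial.C (f x) + Polynomial.X * Polynomial.C (f (j b * x) - f x) := by
    refine Polynomial.eq_of_infinite_eval_eq _ _ (Set.Infinite.mono ?_ (Set.infinite_range_of_injective Nat.cast_injective))
    rintro _ ⟨k, rfl⟩
    simp [← hQ, hnat]
  rw [hQ, hQ']
  simp

variable (hR : IsHopfFn R) [IsDomain R] (hsep : ∀ x y, (∀ r ∈ R, r x = r y) → x = y)
include hR hsep

lemma exists_coordinate {N : Submodule ℂ M} {b : M} (hb : b ∉ N) {y : E → M} (hy : RegV S y)
    (hyN : ∀ x, y x ∈ N) (hym : ∀ m ∈ N, ∀ x, y (j m * x) = m + y x) :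
    ∃ g ∈ S, (∀ m ∈ N, ∀ x, g (j m * x) = g x) ∧
      ∀ (t : ℂ) x, g (j (t • b) * x) = g x + t := by
  let J : Submodule ℂ (Γ → ℂ) :=
    { carrier := {l | l ∈ R ∧ ∃ g ∈ S, (∀ m ∈ N, ∀ x, g (j m * x) = g x) ∧
        ∀ (t : ℂ) x, g (j (t • b) * x) = g x + t * l (q x)}
      zero_mem' := ⟨R.zero_mem, 0, S.zero_mem, fun _ _ _ => rfl, by simp⟩
      add_mem' := by
        rintro l l' ⟨hl, g, hg, h1, h2⟩ ⟨hl', g', hg', h1', h2'⟩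
        refine ⟨R.add_mem hl hl', g + g', S.add_mem hg hg', fun m hm x => ?_, fun t x => ?_⟩
        · simp [h1 m hm, h1' m hm]
        · simp only [Pi.add_apply, h2, h2']
          ring
      smul_mem' := by
        rintro c l ⟨hl, g, hg, h1, h2⟩
        refine ⟨R.smul_mem hl c, c • g, S.smul_mem hg c, fun m hm x => ?_, fun t x => ?_⟩
        · simp [h1 m hm]
        · simp only [Pi.smul_apply, h2, smul_eq_mul]
          ring }
  obtain ⟨g₀, hg₀, hne⟩ : ∃ g ∈ S, g (j (-y (j b)) * j b) ≠ g (j (-y 1)) := by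
    by_contra! hh
    have := h.alg.sep _ _ hh
    rw [← h.map_add] at this
    have := h.inj this
    apply hb
    have hb' : b = y (j b) + (-y 1) := by grind
    rw [hb']
    exact N.add_mem (hyN _) (N.neg_mem (hyN _))
  obtain ⟨f, hf, hfN, hfb, hmin⟩ := h.exists_minimal (N := N) (b := b)
    (f₀ := fun x => g₀ (j (-y x) * x)) (h.shift_mem hg₀ hy.neg)
    (fun m hm x => by
      show g₀ (j (-y (j m * x)) * (j m * x)) = _
      rw [hym m hm, h.j_mul_j]
      simp)
    (fun hh => hne (by have := hh 1 1; simp_all))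
  have hlin := h.exists_linear_of_minimal hf hmin
  obtain ⟨l, hl, hlq⟩ := h.exists_descend hR hsep (f := fun x => f (j b * x) - f x)
    (S.sub_mem (h.alg.toIsHopfFn.left_translate hf _) hf) fun m x => by
      have := hmin m 1 x
      rw [one_smul] at this
      show f (j b * (j m * x)) - f (j m * x) = _
      rw [h.j_mul_j, add_comm, ← h.j_mul_j]
      grind
  have hlJ : l ∈ J := ⟨hl, f, hf, hfN, fun t x => by
    rw [hlin, ← Function.comp_apply (f := l) (g := q), hlq]⟩
  have hl0 : l ≠ 0 := by
    rintro rfl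
    refine hfb fun t x => ?_
    have := congrFun hlq x
    simp only [Function.comp_apply, Pi.zero_apply] at this
    rw [hlin, ← this, mul_zero, add_zero]
  obtain ⟨-, g, hg, h1, h2⟩ := hR.one_mem_of_translate_stable J (fun l hl => hl.1)
    (by
      rintro r hr l ⟨hl, g, hg, h1, h2⟩
      refine ⟨R.mul_mem hr hl, (r ∘ q) * g, S.mul_mem (h.comp_mem r hr) hg,
        fun m hm x => ?_, fun t x => ?_⟩
      · simp [h1 m hm, h.map_j]
      · simp only [Pi.mul_apply, Function.comp_apply, map_mul, h.map_j, one_mul, h2]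
        ring)
    (by
      rintro l ⟨hl, g, hg, h1, h2⟩ z
      obtain ⟨z, rfl⟩ := h.surj z
      refine ⟨hR.right_translate hl _, fun x => g (x * z), h.alg.toIsHopfFn.right_translate hg z,
        fun m hm x => ?_, fun t x => ?_⟩
      · simp only [mul_assoc, h1 m hm]
      · simp only [mul_assoc, h2, map_mul])
    hlJ hl0
  exact ⟨g, hg, h1, fun t x => by simpa using h2 t x⟩

lemma exists_trivialization [Module.Finite ℂ M] :
    ∃ F : E → M, RegV S F ∧ ∀ m x, F (j m * x) = m + F x := by
  let X : Set (Submodule ℂ M) := {N | ∃ y, RegV S y ∧ (∀ x, y x ∈ N) ∧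
    ∀ m ∈ N, ∀ x, y (j m * x) = m + y x}
  obtain ⟨N, ⟨y, hy, hyN, hym⟩, hmax⟩ := wellFounded_gt.has_min X
    ⟨⊥, fun _ => 0, RegV.const 0, fun _ => Submodule.zero_mem _, fun m hm x => by simp_all⟩
  by_cases hN : N = ⊤
  · exact ⟨y, hy, fun m x => hym m (hN ▸ Submodule.mem_top) x⟩
  · exfalso
    obtain ⟨b, hb⟩ : ∃ b, b ∉ N := by
      by_contra! hh
      exact hN (Submodule.eq_top_iff'.2 hh)
    obtain ⟨g, hg, h1, h2⟩ := h.exists_coordinate hR hsep hb hy hyN hym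
    have hgb := (RegV.smul hg (RegV.const b)).neg
    refine hmax (N ⊔ ℂ ∙ b) ⟨fun x => g x • b + y (j (-(g x • b)) * x),
      (RegV.smul hg (RegV.const b)).add fun ξ => h.shift_mem (hy ξ) hgb, fun x => ?_,
      fun m hm x => ?_⟩ ?_
    · exact Submodule.add_mem _ (Submodule.mem_sup_right
        (Submodule.smul_mem _ _ (Submodule.mem_span_singleton_self b)))
        (Submodule.mem_sup_left (hyN _))
    · obtain ⟨n, hn, k, hk, rfl⟩ := Submodule.mem_sup.1 hm
      obtain ⟨t, rfl⟩ := Submodule.mem_span_singleton.1 hk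
      have e1 : g (j (n + t • b) * x) = g x + t := by rw [h.map_add, mul_assoc, h1 n hn, h2]
      have e2 : j (-((g x + t) • b)) * (j (n + t • b) * x) = j n * (j (-(g x • b)) * x) := by
        rw [h.j_mul_j, h.j_mul_j]
        congr 2
        rw [add_smul]
        abel
      simp only [e1, e2, hym n hn]
      rw [add_smul]
      abel
    simp_all

end IsVecExt

end Torsor


section CocycleData

variable {E Γ M : Type} [Group E] [Group Γ] [AddCommGroup M] [Module ℂ M]

/-- A regular trivialization `F` of a vector extension together with its two-cocycle `f`. -/
structure IsCocData (S : FnAlg E) (R : FnAlg Γ) (j : M → E)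
    (q : E →* Γ) (π : Γ →* (M ⊸ M)) (F : E → M) (f : Γ → Γ → M) : Prop where
  reg : RegV S F
  equi : ∀ m x, F (j m * x) = m + F x
  bireg : BiRegV R R f
  map_mul : ∀ x y, F (x * y) = F x + π (q x) (F y) + f (q x) (q y)

variable {S : FnAlg E} {R : FnAlg Γ} {j : M → E} {q : E →* Γ}
  {π : Γ →* (M ⊸ M)} {F : E → M} {f : Γ → Γ → M}

namespace IsVecExt

variable (h : IsVecExt S R j q)
include h

lemma eq_of_coords (hequi : ∀ m x, F (j m * x) = m + F x) {x y : E} (hF : F x = F y)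
    (hq : q x = q y) : x = y := by
  obtain ⟨m, rfl⟩ := h.exists_mul_of_q_eq hq
  rw [hequi, add_eq_right] at hF
  rw [hF, h.j_zero, one_mul]

lemma exists_point (hequi : ∀ m x, F (j m * x) = m + F x) (m : M) (g : Γ) :
    ∃ x, F x = m ∧ q x = g := by
  obtain ⟨x, rfl⟩ := h.surj g
  exact ⟨j (m - F x) * x, by grind, by rw [map_mul, h.map_j, one_mul]⟩

variable (hR : IsHopfFn R) [IsDomain R] (hsep : ∀ x y, (∀ r ∈ R, r x = r y) → x = y)
include hR hsep

lemma exists_descend_section (hF : RegV S F) (hequi : ∀ m x, F (j m * x) = m + F x) {s : E → ℂ}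
    (hs : s ∈ S) : ∃ r ∈ R, ∀ x, r (q x) = s (j (-F x) * x) := by
  obtain ⟨r, hr, hrq⟩ := h.exists_descend hR hsep (h.shift_mem hs hF.neg) fun m x => by
    rw [hequi, h.j_mul_j]
    congr 3
    abel
  exact ⟨r, hr, congrFun hrq⟩

lemma exists_coords (hF : RegV S F) (hequi : ∀ m x, F (j m * x) = m + F x) {s : E → ℂ}
    (hs : s ∈ S) : ∃ T ∈ biReg (vecFn M) R, ∀ x, s x = T (F x) (q x) := by
  obtain ⟨n, a, c, ha, hc, hac⟩ := biReg_expand (h.reg s hs)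
  choose r hr hrq using fun i => h.exists_descend_section hR hsep hF hequi (hc i)
  refine ⟨∑ i, fun m g => a i m * r i g,
    Submodule.sum_mem _ fun i _ => biReg_of_mul (ha i) (hr i), fun x => ?_⟩
  have := hac (F x) (j (-F x) * x)
  rw [h.j_mul_j, add_neg_cancel, h.j_zero, one_mul] at this
  simp only [this, Finset.sum_apply, hrq]

lemma exists_cocData [Module.Finite ℂ M] (hπ : RegOp R π)
    (hconj : ∀ x m, x * j m * x⁻¹ = j (π (q x) m)) : ∃ F f, IsCocData S R j q π F f := by
  obtain ⟨F, hF, hequi⟩ := h.exists_trivialization hR hsep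
  choose σ hσ using h.surj
  have hid : ∀ a ∈ S, a ∘ (id : E → E) ∈ S := fun a ha => ha
  let c : E → E → M := fun x y => F (x * y) - F x - π (q x) (F y)
  have hc : BiRegV S S c := by
    refine BiRegV.sub (BiRegV.sub (fun ξ => h.alg.comul _ (hF ξ)) hF.left) ?_
    exact (hπ.comp h.comp_mem).biApply hF.right
  have hl : ∀ m x y, c (j m * x) y = c x y := fun m x y => by
    simp only [c, map_mul, h.map_j, one_mul, mul_assoc, hequi]
    abel
  have hr : ∀ m x y, c x (j m * y) = c x y := fun m x y => by
    have : x * (j m * y) = j (π (q x) m) * (x * y) := by rw [← hconj]; group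
    grind
  have hinv : ∀ x y x' y', q x = q x' → q y = q y' → c x y = c x' y' := fun x y x' y' hx hy => by
    obtain ⟨m, rfl⟩ := h.exists_mul_of_q_eq hx
    obtain ⟨n, rfl⟩ := h.exists_mul_of_q_eq hy
    rw [hl, hr]
  refine ⟨F, fun g g' => c (σ g) (σ g'), hF, hequi, fun ξ => ?_, fun x y => ?_⟩
  · obtain ⟨n, a, b, ha, hb, hab⟩ := biReg_expand (hc ξ)
    choose r hrR hrq using fun i => h.exists_descend_section hR hsep hF hequi (ha i)
    choose s hs hsq using fun i => h.exists_descend_section hR hsep hF hequi (hb i)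
    have : (fun g g' => ξ (c (σ g) (σ g'))) = ∑ i, fun g g' => r i g * s i g' := by
      funext g g'
      have e := hab (j (-F (σ g)) * σ g) (j (-F (σ g')) * σ g')
      rw [hl, hr] at e
      rw [e]
      simp only [Finset.sum_apply, ← hrq, ← hsq, hσ]
    rw [this]
    exact Submodule.sum_mem _ fun i _ => biReg_of_mul (hrR i) (hs i)
  · rw [hinv (σ (q x)) (σ (q y)) x y (hσ _) (hσ _)]
    grind

lemma exists_cobd_of_cocData (hd : IsCocData S R j q π F f) {F' : E → M} {f' : Γ → Γ → M}
    (hd' : IsCocData S R j q π F' f') [Module.Finite ℂ M] :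
    ∃ b : Γ → M, RegV R b ∧ ∀ x y, f x y - f' x y = cobd π b x y := by
  choose σ hσ using h.surj
  have hinv : ∀ x, F' (σ (q x)) - F (σ (q x)) = F' x - F x := fun x => by
    obtain ⟨m, hm⟩ := h.exists_mul_of_q_eq (hσ (q x))
    rw [hm, hd'.equi, hd.equi]
    abel
  refine ⟨fun g => F' (σ g) - F (σ g), fun ξ => ?_, fun g g' => ?_⟩
  · obtain ⟨r, hr, hrq⟩ := h.exists_descend hR hsep (f := fun x => ξ (F' x - F x))
      ((hd'.reg.sub hd.reg) ξ) fun m x => by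
        rw [hd'.equi, hd.equi]
        simp
    convert hr using 1
    funext g
    rw [← hσ g]
    beta_reduce
    rw [hinv, hσ g]
    exact (congrFun hrq (σ g)).symm.trans (by grind)
  · have h1 := hd.map_mul (σ g) (σ g')
    have h2 := hd'.map_mul (σ g) (σ g')
    have h3 := hinv (σ g * σ g')
    rw [map_mul] at h3
    simp only [hσ] at h1 h2 h3
    simp only [cobd, h3, map_sub]
    grind

end IsVecExt

namespace IsCocData

variable (hd : IsCocData S R j q π F f)
include hd

lemma isCoc (h : IsVecExt S R j q) : IsCoc π f := by
  intro g g' g''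
  obtain ⟨x, rfl⟩ := h.surj g
  obtain ⟨y, rfl⟩ := h.surj g'
  obtain ⟨z, rfl⟩ := h.surj g''
  have h1 := hd.map_mul (x * y) z
  rw [mul_assoc, hd.map_mul x (y * z), hd.map_mul y z, hd.map_mul x y] at h1
  simp only [_root_.map_add, _root_.map_mul, Module.End.mul_apply] at h1
  grind

lemma sub_cobd (hR : IsHopfFn R) [Module.Finite ℂ M] (hπ : RegOp R π) (h : IsVecExt S R j q)
    {b : Γ → M} (hb : RegV R b) :
    IsCocData S R j q π (fun x => F x + b (q x)) (fun x y => f x y - cobd π b x y) where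
  reg := hd.reg.add (hb.comp h.comp_mem)
  equi m x := by rw [hd.equi, _root_.map_mul, h.map_j, one_mul, add_assoc]
  bireg := hd.bireg.sub (BiRegV.cobd hR hπ hb)
  map_mul x y := by
    simp only [hd.map_mul, cobd, _root_.map_mul, _root_.map_add]
    abel

lemma comp {E' : Type} [Group E'] {S' : FnAlg E'} {j' : M → E'} {q' : E' →* Γ}
    (φ : E' →* E) (hφ : ∀ s ∈ S, s ∘ φ ∈ S') (hj : ∀ m, φ (j' m) = j m)
    (hq : ∀ x, q (φ x) = q' x) : IsCocData S' R j' q' π (fun x => F (φ x)) f where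
  reg := hd.reg.comp hφ
  equi m x := by rw [_root_.map_mul, hj, hd.equi]
  bireg := hd.bireg
  map_mul x y := by rw [_root_.map_mul, hd.map_mul, hq, hq]

lemma eq_curv [Module.Finite ℂ M] {𝔤 𝔢 : Type} [LieRing 𝔤] [LieAlgebra ℂ 𝔤] [LieRing 𝔢]
    [LieAlgebra ℂ 𝔢] [LieRingModule 𝔤 M] {der : 𝔤 ⊸ FnDual Γ}
    {derE : 𝔢 ⊸ FnDual E} (h : IsVecExt S R j q) (hE : IsLieFn S 𝔢 derE)
    (hM : IsMod R der π) (di : M ⊸ 𝔢) (dq : 𝔢 ⊸ 𝔤)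
    (hdi : ∀ m, vext (derE (di m)) F = m)
    (hdq : ∀ w, ∀ r ∈ R, derE w (r ∘ q) = der (dq w) r) (s : 𝔤 ⊸ 𝔢) (hs : ∀ u, dq (s u) = u)
    {ω : 𝔤 → 𝔤 → M} (hω : ∀ u v, di (ω u v) = ⁅s u, s v⁆ - s ⁅u, v⁆) (u v : 𝔤) :
    ω u v = curv der f u v + (⁅u, vext (derE (s v)) F⁆ - ⁅v, vext (derE (s u)) F⁆
      - vext (derE (s ⁅u, v⁆)) F) := by
  have hpush : ∀ w {G : Γ → M}, RegV R G → vext (derE w) (fun x => G (q x)) = vext (der (dq w)) G :=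
    fun w G hG => dual_ext fun ξ => by
      rw [dual_vext, dual_vext]
      exact hdq w _ (hG ξ)
  have key : ∀ u v, vext (derE (s u)) (fun x => vext (derE (s v)) fun y => F (x * y)) =
      ⁅u, vext (derE (s v)) F⁆ + tens (der u) (der v) f := fun u v => by
    have e1 : ∀ x, (vext (derE (s v)) fun y => F (x * y)) =
        π (q x) (vext (derE (s v)) F) + vext (der v) (f (q x)) := fun x => by
      simp only [hd.map_mul]
      rw [vext_add, vext_add, (hE.pd _).vext_const, zero_add, ← map_vext,
        hpush _ (hd.bireg.eval_left (q x)), hs]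
    have h1 : RegV R fun x => π x (vext (derE (s v)) F) := hM.reg.apply (RegV.const _)
    have h2 : RegV R fun x => vext (der v) (f x) := hd.bireg.contract _
    simp only [e1]
    rw [vext_add, hpush _ h1, hpush _ h2, hs, ← hM.act]
    rfl
  rw [← hdi (ω u v), hω, map_sub, vext_sub_left, hE.vext_lie hd.reg, key, key]
  simp only [curv]
  abel

end IsCocData

end CocycleData

section LieExistence

variable {Γ : Type} [Group Γ] {R : FnAlg Γ}

/-- The left-invariant derivations of a function algebra. -/
def leftInvDer (R : FnAlg Γ) : LieSubalgebra ℂ (Derivation ℂ R R) where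
  carrier := {D | ∀ (z : Γ) (f g : R), (∀ x, g.1 x = f.1 (z * x)) →
    ∀ x, (D g).1 x = (D f).1 (z * x)}
  zero_mem' := fun _ _ _ _ _ => rfl
  add_mem' := fun {D D'} h h' z f g hfg x => by
    show (D g).1 x + (D' g).1 x = (D f).1 (z * x) + (D' f).1 (z * x)
    rw [h z f g hfg, h' z f g hfg]
  smul_mem' := fun c D h z f g hfg x => by
    show c * (D g).1 x = c * (D f).1 (z * x)
    rw [h z f g hfg]
  lie_mem' := fun {D D'} h h' z f g hfg x => by
    simp only [Derivation.commutator_apply]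
    show (D (D' g)).1 x - (D' (D g)).1 x = (D (D' f)).1 (z * x) - (D' (D f)).1 (z * x)
    rw [h z _ _ (h' z f g hfg), h' z _ _ (h z f g hfg)]

lemma IsHopfFn.exists_isLieFn (hR : IsHopfFn R) :
    ∃ der : leftInvDer R ⊸ FnDual Γ, IsLieFn R (leftInvDer R) der := by
  obtain ⟨P, hP⟩ := (Subalgebra.toSubmodule R).subtype.exists_leftInverse_of_injective
    (LinearMap.ker_eq_bot.2 Subtype.val_injective)
  have hP' : ∀ f (hf : f ∈ R), P f = ⟨f, hf⟩ := fun f hf =>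
    LinearMap.congr_fun hP (⟨f, hf⟩ : Subalgebra.toSubmodule R)
  let der : leftInvDer R ⊸ FnDual Γ := LinearMap.mk₂ ℂ
    (fun D f => (D.1 (P f : R)).1 1) (fun _ _ _ => rfl) (fun _ _ _ => rfl)
    (fun D f g => by simp)
    (fun c D f => by rw [map_smul]; exact congrFun (congrArg Subtype.val (D.1.map_smul _ _)) 1)
  have hder : ∀ D f (hf : f ∈ R), der D f = (D.1 ⟨f, hf⟩).1 1 := fun D f hf => by
    show (D.1 (P f : R)).1 1 = _
    rw [hP' f hf]
  have hlinv : ∀ D f (hf : f ∈ R), linv (der D) f = (D.1 ⟨f, hf⟩).1 := fun D f hf => by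
    funext x
    rw [linv_apply, hder D _ (hR.left_translate hf x)]
    have := D.2 x ⟨f, hf⟩ ⟨_, hR.left_translate hf x⟩ (fun _ => rfl) 1
    simp_all
  refine ⟨der, ⟨fun D f hf g hg => ?_, fun X hX => ?_, fun D hD => ?_, fun D D' f hf => ?_⟩⟩
  · rw [hder D f hf, hder D g hg, hder D _ (R.mul_mem hf hg)]
    have := congrFun (congrArg Subtype.val (D.1.leibniz (⟨f, hf⟩ : R) ⟨g, hg⟩)) 1
    exact this
  · refine ⟨⟨linvDer hR hX, fun z f g hfg x => ?_⟩, fun f hf => ?_⟩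
    · show linv X g.1 x = linv X f.1 (z * x)
      rw [← linv_translate, show g.1 = fun y => f.1 (z * y) from funext hfg]
    · rw [hder _ f hf]
      show linv X f 1 = X f
      simp
  · apply Subtype.ext
    apply Derivation.ext
    intro f
    apply Subtype.ext
    rw [← hlinv D f.1 f.2]
    funext x
    rw [linv_apply, hD _ (hR.left_translate f.2 x)]
    rfl
  · rw [hder _ f hf, hlinv D' f hf, hlinv D f hf, hder D _ (D'.1 ⟨f, hf⟩).2,
      hder D' _ (D.1 ⟨f, hf⟩).2]
    rfl

lemma IsLieFn.exists_lift {𝔤 V : Type} [LieRing 𝔤] [LieAlgebra ℂ 𝔤] [AddCommGroup V] [Module ℂ V]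
    {der : 𝔤 ⊸ FnDual Γ} (hL : IsLieFn R 𝔤 der) (X : V → FnDual Γ)
    (hX : ∀ v, IsPD R (X v)) (hadd : ∀ v w, ∀ f ∈ R, X (v + w) f = X v f + X w f)
    (hsmul : ∀ (c : ℂ) v, ∀ f ∈ R, X (c • v) f = c * X v f) :
    ∃ T : V ⊸ 𝔤, ∀ v, ∀ f ∈ R, der (T v) f = X v f := by
  choose T hT using fun v => hL.full (X v) (hX v)
  refine ⟨{ toFun := T, map_add' := fun v w => ?_, map_smul' := fun c v => ?_ }, hT⟩
  · rw [← sub_eq_zero]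
    refine hL.inj _ fun f hf => ?_
    simp_all
  · rw [← sub_eq_zero]
    refine hL.inj _ fun f hf => ?_
    simp_all

end LieExistence


section CoordinateFunctions

lemma append_induction {n m : ℕ} {p : MvPolynomial (Fin (n + m)) ℂ → Prop}
    (hadd : ∀ F G, p F → p G → p (F + G))
    (hmul : ∀ A B, p (rename (Fin.castAdd m) A * rename (Fin.natAdd n) B)) (F) : p F := by
  have key : ∀ (s : Fin (n + m) →₀ ℕ) (a : ℂ), ∃ A B,
      monomial s a = rename (Fin.castAdd m) A * rename (Fin.natAdd n) B := fun s a => by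
    refine ⟨C a * ∏ i, X i ^ s (Fin.castAdd m i), ∏ i, X i ^ s (Fin.natAdd n i), ?_⟩
    rw [monomial_eq, Finsupp.prod_fintype _ _ fun _ => pow_zero _, Fin.prod_univ_add]
    simp [mul_assoc]
  refine MvPolynomial.induction_on' F (fun s a => ?_) hadd
  obtain ⟨A, B, h⟩ := key s a
  exact h ▸ hmul A B

lemma eval_eq_eval_bind₁ {n m : ℕ} {z : Pt m} {w : Pt n} {Q : Fin n → MvPolynomial (Fin m) ℂ}
    (h : ∀ i, w i = eval z (Q i)) (P : MvPolynomial (Fin n) ℂ) :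
    eval w P = eval z (bind₁ Q P) := by
  rw [show w = fun i => eval z (Q i) from funext h]
  exact (eval₂Hom_bind₁ (RingHom.id ℂ) z Q P).symm

namespace AffAlgGroup

variable {G H : AffAlgGroup}

/-- The coordinates of a point. -/
def pt (x : G.Gp) : Pt G.n := x.1

/-- The element of the group of points with given coordinates. -/
def ofPt (x : Pt G.n) (hx : x ∈ G.carrier) : G.Gp := ⟨x, hx⟩

lemma pt_mem (x : G.Gp) : pt x ∈ G.carrier := x.2

@[simp] lemma pt_ofPt {x : Pt G.n} (hx : x ∈ G.carrier) : pt (ofPt x hx) = x := rfl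

lemma pt_injective {x y : G.Gp} (h : pt x = pt y) : x = y := Subtype.ext h

lemma pt_mul (x y : G.Gp) : pt (x * y) = G.mul (pt x) (pt y) := rfl

/-- The coordinate functions. -/
def cd (i : Fin G.n) : G.Gp → ℂ := fun x => pt x i

/-- The functions obtained by evaluating polynomials along a map to affine space. -/
def evalFn {X : Type} {n : ℕ} (p : X → Pt n) : FnAlg X where
  carrier := {f | ∃ P, ∀ x, f x = eval (p x) P}
  mul_mem' := fun ⟨P, hP⟩ ⟨Q, hQ⟩ => ⟨P * Q, fun x => by simp [hP, hQ]⟩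
  add_mem' := fun ⟨P, hP⟩ ⟨Q, hQ⟩ => ⟨P + Q, fun x => by simp [hP, hQ]⟩
  algebraMap_mem' c := ⟨C c, fun x => by simp⟩

lemma mem_evalFn {X : Type} {n : ℕ} {p : X → Pt n} {f : X → ℂ} :
    f ∈ evalFn p ↔ ∃ P, ∀ x, f x = eval (p x) P := Iff.rfl

/-- The algebra of regular functions on the group of points. -/
def reg (G : AffAlgGroup) : FnAlg G.Gp := evalFn pt

lemma mem_reg {f : G.Gp → ℂ} : f ∈ G.reg ↔ ∃ P, ∀ x, f x = eval (pt x) P := Iff.rfl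

lemma eval_mem_reg (P) : (fun x : G.Gp => eval (pt x) P) ∈ G.reg := mem_reg.2 ⟨P, fun _ => rfl⟩

lemma cd_mem (i) : G.cd i ∈ G.reg := mem_reg.2 ⟨X i, fun x => by simp [cd]⟩

/-- The restriction of polynomials to the group. -/
def polyReg (G : AffAlgGroup) : MvPolynomial (Fin G.n) ℂ →ₐ[ℂ] G.reg := aeval fun i => ⟨cd i, cd_mem i⟩

lemma polyReg_eq {P} {f : G.reg} (h : ∀ x, f.1 x = eval (pt x) P) : G.polyReg P = f := by
  apply Subtype.ext
  funext x
  have : ((Pi.evalAlgHom ℂ (fun _ => ℂ) x).comp G.reg.val).comp G.polyReg = aeval (pt x) :=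
    MvPolynomial.algHom_ext fun i => by simp [polyReg, cd]
  exact (DFunLike.congr_fun this P).trans (h x).symm

lemma eval_append (x : G.Gp) (y : H.Gp) (A B) : eval (Fin.append (pt x) (pt y))
    (rename (Fin.castAdd H.n) A * rename (Fin.natAdd G.n) B) = eval (pt x) A * eval (pt y) B := by
  rw [_root_.map_mul, eval_rename, eval_rename]
  congr 3 <;> funext i <;> simp

lemma mem_biReg {F : G.Gp → H.Gp → ℂ} :
    F ∈ biReg G.reg H.reg ↔ ∃ P, ∀ x y, F x y = eval (Fin.append (pt x) (pt y)) P := by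
  refine ⟨fun hF => ?_, fun ⟨P, hP⟩ => ?_⟩
  · refine biReg_induction (p := fun F => ∃ P, ∀ x y, F x y = eval (Fin.append (pt x) (pt y)) P)
      ?_ ⟨0, by simp⟩ ?_ hF
    · intro a ha b hb
      obtain ⟨A, hA⟩ := mem_reg.1 ha
      obtain ⟨B, hB⟩ := mem_reg.1 hb
      exact ⟨_, fun x y => by rw [eval_append, ← hA, ← hB]⟩
    · rintro F F' - - ⟨P, hP⟩ ⟨Q, hQ⟩
      exact ⟨P + Q, fun x y => by simp [hP, hQ]⟩
  · rw [show F = fun x y => eval (Fin.append (pt x) (pt y)) P from funext₂ hP]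
    refine append_induction (p := fun P => (fun x (y : H.Gp) =>
      eval (Fin.append (pt x) (pt y)) P) ∈ biReg G.reg H.reg) ?_ ?_ P
    · intro P Q hP hQ
      simp only [_root_.map_add]
      exact Submodule.add_mem _ hP hQ
    · intro A B
      simp only [eval_append]
      exact biReg_of_mul (eval_mem_reg A) (eval_mem_reg B)

lemma comp_mem_evalFn {X : Type} {n : ℕ} {p : X → Pt n} {α : X → H.Gp}
    (hα : ∀ i, cd i ∘ α ∈ evalFn p) {f} (hf : f ∈ H.reg) : f ∘ α ∈ evalFn p := by
  obtain ⟨P, hP⟩ := mem_reg.1 hf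
  choose Q hQ using fun i => mem_evalFn.1 (hα i)
  exact ⟨bind₁ Q P, fun x => (hP _).trans (eval_eq_eval_bind₁ (fun i => hQ i x) P)⟩

lemma comp_mem_reg {α : G.Gp → H.Gp} (hα : ∀ i, cd i ∘ α ∈ G.reg) {f} (hf : f ∈ H.reg) :
    f ∘ α ∈ G.reg := comp_mem_evalFn hα hf

lemma comp_mem_biReg {K : AffAlgGroup} {α : G.Gp → K.Gp → H.Gp}
    (hα : ∀ i, (fun x y => cd i (α x y)) ∈ biReg G.reg K.reg) {f} (hf : f ∈ H.reg) :
    (fun x y => f (α x y)) ∈ biReg G.reg K.reg := by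
  obtain ⟨P, hP⟩ := mem_reg.1 hf
  choose Q hQ using fun i => mem_biReg.1 (hα i)
  exact mem_biReg.2
    ⟨bind₁ Q P, fun x y => (hP _).trans (eval_eq_eval_bind₁ (fun i => hQ i x y) P)⟩

lemma biReg_of_isRegularOn {K : AffAlgGroup} {V} {α : Pt (G.n + K.n) → Pt H.n}
    (h : IsRegularOn V α) {β : G.Gp → K.Gp → H.Gp} (hV : ∀ x y, Fin.append (pt x) (pt y) ∈ V)
    (hβ : ∀ x y, α (Fin.append (pt x) (pt y)) = pt (β x y)) (i) :
    (fun x y => cd i (β x y)) ∈ biReg G.reg K.reg := by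
  obtain ⟨Q, hQ⟩ := h
  exact mem_biReg.2 ⟨Q i, fun x y => by rw [← hQ _ (hV x y), hβ, cd]⟩

lemma left_append {n m : ℕ} (x : Pt n) (y : Pt m) : Pt.left (Fin.append x y) = x :=
  funext fun _ => Fin.append_left _ _ _

lemma right_append {n m : ℕ} (x : Pt n) (y : Pt m) : Pt.right (Fin.append x y) = y :=
  funext fun _ => Fin.append_right _ _ _

lemma isAlgGrpFn (G : AffAlgGroup) : IsAlgGrpFn G.reg where
  fg := (Subalgebra.fg_iff_finiteType _).2 (.of_surjective G.polyReg fun f =>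
    f.2.imp fun _ => polyReg_eq)
  comul f hf := comp_mem_biReg (biReg_of_isRegularOn G.mul_regular
    (fun x y => by
      rw [Set.mem_setOf_eq, left_append, right_append]
      exact ⟨pt_mem x, pt_mem y⟩)
    (fun x y => by rw [left_append, right_append, pt_mul])) hf
  inv f hf := by
    obtain ⟨Q, hQ⟩ := G.inv_regular
    exact comp_mem_reg (α := fun x => x⁻¹) (fun i => mem_reg.2 ⟨Q i, fun x => hQ _ x.2 i⟩) hf
  sep x y h := pt_injective (funext fun i => h _ (cd_mem i))
  pts p := by
    obtain ⟨Z, hZ⟩ := G.isAlgebraic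
    let z : Pt G.n := fun i => p ⟨G.cd i, cd_mem i⟩
    have key : ∀ P, p (G.polyReg P) = eval z P := fun P => by
      have : p.comp G.polyReg = aeval z := MvPolynomial.algHom_ext fun i => by simp [polyReg, z]
      exact DFunLike.congr_fun this P
    have hz : z ∈ G.carrier := by
      rw [hZ]
      intro P hP
      rw [← key, polyReg_eq, map_zero]
      intro x
      have hx := pt_mem x
      rw [hZ] at hx
      exact (hx P hP).symm
    refine ⟨ofPt z hz, fun f => ?_⟩
    obtain ⟨P, hP⟩ := mem_reg.1 f.2
    rw [hP, pt_ofPt, ← key, polyReg_eq hP]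

lemma IsConnected.isConnFn (h : G.IsConnected) : IsConnFn G.reg := by
  intro S T hS hT hcov hdis
  have key : ∀ S : Set (G.Gp → ℂ), S ⊆ G.reg → ∃ V, IsAlgebraicSet V ∧
      ∀ x, pt x ∈ V ↔ ∀ f ∈ S, f x = 0 := fun S hS => by
    refine ⟨_, ⟨{P | (fun x => eval (pt x) P) ∈ S}, rfl⟩, fun x => ⟨fun hx f hf => ?_,
      fun hx P hP => hx _ hP⟩⟩
    obtain ⟨P, hP⟩ := mem_reg.1 (hS hf)
    rw [hP]
    exact hx P (by rwa [Set.mem_setOf_eq, ← funext hP])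
  obtain ⟨V, hV, hVS⟩ := key S hS
  obtain ⟨W, hW, hWT⟩ := key T hT
  refine (h V W hV hW (fun x hx => ?_) ?_).imp (fun hc x => (hVS x).1 (hc (pt_mem x)))
    fun hc x => (hWT x).1 (hc (pt_mem x))
  · exact (hcov (ofPt x hx)).imp (hVS _).2 (hWT _).2
  · rw [Set.eq_empty_iff_forall_notMem]
    rintro x ⟨hx, hxV, hxW⟩
    exact hdis (ofPt x hx) ((hVS _).1 hxV) ((hWT _).1 hxW)

end AffAlgGroup

end CoordinateFunctions


section TangentVectors

lemma pderiv_natAdd_rename {n m : ℕ} (k : Fin m) (A : MvPolynomial (Fin n) ℂ) :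
    pderiv (Fin.natAdd n k) (rename (Fin.castAdd m) A) = 0 := by
  refine pderiv_eq_zero_of_notMem_vars fun h => ?_
  obtain ⟨i, -, hi⟩ := Finset.mem_image.1 (vars_rename _ _ h)
  exact absurd (congrArg Fin.val hi) (by simp; omega)

lemma pderiv_castAdd_rename {n m : ℕ} (k : Fin n) (A : MvPolynomial (Fin m) ℂ) :
    pderiv (Fin.castAdd m k) (rename (Fin.natAdd n) A) = 0 := by
  refine pderiv_eq_zero_of_notMem_vars fun h => ?_
  obtain ⟨i, -, hi⟩ := Finset.mem_image.1 (vars_rename _ _ h)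
  exact absurd (congrArg Fin.val hi) (by simp; omega)

namespace AffAlgGroup

variable {G H : AffAlgGroup} {X : FnDual G.Gp} (hX : IsPD G.reg X)
include hX

lemma pd_eval (P) :
    X (fun x => eval (pt x) P) = ∑ j, X (cd j) * eval G.one (pderiv j P) := by
  induction P using MvPolynomial.induction_on with
  | C a =>
    simp only [eval_C, pderiv_C, map_zero, mul_zero, Finset.sum_const_zero]
    rw [show (fun _ : G.Gp => a) = a • 1 by funext; simp, map_smul, hX.map_one, smul_zero]
  | add P Q hP hQ =>
    simp only [_root_.map_add, mul_add, Finset.sum_add_distrib, ← hP, ← hQ]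
    exact _root_.map_add X _ _
  | mul_X P i hP =>
    have e : (fun x : G.Gp => eval (pt x) (P * MvPolynomial.X i)) =
        (fun x => eval (pt x) P) * cd i := by funext x; simp [cd]
    rw [e, hX _ (eval_mem_reg P) _ (cd_mem i), hP]
    simp only [Derivation.leibniz, smul_eq_mul, _root_.map_add, _root_.map_mul, eval_X, mul_add,
      Finset.sum_add_distrib, pderiv_X, Finset.mul_sum]
    congr 1
    · rw [Finset.sum_eq_single i (fun j _ hj => by grind) (by simp)]
      simp [mul_comm]
      exact Or.inl rfl
    · exact Finset.sum_congr rfl fun j _ => by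
        show G.one i * _ = _
        ring

lemma pd_mixed {Y : FnDual H.Gp} (hY : IsPD H.reg Y) (F) :
    X (fun x => Y fun y => eval (Fin.append (pt x) (pt y)) F) =
      ∑ j, ∑ k, X (cd j) * Y (cd k) * eval (Fin.append G.one H.one)
        (pderiv (Fin.castAdd H.n j) (pderiv (Fin.natAdd G.n k) F)) := by
  refine append_induction (p := fun F => X (fun x => Y fun y => eval (Fin.append (pt x) (pt y)) F) =
      ∑ j, ∑ k, X (cd j) * Y (cd k) * eval (Fin.append G.one H.one)
        (pderiv (Fin.castAdd H.n j) (pderiv (Fin.natAdd G.n k) F))) ?_ ?_ F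
  · intro P Q hP hQ
    simp only [_root_.map_add, mul_add, Finset.sum_add_distrib, ← hP, ← hQ]
    rw [← _root_.map_add X]
    congr 1
    funext x
    exact _root_.map_add Y _ _
  · intro A B
    have e : (fun x : G.Gp => Y fun y => eval (Fin.append (pt x) (pt y))
        (rename (Fin.castAdd H.n) A * rename (Fin.natAdd G.n) B)) =
        Y (fun y => eval (pt y) B) • fun x => eval (pt x) A := by
      funext x
      simp only [eval_append]
      exact (map_smul Y (eval (pt x) A) fun y => eval (pt y) B).trans (mul_comm _ _)
    rw [e, map_smul, pd_eval hX, pd_eval hY, smul_eq_mul, mul_comm, Finset.sum_mul_sum]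
    refine Finset.sum_congr rfl fun j _ => Finset.sum_congr rfl fun k _ => ?_
    have := eval_append (1 : G.Gp) (1 : H.Gp) (pderiv j A) (pderiv k B)
    have e2 : pderiv (Fin.castAdd H.n j) (pderiv (Fin.natAdd G.n k)
        (rename (Fin.castAdd H.n) A * rename (Fin.natAdd G.n) B)) =
        rename (Fin.castAdd H.n) (pderiv j A) * rename (Fin.natAdd G.n) (pderiv k B) := by
      rw [Derivation.leibniz, pderiv_natAdd_rename, smul_zero, add_zero,
        pderiv_rename (Fin.natAdd_injective _ _), smul_eq_mul, Derivation.leibniz,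
        pderiv_castAdd_rename, smul_zero, zero_add, pderiv_rename (Fin.castAdd_injective _ _),
        smul_eq_mul, mul_comm]
    rw [show Fin.append G.one H.one = Fin.append (pt (1 : G.Gp)) (pt (1 : H.Gp)) from rfl, e2, this]
    show _ * eval G.one _ * (_ * eval H.one _) = _ * (eval G.one _ * eval H.one _)
    ring

lemma pd_eq_of_cd {Y : FnDual G.Gp} (hY : IsPD G.reg Y) (h : ∀ i, X (cd i) = Y (cd i))
    {f} (hf : f ∈ G.reg) : X f = Y f := by
  obtain ⟨P, hP⟩ := mem_reg.1 hf
  rw [show f = fun x => eval (pt x) P from funext hP, pd_eval hX, pd_eval hY]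
  simp only [h]

lemma pd_mem_tangentAt : (fun i => X (cd i)) ∈ tangentAt G.carrier G.one := by
  intro P hP
  have e : (fun x => eval (pt x) P) = fun _ => 0 := by
    funext x
    exact hP _ (pt_mem x)
  have h := pd_eval hX P
  rw [e] at h
  exact h.symm.trans (map_zero X)

omit hX in
lemma exists_der {V : Type} [AddCommGroup V] [Module ℂ V] {e : V ⊸ Pt G.n}
    (hinj : Function.Injective e) (hr : ∀ v, (∃ u, e u = v) ↔ v ∈ tangentAt G.carrier G.one) :
    ∃ der : V ⊸ FnDual G.Gp, (∀ u, IsPD G.reg (der u)) ∧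
      (∀ X, IsPD G.reg X → ∃ u, ∀ f ∈ G.reg, der u f = X f) ∧
      (∀ u, (∀ f ∈ G.reg, der u f = 0) → u = 0) ∧ ∀ u i, der u (cd i) = e u i := by
  obtain ⟨P, hP⟩ := (Subalgebra.toSubmodule G.reg).subtype.exists_leftInverse_of_injective
    (LinearMap.ker_eq_bot.2 Subtype.val_injective)
  obtain ⟨T, hT⟩ := G.polyReg.toLinearMap.exists_rightInverse_of_surjective
    (LinearMap.range_eq_top.2 fun f => f.2.imp fun _ => polyReg_eq)
  let der : V ⊸ FnDual G.Gp := LinearMap.mk₂ ℂ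
    (fun u f => ∑ j, e u j * eval G.one (pderiv j (T (P f : G.reg))))
    (fun u v f => by simp [add_mul, Finset.sum_add_distrib])
    (fun c u f => by simp [mul_assoc, Finset.mul_sum])
    (fun u f g => by simp [mul_add, Finset.sum_add_distrib])
    (fun c u f => by simp [Finset.mul_sum]; grind)
  have hder : ∀ u Q, der u (fun x => eval (pt x) Q) = ∑ j, e u j * eval G.one (pderiv j Q) := by
    intro u Q
    have h1 : G.polyReg (T (P fun x => eval (pt x) Q : G.reg)) = G.polyReg Q := by
      rw [show (P fun x => eval (pt x) Q : G.reg) = ⟨_, eval_mem_reg Q⟩ from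
        LinearMap.congr_fun hP (⟨_, eval_mem_reg Q⟩ : Subalgebra.toSubmodule G.reg),
        polyReg_eq (P := Q) (f := ⟨_, eval_mem_reg Q⟩) fun _ => rfl]
      exact LinearMap.congr_fun hT _
    have h2 := (hr _).1 ⟨u, rfl⟩ (T (P fun x => eval (pt x) Q : G.reg) - Q) fun x hx => by
      have := polyReg_eq (P := T (P fun x => eval (pt x) Q : G.reg) - Q)
        (f := ⟨_, eval_mem_reg _⟩) fun _ => rfl
      rw [map_sub, h1, sub_self] at this
      exact (congrFun (congrArg Subtype.val this) (ofPt x hx)).symm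
    simp only [map_sub, mul_sub, Finset.sum_sub_distrib] at h2
    exact sub_eq_zero.1 h2
  have hcd : ∀ u i, der u (cd i) = e u i := fun u i => by
    rw [show cd i = fun x : G.Gp => eval (pt x) (MvPolynomial.X i) by funext; simp [cd], hder,
      Finset.sum_eq_single i (fun j _ hj => by simp_all) (by simp)]
    simp
  have hpd : ∀ u, IsPD G.reg (der u) := by
    intro u f hf g hg
    obtain ⟨A, hA⟩ := mem_reg.1 hf
    obtain ⟨B, hB⟩ := mem_reg.1 hg
    rw [show f * g = fun x => eval (pt x) (A * B) by funext x; simp [hA, hB], hder, hA, hB,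
      show f = fun x => eval (pt x) A from funext hA, show g = fun x => eval (pt x) B from funext hB,
      hder, hder]
    simp only [Derivation.leibniz, smul_eq_mul, _root_.map_add, _root_.map_mul, mul_add,
      Finset.sum_add_distrib, Finset.mul_sum]
    show _ = ∑ x, eval G.one A * _ + ∑ x, eval G.one B * _
    simp only [mul_left_comm]
  refine ⟨der, hpd, fun X hX => ?_, fun u hu => ?_, hcd⟩
  · obtain ⟨u, hu⟩ := (hr _).2 (pd_mem_tangentAt hX)
    exact ⟨u, fun f hf => pd_eq_of_cd (hpd u) hX (fun i => by rw [hcd, hu]) hf⟩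
  · refine hinj ?_
    rw [map_zero]
    funext i
    rw [← hcd, hu _ (cd_mem i)]
    rfl

end AffAlgGroup

lemma IsLieFn.der_commutator {Γ 𝔤 : Type} [Group Γ] [LieRing 𝔤] [LieAlgebra ℂ 𝔤]
    {R : FnAlg Γ} {der : 𝔤 ⊸ FnDual Γ} (hL : IsLieFn R 𝔤 der)
    (hR : IsHopfFn R) (u v : 𝔤) {f : Γ → ℂ} (hf : f ∈ R) :
    der u (fun x => der v fun y => f (x * y * (x⁻¹ * y⁻¹))) = der ⁅u, v⁆ f := by
  have _ := hL.finite hR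
  obtain ⟨Ad, h1, -, -, -, h2⟩ := exists_adjoint hR hL
  obtain ⟨n, a, b, ha, hb, hab⟩ := biReg_expand (hR.comul f hf)
  have key : ∀ x, der v (fun y => f (x * y * (x⁻¹ * y⁻¹))) =
      der v (fun y => f (x * y * x⁻¹)) + der v (fun y => f y⁻¹) := fun x => by
    have e1 : (fun y => f (x * y * (x⁻¹ * y⁻¹))) =
        ∑ i, (fun y => a i (x * y * x⁻¹)) * fun y => b i y⁻¹ := by
      funext y
      rw [← mul_assoc, hab, Finset.sum_apply]
      rfl
    have e2 : (fun y => f (x * y * x⁻¹)) = ∑ i, b i 1 • fun y => a i (x * y * x⁻¹) := by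
      funext y
      rw [← mul_one (x * y * x⁻¹), hab, Finset.sum_apply]
      simp [mul_comm]
    have e3 : (fun y => f y⁻¹) = ∑ i, a i 1 • fun y => b i y⁻¹ := by
      funext y
      rw [← one_mul y⁻¹, hab, Finset.sum_apply]
      simp
    rw [e1, e2, e3]
    simp only [map_sum, map_smul, hL.pd v _ (hR.conj_mem x (ha _)) _ (hR.inv _ (hb _)),
      Finset.sum_add_distrib, smul_eq_mul, mul_one, inv_one, mul_inv_cancel]
    grind
  have e4 : (fun x => der v fun y => f (x * y * (x⁻¹ * y⁻¹))) =
      (fun x => der v fun y => f (x * y * x⁻¹)) + der v (fun y => f y⁻¹) • 1 := by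
    funext x
    simp [key]
  rw [e4, _root_.map_add, map_smul, (hL.pd u).map_one, smul_zero, add_zero, ← h2]
  refine Eq.trans ?_ (dual_vext (der u) (fun x => Ad x v) (LinearMap.flip der f)).symm
  exact congrArg _ (funext fun x => (h1 x v f hf).symm)

namespace AffAlgGroup

variable {G : AffAlgGroup} {𝔤 : Type} [LieRing 𝔤] [LieAlgebra ℂ 𝔤]

lemma commutator_apply {F} (hF : IsCommutatorRep G F) (i) (x y : G.Gp) :
    cd i (x * y * (x⁻¹ * y⁻¹)) = eval (Fin.append (pt x) (pt y)) (F i) :=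
  hF _ (pt_mem x) _ (pt_mem y) i

lemma isLieAlgebraOf {der : 𝔤 ⊸ FnDual G.Gp} (hL : IsLieFn G.reg 𝔤 der) :
    IsLieAlgebraOf G 𝔤 (LinearMap.pi fun i => LinearMap.flip der (cd i)) where
  inj := by
    refine (injective_iff_map_eq_zero _).2 fun u hu => hL.inj u fun f hf => ?_
    exact pd_eq_of_cd (hL.pd u) (Y := 0) (fun _ _ _ _ => by simp) (congrFun hu) hf
  range_eq v := by
    refine ⟨?_, fun hv => ?_⟩
    · rintro ⟨u, rfl⟩
      exact pd_mem_tangentAt (hL.pd u)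
    · obtain ⟨der', h1, h2, -, h4⟩ := exists_der
        (e := (tangentAt G.carrier G.one).subtype) Subtype.val_injective
        fun v => ⟨fun ⟨u, hu⟩ => hu ▸ u.2, fun hv => ⟨⟨v, hv⟩, rfl⟩⟩
      obtain ⟨u, hu⟩ := hL.full _ (h1 ⟨v, hv⟩)
      exact ⟨u, funext fun i => (hu _ (cd_mem i)).trans (h4 _ i)⟩
  bracket_eq F hF u v i := by
    refine Eq.trans ?_ (pd_mixed (hL.pd u) (hL.pd v) (F i))
    refine (hL.der_commutator G.isAlgGrpFn.toIsHopfFn u v (cd_mem i)).symm.trans ?_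
    simp only [commutator_apply hF]

lemma exists_isLieFn {e : 𝔤 ⊸ Pt G.n} (h : IsLieAlgebraOf G 𝔤 e) :
    ∃ der : 𝔤 ⊸ FnDual G.Gp, IsLieFn G.reg 𝔤 der ∧ ∀ u i, der u (cd i) = e u i := by
  obtain ⟨der, h1, h2, h3, h4⟩ := exists_der h.inj h.range_eq
  have hR := G.isAlgGrpFn.toIsHopfFn
  obtain ⟨der₀, hL⟩ := hR.exists_isLieFn
  refine ⟨der, ⟨h1, h2, h3, fun u v f hf => ?_⟩, h4⟩
  obtain ⟨D, hD⟩ := hL.full _ (h1 u)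
  obtain ⟨D', hD'⟩ := hL.full _ (h1 v)
  have e1 : ∀ {D : leftInvDer G.reg} {u}, (∀ f ∈ G.reg, der₀ D f = der u f) → ∀ f ∈ G.reg,
      linv (der u) f = linv (der₀ D) f := fun hD f hf =>
    funext fun x => (hD _ (hR.left_translate hf x)).symm
  rw [e1 hD f hf, e1 hD' f hf, ← hD _ (hR.linv_mem _ hf), ← hD' _ (hR.linv_mem _ hf),
    ← hL.lie D D' f hf]
  refine pd_eq_of_cd (h1 _) (hL.pd _) (fun i => ?_) hf
  obtain ⟨F, hF⟩ : ∃ F, IsCommutatorRep G F := by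
    have hc : ∀ i, (fun x y => cd i (x * y * (x⁻¹ * y⁻¹))) ∈ biReg G.reg G.reg := fun i => by
      obtain ⟨n, a, b, ha, hb, hab⟩ := biReg_expand (hR.comul _ (cd_mem i))
      have e : (fun x y => cd i (x * y * (x⁻¹ * y⁻¹))) =
          ∑ l, (fun x y => a l (x * y)) * fun x y => b l (x⁻¹ * y⁻¹) := by
        funext x y
        rw [hab]
        simp
      rw [e]
      exact Submodule.sum_mem _ fun l _ => biReg_mul (hR.comul _ (ha l))
        (biReg_comp (hR.comul _ (hb l)) hR.inv hR.inv)
    choose F hF using fun i => mem_biReg.1 (hc i)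
    exact ⟨F, fun x hx y hy i => hF i (ofPt x hx) (ofPt y hy)⟩
  rw [h4, h.bracket_eq F hF]
  refine Eq.trans ?_ ((isLieAlgebraOf hL).bracket_eq F hF D D' i).symm
  simp only [← h4, ← hD _ (cd_mem _), ← hD' _ (cd_mem _)]
  rfl

end AffAlgGroup

end TangentVectors


section Twist

namespace AffAlgGroup

/-- The affine algebraic group given by a group embedded in affine space. -/
def ofEmb {T : Type} [Group T] {n : ℕ} (p : T → Pt n) (hp : Function.Injective p)
    (halg : IsAlgebraicSet (Set.range p))
    (hmul : ∀ i, (fun z : T × T => p (z.1 * z.2) i) ∈ evalFn fun z => Fin.append (p z.1) (p z.2))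
    (hinv : ∀ i, (fun x => p x⁻¹ i) ∈ evalFn p) : AffAlgGroup where
  n := n
  carrier := Set.range p
  isAlgebraic := halg
  one := p 1
  one_mem := ⟨1, rfl⟩
  mul z w := p (Function.invFun p z * Function.invFun p w)
  inv z := p (Function.invFun p z)⁻¹
  mul_mem _ _ := ⟨_, rfl⟩
  inv_mem _ := ⟨_, rfl⟩
  mul_assoc' := by
    rintro _ _ _ ⟨x, rfl⟩ ⟨y, rfl⟩ ⟨z, rfl⟩
    simp only [Function.leftInverse_invFun hp _, mul_assoc]
  one_mul' := by
    rintro _ ⟨x, rfl⟩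
    simp only [Function.leftInverse_invFun hp _, one_mul]
  mul_one' := by
    rintro _ ⟨x, rfl⟩
    simp only [Function.leftInverse_invFun hp _, mul_one]
  inv_mul' := by
    rintro _ ⟨x, rfl⟩
    simp only [Function.leftInverse_invFun hp _, inv_mul_cancel]
  mul_regular := by
    choose Q hQ using fun i => mem_evalFn.1 (hmul i)
    refine ⟨Q, fun z hz i => ?_⟩
    obtain ⟨⟨x, hx⟩, y, hy⟩ := hz
    have e : z = Fin.append (p x) (p y) := by
      rw [hx, hy]
      exact (Fin.append_castAdd_natAdd (f := z)).symm
    show p (Function.invFun p z.left * Function.invFun p z.right) i = _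
    rw [← hx, ← hy, Function.leftInverse_invFun hp, Function.leftInverse_invFun hp, e]
    exact hQ i (x, y)
  inv_regular := by
    choose Q hQ using fun i => mem_evalFn.1 (hinv i)
    refine ⟨Q, ?_⟩
    rintro _ ⟨x, rfl⟩ i
    show p (Function.invFun p (p x))⁻¹ i = _
    rw [Function.leftInverse_invFun hp]
    exact hQ i x

end AffAlgGroup

open AffAlgGroup

variable {G A : AffAlgGroup}

lemma isAlgebraicSet_append {n m : ℕ} {V : Set (Pt n)} {W : Set (Pt m)} (hV : IsAlgebraicSet V)
    (hW : IsAlgebraicSet W) :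
    IsAlgebraicSet {z : Pt (n + m) | Pt.left z ∈ V ∧ Pt.right z ∈ W} := by
  obtain ⟨S, rfl⟩ := hV
  obtain ⟨T, rfl⟩ := hW
  refine ⟨rename (Fin.castAdd m) '' S ∪ rename (Fin.natAdd n) '' T, Set.ext fun z => ?_⟩
  simp only [Set.mem_setOf_eq, Set.mem_union, or_imp, forall_and, Set.forall_mem_image,
    eval_rename]
  exact Iff.rfl

/-- Data defining a twisted product of two algebraic groups. -/
structure TwistData (G A : AffAlgGroup) : Type where
  act : G.Gp → A.Gp → A.Gp
  c : G.Gp → G.Gp → A.Gp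
  act_reg : ∀ f ∈ A.reg, (fun g a => f (act g a)) ∈ biReg G.reg A.reg
  c_reg : ∀ f ∈ A.reg, (fun g h => f (c g h)) ∈ biReg G.reg G.reg
  act_one : ∀ a, act 1 a = a
  act_map_one : ∀ g, act g 1 = 1
  c_one_left : ∀ g, c 1 g = 1
  c_one_right : ∀ g, c g 1 = 1
  assoc : ∀ g h k a b, act g (a * act h b * c h k) * c g (h * k) =
    act g a * c g h * act (g * h) b * c (g * h) k

namespace TwistData

/-- The underlying set of a twisted product. -/
def T (_ : TwistData G A) : Type := A.Gp × G.Gp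

variable (D : TwistData G A)

instance : Group D.T where
  mul x y := (x.1 * D.act x.2 y.1 * D.c x.2 y.2, x.2 * y.2)
  one := (1, 1)
  inv x := ((D.act x.2⁻¹ x.1 * D.c x.2⁻¹ x.2)⁻¹, x.2⁻¹)
  mul_assoc x y z := Prod.ext (by
    show x.1 * D.act x.2 y.1 * D.c x.2 y.2 * D.act (x.2 * y.2) z.1 * D.c (x.2 * y.2) z.2 =
      x.1 * D.act x.2 (y.1 * D.act y.2 z.1 * D.c y.2 z.2) * D.c x.2 (y.2 * z.2)
    rw [mul_assoc x.1 (D.act x.2 (_ * _)), D.assoc]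
    simp only [mul_assoc]) (mul_assoc _ _ _)
  one_mul x := Prod.ext (by
    show 1 * D.act 1 x.1 * D.c 1 x.2 = x.1
    rw [D.act_one, D.c_one_left, one_mul, mul_one]) (one_mul _)
  mul_one x := Prod.ext (by
    show x.1 * D.act x.2 1 * D.c x.2 1 = x.1
    rw [D.act_map_one, D.c_one_right, mul_one, mul_one]) (mul_one _)
  inv_mul_cancel x := Prod.ext (by
    show (D.act x.2⁻¹ x.1 * D.c x.2⁻¹ x.2)⁻¹ * D.act x.2⁻¹ x.1 * D.c x.2⁻¹ x.2 = 1
    rw [mul_assoc, inv_mul_cancel]) (inv_mul_cancel _)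

/-- The coordinates of a point of the twisted product. -/
def emb (x : D.T) : Pt (A.n + G.n) := Fin.append (pt x.1) (pt x.2)

lemma emb_injective : Function.Injective D.emb := fun x y h => Prod.ext
  (pt_injective (by simpa only [emb, left_append] using congrArg Pt.left h))
  (pt_injective (by simpa only [emb, right_append] using congrArg Pt.right h))

variable {Ω : Type} {S : FnAlg Ω}

lemma mor_mul {H : AffAlgGroup} {α β : Ω → H.Gp} (hα : ∀ f ∈ H.reg, f ∘ α ∈ S)
    (hβ : ∀ f ∈ H.reg, f ∘ β ∈ S) (f) (hf : f ∈ H.reg) : (f ∘ fun x => α x * β x) ∈ S :=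
  biReg_diag (F := fun x y => f (α x * β y)) (biReg_comp (H.isAlgGrpFn.comul f hf) hα hβ) le_rfl

lemma mor_biReg {H K L : AffAlgGroup} {α : Ω → H.Gp} {β : Ω → K.Gp} (hα : ∀ f ∈ H.reg, f ∘ α ∈ S)
    (hβ : ∀ f ∈ K.reg, f ∘ β ∈ S) {F : H.Gp → K.Gp → L.Gp}
    (hF : ∀ f ∈ L.reg, (fun x y => f (F x y)) ∈ biReg H.reg K.reg) (f) (hf : f ∈ L.reg) :
    (f ∘ fun x => F (α x) (β x)) ∈ S :=
  biReg_diag (F := fun x y => f (F (α x) (β y))) (biReg_comp (hF f hf) hα hβ) le_rfl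

lemma append_mem {α : Ω → A.Gp} {β : Ω → G.Gp} (hα : ∀ f ∈ A.reg, f ∘ α ∈ S)
    (hβ : ∀ f ∈ G.reg, f ∘ β ∈ S) (i) : (fun x => Fin.append (pt (α x)) (pt (β x)) i) ∈ S := by
  refine Fin.addCases (fun i => ?_) (fun i => ?_) i
  · simp only [Fin.append_left]
    exact hα _ (cd_mem i)
  · simp only [Fin.append_right]
    exact hβ _ (cd_mem i)

/-- The twisted product as an algebraic group. -/
def grp : AffAlgGroup :=
  ofEmb D.emb D.emb_injective
    (by
      convert isAlgebraicSet_append A.isAlgebraic G.isAlgebraic using 1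
      ext z
      refine ⟨?_, fun hz => ⟨(ofPt _ hz.1, ofPt _ hz.2), Fin.append_castAdd_natAdd (f := z)⟩⟩
      rintro ⟨x, rfl⟩
      simp only [emb, Set.mem_setOf_eq, left_append, right_append]
      exact ⟨pt_mem _, pt_mem _⟩)
    (by
      let p := fun z : D.T × D.T => Fin.append (D.emb z.1) (D.emb z.2)
      have h1 : ∀ f ∈ A.reg, (f ∘ fun z : D.T × D.T => z.1.1) ∈ evalFn p := fun f =>
        comp_mem_evalFn fun i => ⟨X (Fin.castAdd _ (Fin.castAdd _ i)), fun z => by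
          simp only [p, emb, cd, eval_X, Function.comp, Fin.append_left, Fin.append_right]⟩
      have h2 : ∀ f ∈ G.reg, (f ∘ fun z : D.T × D.T => z.1.2) ∈ evalFn p := fun f =>
        comp_mem_evalFn fun i => ⟨X (Fin.castAdd _ (Fin.natAdd _ i)), fun z => by
          simp only [p, emb, cd, eval_X, Function.comp, Fin.append_left, Fin.append_right]⟩
      have h3 : ∀ f ∈ A.reg, (f ∘ fun z : D.T × D.T => z.2.1) ∈ evalFn p := fun f =>
        comp_mem_evalFn fun i => ⟨X (Fin.natAdd _ (Fin.castAdd _ i)), fun z => by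
          simp only [p, emb, cd, eval_X, Function.comp, Fin.append_left, Fin.append_right]⟩
      have h4 : ∀ f ∈ G.reg, (f ∘ fun z : D.T × D.T => z.2.2) ∈ evalFn p := fun f =>
        comp_mem_evalFn fun i => ⟨X (Fin.natAdd _ (Fin.natAdd _ i)), fun z => by
          simp only [p, emb, cd, eval_X, Function.comp, Fin.append_left, Fin.append_right]⟩
      exact append_mem (mor_mul (mor_mul h1 (mor_biReg h2 h3 D.act_reg)) (mor_biReg h2 h4 D.c_reg))
        (mor_mul h2 h4))
    (by
      have h1 : ∀ f ∈ A.reg, (f ∘ fun z : D.T => z.1) ∈ evalFn D.emb := fun f =>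
        comp_mem_evalFn fun i => ⟨X (Fin.castAdd _ i), fun z => by simp [emb, cd]⟩
      have h2 : ∀ f ∈ G.reg, (f ∘ fun z : D.T => z.2) ∈ evalFn D.emb := fun f =>
        comp_mem_evalFn fun i => ⟨X (Fin.natAdd _ i), fun z => by simp [emb, cd]⟩
      have h3 : ∀ f ∈ G.reg, (f ∘ fun z : D.T => z.2⁻¹) ∈ evalFn D.emb := fun f hf =>
        h2 _ (G.isAlgGrpFn.inv f hf)
      exact append_mem (fun f hf => mor_mul (mor_biReg h3 h1 D.act_reg) (mor_biReg h3 h2 D.c_reg) _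
        (A.isAlgGrpFn.inv f hf)) h3)

/-- The point of the twisted product with given components. -/
def pnt (a : A.Gp) (g : G.Gp) : D.grp.Gp := ofPt (G := D.grp) (D.emb (a, g)) ⟨(a, g), rfl⟩

/-- The first component of a point of the twisted product. -/
def fst (x : D.grp.Gp) : A.Gp := (Function.invFun D.emb (pt x)).1

/-- The second component of a point of the twisted product. -/
def snd (x : D.grp.Gp) : G.Gp := (Function.invFun D.emb (pt x)).2

@[simp] lemma fst_pnt (a : A.Gp) (g : G.Gp) : D.fst (D.pnt a g) = a :=
  congrArg Prod.fst (Function.leftInverse_invFun D.emb_injective (a, g))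

@[simp] lemma snd_pnt (a : A.Gp) (g : G.Gp) : D.snd (D.pnt a g) = g :=
  congrArg Prod.snd (Function.leftInverse_invFun D.emb_injective (a, g))

lemma pnt_surj (x : D.grp.Gp) : ∃ a g, D.pnt a g = x := by
  obtain ⟨⟨a, g⟩, h⟩ := pt_mem x
  exact ⟨a, g, pt_injective h⟩

lemma pnt_mul (a a' : A.Gp) (g g' : G.Gp) :
    D.pnt a g * D.pnt a' g' = D.pnt (a * D.act g a' * D.c g g') (g * g') :=
  pt_injective (congrArg₂ (fun x y => D.emb (x * y))
    (Function.leftInverse_invFun D.emb_injective _) (Function.leftInverse_invFun D.emb_injective _))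

lemma mem_grp_reg {f : D.grp.Gp → ℂ} :
    f ∈ D.grp.reg ↔ (fun a g => f (D.pnt a g)) ∈ biReg A.reg G.reg := by
  rw [mem_reg, mem_biReg]
  refine exists_congr fun P => ⟨fun h a g => h _, fun h x => ?_⟩
  obtain ⟨a, g, rfl⟩ := D.pnt_surj x
  exact h a g

end TwistData

end Twist


section Levi

open AffAlgGroup

variable {G H : AffAlgGroup}

lemma IsUnitriangular.det {m : ℕ} {x : Pt (m * m)} (h : IsUnitriangular m x) :
    (Matrix.of (matEntry x)).det = 1 := by
  rw [Matrix.det_of_upperTriangular (M := Matrix.of (matEntry x)) fun i j hij => h.2 i j hij]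
  exact Finset.prod_eq_one fun i _ => h.1 i

lemma AffAlgGroup.IsUnipotent.exists_matrix (h : G.IsUnipotent) :
    ∃ (m : ℕ) (φ : G.Gp →* Matrix (Fin m) (Fin m) ℂ), (∀ i j, (fun x => φ x i j) ∈ G.reg) ∧
      Function.Injective φ ∧ (∀ x i, φ x i i = 1) ∧ ∀ x i j, j < i → φ x i j = 0 := by
  obtain ⟨m, φ, ⟨P, hP⟩, hinj, hut, hmul⟩ := h
  let ψ : G.Gp → Matrix (Fin m) (Fin m) ℂ := fun x => Matrix.of (matEntry (φ (pt x)))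
  have hψ : ∀ x y, ψ (x * y) = ψ x * ψ y := fun x y => by
    ext i j
    show matEntry (φ (pt (x * y))) i j = _
    rw [pt_mul, hmul _ (pt_mem x) _ (pt_mem y), Matrix.mul_apply]
    simp only [matEntry, matMulPt, Equiv.symm_apply_apply]
    rfl
  have h1 : ψ 1 = 1 := by
    have hu := (Matrix.isUnit_iff_isUnit_det _).2 (by
      rw [(hut _ (pt_mem 1)).det]
      exact isUnit_one)
    refine hu.mul_left_cancel ?_
    rw [← hψ, mul_one, mul_one]
  refine ⟨m, { toFun := ψ, map_one' := h1, map_mul' := hψ }, fun i j => mem_reg.2 ⟨_, fun x =>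
    hP _ (pt_mem x) _⟩, fun x y hxy => pt_injective (hinj (pt_mem x) (pt_mem y) (funext fun k => ?_)),
    fun x => (hut _ (pt_mem x)).1, fun x => (hut _ (pt_mem x)).2⟩
  have := congrFun (congrFun hxy (finProdFinEquiv.symm k).1) (finProdFinEquiv.symm k).2
  simpa only [ψ, matEntry, MonoidHom.coe_mk, OneHom.coe_mk, Matrix.of_apply, Prod.mk.eta,
    Equiv.apply_symm_apply] using this

lemma AffAlgGroup.IsUnipotent.isPowPoly (h : G.IsUnipotent) : IsPowPoly G.reg := by
  obtain ⟨m, φ, h1, h2, h3, h4⟩ := h.exists_matrix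
  exact G.isAlgGrpFn.isPowPoly_of_unitriangular h1 h2 h3 h4

lemma AffAlgGroup.IsConnected.isDomain (h : G.IsConnected) : IsDomain G.reg :=
  G.isAlgGrpFn.isDomain_of_conn h.isConnFn

open Classical in
lemma AffAlgGroup.IsReductive.isRedFn (h : G.IsReductive) : IsRedFn G.reg := by
  intro K hK Z hZ hKZ hconn m ψ hψ hinj hdiag hlow
  have hinter : ∀ {z}, z ∈ pt '' (K : Set G.Gp) ↔ ∃ hz, ofPt z hz ∈ K := fun {z} =>
    ⟨fun ⟨x, hx, e⟩ => by subst e; exact ⟨pt_mem x, hx⟩, fun ⟨hz, h⟩ => ⟨_, h, rfl⟩⟩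
  let K' : AlgSubgroup G :=
    { carrier := pt '' (K : Set G.Gp)
      subset := by grind
      isAlgebraic := by
        obtain ⟨S, hS⟩ := G.isAlgebraic
        refine ⟨S ∪ {P | (fun x => eval (pt x) P) ∈ Z}, Set.ext fun z => ?_⟩
        rw [hinter]
        refine ⟨fun ⟨hz, hzK⟩ P hP => ?_, fun h => ?_⟩
        · rcases hP with hP | hP
          · grind
          · exact (hKZ _).1 hzK _ hP
        · have hz : z ∈ G.carrier := by grind
          refine ⟨hz, (hKZ _).2 fun f hf => ?_⟩
          obtain ⟨P, hP⟩ := mem_reg.1 (hZ hf)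
          rw [hP]
          exact h P (Or.inr (by
            rw [Set.mem_setOf_eq, ← show f = fun x => eval (pt x) P from funext hP]
            exact hf))
      one_mem := ⟨1, K.one_mem, rfl⟩
      mul_mem := by
        rintro _ _ ⟨x, hx, rfl⟩ ⟨y, hy, rfl⟩
        exact ⟨_, K.mul_mem hx hy, rfl⟩
      inv_mem := by
        rintro _ ⟨x, hx, rfl⟩
        exact ⟨_, K.inv_mem hx, rfl⟩ }
  have hK' : K'.carrier = {G.one} := by
    refine h K' ?_ ?_ ?_
    · rintro g hg _ ⟨x, hx, rfl⟩
      exact ⟨_, hK.conj_mem x hx (ofPt g hg), by rw [mul_assoc]; rfl⟩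
    · rintro V W ⟨S, rfl⟩ ⟨T, rfl⟩ hcov hdisj
      let r : Set (MvPolynomial (Fin G.n) ℂ) → Set (K → ℂ) := fun S =>
        (fun P x => eval (pt x.1) P) '' S
      have hr : ∀ S, r S ⊆ pullFn K.subtype G.reg := by
        rintro S _ ⟨P, -, rfl⟩
        exact ⟨_, eval_mem_reg P, rfl⟩
      have hmem : ∀ (S : Set (MvPolynomial (Fin G.n) ℂ)) (x : K), (∀ f ∈ r S, f x = 0) ↔
          pt x.1 ∈ {z : Pt G.n | ∀ P ∈ S, eval z P = 0} := fun S x => by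
        simp only [r, Set.forall_mem_image, Set.mem_setOf_eq]
      refine (hconn (r S) (r T) (hr S) (hr T) (fun x => ?_) fun x h1 h2 => ?_).imp ?_ ?_
      · exact (hcov ⟨x.1, x.2, rfl⟩).imp (hmem S x).2 (hmem T x).2
      · exact (Set.eq_empty_iff_forall_notMem.1 hdisj) _
          ⟨⟨x.1, x.2, rfl⟩, (hmem S x).1 h1, (hmem T x).1 h2⟩
      all_goals
        rintro hx _ ⟨x, hxK, rfl⟩
        exact (hmem _ ⟨x, hxK⟩).1 (hx _)
    · choose Q hQ using fun i j => mem_pullFn.1 (hψ i j)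
      choose P hP using fun i j => mem_reg.1 (hQ i j).1
      have hPψ : ∀ i j x, eval (pt x.1) (P i j) = ψ x i j := fun i j x => by
        rw [← hP, ← congrFun (hQ i j).2 x]
        rfl
      let φ : Pt G.n → Pt (m * m) := fun z k =>
        eval z (P (finProdFinEquiv.symm k).1 (finProdFinEquiv.symm k).2)
      have hφ : ∀ i j x, matEntry (φ (pt x.1)) i j = ψ x i j := fun i j x => by
        simp only [matEntry, φ, Equiv.symm_apply_apply, hPψ]
      refine ⟨m, φ, ⟨_, fun _ _ _ => rfl⟩, ?_, ?_, ?_⟩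
      · rintro _ ⟨x, hx, rfl⟩ _ ⟨y, hy, rfl⟩ hxy
        have : (⟨x, hx⟩ : K) = ⟨y, hy⟩ := hinj (Matrix.ext fun i j => by grind)
        grind
      · rintro _ ⟨x, hx, rfl⟩
        exact ⟨fun i => (hφ i i ⟨x, hx⟩).trans (hdiag _ i),
          fun i j hij => (hφ i j ⟨x, hx⟩).trans (hlow _ i j hij)⟩
      · rintro _ ⟨x, hx, rfl⟩ _ ⟨y, hy, rfl⟩
        funext k
        have e := hPψ (finProdFinEquiv.symm k).1 (finProdFinEquiv.symm k).2 (⟨x, hx⟩ * ⟨y, hy⟩)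
        rw [_root_.map_mul, Matrix.mul_apply] at e
        refine e.trans (Finset.sum_congr rfl fun i _ => ?_)
        rw [← hφ, ← hφ]
  rw [eq_bot_iff]
  intro x hx
  have : pt x ∈ K'.carrier := ⟨x, hx, rfl⟩
  rw [hK'] at this
  exact pt_injective this

namespace AlgSubgroup

variable (K : AlgSubgroup G)

lemma pt_incl (x : K.toGrp.Gp) : pt (K.incl x) = pt x := rfl

lemma incl_injective : Function.Injective K.incl := fun x y h => pt_injective (by
  rw [← pt_incl, ← pt_incl, h])

lemma mem_toGrp_reg {f : K.toGrp.Gp → ℂ} : f ∈ K.toGrp.reg ↔ ∃ r ∈ G.reg, r ∘ K.incl = f := by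
  refine ⟨fun hf => ?_, ?_⟩
  · obtain ⟨P, hP⟩ := mem_reg.1 hf
    refine ⟨fun x => eval (pt x) P, eval_mem_reg (G := G) P, ?_⟩
    funext x
    exact (hP x).symm
  · rintro ⟨r, hr, rfl⟩
    obtain ⟨P, hP⟩ := mem_reg.1 hr
    exact mem_reg.2 ⟨P, fun x => hP _⟩

lemma isTangentTo {𝔤 : Type} [LieRing 𝔤] [LieAlgebra ℂ 𝔤] {e : 𝔤 ⊸ Pt G.n}
    {𝔥 : LieSubalgebra ℂ 𝔤} (h𝔥 : IsLieSubalgebraOf K e 𝔥)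
    {der : 𝔤 ⊸ FnDual G.Gp} (hL : IsLieFn G.reg 𝔤 der)
    (hd : ∀ u i, der u (cd i) = e u i) : IsTangentTo G.reg der K.incl 𝔥 := by
  intro u
  rw [h𝔥 u]
  have key : ∀ P, der u (fun x => eval (pt x) P) = ∑ j, e u j * eval G.one (pderiv j P) :=
    fun P => by simp only [pd_eval (hL.pd u), hd]
  refine ⟨fun h f hf h0 => ?_, fun h P hP => ?_⟩
  · obtain ⟨P, hP⟩ := mem_reg.1 hf
    rw [funext hP, key]
    refine h P fun x hx => ?_
    have e := hP (ofPt x (K.subset hx))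
    rw [pt_ofPt] at e
    rw [← e]
    exact congrFun h0 (ofPt x hx)
  · rw [← key]
    refine h _ (eval_mem_reg P) ?_
    funext x
    exact hP _ (pt_mem x)

end AlgSubgroup

lemma LeviDecomposition.exists_isLeviFn (LD : LeviDecomposition G) (hG : G.IsConnected) :
    ∃ prU prL, IsLeviFn G.reg LD.Gu.toGrp.reg LD.L.toGrp.reg LD.Gu.incl LD.L.incl prU prL := by
  set ιU := LD.Gu.incl with hιU
  set ιL := LD.L.incl with hιL
  have hUi : Function.Injective ιU := LD.Gu.incl_injective
  have hLi : Function.Injective ιL := LD.L.incl_injective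
  have hconj : ∀ l u, ∃ u', ιL l * ιU u * (ιL l)⁻¹ = ιU u' := fun l u =>
    ⟨ofPt _ (LD.Gu_radical.1 _ (pt_mem (ιL l)) _ (pt_mem u)),
      by rw [mul_assoc]; rfl⟩
  have hdec : ∀ x, ∃ u l, ιU u * ιL l = x := fun x => by
    obtain ⟨u, hu, l, hl, e⟩ := LD.decomp _ (pt_mem x)
    exact ⟨ofPt u hu, ofPt l hl, pt_injective e.symm⟩
  have huniq : ∀ u l u' l', ιU u * ιL l = ιU u' * ιL l' → u = u' ∧ l = l' := by
    intro u l u' l' h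
    have h1 : ιU (u'⁻¹ * u) = ιL (l' * l⁻¹) := by
      rw [map_mul, map_mul, map_inv, map_inv, inv_mul_eq_iff_eq_mul, ← mul_assoc, ← h,
        mul_inv_cancel_right]
    have h2 : pt (ιU (u'⁻¹ * u)) ∈ LD.Gu.carrier ∩ LD.L.carrier :=
      ⟨pt_mem (u'⁻¹ * u), by rw [h1]; exact pt_mem (l' * l⁻¹)⟩
    rw [LD.inter] at h2
    have h3 : ιU (u'⁻¹ * u) = 1 := pt_injective h2
    have hu : u'⁻¹ * u = 1 := hUi (h3.trans (map_one _).symm)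
    have hu : u = u' := (inv_mul_eq_one.1 hu).symm
    subst hu
    exact ⟨rfl, hLi (mul_left_cancel h)⟩
  choose act hact using hconj
  choose prU prL hpr using hdec
  have hmul : ∀ u l, prU (ιU u * ιL l) = u ∧ prL (ιU u * ιL l) = l := fun u l =>
    huniq _ _ _ _ (hpr _)
  have hRU : ∀ f ∈ G.reg, f ∘ ιU ∈ LD.Gu.toGrp.reg := fun f hf => LD.Gu.mem_toGrp_reg.2 ⟨f, hf, rfl⟩
  have hRL : ∀ f ∈ G.reg, f ∘ ιL ∈ LD.L.toGrp.reg := fun f hf => LD.L.mem_toGrp_reg.2 ⟨f, hf, rfl⟩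
  let D : TwistData LD.L.toGrp LD.Gu.toGrp :=
    { act := act
      c := 1
      act_reg := fun f hf => by
        obtain ⟨r, hr, rfl⟩ := LD.Gu.mem_toGrp_reg.1 hf
        have e : (fun g a => (r ∘ ιU) (act g a)) = fun g a => r (ιL g * ιU a * (ιL g)⁻¹) := by grind
        rw [e]
        exact biReg_comp (G.isAlgGrpFn.conj_biReg hr) hRL hRU
      c_reg := fun f hf => biReg_of_left (LD.L.toGrp.reg.algebraMap_mem (f 1))
      act_one := fun a => hUi (by rw [← hact]; simp)
      act_map_one := fun g => hUi (by rw [← hact]; simp)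
      c_one_left := fun _ => rfl
      c_one_right := fun _ => rfl
      assoc := fun g h k a b => hUi (by simp [← hact]; group) }
  let α : D.grp.Gp →* G.Gp := MonoidHom.mk' (fun x => ιU (D.fst x) * ιL (D.snd x)) fun x y => by
    obtain ⟨a, g, rfl⟩ := D.pnt_surj x
    obtain ⟨b, h, rfl⟩ := D.pnt_surj y
    have e : ιU (act g b) = _ := (hact g b).symm
    simp only [D.pnt_mul, D.fst_pnt, D.snd_pnt, map_mul]
    rw [show D.act = act from rfl, e, show D.c g h = 1 from rfl, map_one]
    group
  have hα : ∀ a g, α (D.pnt a g) = ιU a * ιL g := fun a g => by simp [α]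
  have hle : pullFn α G.reg ≤ D.grp.reg := by
    rintro _ ⟨r, hr, rfl⟩
    refine D.mem_grp_reg.2 ?_
    show (fun a g => r (α (D.pnt a g))) ∈ _
    simp only [hα]
    exact biReg_comp (G.isAlgGrpFn.comul r hr) hRU hRL
  have hsurj : Function.Surjective α := fun x => ⟨D.pnt (prU x) (prL x), (hα _ _).trans (hpr x)⟩
  have := hG.isDomain
  have : IsDomain (pullFn α G.reg) := by
    have : NoZeroDivisors (pullFn α G.reg) := ⟨by
      rintro ⟨_, r, hr, rfl⟩ ⟨_, s, hs, rfl⟩ h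
      have : (⟨r, hr⟩ : G.reg) * ⟨s, hs⟩ = 0 := Subtype.ext (funext fun x => by
        obtain ⟨y, rfl⟩ := hsurj x
        exact congrFun (congrArg Subtype.val h) y)
      exact (mul_eq_zero.1 this).imp (fun h => Subtype.ext (funext fun y =>
        congrFun (congrArg Subtype.val h) (α y))) fun h => Subtype.ext (funext fun y =>
        congrFun (congrArg Subtype.val h) (α y))⟩
    exact NoZeroDivisors.to_isDomain _
  have heq := IsAlgGrpFn.eq_of_sep (G.isAlgGrpFn.pull α) hle D.grp.isAlgGrpFn fun x y h => by
    have hxy : α x = α y := G.isAlgGrpFn.sep _ _ fun r hr => h _ (comp_mem_pullFn hr)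
    obtain ⟨a, g, rfl⟩ := D.pnt_surj x
    obtain ⟨b, k, rfl⟩ := D.pnt_surj y
    rw [hα, hα] at hxy
    obtain ⟨rfl, rfl⟩ := huniq _ _ _ _ hxy
    rfl
  have hext : ∀ f ∈ D.grp.reg, (fun x => f (D.pnt (prU x) (prL x))) ∈ G.reg := fun f hf => by
    rw [← heq] at hf
    obtain ⟨r, hr, rfl⟩ := mem_pullFn.1 hf
    have e : (fun x => (r ∘ α) (D.pnt (prU x) (prL x))) = r := by
      funext x
      exact congrArg r ((hα _ _).trans (hpr x))
    rw [e]
    exact hr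
  refine ⟨prU, prL, ⟨G.isAlgGrpFn.toIsHopfFn, LD.Gu.toGrp.isAlgGrpFn.toIsHopfFn,
    LD.L.toGrp.isAlgGrpFn.toIsHopfFn, LD.Gu_radical.2.1.isDomain, LD.L_connected.isDomain,
    LD.Gu_radical.2.2.1.isPowPoly, ⟨fun u => ?_, hRU, fun g hg => ?_⟩,
    ⟨fun l => ?_, hRL, fun g hg => ?_⟩, hpr, fun u l => (hmul u l).1, fun u l => (hmul u l).2,
    fun l u => ⟨_, hact l u⟩⟩⟩
  · simpa using (hmul u 1).1
  · have := hext (fun x => g (D.fst x)) (D.mem_grp_reg.2 (by simpa using biReg_of_left hg))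
    simp only [D.fst_pnt, D.snd_pnt] at this
    exact this
  · simpa using (hmul 1 l).2
  · have := hext (fun x => g (D.snd x)) (D.mem_grp_reg.2 (by simpa using biReg_of_right hg))
    simp only [D.fst_pnt, D.snd_pnt] at this
    exact this

end Levi


section Morphisms

open AffAlgGroup

namespace AlgGroupHom

variable {G H : AffAlgGroup}

lemma comp_mem (f : AlgGroupHom G H) {r} (hr : r ∈ H.reg) : r ∘ f.toGpHom ∈ G.reg := by
  obtain ⟨P, hP⟩ := f.regular
  exact comp_mem_reg (α := f.toGpHom) (fun i => mem_reg.2 ⟨P i, fun x => hP _ (pt_mem x) i⟩) hr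

/-- The morphism of algebraic groups attached to a homomorphism of point groups pulling back
regular functions to regular functions. -/
def ofGpHom (φ : G.Gp →* H.Gp) (hφ : ∀ r ∈ H.reg, r ∘ φ ∈ G.reg) : AlgGroupHom G H where
  toFun z := open Classical in if h : z ∈ G.carrier then pt (φ (ofPt z h)) else 0
  maps_to hx := by
    rw [dif_pos hx]
    exact pt_mem _
  map_mul hx hy := by
    rw [dif_pos hx, dif_pos hy, dif_pos (G.mul_mem hx hy), ← pt_mul, ← _root_.map_mul]
    rfl
  regular := by
    choose P hP using fun i => mem_reg.1 (hφ _ (cd_mem i))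
    refine ⟨P, fun x hx i => ?_⟩
    beta_reduce
    rw [dif_pos hx]
    exact hP i (ofPt x hx)

lemma ofGpHom_pt (φ : G.Gp →* H.Gp) (hφ) (x) : (ofGpHom φ hφ).toFun (pt x) = pt (φ x) :=
  dif_pos (pt_mem x)

lemma toGpHom_ofGpHom (φ : G.Gp →* H.Gp) (hφ) (x) : (ofGpHom φ hφ).toGpHom x = φ x :=
  pt_injective (ofGpHom_pt φ hφ x)

lemma exists_isDerivAtOne (f : AlgGroupHom G H) : ∃ df, IsDerivAtOne f df ∧
    ∀ X, IsPD G.reg X → df (fun i => X (cd i)) = fun i => X (cd i ∘ f.toGpHom) := by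
  obtain ⟨P, hP⟩ := f.regular
  refine ⟨LinearMap.pi fun i => ∑ j, eval G.one (pderiv j (P i)) • LinearMap.proj j,
    fun Q hQ v hv i => ?_, fun X hX => ?_⟩
  · have h := hv (P i - Q i) fun x hx => by rw [map_sub, ← hP x hx, ← hQ x hx, sub_self]
    simp only [map_sub, mul_sub, Finset.sum_sub_distrib, sub_eq_zero] at h
    rw [← h]
    simp [mul_comm]
  · funext i
    have e : cd i ∘ f.toGpHom = fun x => eval (pt x) (P i) := by
      funext x
      exact hP _ (pt_mem x) i
    rw [e, pd_eval hX]
    simp [mul_comm]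

lemma isPD_comp (f : AlgGroupHom G H) {Z : FnDual G.Gp} (hZ : IsPD G.reg Z) :
    IsPD H.reg (Z ∘ₗ LinearMap.funLeft ℂ ℂ f.toGpHom) := fun r hr s hs => by
  refine (hZ _ (f.comp_mem hr) _ (f.comp_mem hs)).trans ?_
  simp only [Function.comp, _root_.map_one]
  rfl

lemma exists_tangentMap {V 𝔤 : Type} [AddCommGroup V] [Module ℂ V] [LieRing 𝔤] [LieAlgebra ℂ 𝔤]
    (f : AlgGroupHom G H) {d : V ⊸ FnDual G.Gp} (hd : ∀ v, IsPD G.reg (d v))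
    {der : 𝔤 ⊸ FnDual H.Gp} (hL : IsLieFn H.reg 𝔤 der) :
    ∃ T : V ⊸ 𝔤, ∀ v, ∀ r ∈ H.reg, der (T v) r = d v (r ∘ f.toGpHom) :=
  hL.exists_lift (fun v => d v ∘ₗ LinearMap.funLeft ℂ ℂ f.toGpHom) (fun v => f.isPD_comp (hd v))
    (fun v w r _ => by simp) (fun c v r _ => by simp)

lemma exists_lieHom {𝔤 𝔢 : Type} [LieRing 𝔤] [LieAlgebra ℂ 𝔤] [LieRing 𝔢] [LieAlgebra ℂ 𝔢]
    (f : AlgGroupHom G H) {d : 𝔢 ⊸ FnDual G.Gp} (hd : IsLieFn G.reg 𝔢 d)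
    {der : 𝔤 ⊸ FnDual H.Gp} (hL : IsLieFn H.reg 𝔤 der) :
    ∃ T : 𝔢 →ₗ⁅ℂ⁆ 𝔤, ∀ v, ∀ r ∈ H.reg, der (T v) r = d v (r ∘ f.toGpHom) := by
  obtain ⟨T, hT⟩ := f.exists_tangentMap hd.pd hL
  have hlin : ∀ z, ∀ r ∈ H.reg, linv (d z) (r ∘ f.toGpHom) = linv (der (T z)) r ∘ f.toGpHom := by
    intro z r hr
    funext x
    show d z _ = der (T z) _
    rw [hT z _ (H.isAlgGrpFn.left_translate hr _)]
    refine congrArg (d z) (funext fun y => ?_)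
    simp only [Function.comp, _root_.map_mul]
  refine ⟨{ T with map_lie' := fun {w z} => sub_eq_zero.1 (hL.inj _ fun r hr => ?_) }, hT⟩
  show der (T ⁅w, z⁆ - ⁅T w, T z⁆) r = 0
  rw [map_sub, LinearMap.sub_apply, hT _ r hr, hd.lie _ _ _ (f.comp_mem hr), hL.lie _ _ _ hr,
    hlin z r hr, hlin w r hr, hT _ _ (H.isAlgGrpFn.linv_mem _ hr),
    hT _ _ (H.isAlgGrpFn.linv_mem _ hr), sub_self]

end AlgGroupHom

end Morphisms

section Coefficients

open AffAlgGroup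

variable {G A : AffAlgGroup} {M : Type} [AddCommGroup M] [Module ℂ M]
  {derA : M ⊸ FnDual A.Gp} {log : A.Gp → M}

namespace AlgAction

/-- The action on points. -/
def gp (ρ : AlgAction G A) (g : G.Gp) (a : A.Gp) : A.Gp := ofPt _ (ρ.maps_to (pt_mem g) (pt_mem a))

variable (ρ : AlgAction G A)

lemma gp_one (a) : ρ.gp 1 a = a := pt_injective (ρ.act_one (pt_mem a))

lemma gp_mul (g h a) : ρ.gp (g * h) a = ρ.gp g (ρ.gp h a) :=
  pt_injective (ρ.act_mul (pt_mem g) (pt_mem h) (pt_mem a))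

lemma gp_map_mul (g a b) : ρ.gp g (a * b) = ρ.gp g a * ρ.gp g b :=
  pt_injective (ρ.act_map_mul (pt_mem g) (pt_mem a) (pt_mem b))

lemma gp_reg (f) (hf : f ∈ A.reg) : (fun g a => f (ρ.gp g a)) ∈ biReg G.reg A.reg :=
  comp_mem_biReg (biReg_of_isRegularOn ρ.regular
    (fun x y => by
      simp only [Set.mem_setOf_eq, left_append, right_append]
      exact ⟨pt_mem _, pt_mem _⟩)
    fun x y => by
      simp only [left_append, right_append]
      rfl) hf

end AlgAction

lemma IsVecGrp.comp_mem_vecFn (h : IsVecGrp A.reg derA log) {exp : M → A.Gp}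
    (he : ∀ m, log (exp m) = m) {f} (hf : f ∈ A.reg) : f ∘ exp ∈ vecFn M := by
  rw [h.adjoin] at hf
  induction hf using Algebra.adjoin_induction with
  | mem f hf =>
    obtain ⟨ξ, rfl⟩ := hf
    convert dual_mem_vecFn ξ using 1
    funext m
    exact congrArg ξ (he m)
  | algebraMap c => exact (vecFn M).algebraMap_mem c
  | add f g _ _ hf hg => exact add_mem hf hg
  | mul f g _ _ hf hg => exact mul_mem hf hg

lemma map_smul_of_vecFn {T : M → M} (hadd : ∀ m n, T (m + n) = T m + T n)
    (hT : ∀ ξ : Module.Dual ℂ M, (fun m => ξ (T m)) ∈ vecFn M) (c : ℂ) (m : M) :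
    T (c • m) = c • T m := by
  refine dual_ext fun ξ => ?_
  obtain ⟨P, hP⟩ := exists_polynomial_of_vecFn (hT ξ) m
  have hnat : ∀ n : ℕ, P.eval (n : ℂ) = n * ξ (T m) := fun n => by
    have : ∀ n : ℕ, T ((n : ℂ) • m) = (n : ℂ) • T m := fun n => by
      induction n with
      | zero => simpa using hadd 0 0
      | succ n ih => rw [Nat.cast_succ, add_smul, hadd, ih, one_smul, add_smul, one_smul]
    rw [← hP, this, map_smul, smul_eq_mul]
  have hPe := Polynomial.eq_of_infinite_eval_eq _ _ ((Set.infinite_range_of_injective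
      (Nat.cast_injective)).mono (by
        rintro _ ⟨n, rfl⟩
        exact (hnat n).trans (by rw [Polynomial.eval_C_mul, Polynomial.eval_X, mul_comm])))
  rw [map_smul, smul_eq_mul, hP, hPe, Polynomial.eval_C_mul, Polynomial.eval_X, mul_comm]

/-- Linear coordinates on the vector group `A` in which `G` acts through `π`. -/
structure IsCoef (ρ : AlgAction G A) (derA : M ⊸ FnDual A.Gp) (log : A.Gp → M)
    (exp : M → A.Gp) (π : G.Gp →* (M ⊸ M)) : Prop where
  vec : IsVecGrp A.reg derA log
  pd : ∀ w, IsPD A.reg (derA w)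
  log_exp : ∀ m, log (exp m) = m
  exp_log : ∀ a, exp (log a) = a
  reg : RegOp G.reg π
  act : ∀ g a, log (ρ.gp g a) = π g (log a)

lemma exists_isCoef (hconn : A.IsConnected) (hab : A.IsAbelianGrp) (huni : A.IsUnipotent)
    (ρ : AlgAction G A) {𝔤 : Type} [LieRing 𝔤] [LieAlgebra ℂ 𝔤] [LieRingModule 𝔤 M]
    {e : 𝔤 ⊸ Pt G.n} {der : 𝔤 ⊸ FnDual G.Gp} (hL : IsLieFn G.reg 𝔤 der)
    (hcd : ∀ u i, der u (cd i) = e u i) {eA : M ⊸ Pt A.n} (hinj : Function.Injective eA)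
    (hr : ∀ v, (∃ w, eA w = v) ↔ v ∈ tangentAt A.carrier A.one)
    (hder : IsDerivedActionOnLie ρ e eA) :
    ∃ (_ : Module.Finite ℂ M) (derA : M ⊸ FnDual A.Gp) (log : A.Gp → M)
      (exp : M → A.Gp) (π : G.Gp →* (M ⊸ M)), IsCoef ρ derA log exp π ∧
      IsMod G.reg der π ∧ ∀ w i, derA w (cd i) = eA w i := by
  obtain ⟨derA, pd, full, inj, hcdA⟩ := exists_der hinj hr
  obtain ⟨log, hV⟩ := A.isAlgGrpFn.exists_vecGrp huni.isPowPoly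
    (fun a b => pt_injective (hab _ (pt_mem a) _ (pt_mem b))) pd full inj
  have hfin := hV.finite
  obtain ⟨exp, hexp, hlog⟩ := Function.bijective_iff_has_inverse.1 hV.bij
  have hlin := fun g =>
    map_smul_of_vecFn (T := fun m => log (ρ.gp g (exp m)))
      (fun m n => by
        rw [← hV.map_mul, ← ρ.gp_map_mul]
        congr 2
        exact hV.bij.1 (by rw [hV.map_mul, hlog, hlog, hlog]))
      fun ξ => hV.comp_mem_vecFn hlog (biReg_eval_left (ρ.gp_reg _ (hV.mem ξ)) g)
  have hadd : ∀ g m n, log (ρ.gp g (exp (m + n))) = log (ρ.gp g (exp m)) + log (ρ.gp g (exp n)) :=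
    fun g m n => by
      rw [← hV.map_mul, ← ρ.gp_map_mul]
      congr 2
      exact hV.bij.1 (by rw [hV.map_mul, hlog, hlog, hlog])
  let π : G.Gp →* (M ⊸ M) :=
    { toFun := fun g =>
        { toFun := fun m => log (ρ.gp g (exp m)), map_add' := hadd g, map_smul' := hlin g }
      map_one' := LinearMap.ext fun m => by
        show log (ρ.gp 1 (exp m)) = m
        rw [ρ.gp_one, hlog]
      map_mul' := fun g h => LinearMap.ext fun m => by
        show log (ρ.gp (g * h) (exp m)) = log (ρ.gp g (exp (log (ρ.gp h (exp m)))))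
        rw [ρ.gp_mul, hexp] }
  have hact : ∀ g a, log (ρ.gp g a) = π g (log a) := fun g a => by
    show _ = log (ρ.gp g (exp (log a)))
    rw [hexp]
  have hreg := fun m ξ => biReg_eval (ρ.gp_reg _ (hV.mem ξ)) (exp m)
  have hπ : ∀ g w, ∀ f ∈ A.reg, derA w (fun a => f (ρ.gp g a)) = derA (π g w) f := by
    intro g w
    obtain ⟨v, hv⟩ := full (derA w ∘ₗ LinearMap.funLeft ℂ ℂ (ρ.gp g)) fun r hr s hs => by
      have h1 : ρ.gp g 1 = 1 := by simpa using ρ.gp_map_mul g 1 1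
      refine (pd w _ (biReg_eval_left (ρ.gp_reg r hr) g) _
        (biReg_eval_left (ρ.gp_reg s hs) g)).trans ?_
      rw [h1]
      rfl
    have hvw : v = π g w := dual_ext fun ξ => by
      rw [← hV.der_log, hv _ (hV.mem ξ), ← LinearMap.comp_apply ξ, ← hV.der_log]
      refine congrArg (derA w) (funext fun a => ?_)
      exact congrArg ξ (hact g a)
    intro f hf
    rw [← hvw, hv f hf]
    rfl
  refine ⟨hfin, derA, log, exp, π, ⟨hV, pd, hlog, hexp, hreg, hact⟩, ⟨hreg, fun u w => ?_⟩, hcdA⟩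
  refine hinj (funext fun i => ?_)
  choose S hS using fun i => mem_biReg.1 (ρ.gp_reg _ (cd_mem i))
  rw [hder S fun g hg a ha i => hS i (ofPt g hg) (ofPt a ha)]
  simp only [← hcd, ← hcdA]
  rw [← pd_mixed (hL.pd u) (pd w)]
  simp only [← hS]
  simp only [hπ _ _ _ (cd_mem i)]
  exact (dual_vext (der u) (fun x => π x w) (LinearMap.flip derA (cd i))).symm

end Coefficients


section Extensions

open AffAlgGroup

variable {G A : AffAlgGroup} {ρ : AlgAction G A} {M : Type} [AddCommGroup M] [Module ℂ M]
  {derA : M ⊸ FnDual A.Gp} {log : A.Gp → M} {exp : M → A.Gp}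
  {π : G.Gp →* (M ⊸ M)}

lemma BiRegV.comp_vecFn {Γ Δ : Type} {R : FnAlg Γ} {S : FnAlg Δ}
    {F : Γ → Δ → M} (hF : BiRegV R S F) {a : M → ℂ} (ha : a ∈ vecFn M) :
    (fun x y => a (F x y)) ∈ biReg R S := by
  induction ha using Algebra.adjoin_induction with
  | mem a ha =>
    obtain ⟨ξ, rfl⟩ := ha
    exact hF ξ
  | algebraMap c => exact biReg_of_left (R.algebraMap_mem c)
  | add a b _ _ ha hb => exact add_mem ha hb
  | mul a b _ _ ha hb => exact biReg_mul ha hb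

namespace IsCoef

variable (h : IsCoef ρ derA log exp π)
include h

lemma log_inj {a b : A.Gp} (hab : log a = log b) : a = b := h.vec.bij.1 hab

lemma exp_add (m n : M) : exp (m + n) = exp m * exp n :=
  h.log_inj (by rw [h.vec.map_mul, h.log_exp, h.log_exp, h.log_exp])

lemma gp_exp (g : G.Gp) (m : M) : ρ.gp g (exp m) = exp (π g m) :=
  h.log_inj (by rw [h.act, h.log_exp, h.log_exp])

lemma log_one : log 1 = 0 := by simpa using h.vec.map_mul 1 1

end IsCoef

namespace AlgExtension

/-- The linearly parametrized kernel of an extension. -/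
def jm (e : AlgExtension G A ρ) (exp : M → A.Gp) (m : M) : e.E.Gp := e.i.toGpHom (exp m)

/-- Equivariant coordinates `F` on the total space, with associated cocycle `f`. -/
abbrev Coc (e : AlgExtension G A ρ) (exp : M → A.Gp) (π : G.Gp →* (M ⊸ M)) (F : e.E.Gp → M)
    (f : G.Gp → G.Gp → M) : Prop :=
  IsCocData e.E.reg G.reg (e.jm exp) e.q.toGpHom π F f

variable (e : AlgExtension G A ρ)

lemma q_eq_one_iff (x : e.E.Gp) : e.q.toGpHom x = 1 ↔ ∃ a, e.i.toGpHom a = x := by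
  refine ⟨fun hx => ?_, ?_⟩
  · obtain ⟨a, ha, hax⟩ := (e.exact _ (pt_mem x)).1 (congrArg pt hx)
    exact ⟨ofPt a ha, pt_injective hax⟩
  · rintro ⟨a, rfl⟩
    exact pt_injective ((e.exact _ (pt_mem (e.i.toGpHom a))).2 ⟨_, pt_mem a, rfl⟩)

lemma isVecExt (h : IsCoef ρ derA log exp π) :
    IsVecExt e.E.reg G.reg (e.jm exp) e.q.toGpHom where
  alg := e.E.isAlgGrpFn
  map_add m n := by
    rw [jm, h.exp_add, _root_.map_mul]
    rfl
  inj m n hmn := by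
    have := pt_injective (e.i_inj (pt_mem _) (pt_mem _) (congrArg pt hmn))
    rw [← h.log_exp m, this, h.log_exp]
  surj g := by
    obtain ⟨x, hx, hxg⟩ := e.q_surj _ (pt_mem g)
    exact ⟨ofPt x hx, pt_injective hxg⟩
  comp_mem _ hr := e.q.comp_mem hr
  map_j m := (e.q_eq_one_iff _).2 ⟨_, rfl⟩
  exact x hx := by
    obtain ⟨a, rfl⟩ := (e.q_eq_one_iff x).1 hx
    exact ⟨log a, by rw [jm, h.exp_log]⟩
  reg f hf := biReg_comp (e.E.isAlgGrpFn.comul f hf)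
    (fun _ ha => h.vec.comp_mem_vecFn h.log_exp (e.i.comp_mem ha)) fun _ hb => hb

lemma conj_jm (h : IsCoef ρ derA log exp π) (x : e.E.Gp) (m : M) :
    x * e.jm exp m * x⁻¹ = e.jm exp (π (e.q.toGpHom x) m) := by
  rw [mul_assoc, jm, jm, ← h.gp_exp]
  exact pt_injective (e.conj_compat _ (pt_mem x) _ (pt_mem (exp m)))

section
variable {e} {F : e.E.Gp → M} {f : G.Gp → G.Gp → M}

lemma Coc.map_i (h : IsCoef ρ derA log exp π) (hd : e.Coc exp π F f) (a : A.Gp) :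
    F (e.i.toGpHom a) = log a - f 1 1 := by
  have h1 : F 1 = F 1 + F 1 + f 1 1 := by simpa using hd.map_mul 1 1
  have h2 : F 1 = - f 1 1 := by grind
  have h3 := hd.equi (log a) 1
  rw [mul_one, jm, h.exp_log, h2, ← sub_eq_add_neg] at h3
  exact h3
end

variable [Module.Finite ℂ M] [IsDomain G.reg]

lemma exists_coc (h : IsCoef ρ derA log exp π) : ∃ F f, e.Coc exp π F f :=
  (e.isVecExt h).exists_cocData G.isAlgGrpFn.toIsHopfFn G.isAlgGrpFn.sep h.reg (e.conj_jm h)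

variable {e} {e' : AlgExtension G A ρ}

lemma exists_cobd_of_eqvGen (h : IsCoef ρ derA log exp π) (he : Relation.EqvGen Equiv e e') :
    ∀ {F f F' f'}, e.Coc exp π F f → e'.Coc exp π F' f' →
      ∃ b, RegV G.reg b ∧ ∀ x y, f x y - f' x y = cobd π b x y := by
  have same : ∀ (e : AlgExtension G A ρ) {F f F' f'}, e.Coc exp π F f → e.Coc exp π F' f' →
      ∃ b, RegV G.reg b ∧ ∀ x y, f x y - f' x y = cobd π b x y := fun e _ _ _ _ hd hd' =>
    (e.isVecExt h).exists_cobd_of_cocData G.isAlgGrpFn.toIsHopfFn G.isAlgGrpFn.sep hd hd'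
  induction he with
  | rel e e' he =>
    intro F f F' f' hd hd'
    obtain ⟨φ, hi, hq⟩ := he
    exact same e hd (hd'.comp φ.toGpHom (fun s => φ.comp_mem)
      (fun m => pt_injective (hi _ (pt_mem _))) fun x => pt_injective (hq _ (pt_mem x)))
  | refl e => exact same e
  | symm e e' _ ih =>
    intro F f F' f' hd hd'
    obtain ⟨b, hb, hbe⟩ := ih hd' hd
    refine ⟨fun x => - b x, hb.neg, fun x y => ?_⟩
    rw [← neg_sub, hbe, cobd, cobd, map_neg]
    abel
  | trans e e' e'' _ _ ih ih' =>
    intro F f F' f' hd hd'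
    obtain ⟨F₁, f₁, hd₁⟩ := e'.exists_coc h
    obtain ⟨b, hb, hbe⟩ := ih hd hd₁
    obtain ⟨b', hb', hbe'⟩ := ih' hd₁ hd'
    refine ⟨fun x => b x + b' x, hb.add hb', fun x y => ?_⟩
    rw [← sub_add_sub_cancel _ (f₁ x y), hbe, hbe', cobd, cobd, cobd, _root_.map_add]
    abel

lemma equiv_of_coc (h : IsCoef ρ derA log exp π) {F F' f} (hd : e.Coc exp π F f)
    (hd' : e'.Coc exp π F' f) : e.Equiv e' := by
  have hv := e'.isVecExt h
  choose P hPF hPq using hv.exists_point hd'.equi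
  let φ : e.E.Gp →* e'.E.Gp := MonoidHom.mk' (fun x => P (F x) (e.q.toGpHom x)) fun x y => by
    refine hv.eq_of_coords hd'.equi ?_ ?_
    · rw [hd'.map_mul, hPF, hPF, hPF, hPq, hPq, hd.map_mul]
    grind
  have hφ : ∀ r ∈ e'.E.reg, r ∘ φ ∈ e.E.reg := fun r hr => by
    obtain ⟨T, hT, hrT⟩ := hv.exists_coords G.isAlgGrpFn.toIsHopfFn G.isAlgGrpFn.sep hd'.reg
      hd'.equi hr
    have hc := biReg_comp hT
      (fun a => hd.reg.comp_vecFn) (fun b => e.q.comp_mem)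
    have e1 : r ∘ φ = fun x => T (F x) (e.q.toGpHom x) := by
      funext x
      show r (P (F x) (e.q.toGpHom x)) = _
      grind
    rw [e1]
    exact biReg_diag hc le_rfl
  refine ⟨AlgGroupHom.ofGpHom φ hφ, fun a ha => ?_, fun x hx => ?_⟩
  · refine (AlgGroupHom.ofGpHom_pt φ hφ (e.i.toGpHom (ofPt a ha))).trans (congrArg pt ?_ :
      _ = pt (e'.i.toGpHom (ofPt a ha)))
    refine hv.eq_of_coords hd'.equi ?_ ?_
    · exact (hPF _ _).trans ((Coc.map_i h hd _).trans (Coc.map_i h hd' _).symm)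
    · exact (hPq _ _).trans (((e.q_eq_one_iff _).2 ⟨_, rfl⟩).trans
        ((e'.q_eq_one_iff _).2 ⟨_, rfl⟩).symm)
  · have e1 := AlgGroupHom.ofGpHom_pt φ hφ (ofPt x hx)
    rw [pt_ofPt] at e1
    rw [e1]
    exact congrArg pt (hPq _ _)

lemma isBaerSum_of_coc (h : IsCoef ρ derA log exp π) {e'' : AlgExtension G A ρ} {F F' F'' f f'}
    (hd : e.Coc exp π F f) (hd' : e'.Coc exp π F' f')
    (hd'' : e''.Coc exp π F'' fun x y => f x y + f' x y) : e.IsBaerSum e' e'' := by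
  have hv := e''.isVecExt h
  choose P hPF hPq using hv.exists_point hd''.equi
  let k : e.E.Gp → e'.E.Gp → e''.E.Gp := fun x y => P (F x + F' y) (e.q.toGpHom x)
  have hk : ∀ i, (fun x y => cd i (k x y)) ∈ biReg e.E.reg e'.E.reg := fun i => by
    obtain ⟨T, hT, hrT⟩ := hv.exists_coords G.isAlgGrpFn.toIsHopfFn G.isAlgGrpFn.sep hd''.reg
      hd''.equi (cd_mem i)
    simp only [k, hrT, hPF, hPq]
    refine biReg_induction (p := fun T => (fun x y => T (F x + F' y) (e.q.toGpHom x)) ∈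
      biReg e.E.reg e'.E.reg) (fun a ha b hb => ?_) (zero_mem _)
      (fun _ _ _ _ hF hG => add_mem hF hG) hT
    exact biReg_mul ((BiRegV.add hd.reg.left hd'.reg.right).comp_vecFn ha)
      (biReg_of_left (e.q.comp_mem hb))
  choose Q hQ using fun i => mem_biReg.1 (hk i)
  let t : Pt (e.E.n + e'.E.n) → Pt e''.E.n := fun z i => eval z (Q i)
  have ht : ∀ x y, t (Fin.append (pt x) (pt y)) = pt (k x y) := fun x y =>
    funext fun i => (hQ i x y).symm
  refine ⟨t, ⟨Q, fun _ _ _ => rfl⟩, fun x hx y hy _ => ?_, fun x x' y y' hx hx' hy hy' hxy hxy' => ?_,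
    fun x hx y hy _ => ?_, fun a ha b hb => ?_⟩
  · exact (ht (ofPt x hx) (ofPt y hy)).symm ▸ pt_mem _
  · have e0 := ht (ofPt x hx * ofPt x' hx') (ofPt y hy * ofPt y' hy')
    have e1 := ht (ofPt x hx) (ofPt y hy)
    have e2 := ht (ofPt x' hx') (ofPt y' hy')
    rw [pt_mul, pt_mul, pt_ofPt, pt_ofPt, pt_ofPt, pt_ofPt] at e0
    rw [pt_ofPt, pt_ofPt] at e1 e2
    rw [e0, e1, e2, ← pt_mul]
    refine congrArg pt (hv.eq_of_coords hd''.equi ?_ ?_)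
    · have h1 : e.q.toGpHom (ofPt x hx) = e'.q.toGpHom (ofPt y hy) := pt_injective hxy
      have h2 : e.q.toGpHom (ofPt x' hx') = e'.q.toGpHom (ofPt y' hy') := pt_injective hxy'
      simp only [k, hd''.map_mul, hPF, hPq, hd.map_mul, hd'.map_mul, ← h1, ← h2, _root_.map_add]
      abel
    · simp only [k, hPq, _root_.map_mul]
  · have e1 := ht (ofPt x hx) (ofPt y hy)
    rw [pt_ofPt, pt_ofPt] at e1
    rw [e1]
    exact congrArg pt (hPq _ _)
  · refine (ht (e.i.toGpHom (ofPt a ha)) (e'.i.toGpHom (ofPt b hb))).trans (congrArg pt ?_ :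
      _ = pt (e''.i.toGpHom (ofPt a ha * ofPt b hb)))
    refine hv.eq_of_coords hd''.equi ?_ ?_
    · rw [Coc.map_i h hd'']
      refine (hPF _ _).trans ?_
      rw [Coc.map_i h hd, Coc.map_i h hd', h.vec.map_mul]
      abel
    · exact (hPq _ _).trans (((e.q_eq_one_iff _).2 ⟨_, rfl⟩).trans
        ((e''.q_eq_one_iff _).2 ⟨_, rfl⟩).symm)

omit [Module.Finite ℂ M] [IsDomain G.reg] in
lemma exists_of_coc (h : IsCoef ρ derA log exp π) {f : G.Gp → G.Gp → M}
    (hf : BiRegV G.reg G.reg f) (hc : IsCoc π f) (hl : ∀ x, f 1 x = 0) (hr : ∀ x, f x 1 = 0) :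
    ∃ (e : AlgExtension G A ρ) (F : _), e.Coc exp π F f := by
  have hexp0 : exp 0 = 1 := h.log_inj (by rw [h.log_exp, h.log_one])
  have hcomm : ∀ a b, a * b = b * a := fun a b =>
    h.log_inj (by rw [h.vec.map_mul, h.vec.map_mul, add_comm])
  let D : TwistData G A :=
    { act := ρ.gp
      c := fun x y => exp (f x y)
      act_reg := ρ.gp_reg
      c_reg := fun r hr => hf.comp_vecFn (h.vec.comp_mem_vecFn h.log_exp hr)
      act_one := ρ.gp_one
      act_map_one := fun g => h.log_inj (by rw [h.act, h.log_one, map_zero])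
      c_one_left := fun g => by rw [hl, hexp0]
      c_one_right := fun g => by rw [hr, hexp0]
      assoc := fun x y z a b => h.log_inj (by
        simp only [h.vec.map_mul, h.act, h.log_exp, _root_.map_add, _root_.map_mul,
          Module.End.mul_apply]
        have := hc x y z
        grind) }
  have hmul : ∀ a b x y, D.pnt a x * D.pnt b y = D.pnt (a * ρ.gp x b * exp (f x y)) (x * y) :=
    D.pnt_mul
  let i : A.Gp →* D.grp.Gp := MonoidHom.mk' (fun a => D.pnt a 1) fun a b => by
    rw [hmul, ρ.gp_one, hl, hexp0, mul_one, mul_one]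
  let q : D.grp.Gp →* G.Gp := MonoidHom.mk' D.snd fun x y => by
    obtain ⟨a, g, rfl⟩ := D.pnt_surj x
    obtain ⟨b, k, rfl⟩ := D.pnt_surj y
    simp_all
  have hi : ∀ r ∈ D.grp.reg, r ∘ i ∈ A.reg := fun r hr => biReg_eval (D.mem_grp_reg.1 hr) 1
  have hq : ∀ r ∈ G.reg, r ∘ q ∈ D.grp.reg := fun r hr => D.mem_grp_reg.2 (by
    show (fun a g => r (D.snd (D.pnt a g))) ∈ _
    simp only [D.snd_pnt]
    exact biReg_of_right hr)
  have hipt : ∀ a (ha : a ∈ A.carrier), (AlgGroupHom.ofGpHom i hi).toFun a = pt (i (ofPt a ha)) :=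
    fun a ha => AlgGroupHom.ofGpHom_pt i hi (ofPt a ha)
  have hqpt : ∀ x (hx : x ∈ D.grp.carrier),
      (AlgGroupHom.ofGpHom q hq).toFun x = pt (q (ofPt x hx)) :=
    fun x hx => AlgGroupHom.ofGpHom_pt q hq (ofPt x hx)
  let e : AlgExtension G A ρ :=
    { E := D.grp
      i := AlgGroupHom.ofGpHom i hi
      q := AlgGroupHom.ofGpHom q hq
      i_inj := fun a ha b hb hab => by
        rw [hipt a ha, hipt b hb] at hab
        have := congrArg D.fst (pt_injective hab)
        have : ofPt a ha = ofPt b hb := (D.fst_pnt _ 1).symm.trans (this.trans (D.fst_pnt _ 1))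
        exact congrArg pt this
      q_surj := fun g hg => ⟨pt (D.pnt 1 (ofPt g hg)), pt_mem _,
        (AlgGroupHom.ofGpHom_pt q hq _).trans (congrArg pt (D.snd_pnt _ _))⟩
      exact := fun x hx => by
        obtain ⟨a, g, hag⟩ := D.pnt_surj (ofPt x hx)
        rw [hqpt x hx, ← hag]
        refine ⟨fun hg => ⟨pt a, pt_mem a, ?_⟩, ?_⟩
        · have hg : g = 1 := (D.snd_pnt a g).symm.trans (pt_injective hg)
          subst hg
          exact (AlgGroupHom.ofGpHom_pt i hi a).trans (congrArg pt hag)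
        · rintro ⟨b, hb, hbx⟩
          rw [hipt b hb] at hbx
          have hbx : i (ofPt b hb) = ofPt x hx := pt_injective hbx
          rw [hag, ← hbx]
          exact congrArg pt (D.snd_pnt _ _)
      conj_compat := fun x hx b hb => by
        have key : ∀ x b, x * (i b * x⁻¹) = i (ρ.gp (q x) b) := fun x b => by
          obtain ⟨a, g, rfl⟩ := D.pnt_surj x
          rw [← mul_assoc, mul_inv_eq_iff_eq_mul]
          show D.pnt a g * D.pnt b 1 = D.pnt (ρ.gp (D.snd (D.pnt a g)) b) 1 * D.pnt a g
          rw [D.snd_pnt, hmul, hmul, hl, hr, ρ.gp_one, mul_one, one_mul, hcomm a]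
        rw [hipt b hb]
        refine (congrArg pt (key (ofPt x hx) (ofPt b hb))).trans ?_
        refine (AlgGroupHom.ofGpHom_pt i hi _).symm.trans ?_
        rw [hqpt x hx]
        rfl }
  have hej : ∀ m, e.jm exp m = D.pnt (exp m) 1 := fun m => AlgGroupHom.toGpHom_ofGpHom i hi _
  have heq : ∀ x, e.q.toGpHom x = D.snd x := AlgGroupHom.toGpHom_ofGpHom q hq
  refine ⟨e, fun x => log (D.fst x), fun ξ => D.mem_grp_reg.2 ?_, fun m x => ?_, hf,
    fun x y => ?_⟩
  · simp only [D.fst_pnt]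
    exact biReg_of_left (h.vec.mem ξ)
  · obtain ⟨a, g, rfl⟩ := D.pnt_surj x
    rw [hej]
    refine (congrArg (fun z => log (D.fst z)) (hmul _ _ _ _)).trans ?_
    rw [D.fst_pnt, D.fst_pnt, ρ.gp_one, hl, hexp0, mul_one, h.vec.map_mul, h.log_exp]
  · obtain ⟨a, g, rfl⟩ := D.pnt_surj x
    obtain ⟨b, k, rfl⟩ := D.pnt_surj y
    rw [heq, heq]
    refine (congrArg (fun z => log (D.fst z)) (hmul _ _ _ _)).trans ?_
    rw [D.fst_pnt, D.fst_pnt, D.fst_pnt, D.snd_pnt, D.snd_pnt, h.vec.map_mul, h.vec.map_mul,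
      h.act, h.log_exp]

end AlgExtension

end Extensions


section RelativeForms

variable {𝔤 : Type} [LieRing 𝔤] [LieAlgebra ℂ 𝔤] {M : Type} [AddCommGroup M] [Module ℂ M]
  [LieRingModule 𝔤 M] {𝔥 : LieSubalgebra ℂ 𝔤}

/-- The Chevalley–Eilenberg differential of a linear form. -/
def dForm (c : 𝔤 → M) (u v : 𝔤) : M := ⁅u, c v⁆ - ⁅v, c u⁆ - c ⁅u, v⁆

@[simp]
lemma update_vec_zero {n : ℕ} (a b : 𝔤) (v : Fin n → 𝔤) :
    Function.update (Matrix.vecCons a v) 0 b = Matrix.vecCons b v := Fin.update_cons_zero ..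

@[simp]
lemma update_vec_one (a b d : 𝔤) : Function.update ![a, b] 1 d = ![a, d] := by
  ext i; fin_cases i <;> rfl

lemma ceD_one (c : (Fin 1 → 𝔤) → M) (u v : 𝔤) : ceD 1 c ![u, v] = dForm (fun u => c ![u]) u v := by
  have e₁ : (fun k => ![u, v] (Fin.succAbove 1 k)) = ![u] := by ext i; fin_cases i; rfl
  have e₀ : (fun _ => v) = ![v] := by ext i; fin_cases i; rfl
  simp [ceD, dForm, Fin.sum_univ_succ, e₀, e₁, sub_eq_add_neg]

lemma ceD_two (c : (Fin 2 → 𝔤) → M) (u v w : 𝔤) : ceD 2 c ![u, v, w] =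
    ⁅u, c ![v, w]⁆ - ⁅v, c ![u, w]⁆ + ⁅w, c ![u, v]⁆ - c ![⁅u, v⁆, w] - c ![v, ⁅u, w⁆]
      + c ![u, ⁅v, w⁆] := by
  have f₁ : (fun k => ![u, v, w] (Fin.succAbove 1 k)) = ![u, w] := by ext i; fin_cases i <;> rfl
  have f₂ : (fun k => ![u, v, w] (Fin.succAbove 2 k)) = ![u, v] := by ext i; fin_cases i <;> rfl
  have hs : ∀ g : Fin (2 + 1) → M, ∑ i, g i = g 0 + g 1 + g 2 := Fin.sum_univ_three
  simp only [ceD, hs]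
  simp [f₁, f₂]
  abel

lemma skew_of_self {V W : Type} [AddCommGroup V] [Module ℂ V] [AddCommGroup W] [Module ℂ W]
    {β : V ⊸ V ⊸ W} (h : ∀ u, β u u = 0) (u v : V) : β u v = - β v u := by
  have := h (u + v)
  simp_all [eq_neg_iff_add_eq_zero, add_comm]

lemma relZ_bilin {ω : (Fin 2 → 𝔤) → M} (h : ω ∈ relZ 𝔥 M 2) :
    ∃ β : 𝔤 ⊸ 𝔤 ⊸ M, (∀ u v, β u v = ω ![u, v]) ∧ (∀ u, β u u = 0) ∧
      (∀ u v w, ⁅u, β v w⁆ - ⁅v, β u w⁆ + ⁅w, β u v⁆ - β ⁅u, v⁆ w + β ⁅u, w⁆ v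
        - β ⁅v, w⁆ u = 0) ∧ (∀ w ∈ 𝔥, ∀ v, β w v = 0) ∧
      ∀ w ∈ 𝔥, ∀ u v, ⁅w, β u v⁆ = β ⁅w, u⁆ v + β u ⁅w, v⁆ := by
  obtain ⟨⟨⟨hadd, hsmul, halt⟩, hv, he⟩, hz⟩ := h
  let β : 𝔤 ⊸ 𝔤 ⊸ M := LinearMap.mk₂ ℂ (fun u v => ω ![u, v])
    (fun u u' v => by simpa using hadd ![u, v] 0 u u')
    (fun t u v => by simpa using hsmul ![u, v] 0 t u)
    (fun u v v' => by simpa using hadd ![u, v] 1 v v')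
    (fun t u v => by simpa using hsmul ![u, v] 1 t v)
  have hself : ∀ u, β u u = 0 := fun u => halt ![u, u] 0 1 (by simp) rfl
  have hskew := skew_of_self hself
  refine ⟨β, fun u v => rfl, hself, fun u v w => ?_, fun w hw v => hv _ ⟨0, hw⟩,
    fun w hw u v => ?_⟩
  · have := hz ![u, v, w]
    rw [ceD_two] at this
    change ⁅u, β v w⁆ - ⁅v, β u w⁆ + ⁅w, β u v⁆ - β ⁅u, v⁆ w - β v ⁅u, w⁆ + β u ⁅v, w⁆ = 0 at this
    grind
  · simpa [Fin.sum_univ_two, β] using he w hw ![u, v]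

lemma mem_relZ {β : 𝔤 ⊸ 𝔤 ⊸ M} (hself : ∀ u, β u u = 0)
    (hz : ∀ u v w, ⁅u, β v w⁆ - ⁅v, β u w⁆ + ⁅w, β u v⁆ - β ⁅u, v⁆ w + β ⁅u, w⁆ v
        - β ⁅v, w⁆ u = 0) (h0 : ∀ w ∈ 𝔥, ∀ v, β w v = 0)
    (he : ∀ w ∈ 𝔥, ∀ u v, ⁅w, β u v⁆ = β ⁅w, u⁆ v + β u ⁅w, v⁆) :
    (fun v => β (v 0) (v 1)) ∈ relZ 𝔥 M 2 := by
  have hskew := skew_of_self hself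
  refine ⟨⟨⟨fun v i x y => ?_, fun v i t x => ?_, fun v i j hij h => ?_⟩, fun v hv => ?_,
    fun x hx v => ?_⟩, fun v => ?_⟩
  · fin_cases i <;> simp
  · fin_cases i <;> simp
  · have : v 0 = v 1 := by grind
    grind
  · obtain ⟨i, hi⟩ := hv
    fin_cases i <;> grind
  · simp [Fin.sum_univ_two, he x hx]
  · rw [← FinVec.etaExpand_eq v]
    refine (ceD_two _ (v 0) (v 1) (v 2)).trans ?_
    change ⁅v 0, β (v 1) (v 2)⁆ - ⁅v 1, β (v 0) (v 2)⁆ + ⁅v 2, β (v 0) (v 1)⁆ - β ⁅v 0, v 1⁆ (v 2)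
      - β (v 1) ⁅v 0, v 2⁆ + β (v 0) ⁅v 1, v 2⁆ = 0
    grind

lemma mem_relB_iff {ω : (Fin 2 → 𝔤) → M} : ω ∈ relB 𝔥 M 1 ↔ ∃ c : 𝔤 ⊸ M,
    (∀ w ∈ 𝔥, c w = 0) ∧ (∀ w ∈ 𝔥, ∀ u, ⁅w, c u⁆ = c ⁅w, u⁆) ∧
      ∀ u v, ω ![u, v] = dForm c u v := by
  constructor
  · rintro ⟨f, ⟨⟨hadd, hsmul, -⟩, hv, he⟩, rfl⟩
    refine ⟨{ toFun := fun u => f ![u], map_add' := fun u v => ?_, map_smul' := fun t u => ?_ },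
      fun w hw => hv _ ⟨0, hw⟩, fun w hw u => ?_, fun u v => ceD_one _ _ _⟩
    · simpa using hadd ![u] 0 u v
    · simpa using hsmul ![u] 0 t u
    simp_all
  · rintro ⟨c, h0, he, hc⟩
    refine ⟨fun v => c (v 0), ⟨⟨fun v i x y => ?_, fun v i t x => ?_, fun v i j hij h => ?_⟩,
      fun v hv => ?_, fun x hx v => ?_⟩, funext fun v => ?_⟩
    · rw [Subsingleton.elim i 0]; simp
    · rw [Subsingleton.elim i 0]; simp
    · grind
    · simp_all
    · simp [he x hx]
    · rw [← FinVec.etaExpand_eq v]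
      exact (hc (v 0) (v 1)).trans (ceD_one (fun v => c (v 0)) (v 0) (v 1)).symm

end RelativeForms

section Comparison

variable {Γ U L : Type} [Group Γ] [Group U] [Group L] {R : FnAlg Γ}
  {RU : FnAlg U} {RL : FnAlg L} {ιU : U →* Γ} {ιL : L →* Γ}
  {prU : Γ → U} {prL : Γ → L} {𝔤 : Type} [LieRing 𝔤] [LieAlgebra ℂ 𝔤]
  {der : 𝔤 ⊸ FnDual Γ} {M : Type} [AddCommGroup M] [Module ℂ M] [Module.Finite ℂ M]
  [LieRingModule 𝔤 M] {π : Γ →* (M ⊸ M)} {𝔲 𝔥 : LieSubalgebra ℂ 𝔤}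

lemma curv_mem_relZ (hR : IsHopfFn R) (hL : IsLieFn R 𝔤 der) (hM : IsMod R der π)
    (hr : IsRetr R RL ιL prL) (h𝔥 : IsTangentTo R der ιL 𝔥) {f : Γ → Γ → M}
    (hf : BiRegV R R f) (hc : IsCoc π f) (hn : IsNormd ιL f) :
    (fun v => curv der f (v 0) (v 1)) ∈ relZ 𝔥 M 2 := by
  have := mem_relZ (𝔥 := 𝔥) (β := curvL der f)
  simp only [curvL_apply] at this
  exact this (curv_self f) (curv_closed hR hL hM hf hc)
    (fun w hw v => curv_eq_zero_of_normd hr h𝔥 hf hn hw v)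
    (fun w hw u v => curv_equivariant hR hL hM hr h𝔥 hf hc hn hw u v)

variable [LieModule ℂ 𝔤 M] (h : IsLeviFn R RU RL ιU ιL prU prL) (hL : IsLieFn R 𝔤 der)
  (h𝔲 : IsTangentTo R der ιU 𝔲) (h𝔥 : IsTangentTo R der ιL 𝔥) (hM : IsMod R der π)
  {I : FnDual L} (hI : IsMean RL I)
include h hL h𝔲 h𝔥 hM hI

lemma exists_coc_of_relZ {ω : (Fin 2 → 𝔤) → M} (hω : ω ∈ relZ 𝔥 M 2) :
    ∃ f : Γ → Γ → M, BiRegV R R f ∧ IsCoc π f ∧ IsNormd ιL f ∧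
      ∀ u v, curv der f u v = ω ![u, v] := by
  obtain ⟨β, hβ, halt, hz, h0, he⟩ := relZ_bilin hω
  simpa only [hβ] using h.exists_coc hL h𝔲 h𝔥 hM hI β halt hz h0 he

lemma mem_relB_of_relZ {ω : (Fin 2 → 𝔤) → M} (hω : ω ∈ relZ 𝔥 M 2) (c : 𝔤 ⊸ M)
    (hc : ∀ u v, ω ![u, v] = dForm c u v) : ω ∈ relB 𝔥 M 1 := by
  obtain ⟨f, hf, hfc, hn, hcurv⟩ := exists_coc_of_relZ h hL h𝔲 h𝔥 hM hI hω
  obtain ⟨b, hb, hfb⟩ := h.exists_cobd hL h𝔲 hM hI hf hfc c fun u v => (hcurv u v).trans (hc u v)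
  obtain ⟨c', h0, he, hc'⟩ := hn.exists_relative h.hopf hL hM h.retrL h𝔥 hI hf hfc hb hfb
  exact mem_relB_iff.2 ⟨c', h0, he, fun u v => (hcurv u v).symm.trans (hc' u v)⟩

end Comparison

/-- A linear family of functionals applied to a vector-valued function. -/
def vextForm {Γ V M : Type} [AddCommGroup M] [Module ℂ M] [Module.Finite ℂ M] [AddCommGroup V]
    [Module ℂ V] (d : V ⊸ FnDual Γ) (F : Γ → M) : V ⊸ M where
  toFun u := vext (d u) F
  map_add' u v := by rw [map_add, vext_add_left]
  map_smul' t u := by rw [map_smul, vext_smul_functional, RingHom.id_apply]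

section LieClass

variable {G A : AffAlgGroup} {ρ : AlgAction G A} {M : Type} [AddCommGroup M] [Module ℂ M]
  [Module.Finite ℂ M] {derA : M ⊸ FnDual A.Gp} {log : A.Gp → M} {exp : M → A.Gp}
  {π : G.Gp →* (M ⊸ M)} {𝔤 : Type} [LieRing 𝔤] [LieAlgebra ℂ 𝔤]
  {der : 𝔤 ⊸ FnDual G.Gp} [LieRingModule 𝔤 M]

namespace AlgExtension

/-- `ω` is cohomologous to the curvature of a cocycle of the extension. -/
def Rep (e : AlgExtension G A ρ) (exp : M → A.Gp) (π : G.Gp →* (M ⊸ M))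
    (der : 𝔤 ⊸ FnDual G.Gp) (ω : (Fin 2 → 𝔤) → M) : Prop :=
  ∃ F f, e.Coc exp π F f ∧ ∃ c : 𝔤 ⊸ M, ∀ u v, ω ![u, v] = curv der f u v + dForm c u v

variable {e e' : AlgExtension G A ρ}

lemma Coc.rep {F f} (hd : e.Coc exp π F f) {ω : (Fin 2 → 𝔤) → M}
    (hω : ∀ u v, curv der f u v = ω ![u, v]) : e.Rep exp π der ω :=
  ⟨F, f, hd, 0, fun u v => by simp [dForm, hω]⟩

lemma rep_of_represents (h : IsCoef ρ derA log exp π) [IsDomain G.reg]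
    (hL : IsLieFn G.reg 𝔤 der) (hM : IsMod G.reg der π) {e𝔤 : 𝔤 ⊸ Pt G.n}
    (hcd : ∀ u i, der u (AffAlgGroup.cd i) = e𝔤 u i) {eA : M ⊸ Pt A.n}
    (hcdA : ∀ w i, derA w (AffAlgGroup.cd i) = eA w i) {ω : (Fin 2 → 𝔤) → M}
    (hω : RepresentsLieExtension e e𝔤 eA ω) : e.Rep exp π der ω := by
  obtain ⟨F, f, hd⟩ := e.exists_coc h
  obtain ⟨derE, hE⟩ := e.E.isAlgGrpFn.toIsHopfFn.exists_isLieFn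
  obtain ⟨di, hdi⟩ := e.i.exists_tangentMap h.pd hE
  obtain ⟨dq, hdq⟩ := e.q.exists_lieHom hE hL
  obtain ⟨di₀, hdi₀, hdi₀'⟩ := e.i.exists_isDerivAtOne
  obtain ⟨dq₀, hdq₀, hdq₀'⟩ := e.q.exists_isDerivAtOne
  obtain ⟨s, hs, hsω⟩ := hω _ _ (AffAlgGroup.isLieAlgebraOf hE) di dq
    ⟨di₀, hdi₀, fun a => by
      rw [← show _ = eA a from funext (hcdA a), hdi₀' _ (h.pd a)]
      exact funext fun i => hdi a _ (AffAlgGroup.cd_mem i)⟩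
    ⟨dq₀, hdq₀, fun w => (funext fun i => (hcd _ i).symm.trans
      (hdq w _ (AffAlgGroup.cd_mem i))).trans (hdq₀' _ (hE.pd w)).symm⟩
  refine ⟨F, f, hd, (vextForm derE F).comp s, hd.eq_curv (e.isVecExt h) hE hM di dq (fun m => ?_)
    (fun w r hr => (hdq w r hr).symm) s hs hsω⟩
  refine dual_ext fun ξ => ?_
  rw [dual_vext, hdi m _ (hd.reg ξ), ← h.vec.der_log m ξ]
  have : (fun x => ξ (F x)) ∘ e.i.toGpHom = (fun a => ξ (log a)) - fun _ => ξ (f 1 1) :=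
    funext fun a => by simp [hd.map_i h]
  rw [this, map_sub, show (fun _ => ξ (f 1 1)) = ξ (f 1 1) • (1 : A.Gp → ℂ) from
    funext fun _ => by simp, map_smul, (h.pd m).map_one, smul_zero, sub_zero]

section

variable {U L : Type} [Group U] [Group L] {RU : FnAlg U} {RL : FnAlg L}
  {ιU : U →* G.Gp} {ιL : L →* G.Gp} {prU : G.Gp → U} {prL : G.Gp → L} {𝔲 𝔥 : LieSubalgebra ℂ 𝔤}
  [LieModule ℂ 𝔤 M] (h : IsCoef ρ derA log exp π)
  (hl : IsLeviFn G.reg RU RL ιU ιL prU prL) (hL : IsLieFn G.reg 𝔤 der)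
  (h𝔲 : IsTangentTo G.reg der ιU 𝔲) (h𝔥 : IsTangentTo G.reg der ιL 𝔥) (hM : IsMod G.reg der π)
  {I : FnDual L} (hI : IsMean RL I)
include h hl hL h𝔲 h𝔥 hM hI

omit [LieRingModule 𝔤 M] [LieModule ℂ 𝔤 M] hL h𝔲 h𝔥 hM in
lemma exists_normalized_coc [IsDomain G.reg] (e : AlgExtension G A ρ) :
    ∃ F f, e.Coc exp π F f ∧ IsNormd ιL f := by
  obtain ⟨F, f, hd⟩ := e.exists_coc h
  obtain ⟨b, hb, hn⟩ := exists_normalized hl.hopfL hl.hopf hl.retrL.res hI h.reg hd.bireg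
    (hd.isCoc (e.isVecExt h))
  exact ⟨_, _, hd.sub_cobd hl.hopf h.reg (e.isVecExt h) hb, hn⟩

lemma exists_rep {ω : (Fin 2 → 𝔤) → M} (hω : ω ∈ relZ 𝔥 M 2) :
    ∃ e : AlgExtension G A ρ, e.Rep exp π der ω := by
  obtain ⟨f, hf, hc, hn, hcurv⟩ := exists_coc_of_relZ hl hL h𝔲 h𝔥 hM hI hω
  obtain ⟨e, F, hd⟩ := exists_of_coc h hf hc (fun x => by simpa using hn.2 1 x)
    (fun x => by simpa using hn.1 x 1)
  exact ⟨e, hd.rep hcurv⟩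

lemma Rep.sub_mem_relB [IsDomain G.reg] {ω ω' : (Fin 2 → 𝔤) → M} (hr : e.Rep exp π der ω)
    (hr' : e'.Rep exp π der ω') (hω : ω ∈ relZ 𝔥 M 2) (hω' : ω' ∈ relZ 𝔥 M 2)
    (he : Relation.EqvGen Equiv e e') : ω - ω' ∈ relB 𝔥 M 1 := by
  obtain ⟨F, f, hd, c, hc⟩ := hr
  obtain ⟨F', f', hd', c', hc'⟩ := hr'
  obtain ⟨b, hb, hfb⟩ := exists_cobd_of_eqvGen h he hd hd'
  refine mem_relB_of_relZ hl hL h𝔲 h𝔥 hM hI (sub_mem hω hω') (c - c' + vextForm der b) fun u v => ?_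
  have hcu : curv der f u v - curv der f' u v = dForm (vextForm der b) u v := by
    rw [← curv_sub, show (fun x y => f x y - f' x y) = cobd π b from funext₂ hfb,
      curv_cobd hL hM hb]
    rfl
  rw [Pi.sub_apply, hc, hc', sub_eq_iff_eq_add.1 hcu]
  simp only [dForm, LinearMap.add_apply, LinearMap.sub_apply, lie_add, lie_sub]
  abel

omit h𝔥 in
lemma Rep.equiv [IsDomain G.reg] {ω ω' : (Fin 2 → 𝔤) → M} (hr : e.Rep exp π der ω)
    (hr' : e'.Rep exp π der ω') (hω : ω - ω' ∈ relB 𝔥 M 1) : e.Equiv e' := by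
  obtain ⟨F, f, hd, c, hc⟩ := hr
  obtain ⟨F', f', hd', c', hc'⟩ := hr'
  obtain ⟨β, -, -, hβ⟩ := mem_relB_iff.1 hω
  obtain ⟨b, hb, hfb⟩ := hl.exists_cobd hL h𝔲 hM hI (hd.bireg.sub hd'.bireg)
    ((hd.isCoc (e.isVecExt h)).sub (hd'.isCoc (e'.isVecExt h))) (β - c + c') fun u v => by
      have := hβ u v
      rw [Pi.sub_apply, hc, hc'] at this
      rw [curv_sub, ← sub_eq_zero, ← sub_eq_zero.2 this]
      simp only [dForm, LinearMap.add_apply, LinearMap.sub_apply, lie_add, lie_sub]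
      abel
  have hs := hd.sub_cobd hl.hopf h.reg (e.isVecExt h) hb
  rw [show (fun x y => f x y - cobd π b x y) = f' from
    funext₂ fun x y => by grind] at hs
  exact equiv_of_coc h hs hd'

end

end AlgExtension

end LieClass

/-- For a connected algebraic group `G` and a unipotent
connected abelian algebraic group `A_u` with algebraic `G`-action, the map `D`
sending an extension `1 → A_u → Ĝ → G → 1` to the class of its Lie algebra
extension induces a bijection (indeed an isomorphism of abelian groups)
`Ext_alg(G, A_u) ≅ H²(𝔤, 𝔤_red, 𝔞_u)`. -/
theorem ext_by_unipotent_iso_relative_H2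
    (G : AffAlgGroup) (hG : G.IsConnected) (LD : LeviDecomposition G)
    (A : AffAlgGroup) (hA_conn : A.IsConnected) (hA_ab : A.IsAbelianGrp)
    (hA_uni : A.IsUnipotent) (ρ : AlgAction G A)
    (𝔤 : Type) [LieRing 𝔤] [LieAlgebra ℂ 𝔤] (e𝔤 : 𝔤 →ₗ[ℂ] Pt G.n)
    (h𝔤 : IsLieAlgebraOf G 𝔤 e𝔤)
    (𝔥 : LieSubalgebra ℂ 𝔤) (h𝔥 : IsLieSubalgebraOf LD.L e𝔤 𝔥)
    (M : Type) [AddCommGroup M] [Module ℂ M] [LieRingModule 𝔤 M] [LieModule ℂ 𝔤 M]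
    (eA : M →ₗ[ℂ] Pt A.n) (heA_inj : Function.Injective eA)
    (heA_range : ∀ v : Pt A.n, (∃ w : M, eA w = v) ↔ v ∈ tangentAt A.carrier A.one)
    (hder : IsDerivedActionOnLie ρ e𝔤 eA)
    (Ext : Type) [AddCommGroup Ext] (cm : ExtClassMap G A ρ Ext) :
    ∃ D : Ext → relH 𝔥 M 2,
      Function.Bijective D ∧
      (∀ x y : Ext, D (x + y) = D x + D y) ∧
      (∀ (ext : AlgExtension G A ρ) (ω : (Fin 2 → 𝔤) → M) (hω : ω ∈ relZ 𝔥 M 2),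
        RepresentsLieExtension ext e𝔤 eA ω →
        D (cm.cls ext) = relHClass 𝔥 M 1 ⟨ω, hω⟩) := by
  obtain ⟨der, hL, hcd⟩ := AffAlgGroup.exists_isLieFn h𝔤
  obtain ⟨_, derA, log, exp, π, h, hM, hcdA⟩ :=
    exists_isCoef hA_conn hA_ab hA_uni ρ hL hcd heA_inj heA_range hder
  obtain ⟨prU, prL, hl⟩ := LD.exists_isLeviFn hG
  have := hG.isDomain
  have h𝔥' := LD.L.isTangentTo h𝔥 hL hcd
  obtain ⟨𝔲, h𝔲⟩ := exists_isTangentTo hl.hopf hL LD.Gu.incl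
  obtain ⟨I, hI⟩ : ∃ I, IsMean LD.L.toGrp.reg I := by
    have := hl.domL
    obtain ⟨I, h1, hr, hl'⟩ := exists_mean LD.L.toGrp.isAlgGrpFn
      (isLieFn_sub hl.retrL h𝔥' hl.hopf hL) LD.L_reductive.isRedFn
    exact ⟨I, h1, hr, hl'⟩
  choose ext hext using cm.surj
  choose F f hd hn using fun x => AlgExtension.exists_normalized_coc h hl hI (ext x)
  let ω : Ext → (Fin 2 → 𝔤) → M := fun x v => curv der (f x) (v 0) (v 1)
  have hω : ∀ x, ω x ∈ relZ 𝔥 M 2 := fun x => curv_mem_relZ hl.hopf hL hM hl.retrL h𝔥'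
    (hd x).bireg ((hd x).isCoc ((ext x).isVecExt h)) (hn x)
  have hrep : ∀ x, (ext x).Rep exp π der (ω x) := fun x => (hd x).rep fun u v => rfl
  have hcls : ∀ a b : relZ 𝔥 M 2, relHClass 𝔥 M 1 a = relHClass 𝔥 M 1 b ↔
      a.1 - b.1 ∈ relB 𝔥 M 1 := fun a b =>
    QuotientAddGroup.eq_iff_sub_mem (N := (relB 𝔥 M 1).addSubgroupOf (relZ 𝔥 M 2))
  have key : ∀ (e : AlgExtension G A ρ) (ω' : (Fin 2 → 𝔤) → M) (hω' : ω' ∈ relZ 𝔥 M 2),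
      e.Rep exp π der ω' →
      relHClass 𝔥 M 1 ⟨ω (cm.cls e), hω _⟩ = relHClass 𝔥 M 1 ⟨ω', hω'⟩ := fun e ω' hω' he =>
    (hcls _ _).2 ((hrep _).sub_mem_relB h hl hL h𝔲 h𝔥' hM hI he (hω _) hω'
      ((cm.cls_eq_iff _ _).1 (hext _)))
  refine ⟨fun x => relHClass 𝔥 M 1 ⟨ω x, hω x⟩, ⟨fun x y hxy => ?_, fun z => ?_⟩, fun x y => ?_,
    fun e ω' hω' he => key e ω' hω' (AlgExtension.rep_of_represents h hL hM hcd hcdA he)⟩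
  · rw [← hext x, ← hext y]
    exact (cm.cls_eq_iff _ _).2 (.rel _ _
      ((hrep x).equiv h hl hL h𝔲 hM hI (hrep y) ((hcls _ _).1 hxy)))
  · obtain ⟨⟨ω', hω'⟩, rfl⟩ := QuotientAddGroup.mk_surjective z
    obtain ⟨e, he⟩ := AlgExtension.exists_rep h hl hL h𝔲 h𝔥' hM hI hω'
    exact ⟨cm.cls e, key e ω' hω' he⟩
  · obtain ⟨e, F', hd'⟩ := AlgExtension.exists_of_coc h ((hd x).bireg.add (hd y).bireg)
      (((hd x).isCoc ((ext x).isVecExt h)).add ((hd y).isCoc ((ext y).isVecExt h)))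
      (fun z => by simpa using congrArg₂ (· + ·) ((hn x).2 1 z) ((hn y).2 1 z))
      (fun z => by simpa using congrArg₂ (· + ·) ((hn x).1 z 1) ((hn y).1 z 1))
    have hb := cm.cls_baer _ _ _ (AlgExtension.isBaerSum_of_coc h (hd x) (hd y) hd')
    rw [hext, hext] at hb
    rw [hb]
    exact key e (ω x + ω y) (add_mem (hω x) (hω y)) (hd'.rep fun u v => curv_add _ _ _ _)
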